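/- Let σ̂ : ℝ → ℝ be smooth with σ̂'(r) = 0 for r ∉ (−1,1) and σ̂(−1) − σ̂(1) = ∫_{−1}^{1} √(2(f(r) − f(−1))) dr, and set σ_α := (cos α)·σ̂ for α ∈ (0,π). Then there exist α₀ > 0 and β₀, γ₀ > 0 such that for every α ∈ [π/2 − α₀, π/2 + α₀] there is a smooth function v_α : ℝ × [0,∞) → ℝ satisfying: (i) −div(A_α ∇v_α) + f'(v_α) = 0 in ℝ × (0,∞); (ii) N_{∂ℝ²₊} · A_α ∇v_α(R,0) + σ_α'(v_α(R,0)) = 0 for all R ∈ ℝ; (iii) for every k, l ∈ ℕ₀ the function (R,H) ↦ e^{β₀|R| + γ₀ H} ∂_R^k ∂_H^l(v_α(R,H) − θ₀(R)) is square integrable over ℝ × (0,∞); (iv) ∫_ℝ θ₀'(R) ∂_R v_α(R,0) dR > 0; and moreover v_{π/2}(R,H) = θ₀(R) for all (R,H). -/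

import Mathlib

open Filter Topology MeasureTheory Real

/-- Partial derivative in the first variable `R` of `g : ℝ → ℝ → ℝ`. -/
noncomputable def pdR (g : ℝ → ℝ → ℝ) : ℝ → ℝ → ℝ :=
  fun R H => deriv (fun r => g r H) R

/-- Partial derivative in the second variable `H` of `g : ℝ → ℝ → ℝ`. -/
noncomputable def pdH (g : ℝ → ℝ → ℝ) : ℝ → ℝ → ℝ :=
  fun R H => deriv (fun h => g R h) H

/-- Mixed derivative `∂_R^k ∂_H^l g`. -/
noncomputable def pdMix (k l : ℕ) (g : ℝ → ℝ → ℝ) : ℝ → ℝ → ℝ :=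
  fun R H => iteratedDeriv k (fun r => iteratedDeriv l (fun h => g r h) H) R


/-! ### The one-dimensional heat kernel -/

lemma sqrt_two_le : √2 ≤ 2 := by rw [sqrt_le_left] <;> norm_num

/-- The heat kernel on the line at time `t`. -/
noncomputable def gk (t x : ℝ) : ℝ := (√(4 * π * t))⁻¹ * exp (-(x ^ 2) / (4 * t))

lemma gk_nonneg (t x : ℝ) : 0 ≤ gk t x := by unfold gk; positivity

lemma gk_neg (t x : ℝ) : gk t (-x) = gk t x := by simp [gk]

lemma gk_sub_comm (t x y : ℝ) : gk t (x - y) = gk t (y - x) := by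
  rw [← gk_neg, neg_sub]

lemma measurable_gk : Measurable (fun p : ℝ × ℝ => gk p.1 p.2) := by
  unfold gk; fun_prop

@[fun_prop]
lemma Measurable.gk {α : Type*} [MeasurableSpace α] {a b : α → ℝ} (ha : Measurable a)
    (hb : Measurable b) : Measurable (fun z => gk (a z) (b z)) :=
  measurable_gk.comp (ha.prodMk hb)

@[fun_prop]
lemma continuous_gk (t : ℝ) : Continuous (gk t) := by unfold gk; fun_prop

lemma gk_integrable {t : ℝ} (ht : 0 < t) : Integrable (gk t) := by
  have h : (0 : ℝ) < 1 / (4 * t) := by positivity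
  refine ((integrable_exp_neg_mul_sq h).const_mul (√(4 * π * t))⁻¹).congr ?_
  filter_upwards with x
  simp only [gk]; congr 2; field_simp

lemma integral_gk {t : ℝ} (ht : 0 < t) : ∫ x, gk t x = 1 := by
  have h : ∀ x, gk t x = (√(4 * π * t))⁻¹ * exp (-(1 / (4 * t)) * x ^ 2) := by
    intro x; simp only [gk]; congr 2; field_simp
  simp_rw [h]
  rw [integral_const_mul, integral_gaussian, inv_mul_eq_one₀ (by positivity)]
  congr 1; field_simp

lemma integral_gk_sub {t : ℝ} (ht : 0 < t) (x : ℝ) : ∫ y, gk t (x - y) = 1 := by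
  rw [integral_sub_left_eq_self (gk t) volume x, integral_gk ht]

lemma gk_sub_integrable {t : ℝ} (ht : 0 < t) (x : ℝ) : Integrable (fun y => gk t (x - y)) :=
  (gk_integrable ht).comp_sub_left x

lemma hasDerivAt_gk {t : ℝ} (x : ℝ) :
    HasDerivAt (gk t) (-(x / (2 * t)) * gk t x) x := by
  unfold gk
  have h : HasDerivAt (fun x : ℝ => -(x ^ 2) / (4 * t)) (-(x / (2 * t))) x := by
    refine (((hasDerivAt_pow 2 x).neg).div_const (4 * t)).congr_deriv ?_
    by_cases h : t = 0
    · simp [h]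
    · field_simp; norm_num; ring
  exact ((h.exp).const_mul (√(4 * π * t))⁻¹).congr_deriv (by ring)

lemma gk_le_inv_sqrt {t : ℝ} (ht : 0 < t) (x : ℝ) : gk t x ≤ t ^ (-1/2 : ℝ) := by
  unfold gk
  have h1 : exp (-(x ^ 2) / (4 * t)) ≤ 1 := by
    rw [exp_le_one_iff]; rw [neg_div]; simp; positivity
  have h2 : (√(4 * π * t))⁻¹ ≤ t ^ (-1/2 : ℝ) := by
    rw [show (-1/2 : ℝ) = -(1/2) by norm_num, rpow_neg ht.le, ← sqrt_eq_rpow]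
    apply inv_anti₀ (by positivity)
    apply sqrt_le_sqrt
    nlinarith [pi_gt_three]
  calc _ ≤ (√(4 * π * t))⁻¹ * 1 := by gcongr
    _ ≤ _ := by rw [mul_one]; exact h2

lemma gk_scale {t m : ℝ} (ht : 0 < t) (hm : 0 < m) (x : ℝ) :
    gk t x = √m * gk (m * t) x * exp (-(x ^ 2) * (m - 1) / (4 * m * t)) := by
  unfold gk
  rw [show 4 * π * (m * t) = m * (4 * π * t) by ring, sqrt_mul hm.le]
  rw [mul_inv, show √m * ((√m)⁻¹ * (√(4 * π * t))⁻¹ * exp (-(x ^ 2) / (4 * (m * t))))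
      * exp (-(x ^ 2) * (m - 1) / (4 * m * t)) = (√m * (√m)⁻¹) * (√(4 * π * t))⁻¹ *
      (exp (-(x ^ 2) / (4 * (m * t))) * exp (-(x ^ 2) * (m - 1) / (4 * m * t))) by ring]
  rw [mul_inv_cancel₀ (by positivity), one_mul, ← exp_add]
  congr 2
  field_simp; ring

/-- A factor that is dominated by `C * exp (x² / (8 t))` is absorbed by doubling the time. -/
lemma mul_gk_le {t C a x : ℝ} (ht : 0 < t) (h : a ≤ C * exp (x ^ 2 / (8 * t))) :
    a * gk t x ≤ √2 * C * gk (2 * t) x := by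
  rw [gk_scale ht two_pos x]
  have h2 := gk_nonneg (2 * t) x
  have h3 : exp (x ^ 2 / (8 * t)) * exp (-(x ^ 2) * (2 - 1) / (4 * 2 * t)) = 1 := by
    rw [← exp_add, exp_eq_one_iff]; field_simp; ring
  calc a * (√2 * gk (2 * t) x * exp (-(x ^ 2) * (2 - 1) / (4 * 2 * t)))
      ≤ (C * exp (x ^ 2 / (8 * t))) * (√2 * gk (2 * t) x * exp (-(x ^ 2) * (2 - 1) / (4 * 2 * t))) := by
        gcongr
    _ = √2 * C * gk (2 * t) x * (exp (x ^ 2 / (8 * t)) * exp (-(x ^ 2) * (2 - 1) / (4 * 2 * t))) := by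
        ring
    _ = _ := by rw [h3, mul_one]

lemma gk_le_two_mul {t : ℝ} (ht : 0 < t) (x : ℝ) : gk t x ≤ 2 * gk (2 * t) x := by
  have := mul_gk_le (t := t) (C := 1) (a := 1) (x := x) ht (by
    rw [one_mul]; exact one_le_exp (by positivity))
  rw [one_mul] at this
  have h2 := sqrt_two_le
  nlinarith [gk_nonneg (2 * t) x]

lemma abs_mul_gk_le {t : ℝ} (ht : 0 < t) (x : ℝ) :
    |x| * gk t x ≤ 4 * √t * gk (2 * t) x := by
  have h : |x| ≤ 2 * √t * exp (x ^ 2 / (8 * t)) := by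
    have h1 : x ^ 2 / (8 * t) + 1 ≤ exp (x ^ 2 / (8 * t)) := add_one_le_exp _
    have hs : 0 < √t := by positivity
    have h2 : |x| ≤ 2 * √t * (x ^ 2 / (8 * t) + 1) := by
      have : x ^ 2 / (8 * t) = (|x| / √t) ^ 2 / 8 := by
        rw [div_pow, sq_abs, sq_sqrt ht.le]; field_simp
      rw [this]
      obtain ⟨u, hu⟩ : ∃ u, u = |x| / √t := ⟨_, rfl⟩
      have hx : |x| = √t * u := by rw [hu]; field_simp
      rw [← hu, hx]
      nlinarith [mul_nonneg hs.le (sq_nonneg (u / 2 - 1))]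
    calc _ ≤ _ := h2
      _ ≤ _ := by gcongr
  have := mul_gk_le ht h
  have h2 := sqrt_two_le
  have h3 := gk_nonneg (2 * t) x
  calc _ ≤ _ := this
    _ = √2 * (2 * √t * gk (2 * t) x) := by ring
    _ ≤ 2 * (2 * √t * gk (2 * t) x) := by gcongr
    _ = _ := by ring

lemma sqrt_abs_mul_gk_le {t : ℝ} (ht : 0 < t) (x : ℝ) :
    √|x| * gk t x ≤ 4 * t ^ (1/4 : ℝ) * gk (2 * t) x := by
  have ht4 : t ^ (1/4 : ℝ) = √(√t) := by
    rw [sqrt_eq_rpow, sqrt_eq_rpow, ← rpow_mul ht.le]; norm_num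
  have h : √|x| ≤ 2 * t ^ (1/4 : ℝ) * exp (x ^ 2 / (8 * t)) := by
    have h1 : x ^ 2 / (8 * t) + 1 ≤ exp (x ^ 2 / (8 * t)) := add_one_le_exp _
    have hs : 0 < √(√t) := by positivity
    have h2 : √|x| ≤ 2 * t ^ (1/4 : ℝ) * (x ^ 2 / (8 * t) + 1) := by
      obtain ⟨u, hu⟩ : ∃ u, u = √|x| / √(√t) := ⟨_, rfl⟩
      have hx : √|x| = √(√t) * u := by rw [hu]; field_simp
      have : x ^ 2 / (8 * t) = u ^ 4 / 8 := by
        rw [hu, div_pow, show √|x| ^ 4 = (√|x| ^ 2) ^ 2 by ring, show √(√t) ^ 4 = (√(√t) ^ 2) ^ 2 by ring,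
          sq_sqrt (by positivity), sq_sqrt (by positivity), sq_abs, sq_sqrt ht.le]; field_simp
      rw [this, hx, ht4]
      have : u ≤ 2 * (u ^ 4 / 8 + 1) := by nlinarith [sq_nonneg (u ^ 2 - 1), sq_nonneg (u - 1)]
      nlinarith
    calc _ ≤ _ := h2
      _ ≤ _ := by gcongr
  have := mul_gk_le ht h
  have h2 := sqrt_two_le
  have h3 := gk_nonneg (2 * t) x
  calc _ ≤ _ := this
    _ = √2 * (2 * t ^ (1/4 : ℝ) * gk (2 * t) x) := by ring
    _ ≤ 2 * (2 * t ^ (1/4 : ℝ) * gk (2 * t) x) := by gcongr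
    _ = _ := by ring

lemma exp_mul_gk_le {t β : ℝ} (ht : 0 < t) (x : ℝ) :
    exp (β * |x|) * gk t x ≤ 2 * exp (2 * β ^ 2 * t) * gk (2 * t) x := by
  have h : exp (β * |x|) ≤ exp (2 * β ^ 2 * t) * exp (x ^ 2 / (8 * t)) := by
    rw [← exp_add, exp_le_exp]
    have : 2 * β ^ 2 * t + x ^ 2 / (8 * t) - β * |x| = 2 * t * (β - |x| / (4 * t)) ^ 2 := by
      rw [← sq_abs x]; field_simp; ring
    have : 0 ≤ 2 * t * (β - |x| / (4 * t)) ^ 2 := by positivity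
    linarith
  have := mul_gk_le ht h
  have h2 := sqrt_two_le
  have h3 := gk_nonneg (2 * t) x
  calc _ ≤ _ := this
    _ = √2 * (exp (2 * β ^ 2 * t) * gk (2 * t) x) := by ring
    _ ≤ 2 * (exp (2 * β ^ 2 * t) * gk (2 * t) x) := by gcongr
    _ = _ := by ring

lemma abs_exp_neg_sq_sub_le_of_abs_sub_le_one {a b : ℝ} (hab : |a - b| ≤ 1) :
    |exp (-a ^ 2) - exp (-b ^ 2)| ≤ 8 * |a - b| * exp (-a ^ 2 / 4) := by
  have key : ∀ ξ ∈ Set.uIcc b a, ‖-(2 * ξ) * exp (-ξ ^ 2)‖ ≤ 8 * exp (-a ^ 2 / 4) := by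
    intro ξ hξ
    have h1 : |a - ξ| ≤ 1 := (Set.abs_sub_right_of_mem_uIcc hξ).trans hab
    have h2 : a ^ 2 ≤ 2 * ξ ^ 2 + 2 := by
      have := abs_le.1 h1
      have h3 : (a - ξ) ^ 2 ≤ 1 := by nlinarith
      nlinarith [sq_nonneg (a - 2 * ξ)]
    rw [norm_mul, norm_neg, norm_mul, Real.norm_eq_abs, Real.norm_eq_abs, Real.norm_eq_abs, abs_exp, abs_two]
    have h4 : |ξ| ≤ exp (ξ ^ 2 / 2) := by
      have := add_one_le_exp (ξ ^ 2 / 2)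
      have h5 : |ξ| ≤ ξ ^ 2 / 2 + 1 := by
        rw [← sq_abs]; nlinarith [sq_nonneg (|ξ| - 1)]
      linarith
    have h6 : exp (ξ ^ 2 / 2) * exp (-ξ ^ 2) ≤ exp (1/2) * exp (-a ^ 2 / 4) := by
      rw [← exp_add, ← exp_add, exp_le_exp]; linarith
    have h7 : exp (1/2) ≤ 4 := by
      have := exp_le_exp.2 (show (1/2 : ℝ) ≤ 1 by norm_num)
      linarith [exp_one_lt_d9]
    have h8 := exp_pos (-a ^ 2 / 4)
    have h9 := exp_pos (-ξ ^ 2)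
    nlinarith [mul_le_mul_of_nonneg_right h4 h9.le]
  have hd : ∀ ξ ∈ Set.uIcc b a, HasDerivWithinAt (fun ξ => exp (-ξ ^ 2)) (-(2 * ξ) * exp (-ξ ^ 2)) (Set.uIcc b a) ξ := by
    intro ξ _
    refine HasDerivAt.hasDerivWithinAt ((((hasDerivAt_pow 2 ξ).neg).exp).congr_deriv ?_)
    norm_num; ring
  have := Convex.norm_image_sub_le_of_norm_hasDerivWithin_le hd key (convex_uIcc b a)
    (Set.left_mem_uIcc) (Set.right_mem_uIcc)
  rw [Real.norm_eq_abs, Real.norm_eq_abs] at this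
  linarith

lemma abs_exp_neg_sq_sub_le (a b : ℝ) :
    |exp (-a ^ 2) - exp (-b ^ 2)| ≤ 8 * √|a - b| * (exp (-a ^ 2 / 4) + exp (-b ^ 2 / 4)) := by
  have hb := exp_pos (-b ^ 2 / 4)
  have ha := exp_pos (-a ^ 2 / 4)
  rcases le_or_gt |a - b| 1 with h | h
  · have h1 := abs_exp_neg_sq_sub_le_of_abs_sub_le_one h
    have h2 : |a - b| ≤ √|a - b| := by
      apply le_sqrt_of_sq_le; nlinarith [abs_nonneg (a - b)]
    calc _ ≤ _ := h1
      _ ≤ 8 * √|a - b| * exp (-a ^ 2 / 4) := by gcongr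
      _ ≤ _ := by gcongr; linarith
  · have h2 : 1 ≤ √|a - b| := by rw [one_le_sqrt]; exact h.le
    have h3 : exp (-a ^ 2) ≤ exp (-a ^ 2 / 4) := exp_le_exp.2 (by nlinarith [sq_nonneg a])
    have h4 : exp (-b ^ 2) ≤ exp (-b ^ 2 / 4) := exp_le_exp.2 (by nlinarith [sq_nonneg b])
    have h5 : |exp (-a ^ 2) - exp (-b ^ 2)| ≤ exp (-a ^ 2) + exp (-b ^ 2) := by
      rw [abs_sub_le_iff]; constructor <;> linarith [exp_pos (-a ^ 2), exp_pos (-b ^ 2)]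
    nlinarith

lemma abs_gk_sub_le {t : ℝ} (ht : 0 < t) (x x' : ℝ) :
    |gk t x - gk t x'| ≤ 16 * √|x - x'| * t ^ (-1/4 : ℝ) * (gk (4 * t) x + gk (4 * t) x') := by
  have hs : 0 < √(4 * t) := by positivity
  have e1 : ∀ x, exp (-(x ^ 2) / (4 * t)) = exp (-(x / √(4 * t)) ^ 2) := by
    intro x; congr 1; rw [div_pow, sq_sqrt (by positivity), neg_div]
  have e2 : ∀ x, gk (4 * t) x = 2⁻¹ * (√(4 * π * t))⁻¹ * exp (-(x / √(4 * t)) ^ 2 / 4) := by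
    intro x
    rw [gk, show 4 * π * (4 * t) = 2 ^ 2 * (4 * π * t) by ring, sqrt_mul (by positivity),
      sqrt_sq two_pos.le, mul_inv]
    congr 2
    rw [div_pow, sq_sqrt (by positivity)]; field_simp
  have h := abs_exp_neg_sq_sub_le (x / √(4 * t)) (x' / √(4 * t))
  have h3 : √|x / √(4 * t) - x' / √(4 * t)| ≤ √|x - x'| * t ^ (-1/4 : ℝ) := by
    rw [← sub_div, abs_div, abs_of_pos hs, sqrt_div (abs_nonneg _), div_eq_mul_inv]
    gcongr
    rw [show (-1/4 : ℝ) = -(1/4) by norm_num, rpow_neg ht.le]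
    apply inv_anti₀ (by positivity)
    rw [show t ^ (1/4 : ℝ) = √(√t) by
      rw [sqrt_eq_rpow, sqrt_eq_rpow, ← rpow_mul ht.le]; norm_num]
    gcongr; linarith
  have hg : |gk t x - gk t x'| = (√(4 * π * t))⁻¹ *
      |exp (-(x / √(4 * t)) ^ 2) - exp (-(x' / √(4 * t)) ^ 2)| := by
    rw [gk, gk, e1, e1, ← mul_sub, abs_mul, abs_of_nonneg (by positivity)]
  rw [hg, e2, e2]
  have hp : 0 ≤ (√(4 * π * t))⁻¹ := by positivity
  calc _ ≤ (√(4 * π * t))⁻¹ * (8 * √|x / √(4 * t) - x' / √(4 * t)| *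
        (exp (-(x / √(4 * t)) ^ 2 / 4) + exp (-(x' / √(4 * t)) ^ 2 / 4))) := by gcongr
    _ ≤ (√(4 * π * t))⁻¹ * (8 * (√|x - x'| * t ^ (-1/4 : ℝ)) *
        (exp (-(x / √(4 * t)) ^ 2 / 4) + exp (-(x' / √(4 * t)) ^ 2 / 4))) := by gcongr
    _ = _ := by ring

open scoped ENNReal NNReal

/-! ### Integral operators on `L²` -/

lemma sq_lintegral_mul_le {α : Type*} [MeasurableSpace α] {μ : Measure α} {f g : α → ℝ≥0∞}
    (hf : AEMeasurable f μ) (hg : AEMeasurable g μ) :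
    (∫⁻ a, f a * g a ∂μ) ^ 2 ≤ (∫⁻ a, f a ^ 2 ∂μ) * ∫⁻ a, g a ^ 2 ∂μ := by
  have h := ENNReal.lintegral_mul_le_Lp_mul_Lq μ Real.HolderConjugate.two_two hf hg
  simp only [Pi.mul_apply] at h
  calc _ ≤ ((∫⁻ a, f a ^ (2:ℝ) ∂μ) ^ (1 / (2:ℝ)) * (∫⁻ a, g a ^ (2:ℝ) ∂μ) ^ (1 / (2:ℝ))) ^ 2 := by
        gcongr
    _ = _ := by
        rw [mul_pow, ← ENNReal.rpow_natCast, ← ENNReal.rpow_mul, ← ENNReal.rpow_natCast,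
          ← ENNReal.rpow_mul]
        norm_num

lemma sq_lintegral_mul_le_lintegral_mul {α : Type*} [MeasurableSpace α] {μ : Measure α}
    {d g : α → ℝ≥0∞} (hd : AEMeasurable d μ) (hg : AEMeasurable g μ) :
    (∫⁻ a, d a * g a ∂μ) ^ 2 ≤ (∫⁻ a, d a ∂μ) * ∫⁻ a, d a * g a ^ 2 ∂μ := by
  have h := sq_lintegral_mul_le (f := fun a => d a ^ (1/2 : ℝ)) (g := fun a => d a ^ (1/2 : ℝ) * g a)
    (hd.pow_const _) ((hd.pow_const _).mul hg)
  have e : ∀ x : ℝ≥0∞, x ^ (1/2 : ℝ) * x ^ (1/2 : ℝ) = x := by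
    intro x; rw [← ENNReal.rpow_add_of_nonneg] <;> norm_num
  have e2 : ∀ x : ℝ≥0∞, (x ^ (1/2 : ℝ)) ^ 2 = x := by intro x; rw [sq, e]
  simp only [← mul_assoc, e, mul_pow, e2] at h
  exact h

section Schur

variable {T Z : Type*} [MeasurableSpace T] [MeasurableSpace Z]

/-- Row and column bounds (Schur test) for a kernel `κ t z z'` that is integrated in `(t, z')`. -/
structure SchurBd (τ : Measure T) (μ : Measure Z) (κ : T → Z → Z → ℝ) (A : ℝ≥0) : Prop where
  meas : Measurable (fun p : T × Z × Z => κ p.1 p.2.1 p.2.2)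
  row : ∀ᵐ z ∂μ, ∫⁻ p, ‖κ p.1 z p.2‖ₑ ∂(τ.prod μ) ≤ A
  col : ∀ᵐ z' ∂μ, ∫⁻ p, ‖κ p.1 p.2 z'‖ₑ ∂(τ.prod μ) ≤ A

/-- Value at `z` of the integral operator with kernel `κ`. -/
noncomputable def kerFun (τ : Measure T) (μ : Measure Z) (κ : T → Z → Z → ℝ) (Ψ : Z → ℝ) (z : Z) : ℝ :=
  ∫ p, κ p.1 z p.2 * Ψ p.2 ∂(τ.prod μ)

variable {τ : Measure T} {μ : Measure Z} [SFinite τ] [SFinite μ] {κ : T → Z → Z → ℝ} {A : ℝ≥0}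

lemma lintegral_schur (hκ : SchurBd τ μ κ A) {g : Z → ℝ≥0∞} (hg : AEMeasurable g μ) :
    ∫⁻ z, (∫⁻ p, ‖κ p.1 z p.2‖ₑ * g p.2 ∂(τ.prod μ)) ^ 2 ∂μ ≤ A ^ 2 * ∫⁻ z, g z ^ 2 ∂μ := by
  have hm := hκ.meas.enorm
  wlog hg' : Measurable g generalizing g
  · have e : ∀ᵐ p ∂(τ.prod μ), g p.2 = hg.mk g p.2 := Measure.quasiMeasurePreserving_snd.ae hg.ae_eq_mk
    have e1 : ∀ z, ∫⁻ p, ‖κ p.1 z p.2‖ₑ * g p.2 ∂(τ.prod μ)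
        = ∫⁻ p, ‖κ p.1 z p.2‖ₑ * hg.mk g p.2 ∂(τ.prod μ) := fun z =>
      lintegral_congr_ae (by filter_upwards [e] with p hp; rw [hp])
    have e2 : ∫⁻ z, g z ^ 2 ∂μ = ∫⁻ z, hg.mk g z ^ 2 ∂μ :=
      lintegral_congr_ae (by filter_upwards [hg.ae_eq_mk] with p hp; rw [hp])
    simp_rw [e1, e2]
    exact this hg.measurable_mk.aemeasurable hg.measurable_mk
  have h1 : ∀ᵐ z ∂μ, (∫⁻ p, ‖κ p.1 z p.2‖ₑ * g p.2 ∂(τ.prod μ)) ^ 2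
      ≤ A * ∫⁻ p, ‖κ p.1 z p.2‖ₑ * g p.2 ^ 2 ∂(τ.prod μ) := by
    filter_upwards [hκ.row] with z hz
    refine (sq_lintegral_mul_le_lintegral_mul ?_ ?_).trans (by gcongr)
    · exact (hm.comp (measurable_fst.prodMk (measurable_const.prodMk measurable_snd))).aemeasurable
    · exact (hg'.comp measurable_snd).aemeasurable
  calc _ ≤ ∫⁻ z, A * ∫⁻ p, ‖κ p.1 z p.2‖ₑ * g p.2 ^ 2 ∂(τ.prod μ) ∂μ := lintegral_mono_ae h1
    _ = A * ∫⁻ z, ∫⁻ p, ‖κ p.1 z p.2‖ₑ * g p.2 ^ 2 ∂(τ.prod μ) ∂μ := by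
        rw [lintegral_const_mul' _ _ ENNReal.coe_ne_top]
    _ = A * ∫⁻ z, ∫⁻ t, ∫⁻ z', ‖κ t z z'‖ₑ * g z' ^ 2 ∂μ ∂τ ∂μ := by
        congr 1
        refine lintegral_congr fun z => ?_
        rw [lintegral_prod]
        refine Measurable.aemeasurable ?_
        exact (hm.comp (measurable_fst.prodMk (measurable_const.prodMk measurable_snd))).mul
          ((hg'.comp measurable_snd).pow_const 2)
    _ = A * ∫⁻ z', ∫⁻ t, ∫⁻ z, ‖κ t z z'‖ₑ * g z' ^ 2 ∂μ ∂τ ∂μ := by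
        congr 1
        have hF : Measurable (fun q : Z × T × Z => ‖κ q.2.1 q.1 q.2.2‖ₑ * g q.2.2 ^ 2) :=
          (hm.comp (f := fun q : Z × T × Z => (q.2.1, q.1, q.2.2)) (by fun_prop)).mul
            ((hg'.comp (by fun_prop : Measurable fun q : Z × T × Z => q.2.2)).pow_const 2)
        rw [lintegral_lintegral_swap]
        · conv_rhs => rw [lintegral_lintegral_swap (by
            refine Measurable.aemeasurable ?_
            refine Measurable.lintegral_prod_right' (f := fun q : (Z × T) × Z =>
              ‖κ q.1.2 q.2 q.1.1‖ₑ * g q.1.1 ^ 2) ?_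
            exact hF.comp (f := fun q : (Z × T) × Z => (q.2, q.1.2, q.1.1)) (by fun_prop))]
          refine lintegral_congr fun t => ?_
          rw [lintegral_lintegral_swap]
          exact (hF.comp (f := fun q : Z × Z => (q.1, t, q.2)) (by fun_prop)).aemeasurable
        · refine Measurable.aemeasurable ?_
          refine Measurable.lintegral_prod_right' (f := fun q : (Z × T) × Z =>
              ‖κ q.1.2 q.1.1 q.2‖ₑ * g q.2 ^ 2) ?_
          exact hF.comp (f := fun q : (Z × T) × Z => (q.1.1, q.1.2, q.2)) (by fun_prop)
    _ ≤ A * ∫⁻ z', A * g z' ^ 2 ∂μ := by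
        gcongr 1
        apply lintegral_mono_ae
        filter_upwards [hκ.col] with z' hz'
        have hm' : Measurable fun p : T × Z => ‖κ p.1 p.2 z'‖ₑ :=
          hm.comp (measurable_fst.prodMk (measurable_snd.prodMk measurable_const))
        rw [lintegral_prod _ hm'.aemeasurable] at hz'
        calc _ = (∫⁻ t, ∫⁻ z, ‖κ t z z'‖ₑ ∂μ ∂τ) * g z' ^ 2 := by
              rw [← lintegral_mul_const _ (by exact hm'.lintegral_prod_right')]
              refine lintegral_congr fun t => ?_
              rw [lintegral_mul_const]
              exact hm'.comp (measurable_const.prodMk measurable_id)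
          _ ≤ _ := by gcongr
    _ = _ := by rw [lintegral_const_mul' _ _ ENNReal.coe_ne_top, ← mul_assoc, sq]

lemma SchurBd.aestronglyMeasurable_ker (hκ : SchurBd τ μ κ A) {Ψ : Z → ℝ}
    (hΨ : AEStronglyMeasurable Ψ μ) : AEStronglyMeasurable (kerFun τ μ κ Ψ) μ := by
  unfold kerFun
  have : AEStronglyMeasurable (fun q : Z × T × Z => κ q.2.1 q.1 q.2.2 * Ψ q.2.2)
      (μ.prod (τ.prod μ)) := by
    refine AEStronglyMeasurable.mul ?_ ?_
    · exact (hκ.meas.comp (f := fun q : Z × T × Z => (q.2.1, q.1, q.2.2))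
        (by fun_prop)).aestronglyMeasurable
    · exact hΨ.comp_quasiMeasurePreserving
        (Measure.quasiMeasurePreserving_snd.comp Measure.quasiMeasurePreserving_snd)
  exact this.integral_prod_right'

lemma SchurBd.aestronglyMeasurable_integrand (hκ : SchurBd τ μ κ A) {Ψ : Z → ℝ}
    (hΨ : AEStronglyMeasurable Ψ μ) (z : Z) :
    AEStronglyMeasurable (fun p : T × Z => κ p.1 z p.2 * Ψ p.2) (τ.prod μ) :=
  ((hκ.meas.comp (f := fun q : T × Z => (q.1, z, q.2)) (by fun_prop)).aestronglyMeasurable).mul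
    (hΨ.comp_quasiMeasurePreserving Measure.quasiMeasurePreserving_snd)

lemma lintegral_enorm_sq_lt_top {Ψ : Z → ℝ} (hΨ : MemLp Ψ 2 μ) : ∫⁻ z, ‖Ψ z‖ₑ ^ 2 ∂μ < ∞ := by
  have := lintegral_rpow_enorm_lt_top_of_eLpNorm_lt_top two_ne_zero ENNReal.ofNat_ne_top hΨ.2
  simpa using this

lemma eLpNorm_two_sq (Ψ : Z → ℝ) : eLpNorm Ψ 2 μ ^ 2 = ∫⁻ z, ‖Ψ z‖ₑ ^ 2 ∂μ := by
  rw [eLpNorm_eq_lintegral_rpow_enorm_toReal two_ne_zero ENNReal.ofNat_ne_top]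
  rw [← ENNReal.rpow_natCast, ← ENNReal.rpow_mul]
  norm_num

lemma SchurBd.aemeasurable_lintegral (hκ : SchurBd τ μ κ A) {Ψ : Z → ℝ}
    (hΨ : AEStronglyMeasurable Ψ μ) :
    AEMeasurable (fun z => ∫⁻ p, ‖κ p.1 z p.2‖ₑ * ‖Ψ p.2‖ₑ ∂(τ.prod μ)) μ := by
  have h1 : AEMeasurable (fun q : Z × T × Z => ‖κ q.2.1 q.1 q.2.2‖ₑ) (μ.prod (τ.prod μ)) :=
    (hκ.meas.enorm.comp (f := fun q : Z × T × Z => (q.2.1, q.1, q.2.2)) (by fun_prop)).aemeasurable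
  have h2 : AEMeasurable (fun q : Z × T × Z => ‖Ψ q.2.2‖ₑ) (μ.prod (τ.prod μ)) :=
    hΨ.enorm.comp_quasiMeasurePreserving
      (Measure.quasiMeasurePreserving_snd.comp Measure.quasiMeasurePreserving_snd)
  exact AEMeasurable.lintegral_prod_right' (h1.mul h2)

lemma SchurBd.ae_integrable (hκ : SchurBd τ μ κ A) {Ψ : Z → ℝ} (hΨ : MemLp Ψ 2 μ) :
    ∀ᵐ z ∂μ, Integrable (fun p : T × Z => κ p.1 z p.2 * Ψ p.2) (τ.prod μ) := by
  have h := lintegral_schur hκ hΨ.1.enorm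
  have h2 : ∫⁻ z, (∫⁻ p, ‖κ p.1 z p.2‖ₑ * ‖Ψ p.2‖ₑ ∂(τ.prod μ)) ^ 2 ∂μ ≠ ∞ :=
    (h.trans_lt (ENNReal.mul_lt_top (by simp) (lintegral_enorm_sq_lt_top hΨ))).ne
  have hmeas : AEMeasurable (fun z => (∫⁻ p, ‖κ p.1 z p.2‖ₑ * ‖Ψ p.2‖ₑ ∂(τ.prod μ)) ^ 2) μ :=
    (hκ.aemeasurable_lintegral hΨ.1).pow_const 2
  filter_upwards [ae_lt_top' hmeas h2] with z hz
  refine ⟨hκ.aestronglyMeasurable_integrand hΨ.1 z, ?_⟩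
  rw [HasFiniteIntegral]
  simp_rw [enorm_mul]
  by_contra hcon
  rw [not_lt, top_le_iff] at hcon
  rw [hcon] at hz; simp at hz

lemma SchurBd.eLpNorm_ker_le (hκ : SchurBd τ μ κ A) {Ψ : Z → ℝ} (hΨ : AEStronglyMeasurable Ψ μ) :
    eLpNorm (kerFun τ μ κ Ψ) 2 μ ≤ A * eLpNorm Ψ 2 μ := by
  have h := lintegral_schur hκ hΨ.enorm
  have : eLpNorm (kerFun τ μ κ Ψ) 2 μ ^ 2 ≤ (A * eLpNorm Ψ 2 μ) ^ 2 := by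
    rw [mul_pow, eLpNorm_two_sq, eLpNorm_two_sq]
    refine le_trans (lintegral_mono fun z => ?_) h
    gcongr
    refine (enorm_integral_le_lintegral_enorm _).trans (le_of_eq ?_)
    simp_rw [enorm_mul]
  exact (ENNReal.pow_le_pow_left_iff two_ne_zero).1 this

lemma SchurBd.memLp_ker (hκ : SchurBd τ μ κ A) {Ψ : Z → ℝ} (hΨ : MemLp Ψ 2 μ) :
    MemLp (kerFun τ μ κ Ψ) 2 μ :=
  ⟨hκ.aestronglyMeasurable_ker hΨ.1,
    (hκ.eLpNorm_ker_le hΨ.1).trans_lt (ENNReal.mul_lt_top (by simp) hΨ.2)⟩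

lemma ker_congr_ae {Ψ Φ : Z → ℝ} (h : Ψ =ᵐ[μ] Φ) (z : Z) : kerFun τ μ κ Ψ z = kerFun τ μ κ Φ z := by
  have e : ∀ᵐ p ∂(τ.prod μ), Ψ p.2 = Φ p.2 := Measure.quasiMeasurePreserving_snd.ae h
  refine integral_congr_ae ?_
  filter_upwards [e] with p hp; rw [hp]

/-- Linear operators on `L²` given by pointwise formulas. -/
noncomputable def lpOp {Z' : Type*} [MeasurableSpace Z'] {μ' : Measure Z'} (F : (Z → ℝ) → Z' → ℝ)
    (hmem : ∀ Ψ : Z → ℝ, MemLp Ψ 2 μ → MemLp (F Ψ) 2 μ')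
    (hcongr : ∀ Ψ Φ : Z → ℝ, Ψ =ᵐ[μ] Φ → F Ψ =ᵐ[μ'] F Φ)
    (hadd : ∀ Ψ Φ : Z → ℝ, MemLp Ψ 2 μ → MemLp Φ 2 μ → F (Ψ + Φ) =ᵐ[μ'] F Ψ + F Φ)
    (hsmul : ∀ (c : ℝ) (Ψ : Z → ℝ), MemLp Ψ 2 μ → F (c • Ψ) =ᵐ[μ'] c • F Ψ)
    (A : ℝ≥0) (hbd : ∀ Ψ : Z → ℝ, MemLp Ψ 2 μ → eLpNorm (F Ψ) 2 μ' ≤ A * eLpNorm Ψ 2 μ) :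
    Lp ℝ 2 μ →L[ℝ] Lp ℝ 2 μ' :=
  LinearMap.mkContinuous
    { toFun := fun Ψ => (hmem Ψ (Lp.memLp Ψ)).toLp _
      map_add' := fun Ψ Φ => by
        rw [← MemLp.toLp_add]
        exact MemLp.toLp_congr _ _
          ((hcongr _ _ (Lp.coeFn_add Ψ Φ)).trans (hadd _ _ (Lp.memLp Ψ) (Lp.memLp Φ)))
      map_smul' := fun c Ψ => by
        rw [RingHom.id_apply, ← MemLp.toLp_const_smul]
        exact MemLp.toLp_congr _ _
          ((hcongr _ _ (Lp.coeFn_smul c Ψ)).trans (hsmul _ _ (Lp.memLp Ψ))) }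
    A (fun Ψ => by
      rw [LinearMap.coe_mk, AddHom.coe_mk, Lp.norm_toLp, Lp.norm_def]
      have := ENNReal.toReal_mono (ENNReal.mul_ne_top (by simp) (Lp.memLp Ψ).2.ne)
        (hbd Ψ (Lp.memLp Ψ))
      rwa [ENNReal.toReal_mul, ENNReal.coe_toReal] at this)

lemma lpOp_norm_le {Z' : Type*} [MeasurableSpace Z'] {μ' : Measure Z'} {F : (Z → ℝ) → Z' → ℝ}
    {h1 h2 h3 h4} {A : ℝ≥0} {h5} : ‖(lpOp F h1 h2 h3 h4 A h5 : Lp ℝ 2 μ →L[ℝ] Lp ℝ 2 μ')‖ ≤ A :=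
  LinearMap.mkContinuous_norm_le _ A.2 _

lemma coeFn_lpOp {Z' : Type*} [MeasurableSpace Z'] {μ' : Measure Z'} {F : (Z → ℝ) → Z' → ℝ}
    {h1 h2 h3 h4} {A : ℝ≥0} {h5} (Ψ : Lp ℝ 2 μ) :
    (lpOp F h1 h2 h3 h4 A h5 : Lp ℝ 2 μ →L[ℝ] Lp ℝ 2 μ') Ψ =ᵐ[μ'] F Ψ :=
  MemLp.coeFn_toLp (h1 _ (Lp.memLp Ψ))

lemma SchurBd.ker_add (hκ : SchurBd τ μ κ A) {Ψ Φ : Z → ℝ} (hΨ : MemLp Ψ 2 μ) (hΦ : MemLp Φ 2 μ) :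
    kerFun τ μ κ (Ψ + Φ) =ᵐ[μ] kerFun τ μ κ Ψ + kerFun τ μ κ Φ := by
  filter_upwards [hκ.ae_integrable hΨ, hκ.ae_integrable hΦ] with z h1 h2
  simp only [kerFun, Pi.add_apply, mul_add]
  exact integral_add h1 h2

lemma ker_smul (c : ℝ) (Ψ : Z → ℝ) : kerFun τ μ κ (c • Ψ) = c • kerFun τ μ κ Ψ := by
  funext z
  simp only [kerFun, Pi.smul_apply, smul_eq_mul, ← integral_const_mul]
  congr 1; funext p; ring

/-- The integral operator with kernel `κ` on `L²`. -/
noncomputable def kerOp (hκ : SchurBd τ μ κ A) : Lp ℝ 2 μ →L[ℝ] Lp ℝ 2 μ :=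
  lpOp (kerFun τ μ κ) (fun _ => hκ.memLp_ker) (fun _ _ h => ae_of_all _ (ker_congr_ae h))
    (fun _ _ => hκ.ker_add) (fun c Ψ _ => by rw [ker_smul]) A (fun _ h => hκ.eLpNorm_ker_le h.1)

lemma coeFn_kerOp (hκ : SchurBd τ μ κ A) (Ψ : Lp ℝ 2 μ) : kerOp hκ Ψ =ᵐ[μ] kerFun τ μ κ Ψ :=
  coeFn_lpOp Ψ

lemma norm_kerOp_le (hκ : SchurBd τ μ κ A) : ‖kerOp hκ‖ ≤ A :=
  lpOp_norm_le

lemma kerOp_sub {κ₁ κ₂ : T → Z → Z → ℝ} {A₁ A₂ : ℝ≥0} (h₁ : SchurBd τ μ κ₁ A₁)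
    (h₂ : SchurBd τ μ κ₂ A₂) (h : SchurBd τ μ (fun t z z' => κ₁ t z z' - κ₂ t z z') A) :
    kerOp h₁ - kerOp h₂ = kerOp h := by
  ext1 Ψ
  apply Lp.ext
  filter_upwards [coeFn_kerOp h₁ Ψ, coeFn_kerOp h₂ Ψ, coeFn_kerOp h Ψ, h₁.ae_integrable (Lp.memLp Ψ),
    h₂.ae_integrable (Lp.memLp Ψ), Lp.coeFn_sub (kerOp h₁ Ψ) (kerOp h₂ Ψ)] with z e1 e2 e3 i1 i2 e4
  rw [sub_apply, e4, Pi.sub_apply, e1, e2, e3]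
  simp only [kerFun, sub_mul]
  exact (integral_sub i1 i2).symm

lemma norm_kerOp_sub_le {κ₁ κ₂ : T → Z → Z → ℝ} {A₁ A₂ : ℝ≥0} (h₁ : SchurBd τ μ κ₁ A₁)
    (h₂ : SchurBd τ μ κ₂ A₂) (h : SchurBd τ μ (fun t z z' => κ₁ t z z' - κ₂ t z z') A) :
    ‖kerOp h₁ - kerOp h₂‖ ≤ A := by
  rw [kerOp_sub h₁ h₂ h]; exact norm_kerOp_le h

lemma SchurBd.integral_ker_mul (hκ : SchurBd τ μ κ A) {Ψ Φ : Z → ℝ} (hΨ : MemLp Ψ 2 μ)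
    (hΦ : MemLp Φ 2 μ) : ∫ z, kerFun τ μ κ Ψ z * Φ z ∂μ
      = ∫ z, Ψ z * kerFun τ μ (fun t z z' => κ t z' z) Φ z ∂μ := by
  have hmeas : AEStronglyMeasurable (fun q : Z × T × Z => κ q.2.1 q.1 q.2.2 * Ψ q.2.2 * Φ q.1)
      (μ.prod (τ.prod μ)) := by
    refine AEStronglyMeasurable.mul (AEStronglyMeasurable.mul ?_ ?_) ?_
    · exact (hκ.meas.comp (f := fun q : Z × T × Z => (q.2.1, q.1, q.2.2))
        (by fun_prop)).aestronglyMeasurable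
    · exact hΨ.1.comp_quasiMeasurePreserving
        (Measure.quasiMeasurePreserving_snd.comp Measure.quasiMeasurePreserving_snd)
    · exact hΦ.1.comp_quasiMeasurePreserving Measure.quasiMeasurePreserving_fst
  have hint : Integrable (fun q : Z × T × Z => κ q.2.1 q.1 q.2.2 * Ψ q.2.2 * Φ q.1)
      (μ.prod (τ.prod μ)) := by
    refine ⟨hmeas, ?_⟩
    rw [HasFiniteIntegral, lintegral_prod _ hmeas.enorm]
    have h := lintegral_schur hκ hΨ.1.enorm
    have h2 := sq_lintegral_mul_le (hκ.aemeasurable_lintegral hΨ.1) hΦ.1.enorm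
    have e : ∀ z, ∫⁻ p : T × Z, ‖κ p.1 z p.2 * Ψ p.2 * Φ z‖ₑ ∂(τ.prod μ)
        = (∫⁻ p, ‖κ p.1 z p.2‖ₑ * ‖Ψ p.2‖ₑ ∂(τ.prod μ)) * ‖Φ z‖ₑ := by
      intro z
      simp_rw [enorm_mul]
      rw [lintegral_mul_const' _ _ (by simp)]
    simp_rw [e]
    have h3 : (∫⁻ z, (∫⁻ p, ‖κ p.1 z p.2‖ₑ * ‖Ψ p.2‖ₑ ∂(τ.prod μ)) * ‖Φ z‖ₑ ∂μ) ^ 2 < ∞ :=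
      h2.trans_lt (ENNReal.mul_lt_top (h.trans_lt (ENNReal.mul_lt_top (by simp)
        (lintegral_enorm_sq_lt_top hΨ))) (lintegral_enorm_sq_lt_top hΦ))
    by_contra hcon
    rw [not_lt, top_le_iff] at hcon
    rw [hcon] at h3; simp at h3
  have hmp : MeasurePreserving (fun q : Z × T × Z => (q.2.2, q.2.1, q.1)) (μ.prod (τ.prod μ))
      (μ.prod (τ.prod μ)) := by
    have h1 := (Measure.measurePreserving_swap (μ := μ) (ν := τ.prod μ))
    have h2 := measurePreserving_prodAssoc τ μ μ
    have h3 := (MeasurePreserving.id τ).prod (Measure.measurePreserving_swap (μ := μ) (ν := μ))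
    have h4 := (measurePreserving_prodAssoc τ μ μ).symm
    have h5 := (Measure.measurePreserving_swap (μ := τ.prod μ) (ν := μ))
    exact h5.comp (h4.comp (h3.comp (h2.comp h1)))
  have hint' : Integrable (fun q : Z × T × Z => κ q.2.1 q.2.2 q.1 * Ψ q.1 * Φ q.2.2)
      (μ.prod (τ.prod μ)) :=
    (hmp.integrable_comp hint.1).2 hint
  have l : ∫ z, kerFun τ μ κ Ψ z * Φ z ∂μ
      = ∫ q : Z × T × Z, κ q.2.1 q.1 q.2.2 * Ψ q.2.2 * Φ q.1 ∂(μ.prod (τ.prod μ)) := by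
    rw [integral_prod _ hint]
    simp_rw [kerFun, ← integral_mul_const]
  have r : ∫ z, Ψ z * kerFun τ μ (fun t z z' => κ t z' z) Φ z ∂μ
      = ∫ q : Z × T × Z, κ q.2.1 q.2.2 q.1 * Ψ q.1 * Φ q.2.2 ∂(μ.prod (τ.prod μ)) := by
    rw [integral_prod _ hint']
    simp_rw [kerFun, ← integral_const_mul]
    refine integral_congr_ae (ae_of_all _ fun z => integral_congr_ae (ae_of_all _ fun p => ?_))
    ring
  rw [l, r]
  conv_lhs => rw [← hmp.map_eq]
  rw [integral_map hmp.measurable.aemeasurable (by rw [hmp.map_eq]; exact hmeas)]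

end Schur


/-! ### The half-plane measure and the dominating kernel -/

/-- Lebesgue measure on `(0, ∞)` plus a unit mass at the boundary point `0`. -/
noncomputable def etaM : Measure ℝ := volume.restrict (Set.Ioi 0) + Measure.dirac 0

/-- Lebesgue measure on the open half-plane plus arc length on its boundary. -/
noncomputable def nuM : Measure (ℝ × ℝ) := volume.prod etaM

/-- Lebesgue measure on the positive times. -/
noncomputable def tauM : Measure ℝ := volume.restrict (Set.Ioi 0)

instance : SigmaFinite etaM := by unfold etaM; infer_instance
instance : SigmaFinite nuM := by unfold nuM; infer_instance
instance : SigmaFinite tauM := by unfold tauM; infer_instance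

lemma ae_eta_nonneg : ∀ᵐ y ∂etaM, 0 ≤ y := by
  rw [etaM, ae_add_measure_iff]
  refine ⟨?_, ?_⟩
  · filter_upwards [ae_restrict_mem measurableSet_Ioi] with y hy using le_of_lt hy
  · rw [ae_dirac_iff measurableSet_Ici]

lemma ae_nu_nonneg : ∀ᵐ z ∂nuM, 0 ≤ z.2 :=
  Measure.quasiMeasurePreserving_snd.ae ae_eta_nonneg

lemma ae_tau_pos : ∀ᵐ t ∂tauM, 0 < t := ae_restrict_mem measurableSet_Ioi

lemma ae_tau_nu : ∀ᵐ p ∂(tauM.prod nuM), 0 < p.1 ∧ 0 ≤ p.2.2 := by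
  filter_upwards [Measure.quasiMeasurePreserving_fst.ae ae_tau_pos,
    Measure.quasiMeasurePreserving_snd.ae ae_nu_nonneg] with p h1 h2 using ⟨h1, h2⟩

lemma integrable_rpow_mul_exp_tau {s b : ℝ} (hs : -1 < s) (hb : 0 < b) :
    Integrable (fun t : ℝ => t ^ s * exp (-b * t)) tauM := by
  have := integrableOn_rpow_mul_exp_neg_mul_rpow (p := 1) hs one_pos hb
  simpa [IntegrableOn, tauM] using this

/-- Product of two heat kernels at time `8 t`. -/
noncomputable def Dk (t : ℝ) (z z' : ℝ × ℝ) : ℝ := gk (8 * t) (z.1 - z'.1) * gk (8 * t) (z.2 - z'.2)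

/-- The dominating kernel. -/
noncomputable def Dm (t : ℝ) (z z' : ℝ × ℝ) : ℝ := exp (-t / 2) * (1 + t ^ (-1/4 : ℝ)) * Dk t z z'

lemma Dk_nonneg (t : ℝ) (z z' : ℝ × ℝ) : 0 ≤ Dk t z z' := mul_nonneg (gk_nonneg _ _) (gk_nonneg _ _)

lemma Dm_nonneg {t : ℝ} (ht : 0 < t) (z z' : ℝ × ℝ) : 0 ≤ Dm t z z' := by
  have := Dk_nonneg t z z'
  unfold Dm; positivity

lemma Dk_comm (t : ℝ) (z z' : ℝ × ℝ) : Dk t z z' = Dk t z' z := by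
  rw [Dk, gk_sub_comm, gk_sub_comm (8 * t) z.2, Dk]

lemma Dm_comm (t : ℝ) (z z' : ℝ × ℝ) : Dm t z z' = Dm t z' z := by rw [Dm, Dk_comm, Dm]

lemma exp_mul_Dk_le_Dm {t : ℝ} (ht : 0 < t) (z z' : ℝ × ℝ) : exp (-t / 2) * Dk t z z' ≤ Dm t z z' := by
  unfold Dm
  have h := Dk_nonneg t z z'
  have : 0 ≤ t ^ (-1/4 : ℝ) := by positivity
  gcongr
  nlinarith [exp_pos (-t / 2)]

@[fun_prop]
lemma Measurable.Dk {α : Type*} [MeasurableSpace α] {a : α → ℝ} {b c : α → ℝ × ℝ} (ha : Measurable a)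
    (hb : Measurable b) (hc : Measurable c) : Measurable (fun z => Dk (a z) (b z) (c z)) := by
  unfold _root_.Dk; fun_prop

@[fun_prop]
lemma Measurable.Dm {α : Type*} [MeasurableSpace α] {a : α → ℝ} {b c : α → ℝ × ℝ} (ha : Measurable a)
    (hb : Measurable b) (hc : Measurable c) : Measurable (fun z => Dm (a z) (b z) (c z)) := by
  unfold _root_.Dm; fun_prop

lemma lintegral_gk {t : ℝ} (ht : 0 < t) (x : ℝ) : ∫⁻ x', ENNReal.ofReal (gk t (x - x')) = 1 := by
  rw [← ofReal_integral_eq_lintegral_ofReal (gk_sub_integrable ht x)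
    (ae_of_all _ fun _ => gk_nonneg _ _), integral_gk_sub ht, ENNReal.ofReal_one]

lemma lintegral_gk_eta_le {t : ℝ} (ht : 0 < t) (y : ℝ) :
    ∫⁻ y', ENNReal.ofReal (gk t (y - y')) ∂etaM ≤ ENNReal.ofReal (1 + t ^ (-1/2 : ℝ)) := by
  rw [etaM, lintegral_add_measure, lintegral_dirac' _ (by fun_prop),
    ENNReal.ofReal_add zero_le_one (by positivity)]
  gcongr
  · calc _ ≤ ∫⁻ x', ENNReal.ofReal (gk t (y - x')) := setLIntegral_le_lintegral _ _
      _ = _ := by rw [lintegral_gk ht, ENNReal.ofReal_one]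
  · exact gk_le_inv_sqrt ht _

lemma lintegral_Dk_le {t : ℝ} (ht : 0 < t) (z : ℝ × ℝ) :
    ∫⁻ z', ENNReal.ofReal (Dk t z z') ∂nuM ≤ ENNReal.ofReal (1 + t ^ (-1/2 : ℝ)) := by
  have h8 : (0:ℝ) < 8 * t := by positivity
  simp_rw [Dk, ENNReal.ofReal_mul (gk_nonneg _ _)]
  rw [nuM, lintegral_prod_mul (f := fun x => ENNReal.ofReal (gk (8 * t) (z.1 - x)))
    (g := fun y => ENNReal.ofReal (gk (8 * t) (z.2 - y))) (by fun_prop) (by fun_prop),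
    lintegral_gk h8, one_mul]
  refine (lintegral_gk_eta_le h8 _).trans (ENNReal.ofReal_le_ofReal ?_)
  gcongr 1 + ?_
  exact rpow_le_rpow_of_nonpos ht (by linarith) (by norm_num)

lemma exists_lintegral_Dm_le : ∃ A : ℝ≥0, ∀ z : ℝ × ℝ,
    ∫⁻ p, ENNReal.ofReal (Dm p.1 z p.2) ∂(tauM.prod nuM) ≤ A := by
  have hI : Integrable (fun t : ℝ => exp (-t / 2) * (1 + t ^ (-1/4 : ℝ)) * (1 + t ^ (-1/2 : ℝ))) tauM := by
    have h0 := integrable_rpow_mul_exp_tau (s := 0) (b := 1/2) (by norm_num) (by norm_num)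
    have h1 := integrable_rpow_mul_exp_tau (s := -1/4) (b := 1/2) (by norm_num) (by norm_num)
    have h2 := integrable_rpow_mul_exp_tau (s := -1/2) (b := 1/2) (by norm_num) (by norm_num)
    have h3 := integrable_rpow_mul_exp_tau (s := -3/4) (b := 1/2) (by norm_num) (by norm_num)
    refine (((h0.add h1).add h2).add h3).congr ?_
    filter_upwards [ae_tau_pos] with t ht
    have : t ^ (-3/4 : ℝ) = t ^ (-1/4 : ℝ) * t ^ (-1/2 : ℝ) := by
      rw [← rpow_add ht]; norm_num
    simp only [Pi.add_apply, rpow_zero, this, show -(1/2) * t = -t / 2 by ring]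
    ring
  refine ⟨(∫ t, exp (-t / 2) * (1 + t ^ (-1/4 : ℝ)) * (1 + t ^ (-1/2 : ℝ)) ∂tauM).toNNReal, fun z => ?_⟩
  rw [lintegral_prod _ (by fun_prop)]
  calc _ ≤ ∫⁻ t, ENNReal.ofReal (exp (-t / 2) * (1 + t ^ (-1/4 : ℝ)) * (1 + t ^ (-1/2 : ℝ))) ∂tauM := by
        apply lintegral_mono_ae
        filter_upwards [ae_tau_pos] with t ht
        have hq : 0 ≤ exp (-t / 2) * (1 + t ^ (-1/4 : ℝ)) := by positivity
        simp only [Dm]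
        simp_rw [ENNReal.ofReal_mul hq]
        rw [lintegral_const_mul _ (by fun_prop)]
        gcongr
        exact lintegral_Dk_le ht z
    _ = _ := by
        rw [← ofReal_integral_eq_lintegral_ofReal hI]
        · rfl
        · filter_upwards [ae_tau_pos] with t ht
          simp only [Pi.zero_apply]; positivity

/-- A uniform bound of the row integrals of the dominating kernel. -/
noncomputable def AD : ℝ≥0 := exists_lintegral_Dm_le.choose

lemma lintegral_Dm_le (z : ℝ × ℝ) :
    ∫⁻ p, ENNReal.ofReal (Dm p.1 z p.2) ∂(tauM.prod nuM) ≤ AD :=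
  exists_lintegral_Dm_le.choose_spec z

lemma integrable_Dm (z : ℝ × ℝ) : Integrable (fun p => Dm p.1 z p.2) (tauM.prod nuM) := by
  refine ⟨by fun_prop, ?_⟩
  rw [hasFiniteIntegral_iff_ofReal]
  · exact (lintegral_Dm_le z).trans_lt (by simp)
  · filter_upwards [ae_tau_nu] with p hp using Dm_nonneg hp.1 _ _

lemma integral_Dm_le (z : ℝ × ℝ) : ∫ p, Dm p.1 z p.2 ∂(tauM.prod nuM) ≤ AD := by
  rw [integral_eq_lintegral_of_nonneg_ae]
  · exact ENNReal.toReal_le_coe_of_le_coe (lintegral_Dm_le z)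
  · filter_upwards [ae_tau_nu] with p hp using Dm_nonneg hp.1 _ _
  · fun_prop

lemma SchurBd.of_le_Dm {κ : ℝ → ℝ × ℝ → ℝ × ℝ → ℝ}
    (hm : Measurable (fun p : ℝ × (ℝ × ℝ) × ℝ × ℝ => κ p.1 p.2.1 p.2.2)) {C : ℝ≥0}
    (h : ∀ t z z', 0 < t → 0 ≤ z.2 → 0 ≤ z'.2 → |κ t z z'| ≤ C * Dm t z z') :
    SchurBd tauM nuM κ (C * AD) := by
  have key : ∀ᵐ z ∂nuM, ∫⁻ p, ENNReal.ofReal (C * Dm p.1 z p.2) ∂(tauM.prod nuM) ≤ (C * AD : ℝ≥0) := by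
    filter_upwards with z
    simp_rw [ENNReal.ofReal_mul C.coe_nonneg]
    rw [lintegral_const_mul _ (by fun_prop), ENNReal.coe_mul]
    gcongr
    · simp
    · exact lintegral_Dm_le z
  refine ⟨hm, ?_, ?_⟩
  · filter_upwards [key, ae_nu_nonneg] with z hz hz0
    refine le_trans (lintegral_mono_ae ?_) hz
    filter_upwards [ae_tau_nu] with p hp
    rw [← ofReal_norm]
    exact ENNReal.ofReal_le_ofReal (h _ _ _ hp.1 hz0 hp.2)
  · filter_upwards [key, ae_nu_nonneg] with z hz hz0
    refine le_trans (lintegral_mono_ae ?_) hz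
    filter_upwards [ae_tau_nu] with p hp
    rw [← ofReal_norm, Dm_comm]
    exact ENNReal.ofReal_le_ofReal (h _ _ _ hp.1 hp.2 hz0)

lemma exists_lintegral_Dk_mul_le : ∃ A : ℝ≥0, ∀ (z : ℝ × ℝ) (Ψ : ℝ × ℝ → ℝ),
    AEStronglyMeasurable Ψ nuM →
    ∫⁻ p, ENNReal.ofReal (exp (-p.1 / 2) * Dk p.1 z p.2) * ‖Ψ p.2‖ₑ ∂(tauM.prod nuM)
      ≤ A * eLpNorm Ψ 2 nuM := by
  have hI : Integrable (fun t : ℝ => exp (-t / 2) * t ^ (-1/4 : ℝ) * (1 + t ^ (-1/2 : ℝ))) tauM := by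
    have h1 := integrable_rpow_mul_exp_tau (s := -1/4) (b := 1/2) (by norm_num) (by norm_num)
    have h3 := integrable_rpow_mul_exp_tau (s := -3/4) (b := 1/2) (by norm_num) (by norm_num)
    refine (h1.add h3).congr ?_
    filter_upwards [ae_tau_pos] with t ht
    have : t ^ (-3/4 : ℝ) = t ^ (-1/4 : ℝ) * t ^ (-1/2 : ℝ) := by
      rw [← rpow_add ht]; norm_num
    simp only [Pi.add_apply, this, show -(1/2) * t = -t / 2 by ring]
    ring
  have hJ := integrable_rpow_mul_exp_tau (s := -3/4) (b := 1/2) (by norm_num) (by norm_num)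
  obtain ⟨I, hIe⟩ : ∃ I, I = (∫ t, exp (-t / 2) * t ^ (-1/4 : ℝ) * (1 + t ^ (-1/2 : ℝ)) ∂tauM).toNNReal :=
    ⟨_, rfl⟩
  obtain ⟨J, hJe⟩ : ∃ J, J = (∫ t, t ^ (-3/4 : ℝ) * exp (-(1/2) * t) ∂tauM).toNNReal := ⟨_, rfl⟩
  refine ⟨NNReal.sqrt (I * J), fun z Ψ hΨ => ?_⟩
  have hsq : ((NNReal.sqrt (I * J) : ℝ≥0∞) * eLpNorm Ψ 2 nuM) ^ 2 = I * (J * ∫⁻ z, ‖Ψ z‖ₑ ^ 2 ∂nuM) := by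
    rw [mul_pow, eLpNorm_two_sq, ← ENNReal.coe_pow, NNReal.sq_sqrt, ENNReal.coe_mul, mul_assoc]
  rw [← ENNReal.pow_le_pow_left_iff two_ne_zero, hsq]
  have e : ∀ᵐ p ∂(tauM.prod nuM), ENNReal.ofReal (exp (-p.1 / 2) * Dk p.1 z p.2) * ‖Ψ p.2‖ₑ
      = ENNReal.ofReal (exp (-p.1 / 4) * p.1 ^ (3/8 : ℝ) * Dk p.1 z p.2) *
        (ENNReal.ofReal (exp (-p.1 / 4) * p.1 ^ (-3/8 : ℝ)) * ‖Ψ p.2‖ₑ) := by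
    filter_upwards [ae_tau_nu] with p hp
    rw [← mul_assoc, ← ENNReal.ofReal_mul' (mul_nonneg (exp_pos _).le (rpow_nonneg hp.1.le _))]
    congr 2
    have h1 : exp (-p.1 / 2) = exp (-p.1 / 4) * exp (-p.1 / 4) := by rw [← exp_add]; ring_nf
    have h2 : p.1 ^ (3/8 : ℝ) * p.1 ^ (-3/8 : ℝ) = 1 := by rw [← rpow_add hp.1]; norm_num
    rw [h1]
    linear_combination (- exp (-p.1 / 4) * exp (-p.1 / 4) * Dk p.1 z p.2) * h2
  rw [lintegral_congr_ae e]
  refine (sq_lintegral_mul_le (by fun_prop) ?_).trans ?_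
  · have h1 : AEMeasurable (fun p : ℝ × ℝ × ℝ => ENNReal.ofReal (exp (-p.1 / 4) * p.1 ^ (-3/8 : ℝ)))
      (tauM.prod nuM) := by fun_prop
    exact h1.mul (hΨ.enorm.comp_quasiMeasurePreserving Measure.quasiMeasurePreserving_snd)
  gcongr
  · rw [lintegral_prod _ (by fun_prop)]
    calc _ ≤ ∫⁻ t, ENNReal.ofReal (exp (-t / 2) * t ^ (-1/4 : ℝ) * (1 + t ^ (-1/2 : ℝ))) ∂tauM := by
          apply lintegral_mono_ae
          filter_upwards [ae_tau_pos] with t ht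
          have hq : 0 ≤ exp (-t / 2) * t ^ (-1/4 : ℝ) := by positivity
          calc _ ≤ ∫⁻ z', ENNReal.ofReal (exp (-t / 2) * t ^ (-1/4 : ℝ) * Dk t z z') ∂nuM := by
                apply lintegral_mono
                intro z'
                beta_reduce
                have hD := Dk_nonneg t z z'
                rw [← ENNReal.ofReal_pow (by positivity)]
                apply ENNReal.ofReal_le_ofReal
                have hD2 : Dk t z z' ≤ t ^ (-1 : ℝ) := by
                  have h8 : (0:ℝ) < 8 * t := by positivity
                  have : ∀ x, gk (8 * t) x ≤ t ^ (-1/2 : ℝ) := fun x =>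
                    (gk_le_inv_sqrt h8 x).trans
                      (rpow_le_rpow_of_nonpos ht (by linarith) (by norm_num))
                  calc Dk t z z' ≤ t ^ (-1/2 : ℝ) * t ^ (-1/2 : ℝ) :=
                        mul_le_mul (this _) (this _) (gk_nonneg _ _) (by positivity)
                    _ = _ := by rw [← rpow_add ht]; norm_num
                have h1 : exp (-t / 2) = exp (-t / 4) * exp (-t / 4) := by rw [← exp_add]; ring_nf
                have h2 : t ^ (-1/4 : ℝ) = t ^ (3/8 : ℝ) * t ^ (3/8 : ℝ) * t ^ (-1 : ℝ) := by
                  rw [← rpow_add ht, ← rpow_add ht]; norm_num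
                rw [h1, h2]
                calc _ = exp (-t / 4) * exp (-t / 4) * (t ^ (3/8 : ℝ) * t ^ (3/8 : ℝ) * Dk t z z') * Dk t z z' := by ring
                  _ ≤ _ := by gcongr
            _ ≤ _ := by
                simp_rw [ENNReal.ofReal_mul hq]
                rw [lintegral_const_mul _ (by fun_prop)]
                gcongr
                exact lintegral_Dk_le ht z
      _ = _ := by
          rw [← ofReal_integral_eq_lintegral_ofReal hI, hIe]
          · rfl
          · filter_upwards [ae_tau_pos] with t ht
            simp only [Pi.zero_apply]; positivity
  · apply le_of_eq
    simp_rw [mul_pow]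
    rw [lintegral_prod_mul (f := fun t : ℝ => ENNReal.ofReal (exp (-t / 4) * t ^ (-3/8 : ℝ)) ^ 2)
      (g := fun z => ‖Ψ z‖ₑ ^ 2) (by fun_prop) (hΨ.enorm.pow_const 2)]
    congr 1
    rw [hJe]
    change _ = ENNReal.ofReal _
    rw [ofReal_integral_eq_lintegral_ofReal hJ]
    · apply lintegral_congr_ae
      filter_upwards [ae_tau_pos] with t ht
      rw [← ENNReal.ofReal_pow (by positivity)]
      congr 1
      have h1 : exp (-(1/2) * t) = exp (-t / 4) * exp (-t / 4) := by rw [← exp_add]; ring_nf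
      have h2 : t ^ (-3/4 : ℝ) = t ^ (-3/8 : ℝ) * t ^ (-3/8 : ℝ) := by rw [← rpow_add ht]; norm_num
      rw [h1, h2]; ring
    · filter_upwards [ae_tau_pos] with t ht
      simp only [Pi.zero_apply]; positivity

/-- The constant in the pointwise bound of the dominating kernel by the `L²` norm. -/
noncomputable def AD₂ : ℝ≥0 := exists_lintegral_Dk_mul_le.choose

lemma lintegral_Dk_mul_le (z : ℝ × ℝ) {Ψ : ℝ × ℝ → ℝ} (hΨ : AEStronglyMeasurable Ψ nuM) :
    ∫⁻ p, ENNReal.ofReal (exp (-p.1 / 2) * Dk p.1 z p.2) * ‖Ψ p.2‖ₑ ∂(tauM.prod nuM)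
      ≤ AD₂ * eLpNorm Ψ 2 nuM :=
  exists_lintegral_Dk_mul_le.choose_spec z Ψ hΨ

section Pointwise

variable {κ : ℝ → ℝ × ℝ → ℝ × ℝ → ℝ} {C : ℝ≥0} {z : ℝ × ℝ} {Ψ : ℝ × ℝ → ℝ}

lemma lintegral_ker_mul_le (h : ∀ t z', 0 < t → 0 ≤ z'.2 → |κ t z z'| ≤ C * (exp (-t / 2) * Dk t z z'))
    (hΨ : AEStronglyMeasurable Ψ nuM) :
    ∫⁻ p, ‖κ p.1 z p.2 * Ψ p.2‖ₑ ∂(tauM.prod nuM) ≤ C * (AD₂ * eLpNorm Ψ 2 nuM) := by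
  refine le_trans ?_ (mul_le_mul_right (lintegral_Dk_mul_le z hΨ) C)
  rw [← lintegral_const_mul' _ _ (by simp)]
  apply lintegral_mono_ae
  filter_upwards [ae_tau_nu] with p hp
  rw [enorm_mul, ← mul_assoc]
  gcongr
  rw [← ofReal_norm, ← ENNReal.ofReal_coe_nnreal, ← ENNReal.ofReal_mul C.coe_nonneg]
  exact ENNReal.ofReal_le_ofReal (h _ _ hp.1 hp.2)

lemma abs_kerFun_le (h : ∀ t z', 0 < t → 0 ≤ z'.2 → |κ t z z'| ≤ C * (exp (-t / 2) * Dk t z z'))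
    (hΨ : MemLp Ψ 2 nuM) : |kerFun tauM nuM κ Ψ z| ≤ C * (AD₂ * (eLpNorm Ψ 2 nuM).toReal) := by
  have h1 : ‖kerFun tauM nuM κ Ψ z‖ₑ ≤ C * (AD₂ * eLpNorm Ψ 2 nuM) :=
    (enorm_integral_le_lintegral_enorm _).trans (lintegral_ker_mul_le h hΨ.1)
  have h2 := ENNReal.toReal_mono (ENNReal.mul_ne_top (by simp) (ENNReal.mul_ne_top (by simp) hΨ.2.ne)) h1
  simpa [ENNReal.toReal_mul] using h2

end Pointwise


/-! ### The Neumann resolvent kernel and its Green representation -/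

lemma gk_le_of_le {t T : ℝ} (ht : 0 < t) (h1 : t ≤ T) (h2 : T ≤ 4 * t) (x : ℝ) : gk t x ≤ 2 * gk T x := by
  have hm : 0 < T / t := by have : 0 < T := by linarith
                            positivity
  rw [gk_scale ht hm x, div_mul_cancel₀ _ ht.ne']
  have h3 : √(T / t) ≤ 2 := by
    rw [sqrt_le_left (by norm_num), div_le_iff₀ ht]; linarith
  have h4 : exp (-(x ^ 2) * (T / t - 1) / (4 * (T / t) * t)) ≤ 1 := by
    rw [exp_le_one_iff]
    apply div_nonpos_of_nonpos_of_nonneg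
    · have : 1 ≤ T / t := by rw [le_div_iff₀ ht]; linarith
      nlinarith [sq_nonneg x]
    · positivity
  have := gk_nonneg T x
  calc _ ≤ 2 * gk T x * 1 := by gcongr
    _ = _ := by ring

/-- The time derivative of the heat kernel. -/
noncomputable def dgk (t x : ℝ) : ℝ := gk t x * (x ^ 2 / (4 * t ^ 2) - 1 / (2 * t))

lemma hasDerivAt_gk_time {t : ℝ} (ht : 0 < t) (x : ℝ) : HasDerivAt (fun t => gk t x) (dgk t x) t := by
  unfold dgk gk
  have hp : 0 < 4 * π * t := by positivity
  have h1 : HasDerivAt (fun t : ℝ => (√(4 * π * t))⁻¹) (-(4 * π / (2 * √(4 * π * t))) / √(4 * π * t) ^ 2) t := by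
    have h := ((hasDerivAt_id t).const_mul (4 * π)).sqrt hp.ne'
    simp only [mul_one, id] at h
    exact h.fun_inv (by positivity)
  have h2 : HasDerivAt (fun t : ℝ => -(x ^ 2) / (4 * t)) (x ^ 2 / (4 * t ^ 2)) t := by
    have h := (((hasDerivAt_id t).const_mul 4).fun_inv (by simp; positivity)).const_mul (-(x ^ 2))
    simp only [id] at h
    refine (h.congr_of_eventuallyEq (.of_forall fun s => ?_)).congr_deriv ?_
    · simp [div_eq_mul_inv]
    · field_simp
  refine (h1.mul h2.exp).congr_deriv ?_
  have hs : √(4 * π * t) ^ 2 = 4 * π * t := sq_sqrt hp.le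
  have hs0 : √(4 * π * t) ≠ 0 := by positivity
  field_simp
  rw [hs]
  ring

lemma abs_dgk_le {t : ℝ} (ht : 0 < t) (x : ℝ) : |dgk t x| ≤ 10 / t * gk (4 * t) x := by
  have h0 := gk_nonneg t x
  have h2 : |x| * (|x| * gk t x) ≤ 32 * t * gk (4 * t) x := by
    calc |x| * (|x| * gk t x) ≤ |x| * (4 * √t * gk (2 * t) x) := mul_le_mul_of_nonneg_left (abs_mul_gk_le ht x) (abs_nonneg _)
      _ = 4 * √t * (|x| * gk (2 * t) x) := by ring
      _ ≤ 4 * √t * (4 * √(2 * t) * gk (2 * (2 * t)) x) := mul_le_mul_of_nonneg_left (abs_mul_gk_le (by positivity) x) (by positivity)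
      _ = 16 * √2 * (√t * √t) * gk (4 * t) x := by rw [sqrt_mul (by norm_num)]; ring_nf
      _ ≤ _ := by
        rw [mul_self_sqrt ht.le]
        have h2 := sqrt_two_le
        have := gk_nonneg (4 * t) x
        gcongr
        linarith
  have h3 : gk t x ≤ 2 * gk (4 * t) x := gk_le_of_le ht (by linarith) le_rfl x
  unfold dgk
  rw [abs_mul, abs_of_nonneg h0]
  have h4 : |x ^ 2 / (4 * t ^ 2) - 1 / (2 * t)| ≤ |x| * |x| / (4 * t ^ 2) + 1 / (2 * t) := by
    refine (abs_sub _ _).trans (le_of_eq ?_)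
    rw [abs_of_nonneg (by positivity), abs_of_nonneg (by positivity), ← sq, sq_abs]
  calc _ ≤ gk t x * (|x| * |x| / (4 * t ^ 2) + 1 / (2 * t)) := by gcongr
    _ = (|x| * (|x| * gk t x)) / (4 * t ^ 2) + gk t x / (2 * t) := by ring
    _ ≤ 32 * t * gk (4 * t) x / (4 * t ^ 2) + 2 * gk (4 * t) x / (2 * t) := by gcongr
    _ ≤ _ := by
      have : 32 * t * gk (4 * t) x / (4 * t ^ 2) + 2 * gk (4 * t) x / (2 * t) = 9 / t * gk (4 * t) x := by
        field_simp; ring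
      rw [this]
      have := gk_nonneg (4 * t) x
      gcongr; norm_num

lemma measurable_dgk (t : ℝ) : Measurable (dgk t) := by unfold dgk; fun_prop

lemma Integrable.bdd_mul_of_gk {t : ℝ} (ht : 0 < t) (y : ℝ) {g : ℝ → ℝ} {C : ℝ} {s : Set ℝ}
    (hs : MeasurableSet s) (hg : AEStronglyMeasurable g (volume.restrict s)) (hC : ∀ x ∈ s, |g x| ≤ C) :
    IntegrableOn (fun y' => gk t (y - y') * g y') s := by
  refine (gk_sub_integrable ht y).integrableOn.mul_bdd (c := C) hg ?_
  filter_upwards [ae_restrict_mem hs] with x hx using hC x hx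

/-- Heat kernel acting on a function on the half-line. -/
noncomputable def halfG (g : ℝ → ℝ) (y t : ℝ) : ℝ := ∫ y' in Set.Ioi 0, gk t (y - y') * g y'

lemma abs_halfG_le {g : ℝ → ℝ} {C : ℝ} (hC : ∀ y, 0 < y → |g y| ≤ C) {t : ℝ} (ht : 0 < t) (y : ℝ) :
    |halfG g y t| ≤ C := by
  have hC0 : 0 ≤ C := (abs_nonneg _).trans (hC 1 one_pos)
  calc |halfG g y t| ≤ ∫ y' in Set.Ioi 0, gk t (y - y') * C := by
        rw [← norm_eq_abs, halfG]
        refine norm_integral_le_of_norm_le ((gk_sub_integrable ht y).integrableOn.mul_const C) ?_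
        filter_upwards [ae_restrict_mem measurableSet_Ioi] with x hx
        rw [norm_mul, norm_of_nonneg (gk_nonneg _ _)]
        exact mul_le_mul_of_nonneg_left (hC x hx) (gk_nonneg _ _)
    _ ≤ ∫ y', gk t (y - y') * C := setIntegral_le_integral ((gk_sub_integrable ht y).mul_const C)
        (ae_of_all _ fun x => mul_nonneg (gk_nonneg _ _) hC0)
    _ = C := by rw [integral_mul_const, integral_gk_sub ht, one_mul]

/-- `g, g', g''` are the derivatives of `g` on `[0, ∞)`, all bounded there. -/
structure BddC2 (g g' g'' : ℝ → ℝ) (C : ℝ) : Prop where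
  d1 : ∀ y, 0 ≤ y → HasDerivAt g (g' y) y
  d2 : ∀ y, 0 ≤ y → HasDerivAt g' (g'' y) y
  meas : Measurable g''
  b0 : ∀ y, 0 ≤ y → |g y| ≤ C
  b1 : ∀ y, 0 ≤ y → |g' y| ≤ C
  b2 : ∀ y, 0 ≤ y → |g'' y| ≤ C

namespace BddC2

variable {g g' g'' : ℝ → ℝ} {C : ℝ}

lemma cont (h : BddC2 g g' g'' C) : ContinuousOn g (Set.Ici 0) :=
  fun y hy => (h.d1 y hy).continuousAt.continuousWithinAt

lemma aesm (h : BddC2 g g' g'' C) : AEStronglyMeasurable g (volume.restrict (Set.Ioi 0)) :=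
  (h.cont.mono Set.Ioi_subset_Ici_self).aestronglyMeasurable measurableSet_Ioi

lemma hasDerivAt_halfG (h : BddC2 g g' g'' C) {t : ℝ} (ht : 0 < t) (y : ℝ) :
    HasDerivAt (halfG g y) (halfG g'' y t + gk t y * g' 0 - y / (2 * t) * gk t y * g 0) t := by
  have hC0 : 0 ≤ C := (abs_nonneg _).trans (h.b0 0 le_rfl)
  have h1 : HasDerivAt (halfG g y) (∫ y' in Set.Ioi 0, dgk t (y - y') * g y') t := by
    refine (hasDerivAt_integral_of_dominated_loc_of_deriv_le (x₀ := t)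
      (F := fun t y' => gk t (y - y') * g y') (F' := fun t y' => dgk t (y - y') * g y') (s := Set.Ioo (t / 2) (2 * t))
      (bound := fun y' => 40 / t * gk (8 * t) (y - y') * C)
      (Ioo_mem_nhds (by linarith) (by linarith)) ?_ ?_ ?_ ?_ ?_ ?_).2
    · filter_upwards with s
      exact (AEStronglyMeasurable.mul (by fun_prop) h.aesm)
    · exact Integrable.bdd_mul_of_gk ht y measurableSet_Ioi h.aesm fun x hx => h.b0 x (le_of_lt hx)
    · exact ((measurable_dgk t).comp (measurable_const.sub measurable_id)).aestronglyMeasurable.mul h.aesm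
    · filter_upwards [ae_restrict_mem measurableSet_Ioi] with x hx s hs
      have hs0 : 0 < s := by linarith [hs.1]
      rw [norm_mul]
      refine mul_le_mul ?_ (h.b0 x (le_of_lt hx)) (norm_nonneg _) ?_
      · have h3 : gk (4 * s) (y - x) ≤ 2 * gk (8 * t) (y - x) :=
          gk_le_of_le (by linarith) (by linarith [hs.2]) (by linarith [hs.1]) _
        calc _ ≤ 10 / s * gk (4 * s) (y - x) := abs_dgk_le hs0 _
          _ ≤ 10 / (t / 2) * (2 * gk (8 * t) (y - x)) := by
            gcongr
            · exact gk_nonneg _ _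
            · exact hs.1.le
          _ = _ := by field_simp; ring
      · have := gk_nonneg (8 * t) (y - x)
        positivity
    · exact (((gk_sub_integrable (by positivity) y).const_mul _).mul_const C).integrableOn
    · filter_upwards with x s hs
      exact (hasDerivAt_gk_time (by linarith [hs.1]) _).mul_const _
  refine h1.congr_deriv ?_
  have hk : ∀ x, HasDerivAt (fun x => gk t (y - x)) ((y - x) / (2 * t) * gk t (y - x)) x := fun x =>
    ((hasDerivAt_gk (t := t) (y - x)).comp x ((hasDerivAt_id x).const_sub y)).congr_deriv (by ring)
  have hk' : ∀ x, HasDerivAt (fun x => (y - x) / (2 * t) * gk t (y - x)) (dgk t (y - x)) x := fun x =>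
    ((((hasDerivAt_id x).const_sub y).div_const (2 * t)).mul (hk x)).congr_deriv (by
      unfold dgk; simp only [id]; field_simp; ring)
  have i1 : IntegrableOn (fun x => dgk t (y - x) * g x) (Set.Ioi 0) := by
    refine Integrable.mul_bdd (c := C) (f := fun x => dgk t (y - x)) ?_ h.aesm ?_
    · refine Integrable.integrableOn ?_
      refine ((gk_sub_integrable (t := 4 * t) (by positivity) y).const_mul (10 / t)).mono'
        ((measurable_dgk t).comp (measurable_const.sub measurable_id)).aestronglyMeasurable ?_
      filter_upwards with x using abs_dgk_le ht _
    · filter_upwards [ae_restrict_mem measurableSet_Ioi] with x hx using h.b0 x (le_of_lt hx)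
  have i2 : IntegrableOn (fun x => gk t (y - x) * g'' x) (Set.Ioi 0) :=
    Integrable.bdd_mul_of_gk ht y measurableSet_Ioi h.meas.aestronglyMeasurable
      fun x hx => h.b2 x (le_of_lt hx)
  have e : ∫ x in Set.Ioi (0:ℝ), (dgk t (y - x) * g x - gk t (y - x) * g'' x)
      = 0 - ((y - 0) / (2 * t) * gk t (y - 0) * g 0 - gk t (y - 0) * g' 0) := by
    refine integral_Ioi_of_hasDerivAt_of_tendsto'
      (f := fun x => (y - x) / (2 * t) * gk t (y - x) * g x - gk t (y - x) * g' x)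
      (fun x hx => ?_) (i1.sub i2) ?_
    · refine (((hk' x).mul (h.d1 x hx)).sub ((hk x).mul (h.d2 x hx))).congr_deriv ?_
      ring
    · have hlim : Tendsto (fun x => gk (2 * t) (y - x)) atTop (𝓝 0) := by
        have h2 : Tendsto (fun x : ℝ => -((y - x) ^ 2) / (4 * (2 * t))) atTop atBot := by
          have : Tendsto (fun x : ℝ => (x - y) ^ 2) atTop atTop :=
            (tendsto_pow_atTop two_ne_zero).comp (tendsto_atTop_add_const_right _ (-y) tendsto_id)
          have h3 := (this.atTop_div_const (by positivity : 0 < 4 * (2 * t)))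
          refine (tendsto_neg_atTop_atBot.comp h3).congr fun x => ?_
          simp only [Function.comp]; ring
        have := (tendsto_exp_atBot.comp h2).const_mul (√(4 * π * (2 * t)))⁻¹
        simpa [gk] using this
      refine squeeze_zero_norm' (a := fun x => (2 / √t + 2) * C * gk (2 * t) (y - x)) ?_ ?_
      · filter_upwards [eventually_ge_atTop 0] with x hx
        have hsq : √t * √t = t := mul_self_sqrt ht.le
        have hst : 0 < √t := by positivity
        have a1 := abs_mul_gk_le ht (y - x)
        have a2 := gk_le_two_mul ht (y - x)
        have a3 := gk_nonneg (2 * t) (y - x)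
        calc ‖(y - x) / (2 * t) * gk t (y - x) * g x - gk t (y - x) * g' x‖
            ≤ ‖(y - x) / (2 * t) * gk t (y - x) * g x‖ + ‖gk t (y - x) * g' x‖ := norm_sub_le _ _
          _ = (|y - x| * gk t (y - x)) / (2 * t) * |g x| + gk t (y - x) * |g' x| := by
            simp only [norm_mul, norm_div, norm_eq_abs, abs_of_pos ht, abs_of_nonneg (gk_nonneg t (y - x)), Nat.abs_ofNat]
            ring
          _ ≤ (4 * √t * gk (2 * t) (y - x)) / (2 * t) * C + 2 * gk (2 * t) (y - x) * C := by
            have b0 := h.b0 x hx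
            have b1 := h.b1 x hx
            gcongr
          _ = _ := by
            have : (4 * √t * gk (2 * t) (y - x)) / (2 * t) = 2 / √t * gk (2 * t) (y - x) := by
              rw [div_mul_eq_mul_div, div_eq_div_iff (by positivity) hst.ne']
              linear_combination (4 * gk (2 * t) (y - x)) * hsq
            rw [this]; ring
      · simpa using hlim.const_mul ((2 / √t + 2) * C)
  rw [integral_sub i1 i2] at e
  unfold halfG
  simp only [sub_zero] at e
  linear_combination e

end BddC2

/-- `A, A', A''` are the derivatives of `A` on the line, all bounded. -/
structure BddC2R (A A' A'' : ℝ → ℝ) (C : ℝ) : Prop where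
  d1 : ∀ x, HasDerivAt A (A' x) x
  d2 : ∀ x, HasDerivAt A' (A'' x) x
  meas : Measurable A''
  b0 : ∀ x, |A x| ≤ C
  b1 : ∀ x, |A' x| ≤ C
  b2 : ∀ x, |A'' x| ≤ C

/-- Heat kernel acting on a function on the line. -/
noncomputable def lineG (A : ℝ → ℝ) (x t : ℝ) : ℝ := ∫ x', gk t (x - x') * A x'

/-- Neumann heat kernel acting on a function on the half-line. -/
noncomputable def evenG (g : ℝ → ℝ) (y t : ℝ) : ℝ := halfG g y t + halfG g (-y) t

/-- The Neumann heat kernel of the half-line. -/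
noncomputable def nk (t y y' : ℝ) : ℝ := gk t (y - y') + gk t (y + y')

lemma lineG_eq {A : ℝ → ℝ} {C : ℝ} (hm : AEStronglyMeasurable A) (hC : ∀ x, |A x| ≤ C) {t : ℝ}
    (ht : 0 < t) (x : ℝ) : lineG A x t = halfG A x t + halfG (fun w => A (-w)) (-x) t := by
  have hi : Integrable (fun x' => gk t (x - x') * A x') :=
    (gk_sub_integrable ht x).mul_bdd (c := C) hm (ae_of_all _ hC)
  unfold lineG halfG
  rw [← integral_add_compl (measurableSet_Ioi (a := (0:ℝ))) hi, Set.compl_Ioi]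
  congr 1
  have := integral_comp_neg_Ioi (0:ℝ) (fun x' => gk t (x - x') * A x')
  rw [neg_zero] at this
  rw [← this]
  congr 1; ext w
  rw [← gk_neg]; ring_nf

lemma BddC2R.continuous {A A' A'' : ℝ → ℝ} {C : ℝ} (h : BddC2R A A' A'' C) : Continuous A :=
  continuous_iff_continuousAt.2 fun x => (h.d1 x).continuousAt

lemma BddC2R.hasDerivAt_lineG {A A' A'' : ℝ → ℝ} {C : ℝ} (h : BddC2R A A' A'' C) {t : ℝ} (ht : 0 < t)
    (x : ℝ) : HasDerivAt (lineG A x) (lineG A'' x t) t := by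
  have h1 : BddC2 A A' A'' C := ⟨fun y _ => h.d1 y, fun y _ => h.d2 y, h.meas, fun y _ => h.b0 y,
    fun y _ => h.b1 y, fun y _ => h.b2 y⟩
  have h2 : BddC2 (fun x => A (-x)) (fun x => -A' (-x)) (fun x => A'' (-x)) C :=
    ⟨fun y _ => ((h.d1 (-y)).comp y (hasDerivAt_neg y)).congr_deriv (by ring),
      fun y _ => (((h.d2 (-y)).comp y (hasDerivAt_neg y)).neg).congr_deriv (by ring),
      h.meas.comp measurable_neg, fun y _ => h.b0 _,
    fun y _ => by rw [abs_neg]; exact h.b1 _, fun y _ => h.b2 _⟩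
  have e := (h1.hasDerivAt_halfG ht x).add (h2.hasDerivAt_halfG ht (-x))
  refine (e.congr_of_eventuallyEq ?_).congr_deriv ?_
  · filter_upwards [lt_mem_nhds ht] with s hs
    exact lineG_eq h.continuous.aestronglyMeasurable h.b0 hs x
  · rw [lineG_eq h.meas.aestronglyMeasurable h.b2 ht x, gk_neg, neg_zero]; ring

lemma gk_sqrt_mul {t : ℝ} (ht : 0 < t) (w : ℝ) : √t * gk t (√t * w) = gk 1 w := by
  unfold gk
  rw [sqrt_mul (by positivity) t, mul_pow, sq_sqrt ht.le, mul_one]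
  field_simp

lemma lineG_eq_scaled (A : ℝ → ℝ) {t : ℝ} (ht : 0 < t) (x : ℝ) :
    lineG A x t = ∫ w, gk 1 w * A (x - √t * w) := by
  have hs : 0 < √t := by positivity
  have h1 := integral_sub_left_eq_self (fun w => gk t w * A (x - w)) volume x
  simp only [sub_sub_cancel] at h1
  have h2 := Measure.integral_comp_mul_left (fun w => gk t w * A (x - w)) (√t)
  rw [lineG, h1]
  have h3 : ∫ w, gk 1 w * A (x - √t * w) = √t * ∫ w, gk t (√t * w) * A (x - √t * w) := by
    rw [← integral_const_mul]
    congr 1; ext w; rw [← gk_sqrt_mul ht w]; ring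
  rw [h3, h2, abs_of_pos (by positivity), smul_eq_mul, ← mul_assoc, mul_inv_cancel₀ hs.ne', one_mul]

lemma tendsto_lineG {A : ℝ → ℝ} {C : ℝ} (hA : Continuous A) (hC : ∀ x, |A x| ≤ C) (x : ℝ) :
    Tendsto (lineG A x) (𝓝[>] 0) (𝓝 (A x)) := by
  have h1 : Tendsto (fun t => ∫ w, gk 1 w * A (x - √t * w)) (𝓝[>] 0) (𝓝 (∫ w, gk 1 w * A x)) := by
    refine tendsto_integral_filter_of_dominated_convergence (fun w => gk 1 w * C) ?_ ?_ ?_ ?_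
    · filter_upwards with t
      fun_prop
    · filter_upwards with t
      filter_upwards with w
      rw [norm_mul, norm_of_nonneg (gk_nonneg _ _)]
      exact mul_le_mul_of_nonneg_left (hC _) (gk_nonneg _ _)
    · exact (gk_integrable one_pos).mul_const C
    · filter_upwards with w
      have : Continuous (fun t => gk 1 w * A (x - √t * w)) := by fun_prop
      simpa using (this.tendsto 0).mono_left nhdsWithin_le_nhds
  rw [integral_mul_const, integral_gk one_pos, one_mul] at h1
  refine h1.congr' ?_
  filter_upwards [self_mem_nhdsWithin] with t ht using (lineG_eq_scaled A ht x).symm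

lemma abs_lineG_le {A : ℝ → ℝ} {C : ℝ} (hC : ∀ x, |A x| ≤ C) {t : ℝ} (ht : 0 < t) (x : ℝ) :
    |lineG A x t| ≤ C := by
  rw [lineG, ← norm_eq_abs]
  calc _ ≤ ∫ x', gk t (x - x') * C := by
        refine norm_integral_le_of_norm_le ((gk_sub_integrable ht x).mul_const C) ?_
        filter_upwards with w
        rw [norm_mul, norm_of_nonneg (gk_nonneg _ _)]
        exact mul_le_mul_of_nonneg_left (hC _) (gk_nonneg _ _)
    _ = C := by rw [integral_mul_const, integral_gk_sub ht, one_mul]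

lemma evenG_eq_lineG {g : ℝ → ℝ} {C : ℝ} (hg : ContinuousOn g (Set.Ici 0))
    (hC : ∀ y, 0 ≤ y → |g y| ≤ C) {t : ℝ} (ht : 0 < t) (y : ℝ) :
    evenG g y t = lineG (fun w => g |w|) y t := by
  have hc : Continuous (fun w : ℝ => g |w|) :=
    hg.comp_continuous continuous_abs fun w => abs_nonneg w
  rw [lineG_eq (C := C) hc.aestronglyMeasurable (fun w => hC _ (abs_nonneg w)) ht, evenG]
  have : ∀ y, halfG g y t = halfG (fun w => g |w|) y t := fun y => by
    unfold halfG
    refine setIntegral_congr_fun measurableSet_Ioi fun w hw => ?_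
    simp only [abs_of_pos (Set.mem_Ioi.1 hw)]
  rw [this, this]; simp

lemma tendsto_evenG {g : ℝ → ℝ} {C : ℝ} (hg : ContinuousOn g (Set.Ici 0))
    (hC : ∀ y, 0 ≤ y → |g y| ≤ C) {y : ℝ} (hy : 0 ≤ y) : Tendsto (evenG g y) (𝓝[>] 0) (𝓝 (g y)) := by
  have hc : Continuous (fun w : ℝ => g |w|) :=
    hg.comp_continuous continuous_abs fun w => abs_nonneg w
  have := tendsto_lineG (C := C) hc (fun w => hC _ (abs_nonneg w)) y
  rw [abs_of_nonneg hy] at this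
  refine this.congr' ?_
  filter_upwards [self_mem_nhdsWithin] with t ht using (evenG_eq_lineG hg hC ht y).symm

/-- The kernel of the heat semigroup on the half-plane with Neumann condition, times `exp (-t)`. -/
noncomputable def k0 (t : ℝ) (z z' : ℝ × ℝ) : ℝ := exp (-t) * (gk t (z.1 - z'.1) * nk t z.2 z'.2)

/-- The function equal to `b` on the boundary and to `i` in the interior. -/
noncomputable def bdData (b : ℝ → ℝ) (i : ℝ → ℝ → ℝ) (z : ℝ × ℝ) : ℝ := if z.2 = 0 then b z.1 else i z.1 z.2

lemma gk_add_le_gk_sub {t y y' : ℝ} (ht : 0 < t) (hy : 0 ≤ y) (hy' : 0 ≤ y') : gk t (y + y') ≤ gk t (y - y') := by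
  unfold gk
  have : (y - y') ^ 2 ≤ (y + y') ^ 2 := by nlinarith
  gcongr

lemma gk_le_four_mul {t : ℝ} (ht : 0 < t) (x : ℝ) : gk t x ≤ 4 * gk (8 * t) x := by
  have h1 := gk_le_of_le ht (by linarith) le_rfl x
  have h2 := gk_le_of_le (t := 4 * t) (T := 8 * t) (by linarith) (by linarith) (by linarith) x
  linarith

lemma nk_nonneg (t y y' : ℝ) : 0 ≤ nk t y y' := add_nonneg (gk_nonneg _ _) (gk_nonneg _ _)

lemma nk_le {t y y' : ℝ} (ht : 0 < t) (hy : 0 ≤ y) (hy' : 0 ≤ y') : nk t y y' ≤ 2 * gk t (y - y') := by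
  unfold nk; linarith [gk_add_le_gk_sub ht hy hy']

lemma k0_nonneg (t : ℝ) (z z' : ℝ × ℝ) : 0 ≤ k0 t z z' :=
  mul_nonneg (exp_pos _).le (mul_nonneg (gk_nonneg _ _) (nk_nonneg _ _ _))

lemma nk_comm (t y y' : ℝ) : nk t y y' = nk t y' y := by
  rw [nk, gk_sub_comm, add_comm y, nk]

lemma k0_comm (t : ℝ) (z z' : ℝ × ℝ) : k0 t z z' = k0 t z' z := by
  rw [k0, gk_sub_comm, nk_comm, k0]

lemma abs_k0_le_Dk {t : ℝ} {z z' : ℝ × ℝ} (ht : 0 < t) (hz : 0 ≤ z.2) (hz' : 0 ≤ z'.2) :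
    |k0 t z z'| ≤ (32 : ℝ≥0) * (exp (-t / 2) * Dk t z z') := by
  rw [abs_of_nonneg (k0_nonneg _ _ _), k0, Dk]
  have h1 := gk_le_four_mul ht (z.1 - z'.1)
  have h2 : nk t z.2 z'.2 ≤ 8 * gk (8 * t) (z.2 - z'.2) := by
    linarith [nk_le ht hz hz', gk_le_four_mul ht (z.2 - z'.2)]
  have h3 : exp (-t) ≤ exp (-t / 2) := exp_le_exp.2 (by linarith)
  calc _ ≤ exp (-t / 2) * (4 * gk (8 * t) (z.1 - z'.1) * (8 * gk (8 * t) (z.2 - z'.2))) := by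
        gcongr
        · exact mul_nonneg (gk_nonneg _ _) (nk_nonneg _ _ _)
        · exact nk_nonneg _ _ _
        · have := gk_nonneg (8 * t) (z.1 - z'.1); positivity
    _ = _ := by push_cast; ring

lemma abs_k0_le_Dm {t : ℝ} {z z' : ℝ × ℝ} (ht : 0 < t) (hz : 0 ≤ z.2) (hz' : 0 ≤ z'.2) :
    |k0 t z z'| ≤ (32 : ℝ≥0) * Dm t z z' :=
  (abs_k0_le_Dk ht hz hz').trans (mul_le_mul_of_nonneg_left (exp_mul_Dk_le_Dm ht z z') (by positivity))

@[fun_prop]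
lemma Measurable.k0 {α : Type*} [MeasurableSpace α] {a : α → ℝ} {b c : α → ℝ × ℝ} (ha : Measurable a)
    (hb : Measurable b) (hc : Measurable c) : Measurable (fun z => k0 (a z) (b z) (c z)) := by
  unfold _root_.k0 nk; fun_prop

lemma schurBd_k0 : SchurBd tauM nuM k0 (32 * AD) :=
  SchurBd.of_le_Dm (by fun_prop) fun _ _ _ => abs_k0_le_Dm

/-- A kernel dominated by `Dm` applied to a bounded function is integrable. -/
lemma integrable_ker_mul_bdd {κ : ℝ → ℝ × ℝ → ℝ × ℝ → ℝ} {B : ℝ} {z : ℝ × ℝ}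
    (hm : Measurable (fun p : ℝ × ℝ × ℝ => κ p.1 z p.2))
    (h : ∀ t z', 0 < t → 0 ≤ z'.2 → |κ t z z'| ≤ B * Dm t z z') {ψ : ℝ × ℝ → ℝ}
    (hψ : AEStronglyMeasurable ψ nuM) {C : ℝ} (hC : ∀ z', 0 ≤ z'.2 → |ψ z'| ≤ C) :
    Integrable (fun p => κ p.1 z p.2 * ψ p.2) (tauM.prod nuM) := by
  have hi : Integrable (fun p : ℝ × ℝ × ℝ => κ p.1 z p.2) (tauM.prod nuM) := by
    refine ((integrable_Dm z).const_mul B).mono' hm.aestronglyMeasurable ?_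
    filter_upwards [ae_tau_nu] with p hp using h _ _ hp.1 hp.2
  refine hi.mul_bdd (c := C) (hψ.comp_quasiMeasurePreserving Measure.quasiMeasurePreserving_snd) ?_
  filter_upwards [ae_tau_nu] with p hp using hC _ hp.2

lemma integrable_k0_mul_bdd {z : ℝ × ℝ} (hz : 0 ≤ z.2) {ψ : ℝ × ℝ → ℝ}
    (hψ : AEStronglyMeasurable ψ nuM) {C : ℝ} (hC : ∀ z', 0 ≤ z'.2 → |ψ z'| ≤ C) :
    Integrable (fun p => k0 p.1 z p.2 * ψ p.2) (tauM.prod nuM) :=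
  integrable_ker_mul_bdd (B := (32 : ℝ≥0)) (by fun_prop) (fun _ _ ht hz' => abs_k0_le_Dm ht hz hz') hψ hC

lemma integral_nk_eta {t y : ℝ} (ht : 0 < t) {g : ℝ → ℝ} {C : ℝ}
    (hg : AEStronglyMeasurable g (volume.restrict (Set.Ioi 0))) (hC : ∀ y, 0 < y → |g y| ≤ C) :
    Integrable (fun y' => nk t y y' * g y') etaM ∧
    ∫ y', nk t y y' * g y' ∂etaM = evenG g y t + 2 * gk t y * g 0 := by
  have i1 : IntegrableOn (fun y' => gk t (y - y') * g y') (Set.Ioi 0) :=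
    Integrable.bdd_mul_of_gk ht y measurableSet_Ioi hg fun x hx => hC x hx
  have i2 : IntegrableOn (fun y' => gk t (-y - y') * g y') (Set.Ioi 0) :=
    Integrable.bdd_mul_of_gk ht (-y) measurableSet_Ioi hg fun x hx => hC x hx
  have e : (fun y' => nk t y y' * g y') = fun y' => gk t (y - y') * g y' + gk t (-y - y') * g y' := by
    ext y'; rw [nk, ← gk_neg t (y + y')]; ring_nf
  have i3 : IntegrableOn (fun y' => nk t y y' * g y') (Set.Ioi 0) := by rw [e]; exact i1.add i2
  have i4 : Integrable (fun y' => nk t y y' * g y') (Measure.dirac 0) := by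
    exact integrable_dirac enorm_lt_top
  refine ⟨integrable_add_measure.2 ⟨i3, i4⟩, ?_⟩
  rw [etaM, integral_add_measure i3 i4, integral_dirac, e, integral_add i1 i2, evenG, halfG, halfG, nk, sub_zero,
    add_zero]
  ring

lemma integral_gk_mul_nk {t x y : ℝ} (a g : ℝ → ℝ) :
    ∫ z', k0 t (x, y) z' * (a z'.1 * g z'.2) ∂nuM
      = exp (-t) * (lineG a x t * ∫ y', nk t y y' * g y' ∂etaM) := by
  rw [nuM, lineG, ← integral_prod_mul, ← integral_const_mul]
  congr 1; ext z'; simp only [k0]; ring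

/-- Green representation for tensor products. -/
theorem green_tensor {A A' A'' g g' g'' : ℝ → ℝ} {C C' : ℝ} (hA : BddC2R A A' A'' C)
    (hg : BddC2 g g' g'' C') (x : ℝ) {y : ℝ} (hy : 0 ≤ y) :
    kerFun tauM nuM k0 (bdData (fun x => -(A x * g' 0)) fun x y => (A x - A'' x) * g y - A x * g'' y) (x, y)
      = A x * g y := by
  obtain ⟨ψ, hψ⟩ : ∃ ψ, ψ = bdData (fun x => -(A x * g' 0)) fun x y => (A x - A'' x) * g y - A x * g'' y :=
    ⟨_, rfl⟩
  rw [← hψ]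
  obtain ⟨u, hu⟩ : ∃ u : ℝ → ℝ, u = fun y => if y = 0 then 0 else g y := ⟨_, rfl⟩
  obtain ⟨v, hv⟩ : ∃ v : ℝ → ℝ, v = fun y => if y = 0 then -g' 0 else -g'' y := ⟨_, rfl⟩
  have hψe : ∀ z, ψ z = (A z.1 - A'' z.1) * u z.2 + A z.1 * v z.2 := by
    intro z; simp only [hψ, bdData, hu, hv]; split_ifs <;> ring
  have hC0 : 0 ≤ C := (abs_nonneg _).trans (hA.b0 0)
  have hC0' : 0 ≤ C' := (abs_nonneg _).trans (hg.b0 0 le_rfl)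
  have hub : ∀ y, 0 ≤ y → |u y| ≤ C' := by
    intro y hy; simp only [hu]; split_ifs
    · simpa using hC0'
    · exact hg.b0 y hy
  have hvb : ∀ y, 0 ≤ y → |v y| ≤ C' := by
    intro y hy; simp only [hv]; split_ifs
    · simpa using hg.b1 0 le_rfl
    · simpa using hg.b2 y hy
  have hAA : ∀ x, |A x - A'' x| ≤ C + C := fun x => (abs_sub _ _).trans (add_le_add (hA.b0 x) (hA.b2 x))
  have hAAm : Measurable (fun x => A x - A'' x) := hA.continuous.measurable.sub hA.meas
  have hum : AEStronglyMeasurable u (volume.restrict (Set.Ioi 0)) := by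
    refine hg.aesm.congr ?_
    filter_upwards [ae_restrict_mem measurableSet_Ioi] with w hw
    simp [hu, (Set.mem_Ioi.1 hw).ne']
  have hvm : AEStronglyMeasurable v (volume.restrict (Set.Ioi 0)) := by
    refine hg.meas.neg.aestronglyMeasurable.congr ?_
    filter_upwards [ae_restrict_mem measurableSet_Ioi] with w hw
    simp [hv, (Set.mem_Ioi.1 hw).ne']
  have aeta : ∀ {w : ℝ → ℝ}, AEStronglyMeasurable w (volume.restrict (Set.Ioi 0)) →
      AEStronglyMeasurable w etaM := fun hw => by
    rw [etaM, aestronglyMeasurable_add_measure_iff]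
    exact ⟨hw, aestronglyMeasurable_dirac⟩
  have hψm : AEStronglyMeasurable ψ nuM := by
    rw [show ψ = fun z => (A z.1 - A'' z.1) * u z.2 + A z.1 * v z.2 from funext hψe]
    exact ((hAAm.comp measurable_fst).aestronglyMeasurable.mul
      ((aeta hum).comp_quasiMeasurePreserving Measure.quasiMeasurePreserving_snd)).add
      ((hA.continuous.measurable.comp measurable_fst).aestronglyMeasurable.mul
      ((aeta hvm).comp_quasiMeasurePreserving Measure.quasiMeasurePreserving_snd))
  have hψb : ∀ z, 0 ≤ z.2 → |ψ z| ≤ (C + C) * C' + C * C' := by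
    intro z hz
    rw [hψe]
    refine (abs_add_le _ _).trans (add_le_add ?_ ?_) <;> rw [abs_mul]
    · exact mul_le_mul (hAA _) (hub _ hz) (abs_nonneg _) (by positivity)
    · exact mul_le_mul (hA.b0 _) (hvb _ hz) (abs_nonneg _) hC0
  have hint := integrable_k0_mul_bdd (z := (x, y)) hy hψm hψb
  have lint : ∀ {a : ℝ → ℝ} {B t : ℝ}, 0 < t → Measurable a → (∀ x, |a x| ≤ B) →
      Integrable (fun x' => gk t (x - x') * a x') := fun ht ha hB =>
    (gk_sub_integrable ht x).mul_bdd ha.aestronglyMeasurable (ae_of_all _ hB)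
  have inner : ∀ t, 0 < t → ∫ z', k0 t (x, y) z' * ψ z' ∂nuM = -((-exp (-t)) * (lineG A x t * evenG g y t)
      + exp (-t) * (lineG A'' x t * evenG g y t
        + lineG A x t * (halfG g'' y t + halfG g'' (-y) t + 2 * gk t y * g' 0))) := by
    intro t ht
    obtain ⟨iu, eu⟩ := integral_nk_eta (y := y) ht hum fun y hy => hub y hy.le
    obtain ⟨iv, ev⟩ := integral_nk_eta (y := y) ht hvm fun y hy => hvb y hy.le
    have tens : ∀ {a w : ℝ → ℝ}, Integrable (fun x' => gk t (x - x') * a x') →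
        Integrable (fun y' => nk t y y' * w y') etaM →
        Integrable (fun z' => k0 t (x, y) z' * (a z'.1 * w z'.2)) nuM := fun ha hw => by
      refine ((ha.mul_prod hw).const_mul (exp (-t))).congr ?_
      filter_upwards with z'
      simp only [k0]; ring
    simp_rw [hψe, mul_add]
    rw [integral_add (tens (a := fun x => A x - A'' x) (lint ht hAAm hAA) iu)
      (tens (lint ht hA.continuous.measurable hA.b0) iv),
      integral_gk_mul_nk (fun x => A x - A'' x), integral_gk_mul_nk, eu, ev]
    have e1 : lineG (fun x => A x - A'' x) x t = lineG A x t - lineG A'' x t := by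
      unfold lineG
      rw [← integral_sub (lint ht hA.continuous.measurable hA.b0) (lint ht hA.meas hA.b2)]
      congr 1; ext w; ring
    have hh : ∀ {p q : ℝ → ℝ}, (∀ w, 0 < w → p w = q w) → ∀ y, halfG p y t = halfG q y t := fun hpq y =>
      setIntegral_congr_fun measurableSet_Ioi fun w hw => by simp only [hpq w hw]
    have e2 : evenG u y t = evenG g y t := by
      have : ∀ w, 0 < w → u w = g w := fun w hw => by simp [hu, hw.ne']
      rw [evenG, hh this, hh this, evenG]
    have e3 : evenG v y t = -(halfG g'' y t + halfG g'' (-y) t) := by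
      have : ∀ w, 0 < w → v w = -g'' w := fun w hw => by simp [hv, hw.ne']
      rw [evenG, hh this, hh this]
      simp only [halfG, mul_neg, integral_neg]; ring
    rw [e1, e2, e3, show u 0 = 0 by simp [hu], show v 0 = -g' 0 by simp [hv]]
    ring
  rw [kerFun, integral_prod _ hint]
  have hae : (fun t => ∫ z', k0 t (x, y) z' * ψ z' ∂nuM) =ᵐ[tauM] fun t =>
      -((-exp (-t)) * (lineG A x t * evenG g y t)
      + exp (-t) * (lineG A'' x t * evenG g y t
        + lineG A x t * (halfG g'' y t + halfG g'' (-y) t + 2 * gk t y * g' 0))) := by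
    filter_upwards [ae_tau_pos] with t ht using inner t ht
  have hI := hint.integral_prod_left.congr hae
  rw [integral_congr_ae hae, integral_neg, tauM]
  have hev : ∀ t, 0 < t → HasDerivAt (evenG g y) (halfG g'' y t + halfG g'' (-y) t + 2 * gk t y * g' 0) t :=
    fun t ht => ((hg.hasDerivAt_halfG ht y).add (hg.hasDerivAt_halfG ht (-y))).congr_deriv
      (by rw [gk_neg]; ring)
  rw [integral_Ioi_deriv_mul_eq_sub (u := fun t => exp (-t)) (v := fun t => lineG A x t * evenG g y t)
    (a' := A x * g y) (b' := 0)]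
  · ring
  · intro t _
    exact (hasDerivAt_neg t).exp.congr_deriv (by ring)
  · intro t ht
    exact (hA.hasDerivAt_lineG ht x).mul (hev t ht)
  · have := hI.neg
    rw [tauM] at this
    refine this.congr ?_
    filter_upwards with t
    simp
  · have h1 : Tendsto (fun t : ℝ => exp (-t)) (𝓝[>] 0) (𝓝 1) := by
      have : Continuous fun t : ℝ => exp (-t) := by fun_prop
      simpa using (this.tendsto 0).mono_left nhdsWithin_le_nhds
    have h2 := h1.mul ((tendsto_lineG hA.continuous hA.b0 x).mul (tendsto_evenG hg.cont hg.b0 hy))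
    rw [one_mul] at h2
    exact h2
  · have h1 : Tendsto (fun t : ℝ => exp (-t) * (C * (C' + C'))) atTop (𝓝 0) := by
      simpa using (tendsto_exp_neg_atTop_nhds_zero).mul_const (C * (C' + C'))
    refine squeeze_zero_norm' ?_ h1
    filter_upwards [eventually_gt_atTop 0] with t ht
    simp only [Pi.mul_apply, norm_mul, norm_of_nonneg (exp_pos (-t)).le]
    gcongr
    · exact abs_lineG_le hA.b0 ht x
    · exact (abs_add_le _ _).trans (add_le_add (abs_halfG_le (fun y hy => hg.b0 y hy.le) ht _)
        (abs_halfG_le (fun y hy => hg.b0 y hy.le) ht _))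


/-- A positive weight which varies at most exponentially, with a small rate. -/
structure Wt (W : ℝ × ℝ → ℝ) : Prop where
  pos : ∀ z, 0 < W z
  meas : Measurable W
  le : ∀ z z', W z' ≤ exp ((1/16) * |z.1 - z'.1|) * exp ((1/16) * |z.2 - z'.2|) * W z

lemma wt_one : Wt (fun _ => 1) :=
  ⟨fun _ => one_pos, measurable_const, fun z z' => by
    rw [mul_one]; exact one_le_mul_of_one_le_of_one_le (one_le_exp (by positivity)) (one_le_exp (by positivity))⟩

lemma Wt.le_of_dist {W : ℝ × ℝ → ℝ} (hW : Wt W) {x x' y : ℝ} (h : |x - x'| ≤ 1) : W (x', y) ≤ 3 * W (x, y) := by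
  have h1 := hW.le (x, y) (x', y)
  simp only [sub_self, abs_zero, mul_zero, exp_zero, mul_one] at h1
  refine h1.trans (mul_le_mul_of_nonneg_right ?_ (hW.pos _).le)
  refine le_trans (exp_le_exp.mpr (by linarith : _ ≤ (1:ℝ))) (by linarith [exp_one_lt_d9])

/-- Auxiliary Gaussian kernel with room for exponential weights. -/
noncomputable def Em (t : ℝ) (z z' : ℝ × ℝ) : ℝ :=
  exp (-t) * (1 + t ^ (-1/4 : ℝ)) * (gk (4 * t) (z.1 - z'.1) * gk (4 * t) (z.2 - z'.2))

lemma Em_nonneg {t : ℝ} (ht : 0 < t) (z z' : ℝ × ℝ) : 0 ≤ Em t z z' := by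
  have := gk_nonneg (4 * t) (z.1 - z'.1)
  have := gk_nonneg (4 * t) (z.2 - z'.2)
  unfold Em; positivity

lemma Em_mul_wt_le {W : ℝ × ℝ → ℝ} (hW : Wt W) {t : ℝ} (ht : 0 < t) (z z' : ℝ × ℝ) :
    Em t z z' * W z' ≤ 4 * W z * Dm t z z' := by
  have h4 : 0 < 4 * t := by linarith
  have a1 := exp_mul_gk_le (β := 1/16) h4 (z.1 - z'.1)
  have a2 := exp_mul_gk_le (β := 1/16) h4 (z.2 - z'.2)
  rw [show 2 * (4 * t) = 8 * t by ring] at a1 a2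
  have g1 := gk_nonneg (4 * t) (z.1 - z'.1)
  have g2 := gk_nonneg (4 * t) (z.2 - z'.2)
  have k1 := gk_nonneg (8 * t) (z.1 - z'.1)
  have k2 := gk_nonneg (8 * t) (z.2 - z'.2)
  have h5 := mul_le_mul a1 a2 (by positivity) (by positivity)
  have w := hW.pos z
  have e : exp (-t) * (exp (2 * (1/16) ^ 2 * (4 * t)) * exp (2 * (1/16) ^ 2 * (4 * t))) ≤ exp (-t / 2) := by
    rw [← exp_add, ← exp_add, exp_le_exp]; linarith
  have p0 : 0 ≤ 1 + t ^ (-1/4 : ℝ) := by positivity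
  calc Em t z z' * W z' ≤ Em t z z' * (exp ((1/16) * |z.1 - z'.1|) * exp ((1/16) * |z.2 - z'.2|) * W z) :=
        mul_le_mul_of_nonneg_left (hW.le z z') (Em_nonneg ht z z')
    _ = exp (-t) * (1 + t ^ (-1/4 : ℝ)) * W z * ((exp ((1/16) * |z.1 - z'.1|) * gk (4 * t) (z.1 - z'.1)) *
          (exp ((1/16) * |z.2 - z'.2|) * gk (4 * t) (z.2 - z'.2))) := by unfold Em; ring
    _ ≤ exp (-t) * (1 + t ^ (-1/4 : ℝ)) * W z * ((2 * exp (2 * (1/16) ^ 2 * (4 * t)) * gk (8 * t) (z.1 - z'.1)) *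
          (2 * exp (2 * (1/16) ^ 2 * (4 * t)) * gk (8 * t) (z.2 - z'.2))) :=
        mul_le_mul_of_nonneg_left h5 (by positivity)
    _ = (exp (-t) * (exp (2 * (1/16) ^ 2 * (4 * t)) * exp (2 * (1/16) ^ 2 * (4 * t)))) * (4 * W z *
          ((1 + t ^ (-1/4 : ℝ)) * Dk t z z')) := by unfold Dk; ring
    _ ≤ exp (-t / 2) * (4 * W z * ((1 + t ^ (-1/4 : ℝ)) * Dk t z z')) := by
        have := Dk_nonneg t z z'
        exact mul_le_mul_of_nonneg_right e (by positivity)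
    _ = 4 * W z * Dm t z z' := by unfold Dm; ring

lemma nk_le_gk4 {t y y' : ℝ} (ht : 0 < t) (hy : 0 ≤ y) (hy' : 0 ≤ y') : nk t y y' ≤ 4 * gk (4 * t) (y - y') := by
  linarith [nk_le ht hy hy', gk_le_of_le ht (by linarith) le_rfl (y - y')]

lemma abs_k0_le_Em {t : ℝ} {z z' : ℝ × ℝ} (ht : 0 < t) (hz : 0 ≤ z.2) (hz' : 0 ≤ z'.2) :
    |k0 t z z'| ≤ 8 * Em t z z' := by
  rw [abs_of_nonneg (k0_nonneg _ _ _), k0, Em]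
  have h1 := mul_le_mul (gk_le_of_le ht (by linarith) le_rfl (z.1 - z'.1)) (nk_le_gk4 ht hz hz')
    (nk_nonneg _ _ _) (by have := gk_nonneg (4 * t) (z.1 - z'.1); positivity)
  have g1 := gk_nonneg (4 * t) (z.1 - z'.1)
  have g2 := gk_nonneg (4 * t) (z.2 - z'.2)
  have h2 : 0 ≤ t ^ (-1/4 : ℝ) := by positivity
  calc _ ≤ exp (-t) * (8 * (gk (4 * t) (z.1 - z'.1) * gk (4 * t) (z.2 - z'.2))) :=
        mul_le_mul_of_nonneg_left (by linarith) (exp_pos _).le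
    _ ≤ exp (-t) * (8 * (gk (4 * t) (z.1 - z'.1) * gk (4 * t) (z.2 - z'.2))) * (1 + t ^ (-1/4 : ℝ)) :=
        le_mul_of_one_le_right (by positivity) (by linarith)
    _ = _ := by ring

lemma abs_k0_sub_fst_le {t x₁ x₂ y : ℝ} {z' : ℝ × ℝ} (ht : 0 < t) (hy : 0 ≤ y) (hz' : 0 ≤ z'.2) :
    |k0 t (x₁, y) z' - k0 t (x₂, y) z'| ≤ 64 * √|x₁ - x₂| * (Em t (x₁, y) z' + Em t (x₂, y) z') := by
  have h := abs_gk_sub_le ht (x₁ - z'.1) (x₂ - z'.1)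
  rw [show x₁ - z'.1 - (x₂ - z'.1) = x₁ - x₂ by ring] at h
  have hn := nk_le_gk4 ht hy hz'
  have n0 := nk_nonneg t y z'.2
  have g1 := gk_nonneg (4 * t) (x₁ - z'.1)
  have g3 := gk_nonneg (4 * t) (x₂ - z'.1)
  have g2 := gk_nonneg (4 * t) (y - z'.2)
  have e : k0 t (x₁, y) z' - k0 t (x₂, y) z'
      = exp (-t) * ((gk t (x₁ - z'.1) - gk t (x₂ - z'.1)) * nk t y z'.2) := by unfold k0; ring
  rw [e, abs_mul, abs_mul, abs_of_pos (exp_pos _), abs_of_nonneg n0]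
  have p0 : 0 ≤ t ^ (-1/4 : ℝ) := by positivity
  calc _ ≤ exp (-t) * ((16 * √|x₁ - x₂| * t ^ (-1/4 : ℝ) * (gk (4 * t) (x₁ - z'.1) + gk (4 * t) (x₂ - z'.1))) *
        (4 * gk (4 * t) (y - z'.2))) := by
        refine mul_le_mul_of_nonneg_left (mul_le_mul h hn n0 (by positivity)) (exp_pos _).le
    _ = 64 * √|x₁ - x₂| * (exp (-t) * t ^ (-1/4 : ℝ) * (gk (4 * t) (x₁ - z'.1) + gk (4 * t) (x₂ - z'.1)) *
        gk (4 * t) (y - z'.2)) := by ring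
    _ ≤ 64 * √|x₁ - x₂| * (exp (-t) * (1 + t ^ (-1/4 : ℝ)) * (gk (4 * t) (x₁ - z'.1) + gk (4 * t) (x₂ - z'.1)) *
        gk (4 * t) (y - z'.2)) := by gcongr; linarith
    _ = _ := by unfold Em; ring

lemma abs_k0_sub_snd_le {t x y₁ y₂ : ℝ} {z' : ℝ × ℝ} (ht : 0 < t) (hy₁ : 0 ≤ y₁) (hy₂ : 0 ≤ y₂) (hz' : 0 ≤ z'.2) :
    |k0 t (x, y₁) z' - k0 t (x, y₂) z'| ≤ 64 * √|y₁ - y₂| * (Em t (x, y₁) z' + Em t (x, y₂) z') := by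
  have h := abs_gk_sub_le ht (y₁ - z'.2) (y₂ - z'.2)
  have h' := abs_gk_sub_le ht (y₁ + z'.2) (y₂ + z'.2)
  rw [show y₁ - z'.2 - (y₂ - z'.2) = y₁ - y₂ by ring] at h
  rw [show y₁ + z'.2 - (y₂ + z'.2) = y₁ - y₂ by ring] at h'
  have hx := gk_le_of_le ht (by linarith) le_rfl (x - z'.1)
  have n0 := gk_nonneg t (x - z'.1)
  have g1 := gk_nonneg (4 * t) (y₁ - z'.2)
  have g3 := gk_nonneg (4 * t) (y₂ - z'.2)
  have g2 := gk_nonneg (4 * t) (x - z'.1)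
  have p0 : 0 ≤ t ^ (-1/4 : ℝ) := by positivity
  have a1 := gk_add_le_gk_sub (t := 4 * t) (by linarith) hy₁ hz'
  have a2 := gk_add_le_gk_sub (t := 4 * t) (by linarith) hy₂ hz'
  have e : k0 t (x, y₁) z' - k0 t (x, y₂) z'
      = exp (-t) * (gk t (x - z'.1) * (nk t y₁ z'.2 - nk t y₂ z'.2)) := by unfold k0; ring
  have hn : |nk t y₁ z'.2 - nk t y₂ z'.2|
      ≤ 32 * √|y₁ - y₂| * t ^ (-1/4 : ℝ) * (gk (4 * t) (y₁ - z'.2) + gk (4 * t) (y₂ - z'.2)) := by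
    have e2 : nk t y₁ z'.2 - nk t y₂ z'.2 = (gk t (y₁ - z'.2) - gk t (y₂ - z'.2)) +
      (gk t (y₁ + z'.2) - gk t (y₂ + z'.2)) := by unfold nk; ring
    rw [e2]
    refine (abs_add_le _ _).trans ?_
    have : 16 * √|y₁ - y₂| * t ^ (-1/4 : ℝ) * (gk (4 * t) (y₁ + z'.2) + gk (4 * t) (y₂ + z'.2)) ≤
      16 * √|y₁ - y₂| * t ^ (-1/4 : ℝ) * (gk (4 * t) (y₁ - z'.2) + gk (4 * t) (y₂ - z'.2)) := by gcongr
    linarith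
  rw [e, abs_mul, abs_mul, abs_of_pos (exp_pos _), abs_of_nonneg n0]
  calc _ ≤ exp (-t) * ((2 * gk (4 * t) (x - z'.1)) *
        (32 * √|y₁ - y₂| * t ^ (-1/4 : ℝ) * (gk (4 * t) (y₁ - z'.2) + gk (4 * t) (y₂ - z'.2)))) := by
        refine mul_le_mul_of_nonneg_left (mul_le_mul hx hn (abs_nonneg _) (by positivity)) (exp_pos _).le
    _ = 64 * √|y₁ - y₂| * (exp (-t) * t ^ (-1/4 : ℝ) * (gk (4 * t) (y₁ - z'.2) + gk (4 * t) (y₂ - z'.2)) *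
        gk (4 * t) (x - z'.1)) := by ring
    _ ≤ 64 * √|y₁ - y₂| * (exp (-t) * (1 + t ^ (-1/4 : ℝ)) * (gk (4 * t) (y₁ - z'.2) + gk (4 * t) (y₂ - z'.2)) *
        gk (4 * t) (x - z'.1)) := by gcongr; linarith
    _ = _ := by unfold Em; ring

/-- The tangential derivative of the kernel `k0`. -/
noncomputable def kx (t : ℝ) (z z' : ℝ × ℝ) : ℝ := -((z.1 - z'.1) / (2 * t)) * k0 t z z'

lemma hasDerivAt_k0_fst {t x y : ℝ} (z' : ℝ × ℝ) : HasDerivAt (fun x => k0 t (x, y) z') (kx t (x, y) z') x := by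
  have h := ((hasDerivAt_gk (t := t) (x - z'.1)).comp x ((hasDerivAt_id x).sub_const z'.1))
  refine ((h.mul_const (nk t y z'.2)).const_mul (exp (-t))).congr_deriv ?_
  simp only [kx, k0]; ring

@[fun_prop]
lemma Measurable.kx {α : Type*} [MeasurableSpace α] {a : α → ℝ} {b c : α → ℝ × ℝ} (ha : Measurable a)
    (hb : Measurable b) (hc : Measurable c) : Measurable (fun z => kx (a z) (b z) (c z)) := by
  unfold _root_.kx; fun_prop

lemma abs_kx_mul_sqrt_le {t x y : ℝ} {z' : ℝ × ℝ} (ht : 0 < t) (hy : 0 ≤ y) (hz' : 0 ≤ z'.2) :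
    |kx t (x, y) z'| * √|z'.1 - x| ≤ 64 * Em t (x, y) z' := by
  obtain ⟨d, hd⟩ : ∃ d, d = x - z'.1 := ⟨_, rfl⟩
  have g0 := gk_nonneg (4 * t) d
  have g1 := gk_nonneg (4 * t) (y - z'.2)
  have g2 := gk_nonneg t d
  have n0 := nk_nonneg t y z'.2
  have hs : 0 < √t := by positivity
  have key : |d| / (2 * t) * gk t d * √|d| ≤ 16 * t ^ (-1/4 : ℝ) * gk (4 * t) d := by
    have h1 := abs_mul_gk_le ht d
    have h2 := sqrt_abs_mul_gk_le (t := 2 * t) (by linarith) d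
    rw [show 2 * (2 * t) = 4 * t by ring] at h2
    have h3 : (2 * t) ^ (1/4 : ℝ) ≤ 2 * t ^ (1/4 : ℝ) := by
      rw [mul_rpow (by norm_num) ht.le]
      refine mul_le_mul_of_nonneg_right ?_ (by positivity)
      calc (2:ℝ) ^ (1/4:ℝ) ≤ 2 ^ (1:ℝ) := rpow_le_rpow_of_exponent_le (by norm_num) (by norm_num)
        _ = 2 := by simp
    have h4 : √|d| * gk (2 * t) d ≤ 8 * t ^ (1/4 : ℝ) * gk (4 * t) d := h2.trans (by
      have := mul_le_mul_of_nonneg_right h3 g0; linarith)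
    have h5 : t ^ (-1/4 : ℝ) = √t * t ^ (1/4 : ℝ) / t := by
      rw [eq_div_iff ht.ne', sqrt_eq_rpow, ← rpow_add ht]
      nth_rw 2 [← rpow_one t]
      rw [← rpow_add ht]; norm_num
    rw [h5]
    have e1 : |d| / (2 * t) * gk t d * √|d| = (|d| * gk t d) * (√|d| / (2 * t)) := by ring
    rw [e1]
    calc _ ≤ (4 * √t * gk (2 * t) d) * (√|d| / (2 * t)) := mul_le_mul_of_nonneg_right h1 (by positivity)
      _ = (2 * √t / t) * (√|d| * gk (2 * t) d) := by field_simp; ring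
      _ ≤ (2 * √t / t) * (8 * t ^ (1/4 : ℝ) * gk (4 * t) d) := mul_le_mul_of_nonneg_left h4 (by positivity)
      _ = _ := by ring
  have e : |kx t (x, y) z'| * √|z'.1 - x| = exp (-t) * ((|d| / (2 * t) * gk t d * √|d|) * nk t y z'.2) := by
    have : |2 * t| = 2 * t := abs_of_pos (by linarith)
    rw [kx, abs_mul, abs_of_nonneg (k0_nonneg _ _ _), abs_neg, abs_div, this, ← abs_neg (z'.1 - x), neg_sub]
    simp only [k0, ← hd]; ring
  rw [e]
  have p0 : 0 ≤ t ^ (-1/4 : ℝ) := by positivity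
  calc _ ≤ exp (-t) * ((16 * t ^ (-1/4 : ℝ) * gk (4 * t) d) * (4 * gk (4 * t) (y - z'.2))) :=
        mul_le_mul_of_nonneg_left (mul_le_mul key (nk_le_gk4 ht hy hz') n0 (by positivity)) (exp_pos _).le
    _ = 64 * (exp (-t) * t ^ (-1/4 : ℝ) * (gk (4 * t) d * gk (4 * t) (y - z'.2))) := by ring
    _ ≤ 64 * (exp (-t) * (1 + t ^ (-1/4 : ℝ)) * (gk (4 * t) d * gk (4 * t) (y - z'.2))) := by
      gcongr; linarith
    _ = _ := by simp only [Em, hd]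

lemma integrable_of_le_Dm {F : ℝ × ℝ × ℝ → ℝ} {B : ℝ} {z : ℝ × ℝ}
    (hm : AEStronglyMeasurable F (tauM.prod nuM))
    (h : ∀ t z', 0 < t → 0 ≤ z'.2 → |F (t, z')| ≤ B * Dm t z z') :
    Integrable F (tauM.prod nuM) := by
  refine ((integrable_Dm z).const_mul B).mono' hm ?_
  filter_upwards [ae_tau_nu] with p hp using h _ _ hp.1 hp.2

lemma abs_integral_le_Dm {F : ℝ × ℝ × ℝ → ℝ} {B : ℝ} {z : ℝ × ℝ} (hB : 0 ≤ B)
    (h : ∀ t z', 0 < t → 0 ≤ z'.2 → |F (t, z')| ≤ B * Dm t z z') :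
    |∫ p, F p ∂(tauM.prod nuM)| ≤ B * AD := by
  have h1 := norm_integral_le_of_norm_le ((integrable_Dm z).const_mul B) (f := F) (by
    filter_upwards [ae_tau_nu] with p hp using h _ _ hp.1 hp.2)
  rw [integral_const_mul] at h1
  exact h1.trans (mul_le_mul_of_nonneg_left (integral_Dm_le z) hB)

lemma abs_integral_le_Dm₂ {F : ℝ × ℝ × ℝ → ℝ} {B B' : ℝ} {z z₁ : ℝ × ℝ} (hB : 0 ≤ B) (hB' : 0 ≤ B')
    (h : ∀ t z', 0 < t → 0 ≤ z'.2 → |F (t, z')| ≤ B * Dm t z z' + B' * Dm t z₁ z') :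
    |∫ p, F p ∂(tauM.prod nuM)| ≤ (B + B') * AD := by
  have h1 := norm_integral_le_of_norm_le (((integrable_Dm z).const_mul B).add ((integrable_Dm z₁).const_mul B'))
    (f := F) (by filter_upwards [ae_tau_nu] with p hp using h _ _ hp.1 hp.2)
  simp only [Pi.add_apply] at h1
  rw [integral_add ((integrable_Dm z).const_mul B) ((integrable_Dm z₁).const_mul B'), integral_const_mul,
    integral_const_mul] at h1
  have i1 := mul_le_mul_of_nonneg_left (integral_Dm_le z) hB
  have i2 := mul_le_mul_of_nonneg_left (integral_Dm_le z₁) hB'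
  refine h1.trans ?_
  rw [add_mul]; exact add_le_add i1 i2

section Weighted
variable {W ψ : ℝ × ℝ → ℝ} {C : ℝ}

lemma measurable_kerFun_k0 (hψ : Measurable ψ) : Measurable (kerFun tauM nuM k0 ψ) := by
  unfold kerFun
  have : StronglyMeasurable (fun q : (ℝ × ℝ) × (ℝ × ℝ × ℝ) => k0 q.2.1 q.1 q.2.2 * ψ q.2.2) :=
    Measurable.stronglyMeasurable (by fun_prop)
  exact this.integral_prod_right.measurable

lemma aesm_k0_mul (hψ : Measurable ψ) (z : ℝ × ℝ) :
    AEStronglyMeasurable (fun p : ℝ × ℝ × ℝ => k0 p.1 z p.2 * ψ p.2) (tauM.prod nuM) :=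
  Measurable.aestronglyMeasurable (by fun_prop)

lemma abs_k0_mul_le (hW : Wt W) (hb : ∀ z, 0 ≤ z.2 → |ψ z| ≤ C * W z) (hC : 0 ≤ C) {z : ℝ × ℝ} (hz : 0 ≤ z.2)
    (t : ℝ) (z' : ℝ × ℝ) (ht : 0 < t) (hz' : 0 ≤ z'.2) :
    |k0 t z z' * ψ z'| ≤ 32 * C * W z * Dm t z z' := by
  rw [abs_mul]
  have h1 := mul_le_mul (abs_k0_le_Em ht hz hz') (hb z' hz') (abs_nonneg _)
    (mul_nonneg (by norm_num) (Em_nonneg ht z z'))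
  have h2 := mul_le_mul_of_nonneg_left (Em_mul_wt_le hW ht z z') (mul_nonneg (by norm_num : (0:ℝ) ≤ 8) hC)
  linarith

lemma integrable_k0_mul_wt (hW : Wt W) (hψ : Measurable ψ) (hb : ∀ z, 0 ≤ z.2 → |ψ z| ≤ C * W z) (hC : 0 ≤ C)
    {z : ℝ × ℝ} (hz : 0 ≤ z.2) : Integrable (fun p => k0 p.1 z p.2 * ψ p.2) (tauM.prod nuM) :=
  integrable_of_le_Dm (aesm_k0_mul hψ z) (abs_k0_mul_le hW hb hC hz)

lemma abs_kerFun_k0_le_wt (hW : Wt W) (hb : ∀ z, 0 ≤ z.2 → |ψ z| ≤ C * W z) (hC : 0 ≤ C) {z : ℝ × ℝ}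
    (hz : 0 ≤ z.2) : |kerFun tauM nuM k0 ψ z| ≤ 32 * AD * C * W z := by
  have := abs_integral_le_Dm (F := fun p => k0 p.1 z p.2 * ψ p.2) (B := 32 * C * W z) (z := z)
    (by have := hW.pos z; positivity) (abs_k0_mul_le hW hb hC hz)
  unfold kerFun; linarith

lemma abs_kerFun_k0_sub_le (hW : Wt W) (hψ : Measurable ψ) (hb : ∀ z, 0 ≤ z.2 → |ψ z| ≤ C * W z) (hC : 0 ≤ C)
    {z₁ z₂ : ℝ × ℝ} (h₁ : 0 ≤ z₁.2) (h₂ : 0 ≤ z₂.2) {D : ℝ} (hD : 0 ≤ D)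
    (h : ∀ t z', 0 < t → 0 ≤ z'.2 → |k0 t z₁ z' - k0 t z₂ z'| ≤ D * (Em t z₁ z' + Em t z₂ z')) :
    |kerFun tauM nuM k0 ψ z₁ - kerFun tauM nuM k0 ψ z₂| ≤ 4 * C * D * AD * (W z₁ + W z₂) := by
  unfold kerFun
  rw [← integral_sub (integrable_k0_mul_wt hW hψ hb hC h₁) (integrable_k0_mul_wt hW hψ hb hC h₂)]
  have w1 := hW.pos z₁
  have w2 := hW.pos z₂
  refine (abs_integral_le_Dm₂ (B := 4 * C * D * W z₁) (B' := 4 * C * D * W z₂) (z := z₁) (z₁ := z₂)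
    (by positivity) (by positivity) ?_).trans (le_of_eq (by ring))
  intro t z' ht hz'
  dsimp only
  rw [← sub_mul, abs_mul]
  have e1 := Em_nonneg ht z₁ z'
  have e2 := Em_nonneg ht z₂ z'
  have a1 := mul_le_mul (h t z' ht hz') (hb z' hz') (abs_nonneg _) (by positivity)
  have a2 := mul_le_mul_of_nonneg_left (Em_mul_wt_le hW ht z₁ z') (mul_nonneg hD hC)
  have a3 := mul_le_mul_of_nonneg_left (Em_mul_wt_le hW ht z₂ z') (mul_nonneg hD hC)
  linarith

lemma abs_kerFun_k0_sub_fst_le (hW : Wt W) (hψ : Measurable ψ) (hb : ∀ z, 0 ≤ z.2 → |ψ z| ≤ C * W z)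
    (hC : 0 ≤ C) {x₁ x₂ y : ℝ} (hy : 0 ≤ y) :
    |kerFun tauM nuM k0 ψ (x₁, y) - kerFun tauM nuM k0 ψ (x₂, y)|
      ≤ 256 * C * AD * √|x₁ - x₂| * (W (x₁, y) + W (x₂, y)) := by
  refine (abs_kerFun_k0_sub_le hW hψ hb hC (by exact hy) (by exact hy) (D := 64 * √|x₁ - x₂|) (by positivity)
    fun t z' ht hz' => abs_k0_sub_fst_le ht hy hz').trans (le_of_eq (by ring))

lemma abs_kerFun_k0_sub_snd_le (hW : Wt W) (hψ : Measurable ψ) (hb : ∀ z, 0 ≤ z.2 → |ψ z| ≤ C * W z)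
    (hC : 0 ≤ C) {x y₁ y₂ : ℝ} (hy₁ : 0 ≤ y₁) (hy₂ : 0 ≤ y₂) :
    |kerFun tauM nuM k0 ψ (x, y₁) - kerFun tauM nuM k0 ψ (x, y₂)|
      ≤ 256 * C * AD * √|y₁ - y₂| * (W (x, y₁) + W (x, y₂)) := by
  refine (abs_kerFun_k0_sub_le hW hψ hb hC (by exact hy₁) (by exact hy₂) (D := 64 * √|y₁ - y₂|) (by positivity)
    fun t z' ht hz' => abs_k0_sub_snd_le ht hy₁ hy₂ hz').trans (le_of_eq (by ring))

end Weighted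


section Tangential
variable {W ψ ψ' : ℝ × ℝ → ℝ} {C : ℝ}

lemma Wt.shift (hW : Wt W) (a : ℝ) : Wt (fun z => W (a + z.1, z.2)) := by
  have := hW.meas
  refine ⟨fun z => hW.pos _, by fun_prop, fun z z' => ?_⟩
  have := hW.le (a + z.1, z.2) (a + z'.1, z'.2)
  simpa using this

lemma Wt.freeze (hW : Wt W) (a : ℝ) : Wt (fun z => W (a, z.2)) := by
  have := hW.meas
  refine ⟨fun z => hW.pos _, by fun_prop, fun z z' => ?_⟩
  have h := hW.le (a, z.2) (a, z'.2)
  simp only [sub_self, abs_zero, mul_zero, exp_zero, one_mul] at h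
  refine h.trans (mul_le_mul_of_nonneg_right ?_ (hW.pos _).le)
  exact le_mul_of_one_le_left (exp_pos _).le (one_le_exp (by positivity))

lemma kerFun_k0_translate (x y : ℝ) :
    kerFun tauM nuM k0 ψ (x, y) = ∫ p, k0 p.1 (0, y) p.2 * ψ (x + p.2.1, p.2.2) ∂(tauM.prod nuM) := by
  have hmp : MeasurePreserving (Prod.map id (Prod.map (x + ·) id) : ℝ × ℝ × ℝ → ℝ × ℝ × ℝ)
      (tauM.prod nuM) (tauM.prod nuM) := by
    unfold nuM
    exact (MeasurePreserving.id tauM).prod ((measurePreserving_add_left volume x).prod (MeasurePreserving.id etaM))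
  have he : MeasurableEmbedding (Prod.map id (Prod.map (x + ·) id) : ℝ × ℝ × ℝ → ℝ × ℝ × ℝ) :=
    ((MeasurableEquiv.refl ℝ).prodCongr ((MeasurableEquiv.addLeft x).prodCongr
      (MeasurableEquiv.refl ℝ))).measurableEmbedding
  unfold kerFun
  rw [← hmp.integral_comp he]
  congr 1; ext p
  simp only [Prod.map, id, k0]
  congr 4; ring

/-- Tangential derivatives commute with the solution operator. -/
lemma hasDerivAt_kerFun_k0_of_hasDerivAt (hW : Wt W) (hψ : Measurable ψ) (hψ' : Measurable ψ')
    (hb : ∀ z, 0 ≤ z.2 → |ψ z| ≤ C * W z) (hb' : ∀ z, 0 ≤ z.2 → |ψ' z| ≤ C * W z) (hC : 0 ≤ C)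
    (hd : ∀ x y, 0 ≤ y → HasDerivAt (fun x => ψ (x, y)) (ψ' (x, y)) x) {x y : ℝ} (hy : 0 ≤ y) :
    HasDerivAt (fun x => kerFun tauM nuM k0 ψ (x, y)) (kerFun tauM nuM k0 ψ' (x, y)) x := by
  have e : (fun x => kerFun tauM nuM k0 ψ (x, y))
      = fun x => ∫ p, k0 p.1 (0, y) p.2 * ψ (x + p.2.1, p.2.2) ∂(tauM.prod nuM) :=
    funext fun x => kerFun_k0_translate x y
  rw [e, kerFun_k0_translate]
  have hz : (0:ℝ) ≤ ((0:ℝ), y).2 := hy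
  have bd : ∀ u ∈ Metric.ball x 1, ∀ t z', 0 < t → 0 ≤ z'.2 → ∀ φ : ℝ × ℝ → ℝ,
      (∀ z, 0 ≤ z.2 → |φ z| ≤ C * W z) → |k0 t (0, y) z' * φ (u + z'.1, z'.2)|
        ≤ 96 * C * W (x, y) * Dm t (0, y) z' := by
    intro u hu t z' ht hz' φ hφ
    have h1 := abs_k0_mul_le (hW.shift x) (C := 3 * C) (ψ := fun z => φ (u + z.1, z.2)) (fun z hz => by
      refine (hφ (u + z.1, z.2) hz).trans ?_
      have : |x + z.1 - (u + z.1)| ≤ 1 := by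
        rw [Metric.mem_ball, dist_comm, Real.dist_eq] at hu
        rw [show x + z.1 - (u + z.1) = x - u by ring]; exact hu.le
      have := mul_le_mul_of_nonneg_left (hW.le_of_dist (y := z.2) this) hC
      linarith) (by positivity) hz t z' ht hz'
    rw [add_zero] at h1
    linarith
  refine (hasDerivAt_integral_of_dominated_loc_of_deriv_le (s := Metric.ball x 1) (x₀ := x)
    (F := fun x (p : ℝ × ℝ × ℝ) => k0 p.1 (0, y) p.2 * ψ (x + p.2.1, p.2.2))
    (F' := fun x (p : ℝ × ℝ × ℝ) => k0 p.1 (0, y) p.2 * ψ' (x + p.2.1, p.2.2))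
    (bound := fun p => 96 * C * W (x, y) * Dm p.1 (0, y) p.2)
    (Metric.ball_mem_nhds x one_pos) ?_ ?_ ?_ ?_ ?_ ?_).2
  · exact Eventually.of_forall fun x => Measurable.aestronglyMeasurable (by fun_prop)
  · refine integrable_of_le_Dm (z := (0, y)) (Measurable.aestronglyMeasurable (by fun_prop)) fun t z' ht hz' =>
      bd x (Metric.mem_ball_self one_pos) t z' ht hz' ψ hb
  · exact Measurable.aestronglyMeasurable (by fun_prop)
  · filter_upwards [ae_tau_nu] with p hp u hu using bd u hu _ _ hp.1 hp.2 ψ' hb'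
  · exact (integrable_Dm _).const_mul _
  · filter_upwards [ae_tau_nu] with p hp u _
    have := (hd (u + p.2.1) p.2.2 hp.2).comp u ((hasDerivAt_id u).add_const p.2.1)
    rw [mul_one] at this
    exact this.const_mul _

/-! ### Gain of a tangential derivative for Hölder continuous data -/


lemma gk_shift_le {t x u x' : ℝ} (ht : 0 < t) (h : |u - x| ≤ 1) :
    gk (2 * t) (u - x') ≤ 2 * exp (1 / (8 * t)) * gk (4 * t) (x - x') := by
  have hs : (√(4 * π * (2 * t)))⁻¹ ≤ 2 * (√(4 * π * (4 * t)))⁻¹ := by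
    have h1 : √(4 * π * (4 * t)) ≤ 2 * √(4 * π * (2 * t)) := by
      rw [sqrt_le_left (by positivity), mul_pow, sq_sqrt (by positivity)]
      nlinarith [mul_pos pi_pos ht]
    have p1 : 0 < √(4 * π * (4 * t)) := by positivity
    have p2 : 0 < √(4 * π * (2 * t)) := by positivity
    rw [← div_eq_mul_inv, inv_eq_one_div, div_le_div_iff₀ p2 p1]; linarith
  have he : exp (-((u - x') ^ 2) / (4 * (2 * t))) ≤ exp (1 / (8 * t)) * exp (-((x - x') ^ 2) / (4 * (4 * t))) := by
    rw [← exp_add, exp_le_exp]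
    have h2 : (u - x) ^ 2 ≤ 1 := by rw [← sq_abs]; nlinarith [abs_nonneg (u - x)]
    have h3 : 0 ≤ (1 + (u - x') ^ 2 - (x - x') ^ 2 / 2) / (8 * t) := by
      refine div_nonneg ?_ (by positivity)
      nlinarith [sq_nonneg (u - x' + (u - x))]
    have : 1 / (8 * t) + -((x - x') ^ 2) / (4 * (4 * t)) - -((u - x') ^ 2) / (4 * (2 * t))
      = (1 + (u - x') ^ 2 - (x - x') ^ 2 / 2) / (8 * t) := by field_simp; ring
    linarith
  unfold gk
  calc _ ≤ (2 * (√(4 * π * (4 * t)))⁻¹) * (exp (1 / (8 * t)) * exp (-((x - x') ^ 2) / (4 * (4 * t)))) :=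
        mul_le_mul hs he (exp_pos _).le (by positivity)
    _ = _ := by ring

lemma abs_kx_shift_le {t x u y : ℝ} {z' : ℝ × ℝ} (ht : 0 < t) (h : |u - x| ≤ 1) (hy : 0 ≤ y) (hz' : 0 ≤ z'.2) :
    |kx t (u, y) z'| ≤ 16 * exp (1 / (8 * t)) * √t / t * Em t (x, y) z' := by
  have g0 := gk_nonneg (4 * t) (x - z'.1)
  have g1 := gk_nonneg (4 * t) (y - z'.2)
  have n0 := nk_nonneg t y z'.2
  have hs : 0 < √t := by positivity
  have p0 : 0 ≤ t ^ (-1/4 : ℝ) := by positivity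
  have key : |u - z'.1| * gk t (u - z'.1) ≤ 4 * √t * (2 * exp (1 / (8 * t)) * gk (4 * t) (x - z'.1)) :=
    (abs_mul_gk_le ht _).trans (mul_le_mul_of_nonneg_left (gk_shift_le ht h) (by positivity))
  have e : |kx t (u, y) z'| = exp (-t) / (2 * t) * ((|u - z'.1| * gk t (u - z'.1)) * nk t y z'.2) := by
    have : |2 * t| = 2 * t := abs_of_pos (by linarith)
    rw [kx, abs_mul, abs_of_nonneg (k0_nonneg _ _ _), abs_neg, abs_div, this]
    simp only [k0]; ring
  rw [e]
  calc _ ≤ exp (-t) / (2 * t) * ((4 * √t * (2 * exp (1 / (8 * t)) * gk (4 * t) (x - z'.1))) * (4 * gk (4 * t) (y - z'.2))) :=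
        mul_le_mul_of_nonneg_left (mul_le_mul key (nk_le_gk4 ht hy hz') n0 (by positivity)) (by positivity)
    _ = 16 * exp (1 / (8 * t)) * √t / t * (exp (-t) * (gk (4 * t) (x - z'.1) * gk (4 * t) (y - z'.2))) := by
        field_simp; ring
    _ ≤ 16 * exp (1 / (8 * t)) * √t / t * (exp (-t) * (1 + t ^ (-1/4 : ℝ)) * (gk (4 * t) (x - z'.1) * gk (4 * t) (y - z'.2))) := by
        gcongr
        exact le_mul_of_one_le_right (exp_pos _).le (by linarith)
    _ = _ := by simp only [Em]

lemma integrable_Dm_right {t : ℝ} (ht : 0 < t) (z : ℝ × ℝ) : Integrable (fun z' => Dm t z z') nuM := by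
  unfold Dm
  refine Integrable.const_mul ⟨by fun_prop, ?_⟩ _
  rw [hasFiniteIntegral_iff_ofReal (ae_of_all _ fun _ => Dk_nonneg _ _ _)]
  exact (lintegral_Dk_le ht z).trans_lt ENNReal.ofReal_lt_top

lemma integral_Dm_fst (t : ℝ) (x u y : ℝ) : 0 < t →
    ∫ z', Dm t (x, y) z' ∂nuM = ∫ z', Dm t (u, y) z' ∂nuM := by
  intro ht
  simp only [Dm, Dk, integral_const_mul, nuM]
  rw [integral_prod_mul (fun x' => gk (8 * t) (x - x')) (fun y' => gk (8 * t) (y - y')),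
    integral_prod_mul (fun x' => gk (8 * t) (u - x')) (fun y' => gk (8 * t) (y - y')),
    integral_gk_sub (by linarith), integral_gk_sub (by linarith)]

lemma ae_nu_of_nonneg {p : ℝ × ℝ → Prop} (h : ∀ z, 0 ≤ z.2 → p z) : ∀ᵐ z ∂nuM, p z := by
  filter_upwards [ae_nu_nonneg] with z hz using h z hz

lemma integral_kx_mul_snd {t x y : ℝ} (φ : ℝ → ℝ) : ∫ z', kx t (x, y) z' * φ z'.2 ∂nuM = 0 := by
  have e : (fun z' : ℝ × ℝ => kx t (x, y) z' * φ z'.2)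
      = fun z' => (-((x - z'.1) / (2 * t)) * gk t (x - z'.1)) * (exp (-t) * nk t y z'.2 * φ z'.2) := by
    ext z'; simp only [kx, k0]; ring
  rw [e, nuM, integral_prod_mul (fun x' => -((x - x') / (2 * t)) * gk t (x - x'))
    (fun y' => exp (-t) * nk t y y' * φ y')]
  have h1 : ∫ x', -((x - x') / (2 * t)) * gk t (x - x') = ∫ d, -(d / (2 * t)) * gk t d :=
    integral_sub_left_eq_self (fun d => -(d / (2 * t)) * gk t d) volume x
  have h2 : ∫ d, -(d / (2 * t)) * gk t d = -∫ d, -(d / (2 * t)) * gk t d := by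
    rw [← integral_neg, ← integral_neg_eq_self]
    congr 1; ext d; rw [gk_neg]; ring
  rw [h1, show ∫ d, -(d / (2 * t)) * gk t d = 0 by linarith, zero_mul]

/-- The regularised tangential derivative of the solution operator. -/
noncomputable def kxFun (ψ : ℝ × ℝ → ℝ) (z : ℝ × ℝ) : ℝ :=
  ∫ p, kx p.1 z p.2 * (ψ p.2 - ψ (z.1, p.2.2)) ∂(tauM.prod nuM)

lemma measurable_kxFun (hψ : Measurable ψ) : Measurable (kxFun ψ) := by
  unfold kxFun
  have : StronglyMeasurable (fun q : (ℝ × ℝ) × (ℝ × ℝ × ℝ) =>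
      kx q.2.1 q.1 q.2.2 * (ψ q.2.2 - ψ (q.1.1, q.2.2.2))) :=
    Measurable.stronglyMeasurable (by fun_prop)
  exact this.integral_prod_right.measurable

/-- Hölder continuity of order one half in the tangential direction, relative to the weight. -/
def HolBd (W ψ : ℝ × ℝ → ℝ) (C : ℝ) : Prop :=
  ∀ x x' y, 0 ≤ y → |ψ (x', y) - ψ (x, y)| ≤ C * √|x' - x| * (W (x, y) + W (x', y))

lemma abs_kx_mul_sub_le (hW : Wt W) (hh : HolBd W ψ C) (hC : 0 ≤ C) {x y : ℝ} (hy : 0 ≤ y)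
    (t : ℝ) (z' : ℝ × ℝ) (ht : 0 < t) (hz' : 0 ≤ z'.2) :
    |kx t (x, y) z' * (ψ z' - ψ (x, z'.2))| ≤ 512 * C * W (x, y) * Dm t (x, y) z' := by
  rw [abs_mul]
  have h1 := hh x z'.1 z'.2 hz'
  have w1 := hW.pos (x, z'.2)
  have w2 := hW.pos z'
  have h2 := mul_le_mul_of_nonneg_right (abs_kx_mul_sqrt_le (x := x) ht hy hz')
    (show 0 ≤ C * (W (x, z'.2) + W z') by positivity)
  have a1 := mul_le_mul_of_nonneg_left (Em_mul_wt_le hW ht (x, y) z') hC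
  have a2 := mul_le_mul_of_nonneg_left (Em_mul_wt_le (hW.freeze x) ht (x, y) z') hC
  have h3 := mul_le_mul_of_nonneg_left h1 (abs_nonneg (kx t (x, y) z'))
  simp only [Prod.mk.eta] at h3
  dsimp only at a2
  linarith

lemma abs_kxFun_le (hW : Wt W) (hh : HolBd W ψ C) (hC : 0 ≤ C) {z : ℝ × ℝ} (hz : 0 ≤ z.2) :
    |kxFun ψ z| ≤ 512 * AD * C * W z := by
  have := abs_integral_le_Dm (F := fun p => kx p.1 z p.2 * (ψ p.2 - ψ (z.1, p.2.2))) (B := 512 * C * W z) (z := z)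
    (by have := hW.pos z; positivity) (abs_kx_mul_sub_le hW hh hC hz)
  unfold kxFun; linarith

lemma hasDerivAt_kerFun_k0_of_holBd (hW : Wt W) (hψ : Measurable ψ)
    (hb : ∀ z, 0 ≤ z.2 → |ψ z| ≤ C * W z) (hh : HolBd W ψ C) (hC : 0 ≤ C) {x y : ℝ} (hy : 0 ≤ y) :
    HasDerivAt (fun x => kerFun tauM nuM k0 ψ (x, y)) (kxFun ψ (x, y)) x := by
  have hint : ∀ x, Integrable (fun p => k0 p.1 (x, y) p.2 * ψ p.2) (tauM.prod nuM) := fun x =>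
    integrable_k0_mul_wt hW hψ hb hC (by exact hy)
  have hint' : ∀ x, Integrable (fun p : ℝ × ℝ × ℝ => kx p.1 (x, y) p.2 * (ψ p.2 - ψ (x, p.2.2))) (tauM.prod nuM) :=
    fun x => integrable_of_le_Dm (z := (x, y)) (Measurable.aestronglyMeasurable (by fun_prop))
      (abs_kx_mul_sub_le hW hh hC hy)
  have e : (fun x => kerFun tauM nuM k0 ψ (x, y))
      = fun x => ∫ t, (∫ z', k0 t (x, y) z' * ψ z' ∂nuM) ∂tauM :=
    funext fun x => integral_prod _ (hint x)
  have e' : kxFun ψ (x, y) = ∫ t, (∫ z', kx t (x, y) z' * (ψ z' - ψ (x, z'.2)) ∂nuM) ∂tauM :=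
    integral_prod _ (hint' x)
  have dombd : ∀ {t : ℝ}, 0 < t → ∀ {x u : ℝ}, |u - x| ≤ 1 → ∀ {φ V : ℝ × ℝ → ℝ}, Wt V →
      (∀ z, 0 ≤ z.2 → |φ z| ≤ C * V z) → ∀ z', 0 ≤ z'.2 → ‖kx t (u, y) z' * φ z'‖ ≤
      16 * exp (1 / (8 * t)) * √t / t * C * (4 * V (x, y)) * Dm t (x, y) z' := by
    intro t ht x u hu φ V hV hφ z' hz'
    rw [norm_eq_abs, abs_mul]
    have h1 := mul_le_mul (abs_kx_shift_le (z' := z') ht hu hy hz') (hφ z' hz') (abs_nonneg _)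
      (mul_nonneg (by positivity) (Em_nonneg ht _ _))
    have h2 := mul_le_mul_of_nonneg_left (Em_mul_wt_le hV ht (x, y) z')
      (show 0 ≤ 16 * exp (1 / (8 * t)) * √t / t * C by positivity)
    linarith
  have inner : ∀ t, 0 < t → ∀ x, HasDerivAt (fun x => ∫ z', k0 t (x, y) z' * ψ z' ∂nuM)
      (∫ z', kx t (x, y) z' * (ψ z' - ψ (x, z'.2)) ∂nuM) x := by
    intro t ht x
    have h1 := (hasDerivAt_integral_of_dominated_loc_of_deriv_le (s := Metric.ball x 1) (x₀ := x) (μ := nuM)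
      (F := fun x z' => k0 t (x, y) z' * ψ z') (F' := fun x z' => kx t (x, y) z' * ψ z')
      (bound := fun z' => 16 * exp (1 / (8 * t)) * √t / t * C * (4 * W (x, y)) * Dm t (x, y) z')
      (Metric.ball_mem_nhds x one_pos) (.of_forall fun x => Measurable.aestronglyMeasurable (by fun_prop))
      (((integrable_Dm_right ht (x, y)).const_mul (32 * C * W (x, y))).mono'
        (Measurable.aestronglyMeasurable (by fun_prop))
        (ae_nu_of_nonneg fun z' hz' => abs_k0_mul_le hW hb hC hy t z' ht hz'))
      (Measurable.aestronglyMeasurable (by fun_prop))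
      (ae_nu_of_nonneg fun z' hz' u hu => dombd ht (by
        rw [Metric.mem_ball, Real.dist_eq] at hu; exact hu.le) hW hb z' hz')
      ((integrable_Dm_right ht (x, y)).const_mul _)
      (ae_of_all _ fun z' u _ => (hasDerivAt_k0_fst z').mul_const _)).2
    refine h1.congr_deriv ?_
    have i1 : Integrable (fun z' => kx t (x, y) z' * ψ z') nuM :=
      ((integrable_Dm_right ht (x, y)).const_mul _).mono' (Measurable.aestronglyMeasurable (by fun_prop))
        (ae_nu_of_nonneg fun z' hz' => dombd ht (by simp) hW hb z' hz')
    have i2 : Integrable (fun z' => kx t (x, y) z' * ψ (x, z'.2)) nuM :=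
      ((integrable_Dm_right ht (x, y)).const_mul _).mono' (Measurable.aestronglyMeasurable (by fun_prop))
        (ae_nu_of_nonneg fun z' hz' => dombd (φ := fun z' => ψ (x, z'.2)) ht (by simp) (hW.freeze x)
          (fun z hz => hb (x, z.2) hz) z' hz')
    simp_rw [mul_sub]
    rw [integral_sub i1 i2, integral_kx_mul_snd (fun y' => ψ (x, y')), sub_zero]
  rw [e, e']
  refine (hasDerivAt_integral_of_dominated_loc_of_deriv_le (s := Metric.ball x 1) (x₀ := x)
    (F := fun x t => ∫ z', k0 t (x, y) z' * ψ z' ∂nuM)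
    (F' := fun x t => ∫ z', kx t (x, y) z' * (ψ z' - ψ (x, z'.2)) ∂nuM)
    (bound := fun t => 512 * C * (3 * W (x, y)) * ∫ z', Dm t (x, y) z' ∂nuM)
    (Metric.ball_mem_nhds x one_pos) ?_ ?_ ?_ ?_ ?_ ?_).2
  · exact Eventually.of_forall fun x => (hint x).1.integral_prod_right'
  · exact (hint x).integral_prod_left
  · exact (hint' x).1.integral_prod_right'
  · filter_upwards [ae_tau_pos] with t ht u hu
    rw [Metric.mem_ball, dist_comm, Real.dist_eq] at hu
    have h1 := norm_integral_le_of_norm_le ((integrable_Dm_right ht (u, y)).const_mul (512 * C * W (u, y)))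
      (f := fun z' => kx t (u, y) z' * (ψ z' - ψ (u, z'.2)))
      (ae_nu_of_nonneg fun z' hz' => abs_kx_mul_sub_le hW hh hC hy t z' ht hz')
    refine h1.trans ?_
    rw [integral_const_mul, integral_Dm_fst t u x y ht]
    have h0 : 0 ≤ ∫ z', Dm t (x, y) z' ∂nuM := integral_nonneg fun z' => Dm_nonneg ht _ _
    exact mul_le_mul_of_nonneg_right (mul_le_mul_of_nonneg_left (hW.le_of_dist hu.le) (by positivity)) h0
  · exact (integrable_Dm (x, y)).integral_prod_left.const_mul _
  · filter_upwards [ae_tau_pos] with t ht u _ using inner t ht u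

end Tangential

open scoped ENNReal NNReal ContDiff

/-! ### Function classes defined by iterated differentiation -/

/-- A relation `R g g'` expressing that `g'` is a derivative of `g`. -/
structure Drv (R : (ℝ × ℝ → ℝ) → (ℝ × ℝ → ℝ) → Prop) : Prop where
  add : ∀ {a a' b b'}, R a a' → R b b' → R (fun z => a z + b z) (fun z => a' z + b' z)
  mul : ∀ {a a' b b'}, R a a' → R b b' → R (fun z => a z * b z) (fun z => a' z * b z + a z * b' z)
  comp : ∀ {φ : ℝ → ℝ} {a a'}, ContDiff ℝ ∞ φ → R a a' → R (fun z => φ (a z)) (fun z => deriv φ (a z) * a' z)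

/-- A class `Q1` of functions closed under algebraic operations and smooth composition, together with an
ideal `QW`. -/
structure Alg (Q1 QW : (ℝ × ℝ → ℝ) → Prop) : Prop where
  sub : ∀ {a}, QW a → Q1 a
  add1 : ∀ {a b}, Q1 a → Q1 b → Q1 (fun z => a z + b z)
  addW : ∀ {a b}, QW a → QW b → QW (fun z => a z + b z)
  mul1 : ∀ {a b}, Q1 a → Q1 b → Q1 (fun z => a z * b z)
  mulW : ∀ {a b}, Q1 a → QW b → QW (fun z => a z * b z)
  comp : ∀ {φ : ℝ → ℝ} {a}, ContDiff ℝ ∞ φ → Q1 a → Q1 (fun z => φ (a z))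
  dcomp : ∀ {φ : ℝ → ℝ} {Θ U}, ContDiff ℝ ∞ φ → Q1 Θ → QW U → QW (fun z => φ (Θ z + U z) - φ (Θ z))

/-- Functions in `Q` with `n` successive derivatives in `Q`. -/
def RC (R : (ℝ × ℝ → ℝ) → (ℝ × ℝ → ℝ) → Prop) (Q : (ℝ × ℝ → ℝ) → Prop) : ℕ → (ℝ × ℝ → ℝ) → Prop
  | 0, g => Q g
  | n + 1, g => Q g ∧ ∃ g', R g g' ∧ RC R Q n g'

section RC
variable {R : (ℝ × ℝ → ℝ) → (ℝ × ℝ → ℝ) → Prop} {Q Q' Q1 QW : (ℝ × ℝ → ℝ) → Prop} {n : ℕ} {g : ℝ × ℝ → ℝ}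

lemma RC.base (h : RC R Q n g) : Q g := by
  cases n with
  | zero => exact h
  | succ n => exact h.1

lemma RC.pred (h : RC R Q (n + 1) g) : RC R Q n g := by
  induction n generalizing g with
  | zero => exact h.1
  | succ n ih => obtain ⟨h1, g', h2, h3⟩ := h; exact ⟨h1, g', h2, ih h3⟩

lemma RC.imp (hQ : ∀ g, Q g → Q' g) (h : RC R Q n g) : RC R Q' n g := by
  induction n generalizing g with
  | zero => exact hQ _ h
  | succ n ih => obtain ⟨h1, g', h2, h3⟩ := h; exact ⟨hQ _ h1, g', h2, ih h3⟩

lemma Continuous.of_hasDerivAt {φ φ' : ℝ → ℝ} (h : ∀ x, HasDerivAt φ (φ' x) x) : Continuous φ :=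
  continuous_iff_continuousAt.mpr fun x => (h x).continuousAt

lemma Continuous.hasDerivAt_integral {φ : ℝ → ℝ} (h : Continuous φ) (a x : ℝ) :
    HasDerivAt (fun x => ∫ s in a..x, φ s) (φ x) x :=
  (h.integral_hasStrictDerivAt a x).hasDerivAt

lemma ContDiff.hasDerivAt {φ : ℝ → ℝ} (h : ContDiff ℝ ∞ φ) (x : ℝ) : HasDerivAt φ (deriv φ x) x :=
  (h.differentiable (by simp) x).hasDerivAt

lemma ContDiff.deriv_infty {φ : ℝ → ℝ} (h : ContDiff ℝ ∞ φ) : ContDiff ℝ ∞ (deriv φ) :=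
  (contDiff_infty_iff_deriv.mp h).2

lemma Alg.const (hA : Alg Q1 QW) {a : ℝ × ℝ → ℝ} (ha : Q1 a) (c : ℝ) : Q1 (fun _ => c) :=
  hA.comp (φ := fun _ => c) contDiff_const ha

lemma Alg.rc (hA : Alg Q1 QW) (hR : Drv R) (n : ℕ) : Alg (RC R Q1 n) (RC R QW n) := by
  induction n with
  | zero => exact hA
  | succ n ih =>
    have sub : ∀ {a}, RC R QW (n + 1) a → RC R Q1 (n + 1) a := fun h => h.imp fun _ => hA.sub
    have comp : ∀ {φ : ℝ → ℝ} {a}, ContDiff ℝ ∞ φ → RC R Q1 (n + 1) a → RC R Q1 (n + 1) (fun z => φ (a z)) := by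
      rintro φ a hφ ha
      obtain ⟨h1, a', h2, h3⟩ := id ha
      exact ⟨hA.comp hφ h1, _, hR.comp hφ h2, ih.mul1 (ih.comp hφ.deriv_infty ha.pred) h3⟩
    have add1 : ∀ {a b}, RC R Q1 (n + 1) a → RC R Q1 (n + 1) b → RC R Q1 (n + 1) (fun z => a z + b z) := by
      rintro a b ⟨h1, a', h2, h3⟩ ⟨k1, b', k2, k3⟩
      exact ⟨hA.add1 h1 k1, _, hR.add h2 k2, ih.add1 h3 k3⟩
    refine ⟨sub, add1, ?_, ?_, ?_, comp, ?_⟩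
    · rintro a b ⟨h1, a', h2, h3⟩ ⟨k1, b', k2, k3⟩
      exact ⟨hA.addW h1 k1, _, hR.add h2 k2, ih.addW h3 k3⟩
    · rintro a b ⟨h1, a', h2, h3⟩ ⟨k1, b', k2, k3⟩
      exact ⟨hA.mul1 h1 k1, _, hR.mul h2 k2, ih.add1 (ih.mul1 h3 (RC.pred ⟨k1, b', k2, k3⟩)) (ih.mul1 (RC.pred ⟨h1, a', h2, h3⟩) k3)⟩
    · rintro a b ⟨h1, a', h2, h3⟩ ⟨k1, b', k2, k3⟩
      exact ⟨hA.mulW h1 k1, _, hR.mul h2 k2, ih.addW (ih.mulW h3 (RC.pred ⟨k1, b', k2, k3⟩)) (ih.mulW (RC.pred ⟨h1, a', h2, h3⟩) k3)⟩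
    · rintro φ Θ U hφ hΘ hU
      obtain ⟨h1, Θ', h2, h3⟩ := id hΘ
      obtain ⟨k1, U', k2, k3⟩ := id hU
      have hφ' := hφ.deriv_infty
      refine ⟨hA.dcomp hφ h1 k1, fun z => (deriv φ (Θ z + U z) - deriv φ (Θ z)) * Θ' z
        + deriv φ (Θ z + U z) * U' z, ?_, ?_⟩
      · have e1 := hR.comp hφ (hR.add h2 k2)
        have e2 := hR.comp (φ := fun r => (-1) * φ r) (contDiff_const.mul hφ) h2
        have e3 := hR.add e1 e2
        have d : deriv (fun r => (-1) * φ r) = fun r => -1 * deriv φ r := by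
          ext r; rw [deriv_const_mul _ (hφ.differentiable (by simp)).differentiableAt]
        rw [d] at e3
        convert e3 using 1 <;> (ext z; ring)
      · refine ih.addW ?_ (ih.mulW (ih.comp hφ' (ih.add1 hΘ.pred (ih.sub hU.pred))) k3)
        have e1 := ih.mulW h3 (ih.dcomp hφ' hΘ.pred hU.pred)
        convert e1 using 2; ring

end RC

/-- `g'` is the tangential derivative of `g` on the closed half-plane. -/
def Rx (g g' : ℝ × ℝ → ℝ) : Prop := ∀ x y, 0 ≤ y → HasDerivAt (fun x => g (x, y)) (g' (x, y)) x

/-- `g'` is the normal derivative of `g` in the open half-plane. -/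
def Ry (g g' : ℝ × ℝ → ℝ) : Prop := ∀ x y, 0 < y → HasDerivAt (fun y => g (x, y)) (g' (x, y)) y

lemma drv_Rx : Drv Rx where
  add h k x y hy := (h x y hy).add (k x y hy)
  mul h k x y hy := (h x y hy).mul (k x y hy)
  comp hφ h x y hy := (hφ.hasDerivAt _).comp x (h x y hy)

lemma drv_Ry : Drv Ry where
  add h k x y hy := (h x y hy).add (k x y hy)
  mul h k x y hy := (h x y hy).mul (k x y hy)
  comp hφ h x y hy := (hφ.hasDerivAt _).comp y (h x y hy)

/-- Measurable functions dominated by the weight on the closed half-plane. -/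
def Bd (W g : ℝ × ℝ → ℝ) : Prop := Measurable g ∧ ∃ C, 0 ≤ C ∧ ∀ z, 0 ≤ z.2 → |g z| ≤ C * W z

/-- Functions in `Bd W` which are Hölder continuous in the tangential direction. -/
def Hol (W g : ℝ × ℝ → ℝ) : Prop := Bd W g ∧ ∃ C, 0 ≤ C ∧ HolBd W g C

/-- Continuous functions in `Bd W`. -/
def BdC (W g : ℝ × ℝ → ℝ) : Prop := Bd W g ∧ ContinuousOn g {z | 0 ≤ z.2}

lemma exists_lipschitz_Icc {φ : ℝ → ℝ} (hφ : ContDiff ℝ ∞ φ) (M : ℝ) :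
    ∃ L, 0 ≤ L ∧ ∀ a b, |a| ≤ M → |b| ≤ M → |φ a - φ b| ≤ L * |a - b| := by
  have hc : Continuous (deriv φ) := hφ.deriv_infty.continuous
  obtain ⟨L, hL⟩ := (isCompact_Icc (a := -M) (b := M)).exists_bound_of_continuousOn hc.continuousOn
  refine ⟨max L 0, le_max_right _ _, fun a b ha hb => ?_⟩
  exact (convex_Icc (-M) M).norm_image_sub_le_of_norm_deriv_le
    (fun x _ => (hφ.differentiable (by simp)).differentiableAt) (fun x hx => (hL x hx).trans (le_max_left _ _))
    (abs_le.mp hb) (abs_le.mp ha)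

lemma exists_lipschitz_diff {φ : ℝ → ℝ} (hφ : ContDiff ℝ ∞ φ) (M : ℝ) :
    ∃ L, 0 ≤ L ∧ ∀ a b u, |a| ≤ M → |b| ≤ M → |u| ≤ M →
      |(φ (a + u) - φ a) - (φ (b + u) - φ b)| ≤ L * |u| * |a - b| := by
  obtain ⟨L, hL0, hL⟩ := exists_lipschitz_Icc hφ.deriv_infty (2 * M)
  refine ⟨L, hL0, fun a b u ha hb hu => ?_⟩
  have hM : 0 ≤ M := (abs_nonneg _).trans ha
  have hd := hφ.differentiable (by simp)
  have h1 : ∀ x ∈ Set.Icc (-M) M, HasDerivWithinAt (fun r => φ (r + u) - φ r) (deriv φ (x + u) - deriv φ x)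
      (Set.Icc (-M) M) x := by
    intro x _
    have := (hd.differentiableAt (x := x + u)).hasDerivAt.comp x ((hasDerivAt_id x).add_const u)
    rw [mul_one] at this
    exact (this.sub hd.differentiableAt.hasDerivAt).hasDerivWithinAt
  refine (convex_Icc (-M) M).norm_image_sub_le_of_norm_hasDerivWithin_le h1 (fun x hx => ?_)
    (abs_le.mp hb) (abs_le.mp ha)
  have hx' := abs_le.mpr hx
  have := hL (x + u) x ((abs_add_le _ _).trans (by linarith)) (by linarith)
  simpa using this

section Bases
variable {W : ℝ × ℝ → ℝ} {B : ℝ}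

lemma Bd.comp {φ : ℝ → ℝ} {a : ℝ × ℝ → ℝ} (hφ : ContDiff ℝ ∞ φ) (ha : Bd (fun _ => 1) a) :
    Bd (fun _ => 1) (fun z => φ (a z)) := by
  obtain ⟨h1, C, hC, h2⟩ := ha
  obtain ⟨L, hL⟩ := (isCompact_Icc (a := -C) (b := C)).exists_bound_of_continuousOn hφ.continuous.continuousOn
  refine ⟨hφ.continuous.measurable.comp h1, max L 0, le_max_right _ _, fun z hz => ?_⟩
  rw [mul_one]
  have := h2 z hz
  rw [mul_one] at this
  exact (hL _ (abs_le.mp this)).trans (le_max_left _ _)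

lemma Bd.dcomp {φ : ℝ → ℝ} {Θ U : ℝ × ℝ → ℝ} (hB : ∀ z, 0 ≤ z.2 → W z ≤ B) (hφ : ContDiff ℝ ∞ φ)
    (hΘ : Bd (fun _ => 1) Θ) (hU : Bd W U) : Bd W (fun z => φ (Θ z + U z) - φ (Θ z)) := by
  obtain ⟨h1, C, hC, h2⟩ := hΘ
  obtain ⟨k1, D, hD, k2⟩ := hU
  obtain ⟨L, hL0, hL⟩ := exists_lipschitz_Icc hφ (C + D * B)
  refine ⟨(hφ.continuous.measurable.comp (h1.add k1)).sub (hφ.continuous.measurable.comp h1), L * D,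
    by positivity, fun z hz => ?_⟩
  have a1 := h2 z hz
  have a2 := k2 z hz
  have a3 := mul_le_mul_of_nonneg_left (hB z hz) hD
  rw [mul_one] at a1
  have := hL (Θ z + U z) (Θ z) ((abs_add_le _ _).trans (by linarith)) (by linarith [abs_nonneg (U z)])
  rw [add_sub_cancel_left] at this
  exact this.trans (by nlinarith)

lemma Bd.add {a b : ℝ × ℝ → ℝ} (ha : Bd W a) (hb : Bd W b) : Bd W (fun z => a z + b z) := by
  obtain ⟨h1, C, hC, h2⟩ := ha
  obtain ⟨k1, D, hD, k2⟩ := hb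
  exact ⟨h1.add k1, C + D, by positivity, fun z hz =>
    (abs_add_le _ _).trans (by linarith [h2 z hz, k2 z hz])⟩

lemma Bd.mul {a b : ℝ × ℝ → ℝ} (ha : Bd (fun _ => 1) a) (hb : Bd W b) : Bd W (fun z => a z * b z) := by
  obtain ⟨h1, C, hC, h2⟩ := ha
  obtain ⟨k1, D, hD, k2⟩ := hb
  refine ⟨h1.mul k1, C * D, by positivity, fun z hz => ?_⟩
  rw [abs_mul]
  exact (mul_le_mul (h2 z hz) (k2 z hz) (abs_nonneg _) (by positivity)).trans (le_of_eq (by ring))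

lemma Wt.bound_nonneg (hW : Wt W) (hB : ∀ z, 0 ≤ z.2 → W z ≤ B) : 0 ≤ B :=
  (hW.pos (0, 0)).le.trans (hB (0, 0) le_rfl)

lemma alg_Bd (hW : Wt W) (hB : ∀ z, 0 ≤ z.2 → W z ≤ B) : Alg (Bd fun _ => 1) (Bd W) where
  sub := by
    rintro a ⟨h1, C, hC, h2⟩
    exact ⟨h1, C * B, mul_nonneg hC (hW.bound_nonneg hB), fun z hz => (h2 z hz).trans (by
      rw [mul_one]; exact mul_le_mul_of_nonneg_left (hB z hz) hC)⟩
  add1 := Bd.add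
  addW := Bd.add
  mul1 := Bd.mul
  mulW := Bd.mul
  comp := Bd.comp
  dcomp := Bd.dcomp hB

lemma alg_BdC (hW : Wt W) (hB : ∀ z, 0 ≤ z.2 → W z ≤ B) : Alg (BdC fun _ => 1) (BdC W) where
  sub h := ⟨(alg_Bd hW hB).sub h.1, h.2⟩
  add1 h k := ⟨(alg_Bd hW hB).add1 h.1 k.1, h.2.add k.2⟩
  addW h k := ⟨(alg_Bd hW hB).addW h.1 k.1, h.2.add k.2⟩
  mul1 h k := ⟨(alg_Bd hW hB).mul1 h.1 k.1, h.2.mul k.2⟩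
  mulW h k := ⟨(alg_Bd hW hB).mulW h.1 k.1, h.2.mul k.2⟩
  comp hφ h := ⟨(alg_Bd hW hB).comp hφ h.1, hφ.continuous.comp_continuousOn h.2⟩
  dcomp hφ h k := ⟨(alg_Bd hW hB).dcomp hφ h.1 k.1,
    (hφ.continuous.comp_continuousOn (h.2.add k.2)).sub (hφ.continuous.comp_continuousOn h.2)⟩

lemma Hol.mulW (hW : Wt W) {a b : ℝ × ℝ → ℝ} (ha : Hol (fun _ => 1) a) (hb : Hol W b) (hab : Bd W fun z => a z * b z) :
    Hol W (fun z => a z * b z) := by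
  obtain ⟨⟨h1, C, hC, h2⟩, C', hC', h3⟩ := ha
  obtain ⟨⟨k1, D, hD, k2⟩, D', hD', k3⟩ := hb
  refine ⟨hab, 2 * C' * D + C * D', by positivity, fun x x' y hy => ?_⟩
  have e : a (x', y) * b (x', y) - a (x, y) * b (x, y)
    = (a (x', y) - a (x, y)) * b (x', y) + a (x, y) * (b (x', y) - b (x, y)) := by ring
  rw [e]
  refine (abs_add_le _ _).trans ?_
  rw [abs_mul, abs_mul]
  have w1 := hW.pos (x, y)
  have w2 := hW.pos (x', y)
  have a1 := mul_le_mul (h3 x x' y hy) (k2 (x', y) hy) (abs_nonneg _) (by positivity)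
  have a2 := mul_le_mul (h2 (x, y) hy) (k3 x x' y hy) (abs_nonneg _) (by positivity)
  have : 0 ≤ 2 * C' * D * √|x' - x| * W (x, y) := by positivity
  linarith

lemma Hol.add {a b : ℝ × ℝ → ℝ} (ha : Hol W a) (hb : Hol W b) : Hol W (fun z => a z + b z) := by
  obtain ⟨h1, C, hC, h2⟩ := ha
  obtain ⟨k1, D, hD, k2⟩ := hb
  refine ⟨h1.add k1, C + D, by positivity, fun x x' y hy => ?_⟩
  rw [add_sub_add_comm]
  exact (abs_add_le _ _).trans (by linarith [h2 x x' y hy, k2 x x' y hy])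

lemma alg_Hol (hW : Wt W) (hB : ∀ z, 0 ≤ z.2 → W z ≤ B) : Alg (Hol fun _ => 1) (Hol W) where
  sub := by
    rintro a ⟨h1, C, hC, h2⟩
    have hB0 := hW.bound_nonneg hB
    refine ⟨(alg_Bd hW hB).sub h1, C * B, by positivity, fun x x' y hy => (h2 x x' y hy).trans ?_⟩
    have := mul_le_mul_of_nonneg_left (add_le_add (hB (x, y) hy) (hB (x', y) hy))
      (show 0 ≤ C * √|x' - x| by positivity)
    linarith
  add1 := Hol.add
  addW := Hol.add
  mul1 h k := Hol.mulW wt_one h k ((alg_Bd hW hB).mul1 h.1 k.1)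
  mulW h k := Hol.mulW hW h k ((alg_Bd hW hB).mulW h.1 k.1)
  comp := by
    rintro φ a hφ ⟨h1, C, hC, h2⟩
    refine ⟨Bd.comp hφ h1, ?_⟩
    obtain ⟨-, D, hD, h3⟩ := h1
    obtain ⟨L, hL0, hL⟩ := exists_lipschitz_Icc hφ D
    simp only [mul_one] at h3
    exact ⟨L * C, by positivity, fun x x' y hy => (hL _ _ (h3 _ hy) (h3 _ hy)).trans (by
      have := mul_le_mul_of_nonneg_left (h2 x x' y hy) hL0; linarith)⟩
  dcomp := by
    rintro φ Θ U hφ ⟨h1, C, hC, h2⟩ ⟨k1, D, hD, k2⟩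
    refine ⟨Bd.dcomp hB hφ h1 k1, ?_⟩
    obtain ⟨-, C', hC', h3⟩ := h1
    obtain ⟨-, D', hD', k3⟩ := k1
    simp only [mul_one] at h3
    have k4 : ∀ z, 0 ≤ z.2 → |U z| ≤ D' * B := fun z hz =>
      (k3 z hz).trans (mul_le_mul_of_nonneg_left (hB z hz) hD')
    have hB0 := hW.bound_nonneg hB
    obtain ⟨L, hL0, hL⟩ := exists_lipschitz_Icc hφ (C' + D' * B)
    obtain ⟨L', hL0', hL'⟩ := exists_lipschitz_diff hφ (C' + D' * B)
    refine ⟨L * D + L' * D' * C * 2, by positivity, fun x x' y hy => ?_⟩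
    have p : 0 ≤ D' * B := by positivity
    have e : φ (Θ (x', y) + U (x', y)) - φ (Θ (x', y)) - (φ (Θ (x, y) + U (x, y)) - φ (Θ (x, y)))
      = (φ (Θ (x, y) + U (x', y)) - φ (Θ (x, y) + U (x, y)))
        + ((φ (Θ (x', y) + U (x', y)) - φ (Θ (x', y))) - (φ (Θ (x, y) + U (x', y)) - φ (Θ (x, y)))) := by ring
    rw [e]
    have t1 := h3 (x, y) hy
    have t2 := h3 (x', y) hy
    have u1 := k4 (x, y) hy
    have u2 := k4 (x', y) hy
    have b1 := hL (Θ (x, y) + U (x', y)) (Θ (x, y) + U (x, y)) ((abs_add_le _ _).trans (by linarith))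
      ((abs_add_le _ _).trans (by linarith))
    have b2 := hL' (Θ (x', y)) (Θ (x, y)) (U (x', y)) (by linarith) (by linarith) (by linarith)
    rw [add_sub_add_left_eq_sub] at b1
    have c1 := mul_le_mul_of_nonneg_left (k2 x x' y hy) hL0
    have w1 := hW.pos (x, y)
    have w2 := hW.pos (x', y)
    have c2 := mul_le_mul (mul_le_mul_of_nonneg_left (k3 (x', y) hy) hL0') (h2 x x' y hy) (abs_nonneg _)
      (by positivity)
    refine (abs_add_le _ _).trans ?_
    have c3 : 0 ≤ L' * D' * C * 2 * √|x' - x| * W (x, y) := by positivity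
    linarith

end Bases

section Kernel
variable {W ψ : ℝ × ℝ → ℝ} {B : ℝ} {k : ℕ}

lemma Bd.rx_kerFun {ψ' : ℝ × ℝ → ℝ} (hW : Wt W) (h : Bd W ψ) (h' : Bd W ψ') (hd : Rx ψ ψ') :
    Rx (kerFun tauM nuM k0 ψ) (kerFun tauM nuM k0 ψ') := fun x y hy => by
  obtain ⟨m, C, hC, b⟩ := h
  obtain ⟨m', C', hC', b'⟩ := h'
  exact hasDerivAt_kerFun_k0_of_hasDerivAt (C := max C C') hW m m'
    (fun z hz => (b z hz).trans (mul_le_mul_of_nonneg_right (le_max_left _ _) (hW.pos z).le))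
    (fun z hz => (b' z hz).trans (mul_le_mul_of_nonneg_right (le_max_right _ _) (hW.pos z).le))
    (hC.trans (le_max_left _ _)) hd hy

lemma RC.kerFun_of_base {Q : (ℝ × ℝ → ℝ) → Prop} (hW : Wt W)
    (hQ : ∀ ψ, Bd W ψ → Q (kerFun tauM nuM k0 ψ)) (h : RC Rx (Bd W) k ψ) :
    RC Rx Q k (kerFun tauM nuM k0 ψ) := by
  induction k generalizing ψ with
  | zero => exact hQ _ h
  | succ k ih =>
    obtain ⟨h1, ψ', h2, h3⟩ := h
    exact ⟨hQ _ h1, _, h1.rx_kerFun hW h3.base h2, ih h3⟩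

lemma Bd.kerFun (hW : Wt W) (h : Bd W ψ) : Bd W (kerFun tauM nuM k0 ψ) := by
  obtain ⟨m, C, hC, b⟩ := h
  exact ⟨measurable_kerFun_k0 m, 32 * AD * C, by positivity, fun z hz => abs_kerFun_k0_le_wt hW b hC hz⟩

lemma Hol.kerFun (hW : Wt W) (h : Bd W ψ) : Hol W (kerFun tauM nuM k0 ψ) := by
  refine ⟨h.kerFun hW, ?_⟩
  obtain ⟨m, C, hC, b⟩ := h
  refine ⟨256 * C * AD, by positivity, fun x x' y hy => ?_⟩
  have := abs_kerFun_k0_sub_fst_le (x₁ := x') (x₂ := x) hW m b hC hy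
  linarith

lemma BdC.kerFun (hW : Wt W) (hB : ∀ z, 0 ≤ z.2 → W z ≤ B) (h : Bd W ψ) : BdC W (kerFun tauM nuM k0 ψ) := by
  refine ⟨h.kerFun hW, ?_⟩
  obtain ⟨m, C, hC, b⟩ := h
  have hB0 := hW.bound_nonneg hB
  intro z₀ hz₀
  rw [ContinuousWithinAt, tendsto_iff_dist_tendsto_zero]
  have key : ∀ z ∈ {z : ℝ × ℝ | 0 ≤ z.2}, dist (_root_.kerFun tauM nuM k0 ψ z) (_root_.kerFun tauM nuM k0 ψ z₀)
      ≤ 256 * C * AD * (2 * B) * (√|z.1 - z₀.1| + √|z.2 - z₀.2|) := by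
    intro z hz
    have h1 := abs_kerFun_k0_sub_fst_le (x₁ := z.1) (x₂ := z₀.1) hW m b hC hz
    have h2 := abs_kerFun_k0_sub_snd_le (x := z₀.1) (y₁ := z.2) (y₂ := z₀.2) hW m b hC hz hz₀
    have b1 := mul_le_mul_of_nonneg_left (add_le_add (hB (z.1, z.2) hz) (hB (z₀.1, z.2) hz))
      (show 0 ≤ 256 * C * AD * √|z.1 - z₀.1| by positivity)
    have b2 := mul_le_mul_of_nonneg_left (add_le_add (hB (z₀.1, z.2) hz) (hB (z₀.1, z₀.2) hz₀))
      (show 0 ≤ 256 * C * AD * √|z.2 - z₀.2| by positivity)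
    rw [Real.dist_eq]
    have := abs_sub_le (_root_.kerFun tauM nuM k0 ψ (z.1, z.2)) (_root_.kerFun tauM nuM k0 ψ (z₀.1, z.2))
      (_root_.kerFun tauM nuM k0 ψ (z₀.1, z₀.2))
    simp only [Prod.mk.eta] at *
    linarith
  refine squeeze_zero' (.of_forall fun _ => dist_nonneg) (eventually_nhdsWithin_of_forall key) ?_
  have hc : Continuous (fun z : ℝ × ℝ => 256 * C * AD * (2 * B) * (√|z.1 - z₀.1| + √|z.2 - z₀.2|)) := by fun_prop
  have := hc.tendsto z₀
  simp only [sub_self, abs_zero, sqrt_zero, add_zero, mul_zero] at this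
  exact this.mono_left nhdsWithin_le_nhds

lemma RC.kerFun_hol (hW : Wt W) (h : RC Rx (Bd W) k ψ) : RC Rx (Hol W) k (kerFun tauM nuM k0 ψ) :=
  h.kerFun_of_base hW fun _ => Hol.kerFun hW

lemma RC.kerFun_bdC (hW : Wt W) (hB : ∀ z, 0 ≤ z.2 → W z ≤ B) (h : RC Rx (Bd W) k ψ) :
    RC Rx (BdC W) k (kerFun tauM nuM k0 ψ) := h.kerFun_of_base hW fun _ => BdC.kerFun hW hB

/-- The solution operator gains a tangential derivative on Hölder classes. -/
lemma RC.kerFun_succ (hW : Wt W) (h : RC Rx (Hol W) k ψ) : RC Rx (Bd W) (k + 1) (kerFun tauM nuM k0 ψ) := by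
  induction k generalizing ψ with
  | zero =>
    obtain ⟨h1, C', hC', hh⟩ := h
    refine ⟨h1.kerFun hW, kxFun ψ, fun x y hy => ?_, ?_⟩
    · obtain ⟨m, C, hC, b⟩ := h1
      refine hasDerivAt_kerFun_k0_of_holBd (C := max C C') hW m
        (fun z hz => (b z hz).trans (mul_le_mul_of_nonneg_right (le_max_left _ _) (hW.pos z).le))
        (fun x x' y hy => (hh x x' y hy).trans ?_) (hC.trans (le_max_left _ _)) hy
      have := hW.pos (x, y)
      have := hW.pos (x', y)
      gcongr
      exact le_max_right _ _
    · exact ⟨measurable_kxFun h1.1, 512 * AD * C', by positivity, fun z hz => abs_kxFun_le hW hh hC' hz⟩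
  | succ k ih =>
    obtain ⟨h1, ψ', h2, h3⟩ := h
    exact ⟨h1.1.kerFun hW, _, h1.1.rx_kerFun hW h3.base.1 h2, ih h3⟩

/-- Bootstrapping of tangential regularity. -/
lemma tangential_regularity (hW : Wt W) {U : ℝ × ℝ → ℝ} (hU : U = kerFun tauM nuM k0 ψ) (h0 : Bd W U)
    (hBd : ∀ k, RC Rx (Bd W) k U → RC Rx (Bd W) k ψ) (hHol : ∀ k, RC Rx (Hol W) k U → RC Rx (Hol W) k ψ) (k : ℕ) :
    RC Rx (Bd W) k U := by
  induction k with
  | zero => exact h0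
  | succ k ih =>
    have h1 : RC Rx (Hol W) k U := by rw [hU]; exact (hBd k ih).kerFun_hol hW
    rw [hU]; exact (hHol k h1).kerFun_succ hW

lemma RC.piecewise {Q : (ℝ × ℝ → ℝ) → Prop} (hQ : ∀ a b, Q a → Q b → Q (fun z => if z.2 = 0 then a z else b z))
    {a b : ℝ × ℝ → ℝ} (ha : RC Rx Q k a) (hb : RC Rx Q k b) :
    RC Rx Q k (fun z => if z.2 = 0 then a z else b z) := by
  induction k generalizing a b with
  | zero => exact hQ _ _ ha hb
  | succ k ih =>
    obtain ⟨h1, a', h2, h3⟩ := ha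
    obtain ⟨k1, b', k2, k3⟩ := hb
    refine ⟨hQ _ _ h1 k1, _, fun x y hy => ?_, ih h3 k3⟩
    by_cases h : y = 0
    · simpa [h] using h2 x 0 le_rfl
    · simpa [h] using k2 x y hy

lemma Bd.piecewise {a b : ℝ × ℝ → ℝ} (hW : Wt W) (ha : Bd W a) (hb : Bd W b) :
    Bd W (fun z => if z.2 = 0 then a z else b z) := by
  obtain ⟨m, C, hC, h⟩ := ha
  obtain ⟨m', C', hC', h'⟩ := hb
  refine ⟨Measurable.ite (measurableSet_eq_fun measurable_snd measurable_const) m m', C + C', by positivity,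
    fun z hz => ?_⟩
  have w := hW.pos z
  have p1 : 0 ≤ C * W z := by positivity
  have p2 : 0 ≤ C' * W z := by positivity
  dsimp only
  split_ifs
  · linarith [h z hz]
  · linarith [h' z hz]

lemma Hol.piecewise {a b : ℝ × ℝ → ℝ} (hW : Wt W) (ha : Hol W a) (hb : Hol W b) :
    Hol W (fun z => if z.2 = 0 then a z else b z) := by
  refine ⟨ha.1.piecewise hW hb.1, ?_⟩
  obtain ⟨-, C, hC, h⟩ := ha
  obtain ⟨-, C', hC', h'⟩ := hb
  refine ⟨C + C', by positivity, fun x x' y hy => ?_⟩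
  have w := hW.pos (x, y)
  have w' := hW.pos (x', y)
  have p1 : 0 ≤ C * √|x' - x| * (W (x, y) + W (x', y)) := by positivity
  have p2 : 0 ≤ C' * √|x' - x| * (W (x, y) + W (x', y)) := by positivity
  dsimp only
  split_ifs
  · linarith [h x x' y hy]
  · linarith [h' x x' y hy]

end Kernel


/-! ### Regularity in the normal direction -/

lemma integral_nuM {F : ℝ × ℝ → ℝ} (hF : Integrable F nuM) :
    ∫ z, F z ∂nuM = ∫ x, ((∫ y in Set.Ioi (0:ℝ), F (x, y)) + F (x, 0)) := by
  rw [nuM, integral_prod _ hF]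
  refine integral_congr_ae ?_
  filter_upwards [hF.prod_right_ae] with x hx
  rw [etaM, integrable_add_measure] at hx
  rw [etaM, integral_add_measure hx.1 hx.2, integral_dirac]

lemma integrable_exp_mul_abs {a : ℝ} (ha : 0 < a) : Integrable fun x : ℝ => exp (-a * |x|) := by
  rw [← integrableOn_univ, ← Set.Iic_union_Ioi (a := (0:ℝ)), integrableOn_union]
  constructor
  · refine (integrableOn_exp_mul_Iic ha 0).congr_fun (fun x hx => ?_) measurableSet_Iic
    have hx' : x ≤ 0 := hx
    simp only [abs_of_nonpos hx']; ring_nf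
  · refine (integrableOn_exp_mul_Ioi (neg_lt_zero.mpr ha) 0).congr_fun (fun x hx => ?_) measurableSet_Ioi
    have hx' : 0 < x := hx
    simp only [abs_of_pos hx']

lemma integrable_exp_nuM {a : ℝ} (ha : 0 < a) :
    Integrable (fun z : ℝ × ℝ => exp (-a * |z.1|) * exp (-a * |z.2|)) nuM := by
  have h := integrable_exp_mul_abs ha
  refine Integrable.mul_prod (ν := etaM) (g := fun y => exp (-a * |y|)) h ?_
  rw [etaM, integrable_add_measure]
  exact ⟨h.restrict, integrable_dirac enorm_lt_top⟩

lemma memLp_exp_nuM {a : ℝ} (ha : 0 < a) :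
    MemLp (fun z : ℝ × ℝ => exp (-a * |z.1|) * exp (-a * |z.2|)) 2 nuM := by
  have hm : Measurable (fun z : ℝ × ℝ => exp (-a * |z.1|) * exp (-a * |z.2|)) := by fun_prop
  rw [memLp_two_iff_integrable_sq hm.aestronglyMeasurable]
  convert integrable_exp_nuM (show 0 < 2 * a by positivity) using 2 with z
  rw [mul_pow, ← exp_nat_mul, ← exp_nat_mul]
  congr 2 <;> push_cast <;> ring

lemma memLp_nuM_of_le {φ : ℝ × ℝ → ℝ} {a C : ℝ} (ha : 0 < a) (hφ : Measurable φ)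
    (h : ∀ z, 0 ≤ z.2 → |φ z| ≤ C * (exp (-a * |z.1|) * exp (-a * |z.2|))) : MemLp φ 2 nuM := by
  refine (memLp_exp_nuM ha).of_le_mul (c := C) hφ.aestronglyMeasurable ?_
  filter_upwards [ae_nu_nonneg] with z hz
  rw [Real.norm_eq_abs, Real.norm_eq_abs, abs_of_nonneg (by positivity : 0 ≤ exp (-a * |z.1|) * exp (-a * |z.2|))]
  exact h z hz

lemma exists_le_exp_of_hasCompactSupport {A : ℝ → ℝ} (hA : Continuous A) (hc : HasCompactSupport A) :
    ∃ C, 0 ≤ C ∧ ∀ x, |A x| ≤ C * exp (-1 * |x|) := by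
  obtain ⟨C, hC⟩ := (hc.mul_right (f' := fun x => exp |x|)).exists_bound_of_continuous
    (hA.mul (by fun_prop : Continuous fun x : ℝ => exp |x|))
  refine ⟨max C 0, le_max_right _ _, fun x => ?_⟩
  have h := (hC x).trans (le_max_left C 0)
  simp only [Pi.mul_apply, norm_mul, Real.norm_eq_abs, abs_exp] at h
  rw [neg_one_mul, exp_neg, ← div_eq_mul_inv, le_div_iff₀ (exp_pos _)]
  exact h

lemma abs_le_of_le_exp {φ : ℝ → ℝ} {a C : ℝ} (ha : 0 < a) (h : ∀ x, |φ x| ≤ C * exp (-a * |x|)) (x : ℝ) : |φ x| ≤ C :=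
  (h x).trans (mul_le_of_le_one_right (by simpa using (abs_nonneg _).trans (h 0))
    (exp_le_one_iff.mpr (by nlinarith [abs_nonneg x])))

/-- Weak formulation of the half-plane problem with tensor product test functions. -/
lemma weak_tensor {A A' A'' g g' g'' : ℝ → ℝ} {C C' : ℝ} {ψ : ℝ × ℝ → ℝ} (hA : BddC2R A A' A'' C)
    (hg : BddC2 g g' g'' C') (hψ : MemLp ψ 2 nuM)
    (hφ : MemLp (bdData (fun x => -(A x * g' 0)) fun x y => (A x - A'' x) * g y - A x * g'' y) 2 nuM) :
    ∫ z, kerFun tauM nuM k0 ψ z * bdData (fun x => -(A x * g' 0))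
      (fun x y => (A x - A'' x) * g y - A x * g'' y) z ∂nuM = ∫ z, ψ z * (A z.1 * g z.2) ∂nuM := by
  rw [schurBd_k0.integral_ker_mul hψ hφ]
  refine integral_congr_ae ?_
  filter_upwards [ae_nu_nonneg] with z hz
  have h := green_tensor hA hg z.1 hz
  have e : (fun t z z' => k0 t z' z) = k0 := by ext t z z'; exact k0_comm _ _ _
  rw [e]
  exact congrArg _ h

section Slice
variable {W F F' : ℝ × ℝ → ℝ} {B : ℝ} {g : ℝ → ℝ}

lemma BdC.slice_continuousOn (h : BdC W F) (x : ℝ) : ContinuousOn (fun y => F (x, y)) (Set.Ici 0) :=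
  h.2.comp (by fun_prop) fun _ hy => hy

lemma BdC.bound (hB : ∀ z, 0 ≤ z.2 → W z ≤ B) (h : Bd W F) : ∃ C, 0 ≤ C ∧ ∀ z, 0 ≤ z.2 → |F z| ≤ C := by
  obtain ⟨-, C, hC, b⟩ := h
  refine ⟨max (C * B) 0, le_max_right _ _, fun z hz => (b z hz).trans (le_trans ?_ (le_max_left _ _))⟩
  exact mul_le_mul_of_nonneg_left (hB z hz) hC

lemma BdC.integrable_slice (hB : ∀ z, 0 ≤ z.2 → W z ≤ B) (h : BdC W F) (hg : IntegrableOn g (Set.Ioi 0)) (x : ℝ) :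
    IntegrableOn (fun y => F (x, y) * g y) (Set.Ioi 0) := by
  obtain ⟨C, hC, b⟩ := BdC.bound hB h.1
  refine Integrable.bdd_mul (c := C) hg ?_ ?_
  · exact (h.1.1.comp (by fun_prop : Measurable fun y : ℝ => (x, y))).aestronglyMeasurable
  · filter_upwards [ae_restrict_mem measurableSet_Ioi] with y hy using b (x, y) (le_of_lt hy)

lemma BdC.continuous_slice_fst (h : BdC W F) {y : ℝ} (hy : 0 ≤ y) : Continuous fun x => F (x, y) := by
  rw [← continuousOn_univ]
  exact h.2.comp (by fun_prop) fun _ _ => hy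

lemma BdC.continuous_integral (hB : ∀ z, 0 ≤ z.2 → W z ≤ B) (h : BdC W F) (hg : IntegrableOn g (Set.Ioi 0)) :
    Continuous fun x => ∫ y in Set.Ioi (0:ℝ), F (x, y) * g y := by
  obtain ⟨C, hC, b⟩ := BdC.bound hB h.1
  refine continuous_of_dominated (bound := fun y => C * |g y|) (fun x => ?_) (fun x => ?_) ?_ ?_
  · exact (h.integrable_slice hB hg x).aestronglyMeasurable
  · filter_upwards [ae_restrict_mem measurableSet_Ioi] with y hy
    rw [norm_mul]
    exact mul_le_mul_of_nonneg_right (b (x, y) (le_of_lt hy)) (norm_nonneg _)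
  · exact hg.abs.const_mul C
  · filter_upwards [ae_restrict_mem measurableSet_Ioi] with y hy
    exact (h.continuous_slice_fst (le_of_lt hy)).mul continuous_const

lemma BdC.hasDerivAt_integral (hB : ∀ z, 0 ≤ z.2 → W z ≤ B) (h : BdC W F) (h' : BdC W F') (hd : Rx F F')
    (hg : IntegrableOn g (Set.Ioi 0)) (x : ℝ) :
    HasDerivAt (fun x => ∫ y in Set.Ioi (0:ℝ), F (x, y) * g y) (∫ y in Set.Ioi (0:ℝ), F' (x, y) * g y) x := by
  obtain ⟨C, hC, b⟩ := BdC.bound hB h'.1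
  refine (hasDerivAt_integral_of_dominated_loc_of_deriv_le (s := Set.univ) (F := fun x y => F (x, y) * g y)
    (F' := fun x y => F' (x, y) * g y) (bound := fun y => C * |g y|) Filter.univ_mem
    (.of_forall fun x => (h.integrable_slice hB hg x).aestronglyMeasurable)
    (h.integrable_slice hB hg x) (h'.integrable_slice hB hg x).aestronglyMeasurable ?_ (hg.abs.const_mul C) ?_).2
  · filter_upwards [ae_restrict_mem measurableSet_Ioi] with y hy x _
    rw [norm_mul]
    exact mul_le_mul_of_nonneg_right (b (x, y) (le_of_lt hy)) (norm_nonneg _)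
  · filter_upwards [ae_restrict_mem measurableSet_Ioi] with y hy x _
    exact (hd x y (le_of_lt hy)).mul_const _

end Slice

/-- Antiderivatives of compactly supported functions on the half-line serve as normal test functions. -/
lemma exists_antideriv {ζ : ℝ → ℝ} (hζ : Continuous ζ) {M : ℝ} (hM : 0 ≤ M) (h0 : ∀ y, M ≤ y → ζ y = 0) :
    ∃ η : ℝ → ℝ, (∀ y, HasDerivAt η (ζ y) y) ∧ (∀ y, M ≤ y → η y = 0) := by
  refine ⟨fun y => ∫ s in M..y, ζ s, fun y => hζ.hasDerivAt_integral _ _, fun y hy => ?_⟩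
  beta_reduce
  rw [intervalIntegral.integral_congr (g := fun _ => 0) ?_]
  · simp
  · intro s hs
    rw [Set.uIcc_of_le hy] at hs
    exact h0 s hs.1

lemma exists_bound_Ici {ζ : ℝ → ℝ} (hζ : Continuous ζ) {M : ℝ} (h0 : ∀ y, M ≤ y → ζ y = 0) :
    ∃ C, 0 ≤ C ∧ ∀ y, 0 ≤ y → |ζ y| ≤ C * exp (-1 * |y|) := by
  obtain ⟨C, hC⟩ := (isCompact_Icc (a := 0) (b := M)).exists_bound_of_continuousOn
    (f := fun y => ζ y * exp |y|) (by fun_prop)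
  refine ⟨max C 0, le_max_right _ _, fun y hy => ?_⟩
  rcases le_total M y with h | h
  · rw [h0 y h, abs_zero]; positivity
  · have h := (hC y ⟨hy, h⟩).trans (le_max_left C 0)
    simp only [norm_mul, Real.norm_eq_abs, abs_exp] at h
    rw [neg_one_mul, exp_neg, ← div_eq_mul_inv, le_div_iff₀ (exp_pos _)]
    exact h

lemma integrableOn_of_eq_zero {ζ : ℝ → ℝ} (hζ : Continuous ζ) {M : ℝ} (h0 : ∀ y, M ≤ y → ζ y = 0) :
    IntegrableOn ζ (Set.Ioi 0) := by
  obtain ⟨C, hC, b⟩ := exists_bound_Ici hζ h0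
  refine Integrable.mono' ((integrable_exp_mul_abs one_pos).const_mul C).integrableOn
    hζ.aestronglyMeasurable ?_
  filter_upwards [ae_restrict_mem measurableSet_Ioi] with y hy using b y (le_of_lt hy)

lemma memLp_tensor {A g : ℝ → ℝ} (hA : Continuous A) (hc : HasCompactSupport A) (hg : Continuous g) {M : ℝ}
    (h0 : ∀ y, M ≤ y → g y = 0) : MemLp (fun z : ℝ × ℝ => A z.1 * g z.2) 2 nuM := by
  obtain ⟨D, hD, d⟩ := exists_le_exp_of_hasCompactSupport hA hc
  obtain ⟨C, hC, c⟩ := exists_bound_Ici hg h0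
  refine memLp_nuM_of_le (a := 1) (C := D * C) one_pos (by fun_prop) fun z hz => ?_
  rw [abs_mul]
  exact (mul_le_mul (d z.1) (c z.2 hz) (abs_nonneg _) (by positivity)).trans (le_of_eq (by ring))

lemma exists_bddC2 {g g' g'' : ℝ → ℝ} {M : ℝ} (hg : ∀ y, HasDerivAt g (g' y) y) (hg' : ∀ y, HasDerivAt g' (g'' y) y)
    (hg'' : Continuous g'') (z0 : ∀ y, M ≤ y → g y = 0) (z1 : ∀ y, M ≤ y → g' y = 0) (z2 : ∀ y, M ≤ y → g'' y = 0) :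
    ∃ C, BddC2 g g' g'' C := by
  have b : ∀ {ζ : ℝ → ℝ}, Continuous ζ → (∀ y, M ≤ y → ζ y = 0) → ∃ C, ∀ y, 0 ≤ y → |ζ y| ≤ C := fun hζ h0 => by
    obtain ⟨C, hC, c⟩ := exists_bound_Ici hζ h0
    exact ⟨C, fun y hy => (c y hy).trans (mul_le_of_le_one_right hC (exp_le_one_iff.mpr (by linarith [abs_nonneg y])))⟩
  obtain ⟨C0, c0⟩ := b (.of_hasDerivAt hg) z0
  obtain ⟨C1, c1⟩ := b (.of_hasDerivAt hg') z1
  obtain ⟨C2, c2⟩ := b hg'' z2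
  exact ⟨max C0 (max C1 C2), fun y _ => hg y, fun y _ => hg' y, hg''.measurable, fun y hy => (c0 y hy).trans (le_max_left _ _),
    fun y hy => (c1 y hy).trans (le_max_of_le_right (le_max_left _ _)),
    fun y hy => (c2 y hy).trans (le_max_of_le_right (le_max_right _ _))⟩

lemma BddC2R.of_bounds {A A' A'' : ℝ → ℝ} {C0 C1 C2 : ℝ} (h1 : ∀ x, HasDerivAt A (A' x) x) (h2 : ∀ x, HasDerivAt A' (A'' x) x)
    (hm : Measurable A'') (c0 : ∀ x, |A x| ≤ C0) (c1 : ∀ x, |A' x| ≤ C1) (c2 : ∀ x, |A'' x| ≤ C2) :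
    BddC2R A A' A'' (max C0 (max C1 C2)) :=
  ⟨h1, h2, hm, fun x => (c0 x).trans (le_max_left _ _), fun x => (c1 x).trans (le_max_of_le_right (le_max_left _ _)),
    fun x => (c2 x).trans (le_max_of_le_right (le_max_right _ _))⟩

section Normal
variable {W U U1 U2 b i ψ : ℝ × ℝ → ℝ} {B : ℝ}

/-- The normal derivative reconstructed from boundary data `b` and second derivative `S`. -/
noncomputable def nrm (b S : ℝ × ℝ → ℝ) (z : ℝ × ℝ) : ℝ :=
  -b (z.1, 0) + ∫ s in (0:ℝ)..max z.2 0, S (z.1, max s 0)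

lemma BdC.continuous_clip (h : BdC W U) : Continuous fun z : ℝ × ℝ => U (z.1, max z.2 0) := by
  rw [← continuousOn_univ]
  exact h.2.comp (by fun_prop) fun z _ => le_max_right z.2 0

lemma BdC.continuous_clip_snd (h : BdC W U) (x : ℝ) : Continuous fun s : ℝ => U (x, max s 0) :=
  h.continuous_clip.comp (by fun_prop : Continuous fun s : ℝ => (x, s))

lemma continuous_nrm {S : ℝ × ℝ → ℝ} (hb : BdC W b) (hS : BdC W S) : Continuous (nrm b S) := by
  unfold nrm
  refine ((hb.continuous_slice_fst le_rfl).comp continuous_fst).neg.add ?_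
  refine intervalIntegral.continuous_parametric_intervalIntegral_of_continuous
    (f := fun (z : ℝ × ℝ) s => S (z.1, max s 0)) (s := fun z => max z.2 0) ?_ (by fun_prop)
  exact hS.continuous_clip.comp (by fun_prop : Continuous fun q : (ℝ × ℝ) × ℝ => (q.1.1, q.2))

lemma hasDerivAt_nrm {S : ℝ × ℝ → ℝ} (hS : BdC W S) : Ry (nrm b S) S := by
  intro x y hy
  have hc := hS.continuous_clip_snd x
  have h := (hc.hasDerivAt_integral 0 y).const_add (-b (x, 0))
  rw [max_eq_left hy.le] at h
  refine h.congr_of_eventuallyEq ?_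
  filter_upwards [lt_mem_nhds hy] with y' hy'
  simp only [nrm, max_eq_left (le_of_lt hy')]

variable (hWL : MemLp W 2 nuM) (hB : ∀ z, 0 ≤ z.2 → W z ≤ B) (hW : Wt W)
  (hψ : ψ = fun z => if z.2 = 0 then b z else i z) (hb : BdC W b) (hi : BdC W i)
  (hU : ∀ z, 0 ≤ z.2 → U z = kerFun tauM nuM k0 ψ z) (h0 : BdC W U) (h1 : BdC W U1) (h2 : BdC W U2)
  (hd1 : Rx U U1) (hd2 : Rx U1 U2)
include hWL hB hW hψ hb hi hU h0 h1 h2 hd1 hd2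

local notation "∫₊(" F "," g "," x ")" => ∫ y in Set.Ioi (0:ℝ), F (x, y) * g y

/-- The slice identity obtained from the weak formulation. -/
lemma slice_identity {g g' g'' : ℝ → ℝ} {M : ℝ} (hg : ∀ y, HasDerivAt g (g' y) y)
    (hg' : ∀ y, HasDerivAt g' (g'' y) y) (hg'' : Continuous g'') (z0 : ∀ y, M ≤ y → g y = 0)
    (z1 : ∀ y, M ≤ y → g' y = 0) (z2 : ∀ y, M ≤ y → g'' y = 0) (x : ℝ) :
    (∫ y in Set.Ioi (0:ℝ), (U (x, y) - U2 (x, y) - i (x, y)) * g y) - ∫₊(U,g'',x)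
      - U (x, 0) * g' 0 - b (x, 0) * g 0 = 0 := by
  have gc : Continuous g := .of_hasDerivAt hg
  obtain ⟨C, hBg⟩ := exists_bddC2 hg hg' hg'' z0 z1 z2
  have ig := integrableOn_of_eq_zero gc z0
  have ig'' := integrableOn_of_eq_zero hg'' z2
  have hψB : Bd W ψ := by rw [hψ]; exact hb.1.piecewise hW hi.1
  have lp : ∀ {φ : ℝ × ℝ → ℝ}, Bd W φ → MemLp φ 2 nuM := by
    rintro φ ⟨m, C, hC, bd⟩
    refine hWL.of_le_mul (c := C) m.aestronglyMeasurable ?_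
    filter_upwards [ae_nu_nonneg] with z hz
    rw [Real.norm_eq_abs, Real.norm_eq_abs, abs_of_pos (hW.pos z)]
    exact bd z hz
  -- the function to be shown to vanish
  obtain ⟨h, hh⟩ : ∃ h : ℝ → ℝ, h = fun x => ∫₊(U,g,x) - ∫₊(U2,g,x) - ∫₊(i,g,x) - ∫₊(U,g'',x)
    - U (x, 0) * g' 0 - b (x, 0) * g 0 := ⟨_, rfl⟩
  have cm := h0.continuous_integral hB ig
  have cm1 := h1.continuous_integral hB ig
  have cm2 := h2.continuous_integral hB ig
  have hcont : Continuous h := by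
    rw [hh]
    exact ((((cm.sub cm2).sub (hi.continuous_integral hB ig)).sub (h0.continuous_integral hB ig'')).sub
      ((h0.continuous_slice_fst le_rfl).mul_const _)).sub ((hb.continuous_slice_fst le_rfl).mul_const _)
  have key : ∀ A : ℝ → ℝ, ContDiff ℝ ∞ A → HasCompactSupport A → ∫ x, A x • h x = 0 := by
    intro A hA hc
    have hA1 := hA.deriv_infty
    have hA2 := hA1.deriv_infty
    obtain ⟨_, d0⟩ := hc.exists_bound_of_continuous hA.continuous
    obtain ⟨_, d1⟩ := hc.deriv.exists_bound_of_continuous hA1.continuous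
    obtain ⟨_, d2⟩ := hc.deriv.deriv.exists_bound_of_continuous hA2.continuous
    have hBA := BddC2R.of_bounds hA.hasDerivAt hA1.hasDerivAt hA2.continuous.measurable d0 d1 d2
    obtain ⟨φ, hφ⟩ : ∃ φ, φ = bdData (fun x => -(A x * g' 0))
      fun x y => (A x - deriv (deriv A) x) * g y - A x * g'' y := ⟨_, rfl⟩
    have hTL := memLp_tensor hA.continuous hc gc z0
    have hφL : MemLp φ 2 nuM := by
      have hS : MeasurableSet {z : ℝ × ℝ | z.2 = 0} := measurableSet_eq_fun measurable_snd measurable_const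
      convert ((memLp_tensor hA.continuous hc (.of_hasDerivAt hg') z1).neg.indicator hS).add
        (((hTL.sub (memLp_tensor hA2.continuous hc.deriv.deriv gc z0)).sub
          (memLp_tensor hA.continuous hc hg'' z2)).indicator hS.compl) using 1
      ext z
      by_cases h : z.2 = 0 <;> simp [hφ, bdData, h, Set.indicator, sub_mul]
    have w := weak_tensor hBA hBg (lp hψB) (hφ ▸ hφL)
    rw [← hφ] at w
    have i1 : Integrable (fun z => U z * φ z) nuM := (lp h0.1).integrable_mul hφL
    have i2 : Integrable (fun z => ψ z * (A z.1 * g z.2)) nuM := (lp hψB).integrable_mul hTL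
    have w' : ∫ z, (U z * φ z - ψ z * (A z.1 * g z.2)) ∂nuM = 0 := by
      rw [integral_sub i1 i2, ← w, sub_eq_zero]
      refine integral_congr_ae ?_
      filter_upwards [ae_nu_nonneg] with z hz
      rw [hU z hz]
    have i12 : Integrable (fun z => U z * φ z - ψ z * (A z.1 * g z.2)) nuM := i1.sub i2
    rw [integral_nuM i12] at w'
    have slice : ∀ x, (∫ y in Set.Ioi (0:ℝ), (U (x, y) * φ (x, y) - ψ (x, y) * (A x * g y)))
        + (U (x, 0) * φ (x, 0) - ψ (x, 0) * (A x * g 0))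
        = A x * h x + (A x * ∫₊(U2,g,x) - deriv (deriv A) x * ∫₊(U,g,x)) := by
      intro x
      have a1 := h0.integrable_slice hB ig x
      have a2 := hi.integrable_slice hB ig x
      have a3 := h0.integrable_slice hB ig'' x
      have e : ∫ y in Set.Ioi (0:ℝ), (U (x, y) * φ (x, y) - ψ (x, y) * (A x * g y))
          = ∫ y in Set.Ioi (0:ℝ), ((A x - deriv (deriv A) x) * (U (x, y) * g y) - A x * (U (x, y) * g'' y)
            - A x * (i (x, y) * g y)) := by
        refine setIntegral_congr_fun measurableSet_Ioi fun y hy => ?_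
        simp only [hφ, hψ, bdData, (ne_of_gt hy : y ≠ 0), if_false]
        ring
      have a13 : IntegrableOn (fun y => (A x - deriv (deriv A) x) * (U (x, y) * g y) - A x * (U (x, y) * g'' y))
        (Set.Ioi 0) := (a1.const_mul _).sub (a3.const_mul _)
      rw [e, integral_sub a13 (a2.const_mul _),
        integral_sub (a1.const_mul _) (a3.const_mul _), integral_const_mul, integral_const_mul, integral_const_mul]
      simp only [hφ, hψ, bdData, hh, if_true]
      ring
    have ci : ∀ {p q : ℝ → ℝ}, HasCompactSupport p → Continuous p → Continuous q → Integrable fun x => p x * q x :=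
      fun hs hp hq => (hp.mul hq).integrable_of_hasCompactSupport hs.mul_right
    have j2 := ci hc hA.continuous cm2
    have j3 := ci hc.deriv.deriv hA2.continuous cm
    have ibp : ∫ x, A x * ∫₊(U2,g,x) = ∫ x, deriv (deriv A) x * ∫₊(U,g,x) := by
      rw [integral_mul_deriv_eq_deriv_mul_of_integrable (fun x _ => hA.hasDerivAt x)
          (fun x _ => h1.hasDerivAt_integral hB h2 hd2 ig x) j2 (ci hc.deriv hA1.continuous cm1) (ci hc hA.continuous cm1),
        integral_mul_deriv_eq_deriv_mul_of_integrable (fun x _ => hA1.hasDerivAt x)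
          (fun x _ => h0.hasDerivAt_integral hB h1 hd1 ig x) (ci hc.deriv hA1.continuous cm1) j3
          (ci hc.deriv hA1.continuous cm), neg_neg]
    have j23 : Integrable fun x => A x * ∫₊(U2,g,x) - deriv (deriv A) x * ∫₊(U,g,x) := j2.sub j3
    simp only [slice] at w'
    rwa [integral_add (ci hc hA.continuous hcont) j23, integral_sub j2 j3, ibp, sub_self, add_zero] at w'
  have hz : h = fun _ => 0 := (Continuous.ae_eq_iff_eq volume hcont continuous_const).mp
    (ae_eq_zero_of_integral_contDiff_smul_eq_zero hcont.locallyIntegrable key)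
  have hx := congrFun hz x
  rw [hh] at hx
  have a1 := h0.integrable_slice hB ig x
  have a2 := h2.integrable_slice hB ig x
  have a12 : IntegrableOn (fun y => U (x, y) * g y - U2 (x, y) * g y) (Set.Ioi 0) := a1.sub a2
  simp only [sub_mul]
  rw [integral_sub a12 (hi.integrable_slice hB ig x), integral_sub a1 a2]
  exact hx

lemma normal_repr {S : ℝ × ℝ → ℝ} (hS : BdC W S) (hSe : S = fun z => U z - U2 z - i z)
    (x : ℝ) {y : ℝ} (hy : 0 ≤ y) : U (x, y) = U (x, 0) + ∫ s in (0:ℝ)..y, nrm b S (x, s) := by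
  have hsc := hS.continuous_clip_snd x
  have hnc : Continuous fun s : ℝ => nrm b S (x, s) := (continuous_nrm hb hS).comp (by fun_prop)
  have huc := h0.continuous_clip_snd x
  obtain ⟨T, hT⟩ : ∃ T : ℝ → ℝ, T = fun y => ∫ s in (0:ℝ)..y, nrm b S (x, s) := ⟨_, rfl⟩
  have dT : ∀ y, HasDerivAt T (nrm b S (x, y)) y := fun y => by
    rw [hT]
    exact hnc.hasDerivAt_integral 0 y
  have cT : Continuous T := .of_hasDerivAt dT
  have hT0 : T 0 = 0 := by rw [hT]; simp
  have n0 : nrm b S (x, 0) = -b (x, 0) := by simp [nrm]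
  obtain ⟨E, hE⟩ : ∃ E : ℝ → ℝ, E = fun y => U (x, max y 0) - U (x, 0) - T y := ⟨_, rfl⟩
  have cE : Continuous E := by rw [hE]; exact (huc.sub continuous_const).sub cT
  have key : ∀ ζ : ℝ → ℝ, ContDiff ℝ ∞ ζ → HasCompactSupport ζ → tsupport ζ ⊆ Set.Ioi 0 →
      ∫ y, ζ y • E y = 0 := by
    intro ζ hζ hc hsupp
    obtain ⟨M, hM⟩ := hc.isCompact.bddAbove
    obtain ⟨N, hN, zN⟩ : ∃ N, 0 ≤ N ∧ ∀ y, N ≤ y → ζ y = 0 := ⟨max M 0 + 1, by positivity, fun y hy => by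
      by_contra h
      linarith [hM (subset_tsupport _ h), le_max_left M 0]⟩
    obtain ⟨Z, dZ, zZ⟩ := exists_antideriv hζ.continuous hN zN
    have cZ : Continuous Z := .of_hasDerivAt dZ
    obtain ⟨g, dg, zg⟩ := exists_antideriv cZ hN zZ
    have cg : Continuous g := .of_hasDerivAt dg
    have id := slice_identity hWL hB hW hψ hb hi hU h0 h1 h2 hd1 hd2 dg dZ hζ.continuous zg zZ zN x
    have iζ := integrableOn_of_eq_zero hζ.continuous zN
    have eI : ∀ F : ℝ → ℝ, ∀ g : ℝ → ℝ, Continuous g → (∀ y, N ≤ y → g y = 0) →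
        ∫ y in Set.Ioi (0:ℝ), F y * g y = ∫ y in (0:ℝ)..N, F y * g y := by
      intro F g cg zg
      rw [intervalIntegral.integral_of_le hN]
      refine setIntegral_eq_of_subset_of_forall_sdiff_eq_zero measurableSet_Ioi Set.Ioc_subset_Ioi_self ?_
      intro y hy
      have : N < y := by
        by_contra h
        exact hy.2 ⟨hy.1, not_lt.mp h⟩
      rw [zg y this.le, mul_zero]
    have e1 : ∫ y in Set.Ioi (0:ℝ), (U (x, y) - U2 (x, y) - i (x, y)) * g y
        = ∫ y in (0:ℝ)..N, S (x, max y 0) * g y := by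
      rw [← eI _ g cg zg]
      refine setIntegral_congr_fun measurableSet_Ioi fun y hy => ?_
      have hy' : (0:ℝ) < y := hy
      simp only [hSe, max_eq_left hy'.le]
    have e2 : ∫ y in Set.Ioi (0:ℝ), U (x, y) * ζ y = ∫ y in (0:ℝ)..N, U (x, max y 0) * ζ y := by
      rw [← eI _ ζ hζ.continuous zN]
      refine setIntegral_congr_fun measurableSet_Ioi fun y hy => ?_
      have hy' : (0:ℝ) < y := hy
      simp only [max_eq_left hy'.le]
    have d2 : ∀ y ∈ Set.uIcc 0 N, HasDerivAt (fun y => -b (x, 0) + ∫ s in (0:ℝ)..y, S (x, max s 0))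
        (S (x, max y 0)) y := fun y _ =>
      (hsc.hasDerivAt_integral 0 y).const_add _
    have ne : ∀ y, 0 ≤ y → nrm b S (x, y) = -b (x, 0) + ∫ s in (0:ℝ)..y, S (x, max s 0) := fun y hy => by
      simp only [nrm, max_eq_left hy]
    have p1 := intervalIntegral.integral_mul_deriv_eq_deriv_mul d2 (fun y _ => dg y)
      (hsc.intervalIntegrable _ _) (cZ.intervalIntegrable _ _)
    have p2 := intervalIntegral.integral_mul_deriv_eq_deriv_mul (a := 0) (b := N) (fun y _ => dT y) (fun y _ => dZ y)
      (hnc.intervalIntegrable _ _) (hζ.continuous.intervalIntegrable _ _)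
    have p3 := intervalIntegral.integral_eq_sub_of_hasDerivAt (a := 0) (b := N) (fun y _ => dZ y)
      (hζ.continuous.intervalIntegrable _ _)
    have p4 : ∫ y in (0:ℝ)..N, (-b (x, 0) + ∫ s in (0:ℝ)..y, S (x, max s 0)) * Z y
        = ∫ y in (0:ℝ)..N, nrm b S (x, y) * Z y := by
      refine intervalIntegral.integral_congr fun y hy => ?_
      rw [Set.uIcc_of_le hN] at hy
      simp only [ne y hy.1]
    rw [p4, zg _ le_rfl] at p1
    rw [zZ _ le_rfl, hT0] at p2
    rw [zZ _ le_rfl] at p3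
    rw [e1, e2] at id
    have e3 : ∫ y, ζ y • E y = ∫ y in (0:ℝ)..N, E y * ζ y := by
      rw [← eI _ ζ hζ.continuous zN, ← integral_indicator measurableSet_Ioi]
      refine integral_congr_ae (.of_forall fun y => ?_)
      by_cases hy : y ∈ Set.Ioi (0:ℝ)
      · simp only [Set.indicator_of_mem hy, smul_eq_mul]; ring
      · rw [Set.indicator_of_notMem hy]
        have : ζ y = 0 := by
          by_contra h
          exact hy (hsupp (subset_tsupport _ h))
        simp [this]
    have e4 : ∫ y in (0:ℝ)..N, E y * ζ y = (∫ y in (0:ℝ)..N, U (x, max y 0) * ζ y)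
        - U (x, 0) * (∫ y in (0:ℝ)..N, ζ y) - ∫ y in (0:ℝ)..N, T y * ζ y := by
      rw [← intervalIntegral.integral_const_mul, ← intervalIntegral.integral_sub, ← intervalIntegral.integral_sub]
      · refine intervalIntegral.integral_congr fun y _ => ?_
        simp only [hE]; ring
      · exact ((huc.mul hζ.continuous).sub (continuous_const.mul hζ.continuous)).intervalIntegrable _ _
      · exact (cT.mul hζ.continuous).intervalIntegrable _ _
      · exact (huc.mul hζ.continuous).intervalIntegrable _ _
      · exact (continuous_const.mul hζ.continuous).intervalIntegrable _ _
    rw [e3, e4]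
    simp only [intervalIntegral.integral_same, add_zero, mul_zero] at p1 p2
    rw [p2, p3]
    linarith
  have hae := isOpen_Ioi.ae_eq_zero_of_integral_contDiff_smul_eq_zero
    (cE.locallyIntegrable.locallyIntegrableOn _) key
  have hEq : Set.EqOn E (fun _ => 0) (Set.Ioi 0) := by
    refine Measure.eqOn_open_of_ae_eq (μ := volume) ?_ isOpen_Ioi cE.continuousOn continuousOn_const
    exact (ae_restrict_iff' measurableSet_Ioi).mpr hae
  have hy0 : E y = 0 := by
    rcases hy.eq_or_lt with rfl | h
    · rw [hE]; simp [hT0]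
    · exact hEq h
  rw [hE, hT] at hy0
  simp only [max_eq_left hy] at hy0
  linarith

lemma normal_deriv {S : ℝ × ℝ → ℝ} (hS : BdC W S) (hSe : S = fun z => U z - U2 z - i z) :
    Ry U (nrm b S) ∧ BdC W (nrm b S) := by
  have hn := continuous_nrm hb hS
  have repr := fun x {y : ℝ} (hy : 0 ≤ y) =>
    normal_repr hWL hB hW hψ hb hi hU h0 h1 h2 hd1 hd2 hS hSe x hy
  refine ⟨fun x y hy => ?_, ⟨hn.measurable, ?_⟩, hn.continuousOn⟩
  · have hnc : Continuous fun s : ℝ => nrm b S (x, s) := hn.comp (by fun_prop)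
    refine ((hnc.hasDerivAt_integral 0 y).const_add (U (x, 0))).congr_of_eventuallyEq ?_
    filter_upwards [lt_mem_nhds hy] with y' hy' using repr x (le_of_lt hy')
  · obtain ⟨-, C0, hC0, c0⟩ := h0.1
    obtain ⟨-, C1, hC1, c1⟩ := hS.1
    have up : ∀ x y s : ℝ, 0 ≤ y → y ≤ s → s ≤ y + 1 → W (x, s) ≤ exp (1/16) * W (x, y) := by
      intro x y s hy h1 h2
      refine (hW.le (x, y) (x, s)).trans ?_
      simp only [sub_self, abs_zero, mul_zero, exp_zero, one_mul]
      refine mul_le_mul_of_nonneg_right (exp_le_exp.mpr ?_) (hW.pos _).le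
      have : |y - s| ≤ 1 := abs_le.mpr ⟨by linarith, by linarith⟩
      linarith
    refine ⟨C0 * exp (1/16) + C0 + C1 * exp (1/16), by positivity, fun z hz => ?_⟩
    obtain ⟨x, y⟩ := z
    simp only at hz
    have hnc : Continuous fun s : ℝ => nrm b S (x, s) := hn.comp (by fun_prop)
    have hsc := hS.continuous_clip_snd x
    have w0 := hW.pos (x, y)
    have var : ∀ s ∈ Set.uIoc y (y + 1), ‖nrm b S (x, s) - nrm b S (x, y)‖ ≤ C1 * (exp (1/16) * W (x, y)) := by
      intro s hs
      rw [Set.uIoc_of_le (by linarith)] at hs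
      have e : nrm b S (x, s) - nrm b S (x, y) = ∫ r in y..s, S (x, max r 0) := by
        simp only [nrm, max_eq_left hz, max_eq_left (hz.trans hs.1.le)]
        rw [← intervalIntegral.integral_interval_sub_left (hsc.intervalIntegrable 0 s) (hsc.intervalIntegrable 0 y)]
        ring
      rw [e]
      refine (intervalIntegral.norm_integral_le_of_norm_le_const (C := C1 * (exp (1/16) * W (x, y))) ?_).trans ?_
      · intro r hr
        rw [Set.uIoc_of_le hs.1.le] at hr
        rw [max_eq_left (hz.trans hr.1.le)]
        exact (c1 (x, r) (hz.trans hr.1.le)).trans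
          (mul_le_mul_of_nonneg_left (up x y r hz hr.1.le (hr.2.trans hs.2)) hC1)
      · refine mul_le_of_le_one_right (by positivity) ?_
        rw [abs_of_nonneg (by linarith [hs.1])]; linarith [hs.2]
    have i1 := intervalIntegral.norm_integral_le_of_norm_le_const var
    rw [intervalIntegral.integral_sub (hnc.intervalIntegrable _ _) (by simp), intervalIntegral.integral_const] at i1
    have e : ∫ s in y..(y+1), nrm b S (x, s) = U (x, y + 1) - U (x, y) := by
      rw [repr x hz, repr x (show 0 ≤ y + 1 by linarith),
        ← intervalIntegral.integral_interval_sub_left (hnc.intervalIntegrable 0 (y+1)) (hnc.intervalIntegrable 0 y)]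
      ring
    rw [e, add_sub_cancel_left, one_smul, abs_one, mul_one, Real.norm_eq_abs] at i1
    have j0 := c0 (x, y) hz
    have j1 := (c0 (x, y + 1) (show 0 ≤ y + 1 by linarith)).trans
      (mul_le_mul_of_nonneg_left (up x y (y + 1) hz (by linarith) le_rfl) hC0)
    rw [abs_le] at i1 j0 j1 ⊢
    constructor <;> linarith

end Normal


section Families
variable {W g g' g₁ p p₁ a b i U ψ S S₁ : ℝ × ℝ → ℝ} {B : ℝ} {n : ℕ}

lemma Rx.unique (h : Rx g a) (h' : Rx g b) : ∀ z, 0 ≤ z.2 → a z = b z :=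
  fun z hz => (h z.1 z.2 hz).unique (h' z.1 z.2 hz)

lemma Ry.unique (h : Ry g a) (h' : Ry g b) (ha : BdC W a) (hb : BdC W b) : ∀ z, 0 ≤ z.2 → a z = b z := by
  rintro ⟨x, y⟩ hy
  have ca := ha.continuous_clip_snd x
  have cb := hb.continuous_clip_snd x
  have e : Set.EqOn (fun s : ℝ => a (x, max s 0)) (fun s : ℝ => b (x, max s 0)) (closure (Set.Ioi 0)) := by
    refine Set.EqOn.closure (fun s hs => ?_) ca cb
    have hs' : (0:ℝ) < s := hs
    simp only [max_eq_left hs'.le]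
    exact (h x s hs').unique (h' x s hs')
  rw [closure_Ioi] at e
  have := e (show y ∈ Set.Ici (0:ℝ) from hy)
  simpa only [max_eq_left hy] using this

lemma Rx.congr (h : Rx a p) (he : ∀ z, 0 ≤ z.2 → g z = a z) : Rx g p := fun x y hy => by
  have e : (fun x => g (x, y)) = fun x => a (x, y) := funext fun x => he (x, y) hy
  rw [e]; exact h x y hy

lemma BdC.congr (h : BdC W a) (he : ∀ z, 0 ≤ z.2 → g z = a z) (hg : Measurable g) : BdC W g := by
  obtain ⟨⟨-, C, hC, hb⟩, hc⟩ := h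
  exact ⟨⟨hg, C, hC, fun z hz => by rw [he z hz]; exact hb z hz⟩, hc.congr fun z hz => he z hz⟩

lemma RC.congr_rx (h : RC Rx (BdC W) n a) (he : ∀ z, 0 ≤ z.2 → g z = a z) (hg : Measurable g) :
    RC Rx (BdC W) n g := by
  cases n with
  | zero => exact BdC.congr h he hg
  | succ n => obtain ⟨h1, a', h2, h3⟩ := h; exact ⟨h1.congr he hg, a', h2.congr he, h3⟩

/-- Functions all of whose tangential derivatives are in `BdC W`. -/
def Xinf (W g : ℝ × ℝ → ℝ) : Prop := ∀ n, RC Rx (BdC W) n g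

lemma Xinf.bdC (h : Xinf W g) : BdC W g := h 0

lemma Xinf.exists_deriv (h : Xinf W g) : ∃ g', Rx g g' ∧ Xinf W g' := by
  obtain ⟨-, g', h2, h3⟩ := h 1
  refine ⟨g', h2, fun n => ?_⟩
  obtain ⟨-, g'', k2, k3⟩ := h (n + 1)
  exact k3.congr_rx (h2.unique k2) (RC.base h3).1.1

lemma Xinf.deriv (h : Xinf W g) (hd : Rx g g') (hm : Measurable g') : Xinf W g' := by
  obtain ⟨g'', k2, k3⟩ := h.exists_deriv
  exact fun n => (k3 n).congr_rx (hd.unique k2) hm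

lemma Xinf.of_rx (h : BdC W g) (hd : Rx g g') (h' : Xinf W g') : Xinf W g := by
  intro n
  cases n with
  | zero => exact h
  | succ n => exact ⟨h, g', hd, h' n⟩

lemma alg_Xinf (hW : Wt W) (hB : ∀ z, 0 ≤ z.2 → W z ≤ B) : Alg (Xinf fun _ => 1) (Xinf W) where
  sub h n := ((alg_BdC hW hB).rc drv_Rx n).sub (h n)
  add1 h k n := ((alg_BdC hW hB).rc drv_Rx n).add1 (h n) (k n)
  addW h k n := ((alg_BdC hW hB).rc drv_Rx n).addW (h n) (k n)
  mul1 h k n := ((alg_BdC hW hB).rc drv_Rx n).mul1 (h n) (k n)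
  mulW h k n := ((alg_BdC hW hB).rc drv_Rx n).mulW (h n) (k n)
  comp hφ h n := ((alg_BdC hW hB).rc drv_Rx n).comp hφ (h n)
  dcomp hφ h k n := ((alg_BdC hW hB).rc drv_Rx n).dcomp hφ (h n) (k n)

lemma Alg.sub_W {Q1 QW : (ℝ × ℝ → ℝ) → Prop} (h : Alg Q1 QW) (ha : QW a) (hb : QW b) :
    QW (fun z => a z - b z) := by
  have := h.addW ha (h.mulW (h.const (h.sub hb) (-1)) hb)
  simpa only [neg_one_mul, ← sub_eq_add_neg] using this

lemma hasDerivAt_integral_clip (hB : ∀ z, 0 ≤ z.2 → W z ≤ B) (hS : BdC W S) (hS₁ : BdC W S₁) (hd : Rx S S₁)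
    (u v x : ℝ) : HasDerivAt (fun x => ∫ s in u..v, S (x, max s 0)) (∫ s in u..v, S₁ (x, max s 0)) x := by
  obtain ⟨C, hC, bd⟩ := BdC.bound hB hS₁.1
  refine (intervalIntegral.hasDerivAt_integral_of_dominated_loc_of_deriv_le (s := Set.univ)
    (F := fun x s => S (x, max s 0)) (F' := fun x s => S₁ (x, max s 0)) (bound := fun _ => C) Filter.univ_mem
    (.of_forall fun x => (hS.continuous_clip_snd x).aestronglyMeasurable) ((hS.continuous_clip_snd x).intervalIntegrable _ _)
    (hS₁.continuous_clip_snd x).aestronglyMeasurable ?_ (by simp) ?_).2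
  · exact Eventually.of_forall fun s _ x _ => bd (x, max s 0) (le_max_right _ _)
  · exact Eventually.of_forall fun s _ x _ => hd x (max s 0) (le_max_right _ _)

/-- Tangential and normal derivatives commute. -/
lemma Ry.commute (hB : ∀ z, 0 ≤ z.2 → W z ≤ B) (h : Ry g p) (h1 : Rx g g₁) (h2 : Rx p p₁)
    (hp : BdC W p) (hp₁ : BdC W p₁) : Ry g₁ p₁ := by
  intro x y hy
  have ftc : ∀ y', 0 < y' → ∀ x, g (x, y') = g (x, y) + ∫ s in y..y', p (x, max s 0) := by
    intro y' hy' x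
    have hpos : ∀ s ∈ Set.uIcc y y', 0 < s := fun s hs => lt_of_lt_of_le (lt_min hy hy') hs.1
    rw [intervalIntegral.integral_eq_sub_of_hasDerivAt (f := fun s => g (x, s)) (fun s hs => ?_)
      ((hp.continuous_clip_snd x).intervalIntegrable _ _)]
    · ring
    · rw [max_eq_left (hpos s hs).le]; exact h x s (hpos s hs)
  have ftc' : ∀ y', 0 < y' → g₁ (x, y') = g₁ (x, y) + ∫ s in y..y', p₁ (x, max s 0) := by
    intro y' hy'
    have e := (h1 x y hy.le).add (hasDerivAt_integral_clip hB hp hp₁ h2 y y' x)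
    refine (h1 x y' hy'.le).unique (e.congr_of_eventuallyEq (.of_forall fun x => ftc y' hy' x))
  have d := ((hp₁.continuous_clip_snd x).hasDerivAt_integral y y).const_add (g₁ (x, y))
  rw [max_eq_left hy.le] at d
  refine d.congr_of_eventuallyEq ?_
  filter_upwards [lt_mem_nhds hy] with y' hy' using ftc' y' hy'

lemma rx_nrm {b₁ : ℝ × ℝ → ℝ} (hB : ∀ z, 0 ≤ z.2 → W z ≤ B) (hS : BdC W S) (hS₁ : BdC W S₁) (hd : Rx S S₁) (hb : Rx b b₁) :
    Rx (nrm b S) (nrm b₁ S₁) := fun x y _ =>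
  (hb x 0 le_rfl).neg.add (hasDerivAt_integral_clip hB hS hS₁ hd 0 (max y 0) x)

lemma Rx.sub (h : Rx a p) (h' : Rx b p₁) : Rx (fun z => a z - b z) (fun z => p z - p₁ z) :=
  fun x y hy => (h x y hy).sub (h' x y hy)

lemma normal_Xinf (hWL : MemLp W 2 nuM) (hB : ∀ z, 0 ≤ z.2 → W z ≤ B) (hW : Wt W)
    (hb : Xinf W b) (hi : Xinf W i) (hUX : Xinf W U)
    (hU : ∀ z, 0 ≤ z.2 → U z = kerFun tauM nuM k0 (fun z => if z.2 = 0 then b z else i z) z)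
    {U₁ U₂ : ℝ × ℝ → ℝ} (hd1 : Rx U U₁) (hd2 : Rx U₁ U₂) (hX1 : Xinf W U₁) (hX2 : Xinf W U₂) :
    Ry U (nrm b fun z => U z - U₂ z - i z) ∧ Xinf W (nrm b fun z => U z - U₂ z - i z) := by
  have hA := alg_Xinf hW hB
  have hS : Xinf W fun z => U z - U₂ z - i z := hA.sub_W (hA.sub_W hUX hX2) hi
  refine ⟨(normal_deriv hWL hB hW rfl hb.bdC hi.bdC hU hUX.bdC hX1.bdC hX2.bdC hd1 hd2 hS.bdC rfl).1, fun n => ?_⟩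
  induction n generalizing b i U U₁ U₂ with
  | zero => exact (normal_deriv hWL hB hW rfl hb.bdC hi.bdC hU hUX.bdC hX1.bdC hX2.bdC hd1 hd2 hS.bdC rfl).2
  | succ n ih =>
    obtain ⟨b₁, hb1, hb1X⟩ := hb.exists_deriv
    obtain ⟨i₁, hi1, hi1X⟩ := hi.exists_deriv
    obtain ⟨U₃, hd3, hX3⟩ := hX2.exists_deriv
    have hS1 := hA.sub_W (hA.sub_W hX1 hX3) hi1X
    refine ⟨(normal_deriv hWL hB hW rfl hb.bdC hi.bdC hU hUX.bdC hX1.bdC hX2.bdC hd1 hd2 hS.bdC rfl).2,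
      nrm b₁ fun z => U₁ z - U₃ z - i₁ z, rx_nrm hB hS.bdC hS1.bdC ((hd1.sub hd3).sub hi1) hb1,
      ih hb1X hi1X hX1 ?_ hd2 hd3 hX2 hX3 hS1⟩
    have h1 : RC Rx (Bd W) 1 (fun z => if z.2 = 0 then b z else i z) :=
      RC.piecewise (fun _ _ => Bd.piecewise hW) ((hb 1).imp fun _ h => h.1) ((hi 1).imp fun _ h => h.1)
    obtain ⟨m, C, hC, bd⟩ := (hb.bdC.1.piecewise hW hi.bdC.1)
    obtain ⟨m', C', hC', bd'⟩ := (hb1X.bdC.1.piecewise hW hi1X.bdC.1)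
    have hd : Rx (kerFun tauM nuM k0 (fun z => if z.2 = 0 then b z else i z))
        (kerFun tauM nuM k0 (fun z => if z.2 = 0 then b₁ z else i₁ z)) := fun x y hy =>
      hasDerivAt_kerFun_k0_of_hasDerivAt (C := max C C') hW m m'
        (fun z hz => (bd z hz).trans (mul_le_mul_of_nonneg_right (le_max_left _ _) (hW.pos z).le))
        (fun z hz => (bd' z hz).trans (mul_le_mul_of_nonneg_right (le_max_right _ _) (hW.pos z).le))
        (hC.trans (le_max_left _ _)) (fun x y hy => by
          by_cases h : y = 0
          · simpa [h] using hb1 x 0 le_rfl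
          · simpa [h] using hi1 x y hy) hy
    exact hd1.unique (hd.congr hU)

/-- Functions with `n` normal derivatives, all in `Xinf W`. -/
lemma RC.ry_deriv (hB : ∀ z, 0 ≤ z.2 → W z ≤ B) (h : RC Ry (Xinf W) n g) (hd : Rx g g') (hX : Xinf W g') :
    RC Ry (Xinf W) n g' := by
  induction n generalizing g g' with
  | zero => exact hX
  | succ n ih =>
    obtain ⟨h1, p, h2, h3⟩ := h
    obtain ⟨p₁, hp1, hp1X⟩ := (RC.base h3).exists_deriv
    exact ⟨hX, p₁, h2.commute hB hd hp1 (RC.base h3).bdC hp1X.bdC, ih h3 hp1 hp1X⟩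

/-- Full one-sided regularity for the semilinear problem. -/
lemma full_regularity (hWL : MemLp W 2 nuM) (hB : ∀ z, 0 ≤ z.2 → W z ≤ B) (hW : Wt W) {φ : ℝ → ℝ} (hφ : ContDiff ℝ ∞ φ)
    {Θ : ℝ × ℝ → ℝ} (hΘ : ∀ n, RC Ry (Xinf fun _ => 1) n Θ) (hb : Xinf W b) (hUX : Xinf W U)
    (hU : ∀ z, 0 ≤ z.2 → U z = kerFun tauM nuM k0
      (fun z => if z.2 = 0 then b z else U z - (φ (Θ z + U z) - φ (Θ z))) z) :
    ∃ U₁ U₂ P, Rx U U₁ ∧ Rx U₁ U₂ ∧ Ry U P ∧ Ry P (fun z => φ (Θ z + U z) - φ (Θ z) - U₂ z) ∧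
      (∀ x, P (x, 0) = -b (x, 0)) ∧ (∀ n, RC Ry (Xinf W) n U) ∧ BdC W P := by
  have hA := alg_Xinf hW hB
  obtain ⟨U₁, hd1, hX1⟩ := hUX.exists_deriv
  obtain ⟨U₂, hd2, hX2⟩ := hX1.exists_deriv
  have hN : Xinf W fun z => φ (Θ z + U z) - φ (Θ z) := hA.dcomp hφ (hΘ 0) hUX
  have hi : Xinf W fun z => U z - (φ (Θ z + U z) - φ (Θ z)) := hA.sub_W hUX hN
  have hSX : Xinf W fun z => φ (Θ z + U z) - φ (Θ z) - U₂ z := hA.sub_W hN hX2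
  obtain ⟨hy, hPX⟩ := normal_Xinf hWL hB hW hb hi hUX hU hd1 hd2 hX1 hX2
  have e : (fun z => U z - U₂ z - (U z - (φ (Θ z + U z) - φ (Θ z)))) = fun z => φ (Θ z + U z) - φ (Θ z) - U₂ z := by
    ext z; ring
  rw [e] at hy hPX
  have hyy := hasDerivAt_nrm (b := b) hSX.bdC
  have ind : ∀ n, RC Ry (Xinf W) n U ∧ RC Ry (Xinf W) n (nrm b fun z => φ (Θ z + U z) - φ (Θ z) - U₂ z) := by
    intro n
    induction n with
    | zero => exact ⟨hUX, hPX⟩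
    | succ n ih =>
      have hAn := hA.rc drv_Ry n
      refine ⟨⟨hUX, _, hy, ih.2⟩, hPX, _, hyy, ?_⟩
      exact hAn.sub_W (hAn.dcomp hφ (hΘ n) ih.1) ((ih.1.ry_deriv hB hd1 hX1).ry_deriv hB hd2 hX2)
  exact ⟨U₁, U₂, _, hd1, hd2, hy, hyy, fun x => by simp [nrm], fun n => (ind n).1, hPX.bdC⟩

/-- The family of all mixed one-sided derivatives. -/
lemma exists_family (hB : ∀ z, 0 ≤ z.2 → W z ≤ B) (h : ∀ n, RC Ry (Xinf W) n U) :
    ∃ G : ℕ → ℕ → ℝ × ℝ → ℝ, G 0 0 = U ∧ (∀ k l, BdC W (G k l)) ∧ (∀ k l, Rx (G k l) (G (k + 1) l)) ∧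
      ∀ k l, Ry (G k l) (G k (l + 1)) := by
  have congr : ∀ {n a g}, RC Ry (Xinf W) n a → (∀ z, 0 ≤ z.2 → g z = a z) → Measurable g → RC Ry (Xinf W) n g := by
    intro n a g h he hg
    have hX : Xinf W a → Xinf W g := fun h n => (h n).congr_rx he hg
    cases n with
    | zero => exact hX h
    | succ n =>
      obtain ⟨h1, a', h2, h3⟩ := h
      refine ⟨hX h1, a', fun x y hy => (h2 x y hy).congr_of_eventuallyEq ?_, h3⟩
      filter_upwards [lt_mem_nhds hy] with y' hy' using he (x, y') (le_of_lt hy')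
  have step : ∀ g, (∀ n, RC Ry (Xinf W) n g) → ∃ g', Ry g g' ∧ ∀ n, RC Ry (Xinf W) n g' := by
    intro g h
    obtain ⟨-, g', h2, h3⟩ := h 1
    refine ⟨g', h2, fun n => ?_⟩
    obtain ⟨-, g'', k2, k3⟩ := h (n + 1)
    exact congr k3 (h2.unique k2 (RC.base h3).bdC (RC.base k3).bdC) (RC.base h3).bdC.1.1
  choose! N hN1 hN2 using step
  have xstep : ∀ g, Xinf W g → ∃ g', Rx g g' ∧ Xinf W g' := fun g h => h.exists_deriv
  choose! D hD1 hD2 using xstep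
  have hcol : ∀ l, ∀ n, RC Ry (Xinf W) n (N^[l] U) := by
    intro l
    induction l with
    | zero => exact h
    | succ l ih => rw [Function.iterate_succ_apply']; exact hN2 _ ih
  have hX : ∀ k l, Xinf W (D^[k] (N^[l] U)) := by
    intro k l
    induction k with
    | zero => exact hcol l 0
    | succ k ih => rw [Function.iterate_succ_apply']; exact hD2 _ ih
  have hRx : ∀ k l, Rx (D^[k] (N^[l] U)) (D^[k+1] (N^[l] U)) := fun k l => by
    rw [Function.iterate_succ_apply']; exact hD1 _ (hX k l)
  refine ⟨fun k l => D^[k] (N^[l] U), rfl, fun k l => (hX k l).bdC, hRx, fun k l => ?_⟩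
  induction k with
  | zero =>
    simp only [Function.iterate_zero, id]
    rw [Function.iterate_succ_apply']; exact hN1 _ (hcol l)
  | succ k ih => exact ih.commute hB (hRx k l) (hRx k (l + 1)) (hX k (l+1)).bdC (hX (k+1) (l+1)).bdC

end Families


/-! ### The potential near a well and the optimal profile -/

lemma exists_bounds_near_well {f : ℝ → ℝ} (hf : ContDiff ℝ ∞ f) (h1 : deriv f 1 = 0) (h2 : 0 < deriv (deriv f) 1)
    (hgt : ∀ r ∈ Set.Ioo (-1 : ℝ) 1, f 1 < f r) :
    ∃ C > 0, ∀ r ∈ Set.Icc (0 : ℝ) 1, (1 - r) ^ 2 ≤ C * (f r - f 1) ∧ f r - f 1 ≤ C * (1 - r) ^ 2 ∧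
      |deriv f r| ≤ C * (1 - r) := by
  have hf1 := hf.deriv_infty
  have hf2 := hf1.deriv_infty
  have d0 : ∀ r, HasDerivAt f (deriv f r) r := hf.hasDerivAt
  have d1 : ∀ r, HasDerivAt (deriv f) (deriv (deriv f) r) r :=
    hf1.hasDerivAt
  have key : ∀ (k a : ℝ), a ≤ 1 → (∀ r ∈ Set.Icc a 1, k ≤ deriv (deriv f) r) →
      ∀ r ∈ Set.Icc a 1, deriv f r ≤ -k * (1 - r) ∧ k / 2 * (1 - r) ^ 2 ≤ f r - f 1 := by
    intro k a ha hk
    have m1 : MonotoneOn (fun r => deriv f r - k * r) (Set.Icc a 1) := by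
      apply monotoneOn_of_hasDerivWithinAt_nonneg (convex_Icc a 1) (f' := fun r => deriv (deriv f) r - k)
      · exact (hf1.continuous.sub (by fun_prop)).continuousOn
      · intro x _
        exact ((d1 x).sub ((hasDerivAt_id x).const_mul k)).hasDerivWithinAt.congr_deriv (by simp)
      · intro x hx; linarith [hk x (interior_subset hx)]
    have e1 : ∀ r ∈ Set.Icc a 1, deriv f r ≤ -k * (1 - r) := fun r hr => by
      have := m1 hr ⟨ha, le_rfl⟩ hr.2; simp only [h1] at this; linarith
    have m2 : AntitoneOn (fun r => f r - k / 2 * (1 - r) ^ 2) (Set.Icc a 1) := by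
      apply antitoneOn_of_hasDerivWithinAt_nonpos (convex_Icc a 1) (f' := fun r => deriv f r + k * (1 - r))
      · exact (hf.continuous.sub (by fun_prop)).continuousOn
      · intro x _
        exact ((d0 x).sub ((((hasDerivAt_id x).const_sub 1).pow 2).const_mul (k / 2))).hasDerivWithinAt.congr_deriv
          (by simp; ring)
      · intro x hx; linarith [e1 x (interior_subset hx)]
    refine fun r hr => ⟨e1 r hr, ?_⟩
    have := m2 hr ⟨ha, le_rfl⟩ hr.2; simp at this; linarith
  obtain ⟨δ, hδ, hδ'⟩ : ∃ δ > 0, ∀ r, |r - 1| < δ → deriv (deriv f) 1 / 2 < deriv (deriv f) r := by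
    have := (hf2.continuous.tendsto 1).eventually (lt_mem_nhds (by linarith : deriv (deriv f) 1 / 2 < deriv (deriv f) 1))
    obtain ⟨δ, h, h'⟩ := Metric.eventually_nhds_iff.mp this
    exact ⟨δ, h, fun r hr => h' (by rwa [Real.dist_eq])⟩
  set k := deriv (deriv f) 1 / 2 with hk
  set a := max 0 (1 - δ / 2) with ha
  have ha1 : a < 1 := by simp [ha, hδ]
  have low := key k a ha1.le (fun r hr => (hδ' r (by
    have := (le_max_right _ _).trans hr.1
    rw [abs_lt]; constructor <;> linarith [hr.2])).le)
  obtain ⟨M, hM⟩ := (isCompact_Icc (a := (0:ℝ)) (b := 1)).exists_bound_of_continuousOn hf2.continuous.continuousOn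
  simp only [Real.norm_eq_abs] at hM
  obtain ⟨m, hm, hm'⟩ : ∃ m > 0, ∀ r ∈ Set.Icc 0 a, m ≤ f r - f 1 := by
    obtain ⟨x, hx, hx'⟩ := (isCompact_Icc (a := (0:ℝ)) (b := a)).exists_isMinOn ⟨0, le_rfl, le_max_left _ _⟩
      hf.continuous.continuousOn
    exact ⟨f x - f 1, sub_pos.mpr (hgt x ⟨by linarith [hx.1], by linarith [hx.2]⟩),
      fun r hr => sub_le_sub_right (hx' hr) _⟩
  have hk0 : 0 < k := by positivity
  have hM0 : 0 ≤ M := (abs_nonneg _).trans (hM 1 ⟨by norm_num, le_rfl⟩)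
  have m1 : ∀ r ∈ Set.Icc (0:ℝ) 1, |deriv f r| ≤ M * (1 - r) := by
    intro r hr
    have := (convex_Icc (0:ℝ) 1).norm_image_sub_le_of_norm_hasDerivWithin_le (f := deriv f)
      (fun x _ => (d1 x).hasDerivWithinAt) hM ⟨zero_le_one, le_rfl⟩ hr
    rwa [h1, sub_zero, Real.norm_eq_abs, Real.norm_eq_abs, abs_sub_comm r, abs_of_nonneg (by linarith [hr.2] : (0:ℝ) ≤ 1 - r)] at this
  have m2 : ∀ r ∈ Set.Icc (0:ℝ) 1, f r - f 1 ≤ M * (1 - r) ^ 2 := by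
    intro r hr
    have := (convex_Icc r 1).norm_image_sub_le_of_norm_hasDerivWithin_le (f := f) (C := M * (1 - r))
      (fun x _ => (d0 x).hasDerivWithinAt) (fun x hx => (m1 x ⟨hr.1.trans hx.1, hx.2⟩).trans
        (mul_le_mul_of_nonneg_left (by linarith [hx.1]) hM0)) ⟨hr.2, le_rfl⟩ ⟨le_rfl, hr.2⟩
    rw [Real.norm_eq_abs, Real.norm_eq_abs, abs_sub_comm r, abs_of_nonneg (by linarith [hr.2] : (0:ℝ) ≤ 1 - r)] at this
    linarith [le_abs_self (f r - f 1)]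
  refine ⟨2 / k + 1 / m + M, by positivity, fun r hr => ⟨?_, (m2 r hr).trans ?_, (m1 r hr).trans ?_⟩⟩
  · rcases le_total r a with h | h
    · have := hm' r ⟨hr.1, h⟩
      calc (1 - r) ^ 2 ≤ 1 := by nlinarith [hr.1, hr.2]
        _ = 1 / m * m := by field_simp
        _ ≤ 1 / m * (f r - f 1) := by gcongr
        _ ≤ _ := mul_le_mul_of_nonneg_right (by have : 0 ≤ 2 / k := by positivity
                                                linarith) (by linarith)
    · have := (low r ⟨h, hr.2⟩).2
      have h0 : 0 ≤ f r - f 1 := le_trans (by positivity) this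
      calc (1 - r) ^ 2 = 2 / k * (k / 2 * (1 - r) ^ 2) := by field_simp
        _ ≤ 2 / k * (f r - f 1) := by gcongr
        _ ≤ _ := mul_le_mul_of_nonneg_right (by have : 0 ≤ 1 / m := by positivity
                                                linarith) h0
  · exact mul_le_mul_of_nonneg_right (by have : 0 ≤ 1 / m + 2 / k := by positivity
                                         linarith) (sq_nonneg _)
  · exact mul_le_mul_of_nonneg_right (by have : 0 ≤ 1 / m + 2 / k := by positivity
                                         linarith) (by linarith [hr.2])

/-- Comparison of a function `p` with `E`, where `-p` is the derivative of `E`, on the positive half-line. -/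
structure Tail (E p : ℝ → ℝ) (C : ℝ) : Prop where
  C_pos : 0 < C
  deriv : ∀ x, HasDerivAt E (-p x) x
  pos : ∀ x, 0 < p x
  cont : Continuous p
  le : ∀ x, 0 ≤ x → p x ≤ C * E x
  ge : ∀ x, 0 ≤ x → E x ≤ C * p x

lemma Tail.exp_decay {E p : ℝ → ℝ} {C : ℝ} (h : Tail E p C) {x : ℝ} (hx : 0 ≤ x) :
    E x ≤ E 0 * exp (-(1 / C) * x) := by
  have : AntitoneOn (fun x => E x * exp (1 / C * x)) (Set.Ici 0) := by
    apply antitoneOn_of_hasDerivWithinAt_nonpos (convex_Ici 0)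
      (f' := fun x => -p x * exp (1 / C * x) + E x * (exp (1 / C * x) * (1 / C)))
    · exact fun x _ => ((h.deriv x).continuousAt.mul (by fun_prop)).continuousWithinAt
    · intro x _
      exact ((h.deriv x).mul (((hasDerivAt_id x).const_mul (1 / C)).exp.congr_deriv (by simp))).hasDerivWithinAt
    · intro x hx
      have h1 := h.ge x (interior_subset hx)
      have : E x * (1 / C) ≤ p x := by rw [mul_one_div, div_le_iff₀ h.C_pos]; linarith
      nlinarith [exp_pos (1 / C * x)]
  have := this Set.self_mem_Ici hx hx
  simp only [mul_zero, exp_zero, mul_one] at this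
  rw [neg_mul, exp_neg, ← div_eq_mul_inv, le_div_iff₀ (exp_pos _)]; exact this

/-- Weighted one-sided Hardy-type inequality. -/
lemma Tail.hardy {E p g g' : ℝ → ℝ} {C : ℝ} (h : Tail E p C) (hg : ∀ x, HasDerivAt g (g' x) x) (hg' : Continuous g')
    (h0 : g 0 = 0) {N : ℝ} (hN : 0 ≤ N) :
    ∫ x in 0..N, (p x * g x) ^ 2 ≤ C ^ 6 * ∫ x in 0..N, (p x * g' x) ^ 2 := by
  have hgc : Continuous g := .of_hasDerivAt hg
  have hEc : Continuous E := continuous_iff_continuousAt.mpr fun x => (h.deriv x).continuousAt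
  have hp := h.cont
  have ii : ∀ {φ : ℝ → ℝ}, Continuous φ → IntervalIntegrable φ volume 0 N := fun h => h.intervalIntegrable _ _
  have e1 : ∫ x in 0..N, (2 * E x * -p x * g x ^ 2 + E x ^ 2 * (2 * g x * g' x)) = E N ^ 2 * g N ^ 2 := by
    rw [intervalIntegral.integral_eq_sub_of_hasDerivAt (f := fun x => E x ^ 2 * g x ^ 2), h0]
    · ring
    · intro x _
      exact (((h.deriv x).pow 2).mul ((hg x).pow 2)).congr_deriv (by simp; try ring)
    · exact ii (by fun_prop)
  have hE : ∀ x, 0 ≤ x → 0 ≤ E x ∧ 0 ≤ C := by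
    intro x hx
    have h1 := h.le x hx; have h2 := h.ge x hx; have h3 := h.pos x
    exact ⟨(pos_of_mul_pos_right (h3.trans_le h1) h.C_pos.le).le, h.C_pos.le⟩
  have key : ∫ x in 0..N, (p x * g x) ^ 2 ≤ ∫ x in 0..N,
      (C * (2⁻¹ * -(2 * E x * -p x * g x ^ 2 + E x ^ 2 * (2 * g x * g' x))) + (2⁻¹ * (p x * g x) ^ 2 + C ^ 6 / 2 * (p x * g' x) ^ 2)) := by
    apply intervalIntegral.integral_mono_on hN (ii (by fun_prop)) (ii (by fun_prop))
    intro x hx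
    obtain ⟨h1, h2⟩ := hE x hx.1
    have h3 := h.le x hx.1; have h4 := h.ge x hx.1; have h5 := h.pos x
    have a1 : (p x * g x) ^ 2 ≤ C * (E x * p x * g x ^ 2) := by
      have := mul_le_mul_of_nonneg_right h3 (mul_nonneg h5.le (sq_nonneg (g x)))
      nlinarith
    have a2 : E x ^ 2 ≤ C ^ 2 * p x ^ 2 := by rw [← mul_pow]; gcongr
    have a3 : C * (E x ^ 2 * (g x * g' x)) ≤ 2⁻¹ * (p x * g x) ^ 2 + C ^ 6 / 2 * (p x * g' x) ^ 2 := by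
      have b1 : E x ^ 2 * (g x * g' x) ≤ C ^ 2 * p x ^ 2 * |g x * g' x| :=
        (mul_le_mul_of_nonneg_left (le_abs_self _) (sq_nonneg _)).trans (mul_le_mul_of_nonneg_right a2 (abs_nonneg _))
      have b2 := mul_le_mul_of_nonneg_left b1 h2
      have b3 := sq_nonneg (p x * |g x| - C ^ 3 * (p x * |g' x|))
      rw [abs_mul] at b2
      have b4 := sq_abs (g x); have b5 := sq_abs (g' x)
      have : 2⁻¹ * (p x * g x) ^ 2 + C ^ 6 / 2 * (p x * g' x) ^ 2 = 2⁻¹ * (p x * |g x|) ^ 2 + C ^ 6 / 2 * (p x * |g' x|) ^ 2 := by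
        rw [mul_pow, mul_pow, mul_pow, mul_pow, b4, b5]
      rw [this]; nlinarith
    nlinarith
  rw [intervalIntegral.integral_add (ii (by fun_prop)) (ii (by fun_prop)), intervalIntegral.integral_const_mul,
    intervalIntegral.integral_const_mul, intervalIntegral.integral_neg, e1,
    intervalIntegral.integral_add (ii (by fun_prop)) (ii (by fun_prop)), intervalIntegral.integral_const_mul,
    intervalIntegral.integral_const_mul] at key
  have := mul_nonneg (hE N hN).2 (mul_nonneg (sq_nonneg (E N)) (sq_nonneg (g N)))
  nlinarith


/-- `f` is a double-well potential with optimal profile `θ`. -/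
structure Prof (f θ : ℝ → ℝ) : Prop where
  hf : ContDiff ℝ ∞ f
  dm : deriv f (-1) = 0
  dp : deriv f 1 = 0
  ddm : 0 < deriv (deriv f) (-1)
  ddp : 0 < deriv (deriv f) 1
  eq : f (-1) = f 1
  gt : ∀ r ∈ Set.Ioo (-1 : ℝ) 1, f 1 < f r
  hθ : ContDiff ℝ ∞ θ
  ode : ∀ z, -deriv (deriv θ) z + deriv f (θ z) = 0
  zero : θ 0 = 0
  top : Tendsto θ atTop (nhds 1)
  bot : Tendsto θ atBot (nhds (-1))
  sqrt : ∀ z, deriv θ z = √(2 * (f (θ z) - f (-1)))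
  pos : ∀ z, 0 < deriv θ z

lemma abs_le_exp_mul {φ ψ : ℝ → ℝ} {a B C : ℝ} (hB : ∀ x, |φ x| ≤ B) (hC : ∀ x, |ψ x| ≤ C * exp (-a * |x|)) (x : ℝ) :
    |φ x * ψ x| ≤ B * C * exp (-a * |x|) := by
  rw [abs_mul, mul_assoc]
  exact mul_le_mul (hB x) (hC x) (abs_nonneg _) ((abs_nonneg _).trans (hB x))

lemma integrable_of_le_exp {φ : ℝ → ℝ} {a C : ℝ} (ha : 0 < a) (hφ : Continuous φ) (hC : ∀ x, |φ x| ≤ C * exp (-a * |x|)) :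
    Integrable φ :=
  ((integrable_exp_mul_abs ha).const_mul C).mono' hφ.aestronglyMeasurable (.of_forall hC)

namespace Prof
variable {f θ : ℝ → ℝ} (h : Prof f θ)
include h

lemma hasDerivAt (x : ℝ) : HasDerivAt θ (deriv θ x) x := h.hθ.hasDerivAt x

lemma hasDerivAt' (x : ℝ) : HasDerivAt (deriv θ) (deriv f (θ x)) x := by
  have := h.hθ.deriv_infty.hasDerivAt x
  rwa [show deriv (deriv θ) x = deriv f (θ x) by linarith [h.ode x]] at this

lemma mono : StrictMono θ := strictMono_of_deriv_pos h.pos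

lemma lt_one (x : ℝ) : θ x < 1 :=
  (h.mono (lt_add_one x)).trans_le (h.mono.monotone.ge_of_tendsto h.top _)

lemma neg_one_lt (x : ℝ) : -1 < θ x :=
  (h.mono.monotone.le_of_tendsto h.bot _).trans_lt (h.mono (sub_one_lt x))

lemma sq_deriv (x : ℝ) : deriv θ x ^ 2 = 2 * (f (θ x) - f 1) := by
  rw [h.sqrt, Real.sq_sqrt, h.eq]
  rw [h.eq]; linarith [h.gt (θ x) ⟨h.neg_one_lt x, h.lt_one x⟩]

lemma exists_tails : ∃ C, Tail (fun x => 1 - θ x) (deriv θ) C ∧ Tail (fun x => 1 + θ (-x)) (fun x => deriv θ (-x)) C ∧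
    ∀ x, |deriv f (θ x)| ≤ C * deriv θ x := by
  obtain ⟨C₁, hC₁, h₁⟩ := exists_bounds_near_well h.hf h.dp h.ddp h.gt
  have dneg : ∀ {g : ℝ → ℝ}, deriv (fun r => g (-r)) = fun r => -deriv g (-r) := by
    intro g; ext r; exact deriv_comp_neg ..
  have dneg2 : deriv (deriv fun r => f (-r)) = fun r => deriv (deriv f) (-r) := by
    rw [dneg]; ext r
    rw [deriv.fun_neg, congrFun (dneg (g := deriv f)) r, neg_neg]
  obtain ⟨C₂, hC₂, h₂⟩ := exists_bounds_near_well (f := fun r => f (-r)) (h.hf.comp contDiff_neg) (by simp [dneg, h.dm])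
    (by rw [dneg2]; exact h.ddm)
    (fun r hr => by have := h.gt (-r) ⟨by linarith [hr.2], by linarith [hr.1]⟩; rwa [h.eq])
  have hcont := h.hθ.deriv_infty.continuous
  have gen : ∀ {C₀ E p d F : ℝ}, 2 * C₀ + 1 ≤ 2 * C₁ + 2 * C₂ + 1 → 0 < C₀ → 0 < p → 0 ≤ E → p ^ 2 = 2 * F →
      E ^ 2 ≤ C₀ * F → F ≤ C₀ * E ^ 2 → |d| ≤ C₀ * E → p ≤ (2 * C₁ + 2 * C₂ + 1) ^ 2 * E ∧
      E ≤ (2 * C₁ + 2 * C₂ + 1) ^ 2 * p ∧ |d| ≤ (2 * C₁ + 2 * C₂ + 1) ^ 2 * p := by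
    intro C₀ E p d F hC h0 hp hE h1 h2 h3 h4
    set C := 2 * C₁ + 2 * C₂ + 1
    have hCC : C ≤ C ^ 2 := by nlinarith
    have e1 : E ≤ C * p := by
      apply le_of_sq_le_sq _ (by nlinarith); nlinarith [sq_nonneg p]
    have e2 : p ≤ C * E := by apply le_of_sq_le_sq _ (by nlinarith); nlinarith [sq_nonneg E]
    exact ⟨e2.trans (by gcongr), e1.trans (by gcongr), h4.trans (by nlinarith)⟩
  have gp : ∀ x : ℝ, 0 ≤ x → _ := fun x hx => by
    have hx0 : 0 ≤ θ x := h.zero ▸ h.mono.monotone hx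
    obtain ⟨b1, b2, b3⟩ := h₁ (θ x) ⟨hx0, (h.lt_one x).le⟩
    exact gen (by linarith) hC₁ (h.pos x) (by linarith [h.lt_one x]) (h.sq_deriv x) b1 b2 b3
  have gm : ∀ x : ℝ, x ≤ 0 → _ := fun x hx => by
    have hx0 : θ x ≤ 0 := h.zero ▸ h.mono.monotone hx
    obtain ⟨b1, b2, b3⟩ := h₂ (-θ x) ⟨by linarith, by linarith [h.neg_one_lt x]⟩
    simp only [dneg, neg_neg, sub_neg_eq_add, abs_neg, h.eq] at b1 b2 b3
    exact gen (by linarith) hC₂ (h.pos x) (by linarith [h.neg_one_lt x]) (h.sq_deriv x) b1 b2 b3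
  refine ⟨(2 * C₁ + 2 * C₂ + 1) ^ 2, ⟨by positivity, fun x => (h.hasDerivAt x).const_sub 1, h.pos, hcont,
    fun x hx => (gp x hx).1, fun x hx => (gp x hx).2.1⟩, ⟨by positivity, fun x => ?_, fun x => h.pos _,
    hcont.comp continuous_neg, fun x hx => (gm (-x) (by linarith)).1, fun x hx => (gm (-x) (by linarith)).2.1⟩, fun x => ?_⟩
  · exact (((h.hasDerivAt (-x)).comp x (hasDerivAt_neg x)).const_add 1).congr_deriv (by ring)
  · rcases le_total 0 x with hx | hx
    exacts [(gp x hx).2.2, (gm x hx).2.2]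

/-- Exponential convergence of the profile. -/
lemma exists_decay : ∃ κ > 0, ∃ C, (∀ x, |deriv θ x| ≤ C * exp (-κ * |x|)) ∧
    ∀ φ : ℝ → ℝ, ContDiff ℝ ∞ φ → φ 1 = 0 → φ (-1) = 0 → ∃ C', ∀ x, |φ (θ x)| ≤ C' * exp (-κ * |x|) := by
  obtain ⟨C, t₁, t₂, -⟩ := h.exists_tails
  have hC := t₁.C_pos
  have k1 : ∀ x, 0 ≤ x → 1 - θ x ≤ exp (-(1 / C) * |x|) := fun x hx => by
    simpa [h.zero, abs_of_nonneg hx] using t₁.exp_decay hx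
  have k2 : ∀ x, x ≤ 0 → 1 + θ x ≤ exp (-(1 / C) * |x|) := fun x hx => by
    simpa [h.zero, abs_of_nonpos hx] using t₂.exp_decay (neg_nonneg.mpr hx)
  refine ⟨1 / C, by positivity, C, fun x => ?_, fun φ hφ h1 h2 => ?_⟩
  · rw [abs_of_pos (h.pos x)]
    rcases le_total 0 x with hx | hx
    · exact (t₁.le x hx).trans (by gcongr; exact k1 x hx)
    · have := t₂.le (-x) (neg_nonneg.mpr hx)
      simp only [neg_neg] at this
      exact this.trans (by gcongr; exact k2 x hx)
  · obtain ⟨M, hM⟩ := (isCompact_Icc (a := (-1:ℝ)) (b := 1)).exists_bound_of_continuousOn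
      hφ.deriv_infty.continuous.continuousOn
    have lip : ∀ r ∈ Set.Icc (-1:ℝ) 1, ∀ s ∈ Set.Icc (-1:ℝ) 1, |φ s - φ r| ≤ M * |s - r| := fun r hr s hs =>
      (convex_Icc (-1:ℝ) 1).norm_image_sub_le_of_norm_hasDerivWithin_le (f := φ)
        (fun x _ => (hφ.hasDerivAt x).hasDerivWithinAt) hM hr hs
    have hM0 : 0 ≤ M := (norm_nonneg _).trans (hM 1 ⟨by norm_num, le_rfl⟩)
    have hx' : ∀ x, θ x ∈ Set.Icc (-1:ℝ) 1 := fun x => ⟨(h.neg_one_lt x).le, (h.lt_one x).le⟩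
    refine ⟨M, fun x => ?_⟩
    rcases le_total 0 x with hx | hx
    · have := lip 1 ⟨by norm_num, le_rfl⟩ _ (hx' x)
      rw [h1, sub_zero, abs_sub_comm (θ x), abs_of_pos (by linarith [h.lt_one x] : 0 < 1 - θ x)] at this
      exact this.trans (by gcongr; exact k1 x hx)
    · have := lip (-1) ⟨le_rfl, by norm_num⟩ _ (hx' x)
      rw [h2, sub_zero, sub_neg_eq_add, abs_of_pos (by linarith [h.neg_one_lt x] : 0 < θ x + 1), add_comm] at this
      exact this.trans (by gcongr; exact k2 x hx)

lemma continuous_deriv : Continuous (deriv θ) := h.hθ.deriv_infty.continuous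

lemma exists_abs_deriv_le : ∃ C, ∀ x, |deriv θ x| ≤ C := by
  obtain ⟨κ, hκ, C, hp, -⟩ := h.exists_decay
  exact ⟨C, abs_le_of_le_exp hκ hp⟩

lemma integrable_sq_deriv : Integrable fun x => deriv θ x * deriv θ x := by
  obtain ⟨κ, hκ, C, hp, -⟩ := h.exists_decay
  obtain ⟨B, hB⟩ := h.exists_abs_deriv_le
  have := h.continuous_deriv
  exact integrable_of_le_exp hκ (by fun_prop) (abs_le_exp_mul hB hp)

lemma integral_sq_deriv_pos : 0 < ∫ x, deriv θ x * deriv θ x := by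
  rw [integral_pos_iff_support_of_nonneg (fun x => mul_self_nonneg _) h.integrable_sq_deriv,
    Function.support_eq_univ (fun x => (mul_pos (h.pos x) (h.pos x)).ne')]
  simp

lemma exists_bound_well : ∃ M, ∀ x, |deriv (deriv f) (θ x)| ≤ M := by
  obtain ⟨M, hM⟩ := (isCompact_Icc (a := (-1:ℝ)) (b := 1)).exists_bound_of_continuousOn
    h.hf.deriv_infty.deriv_infty.continuous.continuousOn
  exact ⟨M, fun x => hM _ ⟨(h.neg_one_lt x).le, (h.lt_one x).le⟩⟩

lemma continuous_well : Continuous fun x => deriv (deriv f) (θ x) :=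
  h.hf.deriv_infty.deriv_infty.continuous.comp h.hθ.continuous

/-- Spectral gap of the linearized operator modulo `θ'`. -/
lemma gap : ∃ μ > 0, ∀ (w w' : ℝ → ℝ) (a B : ℝ), 0 < a → (∀ x, HasDerivAt w (w' x) x) → Continuous w' →
    (∀ x, |w x| ≤ B * exp (-a * |x|)) → (∀ x, |w' x| ≤ B * exp (-a * |x|)) →
    μ * ∫ x, w x ^ 2 ≤ (∫ x, (w' x ^ 2 + deriv (deriv f) (θ x) * w x ^ 2)) + (∫ x, deriv θ x * w x) ^ 2 := by
  obtain ⟨C, t₁, t₂, hq⟩ := h.exists_tails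
  obtain ⟨Cp, hp⟩ := h.exists_abs_deriv_le
  have hpc := h.continuous_deriv
  have hVc := h.continuous_well
  obtain ⟨M, hV⟩ := h.exists_bound_well
  have hpi : Integrable fun x => deriv θ x ^ 2 := by simpa only [sq] using h.integrable_sq_deriv
  have hpn : 0 < ∫ x, deriv θ x ^ 2 := by simpa only [sq] using h.integral_sq_deriv_pos
  set P := ∫ x, deriv θ x ^ 2 with hP
  set q : ℝ → ℝ := fun x => deriv f (θ x) / deriv θ x with hqdef
  have hqc : Continuous q := (h.hf.deriv_infty.continuous.comp h.hθ.continuous).div hpc fun x => (h.pos x).ne'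
  have hqb : ∀ x, |q x| ≤ C := fun x => by
    rw [hqdef, abs_div, abs_of_pos (h.pos x), div_le_iff₀ (h.pos x)]; exact hq x
  have hqd : ∀ x, HasDerivAt q (deriv (deriv f) (θ x) - q x ^ 2) x := fun x => by
    have e := ((h.hf.deriv_infty.hasDerivAt (θ x)).comp x (h.hasDerivAt x)).div
      (h.hasDerivAt' x) (h.pos x).ne'
    refine e.congr_deriv ?_
    have := (h.pos x).ne'
    simp only [hqdef, Function.comp]; field_simp
  have hden : 0 < 6 * C ^ 6 + 4 / P + 1 := by positivity
  refine ⟨1 / (6 * C ^ 6 + 4 / P + 1), by positivity, fun w w' a B ha hw hw'c hwB hwB' => ?_⟩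
  have hwc : Continuous w := .of_hasDerivAt hw
  have I : ∀ {φ : ℝ → ℝ} {D}, Continuous φ → (∀ x, |φ x| ≤ D * exp (-a * |x|)) → Integrable φ :=
    fun h1 h2 => integrable_of_le_exp ha h1 h2
  have iww : Integrable fun x => w x * w x := I (by fun_prop) (abs_le_exp_mul (abs_le_of_le_exp ha hwB) hwB)
  have iww' : Integrable fun x => w x * w' x := I (by fun_prop) (abs_le_exp_mul (abs_le_of_le_exp ha hwB) hwB')
  have iww₂ : Integrable fun x => w' x * w' x := I (by fun_prop) (abs_le_exp_mul (abs_le_of_le_exp ha hwB') hwB')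
  have ipw : Integrable fun x => deriv θ x * w x := I (by fun_prop) (abs_le_exp_mul hp hwB)
  have mulB : ∀ {φ ψ : ℝ → ℝ} {D}, Continuous φ → (∀ x, |φ x| ≤ D) → Integrable ψ → Integrable fun x => φ x * ψ x :=
    fun h1 h2 h3 => h3.bdd_mul h1.aestronglyMeasurable (.of_forall h2)
  set A := w 0 / deriv θ 0 with hA
  set w0 : ℝ → ℝ := fun x => w x - A * deriv θ x with hw0
  have iw0 : Integrable fun x => w0 x ^ 2 := by
    have := (iww.sub (ipw.const_mul (2 * A))).add (hpi.const_mul (A ^ 2))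
    refine this.congr (.of_forall fun x => ?_)
    simp only [hw0, Pi.add_apply, Pi.sub_apply]; ring
  have iD : Integrable fun x => (w' x - q x * w x) ^ 2 := by
    have := (iww₂.sub ((mulB hqc hqb iww').const_mul 2)).add (mulB hqc hqb (mulB hqc hqb iww))
    refine this.congr (.of_forall fun x => ?_)
    simp only [Pi.add_apply, Pi.sub_apply]; ring
  have hg : ∀ x, HasDerivAt (fun x => w x / deriv θ x - A) ((w' x - q x * w x) / deriv θ x) x := fun x => by
    refine (((hw x).div (h.hasDerivAt' x) (h.pos x).ne').sub_const A).congr_deriv ?_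
    have := (h.pos x).ne'
    simp only [hqdef]; field_simp
  have hg'c : Continuous fun x => (w' x - q x * w x) / deriv θ x :=
    (hw'c.sub (hqc.mul hwc)).div hpc fun x => (h.pos x).ne'
  have hpg : ∀ x, deriv θ x * (w x / deriv θ x - A) = w0 x := fun x => by
    have := (h.pos x).ne'
    simp only [hw0]; field_simp
  have hpg' : ∀ x, deriv θ x * ((w' x - q x * w x) / deriv θ x) = w' x - q x * w x := fun x =>
    mul_div_cancel₀ _ (h.pos x).ne'
  have hardy : ∀ N, 0 ≤ N → ∫ x in -N..N, w0 x ^ 2 ≤ C ^ 6 * ∫ x in -N..N, (w' x - q x * w x) ^ 2 := by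
    intro N hN
    have h1 := t₁.hardy hg hg'c (by simp [hA]) hN
    have h2 := t₂.hardy (g := fun x => w (-x) / deriv θ (-x) - A)
      (g' := fun x => -((w' (-x) - q (-x) * w (-x)) / deriv θ (-x)))
      (fun x => ((hg (-x)).comp x (hasDerivAt_neg x)).congr_deriv (by ring)) (hg'c.comp continuous_neg).neg (by simp [hA]) hN
    simp only [hpg, hpg', mul_neg, neg_sq] at h1 h2
    rw [intervalIntegral.integral_comp_neg (f := fun x => w0 x ^ 2),
      intervalIntegral.integral_comp_neg (f := fun x => (w' x - q x * w x) ^ 2), neg_zero] at h2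
    rw [← intervalIntegral.integral_add_adjacent_intervals (iw0.intervalIntegrable (b := 0)) iw0.intervalIntegrable,
      ← intervalIntegral.integral_add_adjacent_intervals (iD.intervalIntegrable (b := 0)) iD.intervalIntegrable]
    linarith
  have key : ∫ x, w0 x ^ 2 ≤ C ^ 6 * ∫ x, (w' x - q x * w x) ^ 2 :=
    le_of_tendsto_of_tendsto (intervalIntegral_tendsto_integral iw0 tendsto_neg_atTop_atBot tendsto_id)
      ((intervalIntegral_tendsto_integral iD tendsto_neg_atTop_atBot tendsto_id).const_mul _)
      ((eventually_ge_atTop 0).mono hardy)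
  have iE : Integrable fun x => w' x ^ 2 + deriv (deriv f) (θ x) * w x ^ 2 := by
    refine (iww₂.add (mulB hVc hV iww)).congr (.of_forall fun x => ?_)
    simp only [Pi.add_apply]; ring
  have iq : Integrable fun x => (deriv (deriv f) (θ x) - q x ^ 2) * w x ^ 2 + q x * (2 * w x * w' x) := by
    refine (((mulB hVc hV iww).sub (mulB hqc hqb (mulB hqc hqb iww))).add
      ((mulB hqc hqb iww').const_mul 2)).congr (.of_forall fun x => ?_)
    simp only [Pi.add_apply, Pi.sub_apply]; ring
  have e0 : ∫ x, ((deriv (deriv f) (θ x) - q x ^ 2) * w x ^ 2 + q x * (2 * w x * w' x)) = 0 := by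
    refine integral_eq_zero_of_hasDerivAt_of_integrable (f := fun x => q x * w x ^ 2) (fun x => ?_) iq
      ((mulB hqc hqb iww).congr (.of_forall fun x => by ring))
    exact ((hqd x).mul ((hw x).pow 2)).congr_deriv (by simp)
  have e1 : ∫ x, (w' x ^ 2 + deriv (deriv f) (θ x) * w x ^ 2) = ∫ x, (w' x - q x * w x) ^ 2 := by
    rw [← sub_eq_zero, ← integral_sub iE iD]
    refine (integral_congr_ae (.of_forall fun x => ?_)).trans e0
    ring
  rw [e1]
  set D := ∫ x, (w' x - q x * w x) ^ 2
  set S := ∫ x, w0 x ^ 2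
  set T := ∫ x, deriv θ x * w x
  have hD : 0 ≤ D := integral_nonneg fun x => sq_nonneg _
  have ipw0 : Integrable fun x => deriv θ x * w0 x := by
    refine (ipw.sub (hpi.const_mul A)).congr (.of_forall fun x => ?_)
    simp only [hw0, Pi.sub_apply]; ring
  have f1 : T = (∫ x, deriv θ x * w0 x) + A * P := by
    rw [hP, ← integral_const_mul, ← integral_add ipw0 (hpi.const_mul A)]
    refine integral_congr_ae (.of_forall fun x => ?_)
    simp only [hw0]; ring
  have f2 : (∫ x, deriv θ x * w0 x) ^ 2 ≤ P * S := by
    have q0 : ∀ t : ℝ, 0 ≤ P * (t * t) + (-2 * ∫ x, deriv θ x * w0 x) * t + S := fun t => by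
      have i1 : Integrable fun x => deriv θ x ^ 2 * (t * t) + -2 * (deriv θ x * w0 x * t) :=
        (hpi.mul_const _).add ((ipw0.mul_const _).const_mul _)
      have : P * (t * t) + (-2 * ∫ x, deriv θ x * w0 x) * t + S = ∫ x, (t * deriv θ x - w0 x) ^ 2 := by
        rw [hP, ← integral_mul_const, mul_assoc, ← integral_mul_const, ← integral_const_mul,
          ← integral_add (hpi.mul_const _) ((ipw0.mul_const _).const_mul _), ← integral_add i1 iw0]
        refine integral_congr_ae (.of_forall fun x => ?_)
        ring
      rw [this]; exact integral_nonneg fun x => sq_nonneg _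
    have := discrim_le_zero q0
    rw [discrim] at this; nlinarith
  have f3 : ∫ x, w x ^ 2 ≤ 2 * S + 2 * A ^ 2 * P := by
    rw [hP, ← integral_const_mul, ← integral_const_mul, ← integral_add (iw0.const_mul _) (hpi.const_mul _)]
    refine integral_mono_of_nonneg (.of_forall fun x => sq_nonneg _) ((iw0.const_mul _).add (hpi.const_mul _))
      (.of_forall fun x => ?_)
    simp only [hw0]; nlinarith [sq_nonneg (w x - 2 * A * deriv θ x)]
  have f4 : A ^ 2 * P ≤ 2 / P * T ^ 2 + 2 * S := by
    have : (A * P) ^ 2 ≤ 2 * T ^ 2 + 2 * (P * S) := by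
      rw [show A * P = T - ∫ x, deriv θ x * w0 x by linarith]
      nlinarith [sq_nonneg (T + ∫ x, deriv θ x * w0 x)]
    have e : A ^ 2 * P = (A * P) ^ 2 / P := by field_simp
    rw [e, div_le_iff₀ hpn]
    calc _ ≤ _ := this
      _ = _ := by field_simp
  rw [one_div, inv_mul_le_iff₀ hden]
  have g1 : 0 ≤ T ^ 2 := sq_nonneg _
  have g2 : 0 ≤ 4 / P := by positivity
  have g3 : 0 ≤ C ^ 6 := by have := t₁.C_pos; positivity
  have g4 : 2 * (2 / P * T ^ 2) = 4 / P * T ^ 2 := by ring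
  nlinarith [mul_nonneg g2 hD, mul_nonneg g3 g1]

end Prof


/-! ### Energy identities and coercivity -/

/-- The product exponential weight with rate `a`. -/
noncomputable def wexp (a : ℝ) (z : ℝ × ℝ) : ℝ := exp (-a * |z.1|) * exp (-a * |z.2|)

lemma wexp_le_one {a : ℝ} (ha : 0 < a) (z : ℝ × ℝ) : wexp a z ≤ 1 :=
  mul_le_one₀ (exp_le_one_iff.mpr (by nlinarith [abs_nonneg z.1])) (exp_pos _).le
    (exp_le_one_iff.mpr (by nlinarith [abs_nonneg z.2]))

lemma wt_wexp {a : ℝ} (ha : 0 < a) (ha' : a ≤ 1/16) : Wt (wexp a) where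
  pos z := mul_pos (exp_pos _) (exp_pos _)
  meas := by unfold wexp; fun_prop
  le z z' := by
    have key : ∀ u v : ℝ, exp (-a * |v|) ≤ exp (1/16 * |u - v|) * exp (-a * |u|) := fun u v => by
      rw [← exp_add]
      refine exp_le_exp.mpr ?_
      have h1 : |u| - |v| ≤ |u - v| := abs_sub_abs_le_abs_sub u v
      have h2 := abs_nonneg (u - v)
      nlinarith
    calc wexp a z' ≤ (exp (1/16 * |z.1 - z'.1|) * exp (-a * |z.1|)) * (exp (1/16 * |z.2 - z'.2|) * exp (-a * |z.2|)) :=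
          mul_le_mul (key _ _) (key _ _) (exp_pos _).le (by positivity)
      _ = _ := by unfold wexp; ring

lemma Bd.memLp_wexp {a : ℝ} (ha : 0 < a) {g : ℝ × ℝ → ℝ} (h : Bd (wexp a) g) : MemLp g 2 nuM := by
  obtain ⟨m, C, -, b⟩ := h
  exact memLp_nuM_of_le ha m b

lemma nuM_eq : nuM = (volume : Measure ℝ).prod tauM + volume.prod (Measure.dirac 0) := by
  rw [nuM, etaM, Measure.prod_add, tauM]

lemma prod_tau_le : (volume : Measure ℝ).prod tauM ≤ nuM := by
  rw [nuM_eq]; exact Measure.le_add_right le_rfl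

section Energy
variable {a : ℝ} {F F' g g' g'' : ℝ × ℝ → ℝ}

lemma Bd.integrable_mul (ha : 0 < a) (h : Bd (wexp a) g) (h' : Bd (wexp a) g') :
    Integrable (fun z => g z * g' z) nuM := (h.memLp_wexp ha).integrable_mul (h'.memLp_wexp ha)

lemma Ry.integral_Ioi (ha : 0 < a) (hF : BdC (wexp a) F) (hd : Ry F F') {x : ℝ}
    (hi : IntegrableOn (fun y => F' (x, y)) (Set.Ioi 0)) : ∫ y in Set.Ioi (0:ℝ), F' (x, y) = -F (x, 0) := by
  rw [← zero_sub]
  refine integral_Ioi_of_hasDerivAt_of_tendsto (f := fun y => F (x, y))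
    ((hF.slice_continuousOn x) 0 Set.self_mem_Ici) (fun y hy => hd x y hy) hi ?_
  obtain ⟨⟨-, C, hC, b⟩, -⟩ := hF
  have ht : Tendsto (fun y : ℝ => C * exp (-(a * y))) atTop (𝓝 0) := by
    rw [← mul_zero C]
    exact (tendsto_exp_neg_atTop_nhds_zero.comp (tendsto_id.const_mul_atTop ha)).const_mul C
  refine squeeze_zero_norm' ?_ ht
  filter_upwards [eventually_ge_atTop 0] with y hy
  refine (b (x, y) hy).trans (mul_le_mul_of_nonneg_left ?_ hC)
  simp only [wexp, abs_of_nonneg hy, neg_mul]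
  refine (mul_le_mul_of_nonneg_right (exp_le_one_iff.mpr ?_) (exp_pos _).le).trans (one_mul _).le
  have := abs_nonneg x; nlinarith

lemma Bd.abs_slice_le (h : Bd (wexp a) g) : ∃ C, 0 ≤ C ∧ ∀ y, 0 ≤ y → ∀ x, |g (x, y)| ≤ C * exp (-a * y) * exp (-a * |x|) := by
  obtain ⟨-, C, hC, b⟩ := h
  refine ⟨C, hC, fun y hy x => (b (x, y) hy).trans_eq ?_⟩
  simp only [wexp, abs_of_nonneg hy]; ring

lemma BdC.integrable_slice_mul (ha : 0 < a) {p q : ℝ × ℝ → ℝ} (hp : BdC (wexp a) p) (hq : BdC (wexp a) q) {y : ℝ} (hy : 0 ≤ y) :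
    Integrable fun x => p (x, y) * q (x, y) := by
  obtain ⟨C, hC, b⟩ := hp.1.abs_slice_le
  obtain ⟨C', hC', b'⟩ := hq.1.abs_slice_le
  refine integrable_of_le_exp ha ((hp.continuous_slice_fst hy).mul (hq.continuous_slice_fst hy))
    (abs_le_exp_mul (B := C * exp (-a * y)) (C := C' * exp (-a * y)) (fun x => (b y hy x).trans ?_) (b' y hy))
  exact mul_le_of_le_one_right (by positivity) (exp_le_one_iff.mpr (by nlinarith [abs_nonneg x]))

lemma Rx.integral_mul (ha : 0 < a) (h : BdC (wexp a) g) (h' : BdC (wexp a) g') (h'' : BdC (wexp a) g'')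
    (hd : Rx g g') (hd' : Rx g' g'') {y : ℝ} (hy : 0 ≤ y) : ∫ x, g (x, y) * g'' (x, y) = -∫ x, g' (x, y) * g' (x, y) := by
  exact integral_mul_deriv_eq_deriv_mul_of_integrable (fun x _ => hd x y hy) (fun x _ => hd' x y hy)
    (h.integrable_slice_mul ha h'' hy) (h'.integrable_slice_mul ha h' hy) (h.integrable_slice_mul ha h' hy)

lemma BdC.integrable_mul {a : ℝ} (ha : 0 < a) {p q : ℝ × ℝ → ℝ} (hp : BdC (wexp a) p) (hq : BdC (wexp a) q) :
    Integrable (fun z => p z * q z) (volume.prod tauM) :=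
  (Bd.integrable_mul ha hp.1 hq.1).mono_measure prod_tau_le

/-- Energy identity and trace inequality for the half-plane problem. -/
lemma energy {b i : ℝ × ℝ → ℝ} (hb : Xinf (wexp (1/16)) b) (hi : Xinf (wexp (1/16)) i) {U : ℝ × ℝ → ℝ}
    (hU : U = kerFun tauM nuM k0 fun z => if z.2 = 0 then b z else i z) : ∃ U₁ P : ℝ × ℝ → ℝ,
    Rx U U₁ ∧ BdC (wexp (1/16)) U ∧ BdC (wexp (1/16)) U₁ ∧ BdC (wexp (1/16)) P ∧
    ∫ z, (if z.2 = 0 then b z else i z) * U z ∂nuM =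
      ∫ z, (P z * P z + U z * U z + U₁ z * U₁ z) ∂(volume.prod tauM) ∧
    ∫ x, U (x, 0) * U (x, 0) ≤ ∫ z, (U z * U z + P z * P z) ∂(volume.prod tauM) := by
  have ha : (0:ℝ) < 1/16 := by norm_num
  have hW := wt_wexp ha le_rfl
  have hB : ∀ z : ℝ × ℝ, 0 ≤ z.2 → wexp (1/16) z ≤ 1 := fun z _ => wexp_le_one ha z
  have hWL : MemLp (wexp (1/16)) 2 nuM := memLp_exp_nuM ha
  have hUX : Xinf (wexp (1/16)) U := fun n => by
    rw [hU]
    exact (RC.piecewise (fun _ _ => Bd.piecewise hW) ((hb n).imp fun _ h => h.1) ((hi n).imp fun _ h => h.1)).kerFun_bdC hW hB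
  obtain ⟨U₁, hd1, hX1⟩ := hUX.exists_deriv
  obtain ⟨U₂, hd2, hX2⟩ := hX1.exists_deriv
  obtain ⟨hRy, hP⟩ := normal_Xinf hWL hB hW hb hi hUX (fun z _ => by rw [hU]) hd1 hd2 hX1 hX2
  have hA := alg_BdC hW hB
  have hS : BdC (wexp (1/16)) fun z => U z - U₂ z - i z := hA.sub_W (hA.sub_W hUX.bdC hX2.bdC) hi.bdC
  have hRP : Ry (nrm b fun z => U z - U₂ z - i z) _ := hasDerivAt_nrm (b := b) hS
  have hP0 : ∀ x, nrm b (fun z => U z - U₂ z - i z) (x, 0) = -b (x, 0) := fun x => by simp [nrm]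
  set P := nrm b fun z => U z - U₂ z - i z
  have I := @BdC.integrable_mul _ ha
  have hUc := hUX.bdC
  have hPc := hP.bdC
  have I1 : Integrable (fun z => P z * P z + U z * (U z - U₂ z - i z)) (volume.prod tauM) := (I hPc hPc).add (I hUc hS)
  have I2 := I hi.bdC hUc
  have I3 := I hUc hX2.bdC
  have e1 : ∀ x, IntegrableOn (fun y => P (x, y) * P (x, y) + U (x, y) * (U (x, y) - U₂ (x, y) - i (x, y))) (Set.Ioi 0) →
      ∫ y in Set.Ioi (0:ℝ), (P (x, y) * P (x, y) + U (x, y) * (U (x, y) - U₂ (x, y) - i (x, y))) = U (x, 0) * b (x, 0) := by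
    intro x hx
    refine (Ry.integral_Ioi ha (F := fun z => U z * P z) (hA.mulW (hA.sub hUc) hPc)
      (F' := fun z => P z * P z + U z * (U z - U₂ z - i z)) (fun x y hy => (hRy x y hy).mul (hRP x y hy)) hx).trans ?_
    rw [hP0]; ring
  refine ⟨U₁, P, hd1, hUc, hX1.bdC, hPc, ?_, ?_⟩
  · have hφ : Bd (wexp (1/16)) fun z => if z.2 = 0 then b z else i z := hb.bdC.1.piecewise hW hi.bdC.1
    rw [integral_nuM (hφ.integrable_mul ha hUc.1)]
    calc ∫ x, ((∫ y in Set.Ioi (0:ℝ), (if (x, y).2 = 0 then b (x, y) else i (x, y)) * U (x, y)) +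
          (if (x, (0:ℝ)).2 = 0 then b (x, 0) else i (x, 0)) * U (x, 0))
        = ∫ x, ∫ y, (P (x, y) * P (x, y) + U (x, y) * U (x, y) - U (x, y) * U₂ (x, y)) ∂tauM := by
          refine integral_congr_ae ?_
          filter_upwards [I1.prod_right_ae, I2.prod_right_ae] with x h1 h2
          have : ∫ y in Set.Ioi (0:ℝ), (if (x, y).2 = 0 then b (x, y) else i (x, y)) * U (x, y) =
              ∫ y in Set.Ioi (0:ℝ), i (x, y) * U (x, y) :=
            setIntegral_congr_fun measurableSet_Ioi fun y hy => by
              have hy' : 0 < y := hy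
              simp [hy'.ne']
          rw [this, if_pos rfl, mul_comm (b _), ← e1 x h1]
          exact (integral_add h2 h1).symm.trans (integral_congr_ae (.of_forall fun y => by ring))
      _ = ∫ z, (P z * P z + U z * U z - U z * U₂ z) ∂(volume.prod tauM) :=
          (integral_prod _ (((I hPc hPc).add (I hUc hUc)).sub I3)).symm
      _ = ∫ z, (P z * P z + U z * U z) ∂(volume.prod tauM) - ∫ z, U z * U₂ z ∂(volume.prod tauM) :=
          integral_sub ((I hPc hPc).add (I hUc hUc)) I3
      _ = ∫ z, (P z * P z + U z * U z) ∂(volume.prod tauM) + ∫ z, U₁ z * U₁ z ∂(volume.prod tauM) := by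
          rw [integral_prod_symm _ I3, integral_prod_symm _ (I hX1.bdC hX1.bdC), sub_eq_add_neg, ← integral_neg]
          congr 1
          refine integral_congr_ae ?_
          filter_upwards [ae_tau_pos] with y hy
          rw [hd1.integral_mul ha hUc hX1.bdC hX2.bdC hd2 hy.le, neg_neg]
      _ = _ := (integral_add ((I hPc hPc).add (I hUc hUc)) (I hX1.bdC hX1.bdC)).symm
  · have I4 := I hUc hPc
    have I5 : Integrable (fun z => U z * U z + P z * P z) (volume.prod tauM) := (I hUc hUc).add (I hPc hPc)
    rw [integral_prod _ I5]
    refine integral_mono_of_nonneg (.of_forall fun x => mul_self_nonneg _) I5.integral_prod_left ?_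
    filter_upwards [I4.prod_right_ae, I5.prod_right_ae] with x h4 h5
    have h6 : IntegrableOn (fun y => P (x, y) * U (x, y) + U (x, y) * P (x, y)) (Set.Ioi 0) := by
      refine (h4.const_mul 2).congr (.of_forall fun y => ?_)
      ring
    have h7 := Ry.integral_Ioi ha (F := fun z => U z * U z) (hA.mulW (hA.sub hUc) hUc)
      (F' := fun z => P z * U z + U z * P z) (fun x y hy => (hRy x y hy).mul (hRy x y hy)) h6
    have h8 : U (x, 0) * U (x, 0) = ∫ y in Set.Ioi (0:ℝ), -(P (x, y) * U (x, y) + U (x, y) * P (x, y)) := by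
      rw [integral_neg, h7, neg_neg]
    rw [h8]
    refine integral_mono h6.neg h5 fun y => ?_
    nlinarith [sq_nonneg (P (x, y) + U (x, y))]

/-- Coercivity of the linearized half-plane problem modulo the projection onto `θ'`. -/
lemma Prof.coercive {f θ : ℝ → ℝ} (h : Prof f θ) : ∃ m > 0, ∀ b i U : ℝ × ℝ → ℝ, Xinf (wexp (1/16)) b →
    Xinf (wexp (1/16)) i → (U = kerFun tauM nuM k0 fun z => if z.2 = 0 then b z else i z) →
    MemLp (fun y => ∫ x, deriv θ x * U (x, y)) 2 tauM ∧ m * ∫ z, U z * U z ∂nuM ≤ ∫ z, (if z.2 = 0 then b z else i z) * U z ∂nuM -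
      ∫ z, (1 - deriv (deriv f) (θ z.1)) * (U z * U z) ∂(volume.prod tauM) +
      ∫ y, (∫ x, deriv θ x * U (x, y)) * (∫ x, deriv θ x * U (x, y)) ∂tauM := by
  obtain ⟨μ, hμ, hgap⟩ := h.gap
  obtain ⟨M, hM⟩ := h.exists_bound_well
  have hVc := h.continuous_well
  obtain ⟨κ, hκ, Cp, hp, -⟩ := h.exists_decay
  refine ⟨min μ 1 / 2, by positivity, fun b i U hb hi hU => ?_⟩
  have ha : (0:ℝ) < 1/16 := by norm_num
  obtain ⟨U₁, P, hd, hUc, hU1, hPc, e1, e2⟩ := energy hb hi hU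
  have I := @BdC.integrable_mul _ ha
  have IV : Integrable (fun z : ℝ × ℝ => deriv (deriv f) (θ z.1) * (U z * U z)) (volume.prod tauM) :=
    (I hUc hUc).bdd_mul (c := M) (hVc.comp continuous_fst).aestronglyMeasurable (.of_forall fun z => hM _)
  have IUx := hUc.integrable_slice_mul ha hUc le_rfl
  have e3 : ∫ z, U z * U z ∂nuM = ∫ z, U z * U z ∂(volume.prod tauM) + ∫ x, U (x, 0) * U (x, 0) := by
    rw [integral_nuM (hUc.1.integrable_mul ha hUc.1), integral_prod _ (I hUc hUc)]
    exact integral_add (I hUc hUc).integral_prod_left IUx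
  have e4 : ∫ z, (1 - deriv (deriv f) (θ z.1)) * (U z * U z) ∂(volume.prod tauM) =
      ∫ z, U z * U z ∂(volume.prod tauM) - ∫ z, deriv (deriv f) (θ z.1) * (U z * U z) ∂(volume.prod tauM) := by
    rw [← integral_sub (I hUc hUc) IV]
    exact integral_congr_ae (.of_forall fun z => by ring)
  have e5 : ∫ z, (P z * P z + U z * U z + U₁ z * U₁ z) ∂(volume.prod tauM) = ∫ z, P z * P z ∂(volume.prod tauM) +
      ∫ z, U z * U z ∂(volume.prod tauM) + ∫ z, U₁ z * U₁ z ∂(volume.prod tauM) := by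
    rw [← integral_add (I hPc hPc) (I hUc hUc)]
    exact integral_add ((I hPc hPc).add (I hUc hUc)) (I hU1 hU1)
  have IG : Integrable (fun z => U₁ z * U₁ z + deriv (deriv f) (θ z.1) * (U z * U z)) (volume.prod tauM) :=
    (I hU1 hU1).add IV
  have hm : AEStronglyMeasurable (fun y => ∫ x, deriv θ x * U (x, y)) tauM :=
    (StronglyMeasurable.integral_prod_right (f := fun y x : ℝ => deriv θ x * U (x, y)) (by
      have := hUc.1.1
      have := h.continuous_deriv.measurable
      exact (by fun_prop : Measurable fun p : ℝ × ℝ => deriv θ p.2 * U (p.2, p.1)).stronglyMeasurable)).aestronglyMeasurable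
  have IQ : Integrable (fun y => (∫ x, deriv θ x * U (x, y)) * (∫ x, deriv θ x * U (x, y))) tauM := by
    obtain ⟨C, hC, b⟩ := hUc.1.abs_slice_le
    have hθi : Integrable fun x => Cp * exp (-κ * |x|) := (integrable_exp_mul_abs hκ).const_mul _
    set L := ∫ x, Cp * exp (-κ * |x|)
    have hq : ∀ y, 0 < y → |∫ x, deriv θ x * U (x, y)| ≤ C * L * exp (-(1/16) * y) := fun y hy => by
      have h1 := norm_integral_le_of_norm_le (hθi.const_mul (C * exp (-(1/16) * y)))
        (.of_forall fun x => (by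
          rw [norm_mul, mul_comm]
          refine mul_le_mul ((b y hy.le x).trans ?_) (hp x) (abs_nonneg _) (by positivity)
          exact mul_le_of_le_one_right (by positivity) (exp_le_one_iff.mpr (by nlinarith [abs_nonneg x])) :
          ‖deriv θ x * U (x, y)‖ ≤ C * exp (-(1/16) * y) * (Cp * exp (-κ * |x|))))
      rw [integral_const_mul] at h1
      rw [← Real.norm_eq_abs]
      refine h1.trans_eq (by ring)
    have hL : 0 ≤ L := integral_nonneg fun x => (abs_nonneg _).trans (hp x)
    refine ((integrableOn_exp_mul_Ioi (show -(1/8:ℝ) < 0 by norm_num) 0).const_mul ((C * L) * (C * L))).mono' (hm.mul hm) ?_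
    filter_upwards [ae_tau_pos] with y hy
    rw [norm_mul]
    refine (mul_le_mul (hq y hy) (hq y hy) (abs_nonneg _) (by positivity)).trans_eq ?_
    rw [show -(1/8:ℝ) * y = -(1/16) * y + -(1/16) * y by ring, exp_add]; ring
  have e6 : μ * ∫ z, U z * U z ∂(volume.prod tauM) ≤ (∫ z, U₁ z * U₁ z ∂(volume.prod tauM) +
      ∫ z, deriv (deriv f) (θ z.1) * (U z * U z) ∂(volume.prod tauM)) +
      ∫ y, (∫ x, deriv θ x * U (x, y)) * (∫ x, deriv θ x * U (x, y)) ∂tauM := by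
    rw [← integral_add (I hU1 hU1) IV, integral_prod_symm _ (I hUc hUc), integral_prod_symm _ IG, ← integral_const_mul,
      ← integral_add IG.integral_prod_right IQ]
    refine integral_mono_ae ((I hUc hUc).integral_prod_right.const_mul μ) (IG.integral_prod_right.add IQ) ?_
    filter_upwards [ae_tau_pos] with y hy
    obtain ⟨C, hC, b⟩ := hUc.1.abs_slice_le
    obtain ⟨C', hC', b'⟩ := hU1.1.abs_slice_le
    have := hgap (fun x => U (x, y)) (fun x => U₁ (x, y)) (1/16) (C * exp (-(1/16) * y) + C' * exp (-(1/16) * y)) ha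
      (fun x => hd x y hy.le) (hU1.continuous_slice_fst hy.le)
      (fun x => (b y hy.le x).trans (mul_le_mul_of_nonneg_right (le_add_of_nonneg_right (by positivity)) (exp_pos _).le))
      (fun x => (b' y hy.le x).trans (mul_le_mul_of_nonneg_right (le_add_of_nonneg_left (by positivity)) (exp_pos _).le))
    simpa only [sq] using this
  refine ⟨(memLp_two_iff_integrable_sq hm).mpr (by simpa only [sq] using IQ), ?_⟩
  rw [e1, e3, e4, e5]
  have hA : 0 ≤ ∫ z, U z * U z ∂(volume.prod tauM) := integral_nonneg fun z => mul_self_nonneg _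
  have hP : 0 ≤ ∫ z, P z * P z ∂(volume.prod tauM) := integral_nonneg fun z => mul_self_nonneg _
  rw [integral_add (I hUc hUc) (I hPc hPc)] at e2
  have m1 := min_le_left μ 1
  have m2 := min_le_right μ 1
  have m0 : 0 < min μ 1 := by positivity
  nlinarith [mul_le_mul_of_nonneg_left e2 m0.le, mul_le_mul_of_nonneg_right m1 hA, mul_le_mul_of_nonneg_right m2 hP]

end Energy

open scoped ENNReal NNReal ContDiff InnerProductSpace

/-! ### Multiplication operators, lifts and the modified linear operator -/

/-- Real square integrable functions on the closed half-plane. -/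
noncomputable abbrev XL := Lp ℝ 2 nuM

/-- Real square integrable functions on the half-line. -/
noncomputable abbrev YL := Lp ℝ 2 tauM

section Mul
variable {Z : Type*} [MeasurableSpace Z] {μ : Measure Z} [SFinite μ] {m : Z → ℝ} {M : ℝ≥0}

lemma eLpNorm_mul_le_of_bound (hM : ∀ z, |m z| ≤ M) (Ψ : Z → ℝ) :
    eLpNorm (fun z => m z * Ψ z) 2 μ ≤ M * eLpNorm Ψ 2 μ := by
  refine eLpNorm_le_nnreal_smul_eLpNorm_of_ae_le_mul (.of_forall fun z => ?_) 2
  rw [nnnorm_mul]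
  exact mul_le_mul_of_nonneg_right (hM z) zero_le

/-- Multiplication by a bounded measurable function on `L²`. -/
noncomputable def mulOp (hm : Measurable m) (hM : ∀ z, |m z| ≤ M) : Lp ℝ 2 μ →L[ℝ] Lp ℝ 2 μ :=
  lpOp (fun Ψ z => m z * Ψ z)
    (fun Ψ h => ⟨hm.aestronglyMeasurable.mul h.1, (eLpNorm_mul_le_of_bound hM Ψ).trans_lt (ENNReal.mul_lt_top (by simp) h.2)⟩)
    (fun Ψ Φ h => by filter_upwards [h] with z hz; rw [hz])
    (fun Ψ Φ _ _ => Eventually.of_forall fun z => by simp [mul_add])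
    (fun c Ψ _ => Eventually.of_forall fun z => by simp [mul_left_comm])
    M (fun Ψ _ => eLpNorm_mul_le_of_bound hM Ψ)

lemma coeFn_mulOp (hm : Measurable m) (hM : ∀ z, |m z| ≤ M) (Ψ : Lp ℝ 2 μ) :
    mulOp hm hM Ψ =ᵐ[μ] fun z => m z * Ψ z := coeFn_lpOp Ψ

lemma inner_L2 (Ψ Φ : Lp ℝ 2 μ) : ⟪Ψ, Φ⟫_ℝ = ∫ z, Ψ z * Φ z ∂μ := by
  rw [L2.inner_def]
  exact integral_congr_ae (.of_forall fun z => by simp [mul_comm])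

lemma inner_L2_congr {Ψ Φ : Lp ℝ 2 μ} {a b : Z → ℝ} (h : Ψ =ᵐ[μ] a) (h' : Φ =ᵐ[μ] b) :
    ⟪Ψ, Φ⟫_ℝ = ∫ z, a z * b z ∂μ := by
  rw [inner_L2]
  exact integral_congr_ae (by filter_upwards [h, h'] with z e e'; rw [e, e'])

end Mul

section Lift
variable {φ : ℝ → ℝ}

/-- The function `φ(x) g(y)` in the open half-plane, extended by zero to the boundary. -/
noncomputable def jf (φ g : ℝ → ℝ) (z : ℝ × ℝ) : ℝ := if z.2 = 0 then 0 else φ z.1 * g z.2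

lemma ae_nuM_iff {p : ℝ × ℝ → Prop} :
    (∀ᵐ z ∂nuM, p z) ↔ (∀ᵐ z ∂(volume : Measure ℝ).prod tauM, p z) ∧ ∀ᵐ z ∂(volume : Measure ℝ).prod (Measure.dirac (0:ℝ)), p z := by
  rw [nuM_eq, ae_add_measure_iff]

lemma ae_bdry : ∀ᵐ z ∂(volume : Measure ℝ).prod (Measure.dirac (0:ℝ)), z.2 = 0 :=
  Measure.quasiMeasurePreserving_snd.ae ((ae_dirac_iff (measurableSet_eq_fun measurable_id measurable_const)).mpr rfl)

lemma ae_int : ∀ᵐ z ∂(volume : Measure ℝ).prod tauM, 0 < z.2 :=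
  Measure.quasiMeasurePreserving_snd.ae ae_tau_pos

lemma jf_ae_int (φ g : ℝ → ℝ) : jf φ g =ᵐ[volume.prod tauM] fun z => φ z.1 * g z.2 := by
  filter_upwards [ae_int] with z hz using if_neg hz.ne'

lemma jf_ae_bdry (φ g : ℝ → ℝ) : jf φ g =ᵐ[volume.prod (Measure.dirac 0)] fun _ => 0 := by
  filter_upwards [ae_bdry] with z hz using if_pos hz

lemma eLpNorm_jf_le (hφ : AEMeasurable φ) {g : ℝ → ℝ} (hg : AEMeasurable g tauM) :
    eLpNorm (jf φ g) 2 nuM = eLpNorm φ 2 volume * eLpNorm g 2 tauM := by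
  have h : eLpNorm (jf φ g) 2 nuM ^ 2 = (eLpNorm φ 2 volume * eLpNorm g 2 tauM) ^ 2 := by
    rw [mul_pow, eLpNorm_two_sq, eLpNorm_two_sq, eLpNorm_two_sq, nuM_eq, lintegral_add_measure,
      ← lintegral_prod_mul (by fun_prop) (by fun_prop),
      lintegral_congr_ae (by filter_upwards [jf_ae_bdry φ g] with z hz; rw [hz] :
        (fun z => ‖jf φ g z‖ₑ ^ 2) =ᵐ[volume.prod (Measure.dirac 0)] fun _ => ‖(0:ℝ)‖ₑ ^ 2)]
    simp only [enorm_zero, ne_eq, OfNat.ofNat_ne_zero, not_false_eq_true, zero_pow, lintegral_const, zero_mul, add_zero]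
    refine lintegral_congr_ae ?_
    filter_upwards [jf_ae_int φ g] with z hz
    rw [hz, enorm_mul, mul_pow]
  exact (ENNReal.pow_right_strictMono two_ne_zero).injective h

lemma memLp_jf (hφ : MemLp φ 2 volume) {g : ℝ → ℝ} (hg : MemLp g 2 tauM) : MemLp (jf φ g) 2 nuM := by
  refine ⟨?_, ?_⟩
  · rw [nuM_eq, aestronglyMeasurable_add_measure_iff]
    exact ⟨(hφ.1.comp_fst.mul hg.1.comp_snd).congr (jf_ae_int φ g).symm,
      aestronglyMeasurable_const.congr (jf_ae_bdry φ g).symm⟩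
  · rw [eLpNorm_jf_le hφ.1.aemeasurable hg.1.aemeasurable]
    exact ENNReal.mul_lt_top hφ.2 hg.2

lemma jf_congr (φ : ℝ → ℝ) {g g' : ℝ → ℝ} (h : g =ᵐ[tauM] g') : jf φ g =ᵐ[nuM] jf φ g' :=
  ae_nuM_iff.mpr ⟨by
    filter_upwards [Measure.quasiMeasurePreserving_snd.ae h] with z hz
    simp only [jf, hz], by
    filter_upwards [jf_ae_bdry φ g, jf_ae_bdry φ g'] with z h1 h2 using h1.trans h2.symm⟩

/-- The operator `g ↦ φ(x) g(y)`. -/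
noncomputable def jOp (hφ : MemLp φ 2 volume) : YL →L[ℝ] XL :=
  lpOp (jf φ) (fun _ hg => memLp_jf hφ hg)
    (fun _ _ h => jf_congr φ h)
    (fun g g' _ _ => Eventually.of_forall fun z => by simp only [jf, Pi.add_apply]; split_ifs <;> ring)
    (fun c g _ => Eventually.of_forall fun z => by simp only [jf, Pi.smul_apply, smul_eq_mul]; split_ifs <;> ring)
    (eLpNorm φ 2 volume).toNNReal
    (fun g hg => by rw [eLpNorm_jf_le hφ.1.aemeasurable hg.1.aemeasurable, ENNReal.coe_toNNReal hφ.2.ne])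

lemma coeFn_jOp (hφ : MemLp φ 2 volume) (g : YL) : jOp hφ g =ᵐ[nuM] jf φ g := coeFn_lpOp g

lemma norm_jOp_le (hφ : MemLp φ 2 volume) : ‖jOp hφ‖ ≤ (eLpNorm φ 2 volume).toReal := lpOp_norm_le

lemma jOp_sub {φ' : ℝ → ℝ} (hφ : MemLp φ 2 volume) (hφ' : MemLp φ' 2 volume) :
    jOp hφ - jOp hφ' = jOp (hφ.sub hφ') := by
  ext1 g
  apply Lp.ext
  filter_upwards [coeFn_jOp hφ g, coeFn_jOp hφ' g, coeFn_jOp (hφ.sub hφ') g, Lp.coeFn_sub (jOp hφ g) (jOp hφ' g)]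
    with z e1 e2 e3 e4
  rw [sub_apply, e4, Pi.sub_apply, e1, e2, e3]
  simp only [jf, Pi.sub_apply]
  split_ifs <;> ring

end Lift

/-- Inverting `1 - S K` when `K`, `S` are symmetric and the quadratic form is coercive. -/
lemma isUnit_one_sub_of_coercive {E : Type*} [NormedAddCommGroup E] [InnerProductSpace ℝ E] [CompleteSpace E]
    {K S : E →L[ℝ] E} (hK : ∀ x y, ⟪K x, y⟫_ℝ = ⟪x, K y⟫_ℝ) (hS : ∀ x y, ⟪S x, y⟫_ℝ = ⟪x, S y⟫_ℝ) {m : ℝ} (hm : 0 < m)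
    (h : ∀ x, m * ‖K x‖ ^ 2 ≤ ⟪x - S (K x), K x⟫_ℝ) : IsUnit (1 - S * K) := by
  have hB : ∀ x, (1 - S * K) x = x - S (K x) := fun x => rfl
  have hlow : ∀ x, ‖x‖ ≤ (1 + ‖S‖ / m) * ‖(1 - S * K) x‖ := fun x => by
    have h1 : m * ‖K x‖ ≤ ‖x - S (K x)‖ := by
      rcases eq_or_lt_of_le (norm_nonneg (K x)) with h0 | h0
      · rw [← h0, mul_zero]; exact norm_nonneg _
      · have := (h x).trans (real_inner_le_norm _ _)
        nlinarith
    have h2 : ‖x‖ ≤ ‖x - S (K x)‖ + ‖S‖ * ‖K x‖ := by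
      calc ‖x‖ = ‖(x - S (K x)) + S (K x)‖ := by rw [sub_add_cancel]
        _ ≤ _ := (norm_add_le _ _).trans (by gcongr; exact S.le_opNorm _)
    have h3 : ‖K x‖ ≤ ‖x - S (K x)‖ / m := by rw [le_div_iff₀ hm]; linarith
    rw [hB]
    calc ‖x‖ ≤ ‖x - S (K x)‖ + ‖S‖ * (‖x - S (K x)‖ / m) := h2.trans (by gcongr)
      _ = _ := by ring
  rw [ContinuousLinearMap.isUnit_iff_bijective, ContinuousLinearMap.bijective_iff_dense_range_and_antilipschitz]
  refine ⟨?_, (1 + ‖S‖ / m).toNNReal, ContinuousLinearMap.antilipschitz_of_bound _ fun x => ?_⟩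
  · rw [Submodule.topologicalClosure_eq_top_iff, Submodule.eq_bot_iff]
    intro ψ hψ
    have h1 : ψ = K (S ψ) := by
      refine ext_inner_left ℝ fun x => ?_
      have := (Submodule.mem_orthogonal _ _).mp hψ _ (LinearMap.mem_range_self (1 - S * K : E →L[ℝ] E).toLinearMap x)
      have e : ⟪x - S (K x), ψ⟫_ℝ = 0 := this
      rw [inner_sub_left, hS, hK] at e
      linarith
    have h2 : S ψ = 0 := by
      have := hlow (S ψ)
      rw [hB, ← h1, sub_self, norm_zero, mul_zero] at this
      exact norm_le_zero_iff.mp this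
    rw [h1, h2, map_zero]
  · rw [Real.coe_toNNReal _ (by positivity)]
    exact hlow x


lemma Xinf.of_hasCompactSupport {g : ℝ × ℝ → ℝ} (hg : ContDiff ℝ ∞ g) (hc : HasCompactSupport g) {a : ℝ} :
    Xinf (wexp a) g := by
  intro n
  induction n generalizing g with
  | zero =>
    have hcont : Continuous fun z : ℝ × ℝ => exp (a * |z.1|) * exp (a * |z.2|) := by fun_prop
    obtain ⟨C, hC⟩ := (hc.mul_right (f' := fun z : ℝ × ℝ => exp (a * |z.1|) * exp (a * |z.2|))).exists_bound_of_continuous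
      (hg.continuous.mul hcont)
    refine ⟨⟨hg.continuous.measurable, max C 0, le_max_right _ _, fun z _ => ?_⟩, hg.continuous.continuousOn⟩
    have h := (hC z).trans (le_max_left C 0)
    simp only [Pi.mul_apply, norm_mul, Real.norm_eq_abs, abs_exp] at h
    rw [wexp, neg_mul, neg_mul, exp_neg, exp_neg, ← mul_inv, ← div_eq_mul_inv, le_div_iff₀ (by positivity)]
    exact h
  | succ n ih =>
    refine ⟨(by exact ih hg hc : RC Rx (BdC (wexp a)) n g).base, fun z => fderiv ℝ g z (1, 0), fun x y _ => ?_,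
      ih ((hg.fderiv_right (m := ∞) (by simp)).clm_apply contDiff_const) (hc.fderiv_apply (𝕜 := ℝ) (1, 0))⟩
    exact ((hg.differentiable (by simp) (x, y)).hasFDerivAt.comp_hasDerivAt (f := fun x => (x, y)) x
      ((hasDerivAt_id x).prodMk (hasDerivAt_const x y)))

instance : IsLocallyFiniteMeasure nuM := by
  have : IsLocallyFiniteMeasure etaM := ⟨fun x => by
    obtain ⟨s, hx, hs, h⟩ := (volume.restrict (Set.Ioi (0:ℝ))).exists_isOpen_measure_lt_top x
    exact ⟨s, hs.mem_nhds hx, by rw [etaM, Measure.add_apply]; exact ENNReal.add_lt_top.mpr ⟨h, measure_lt_top _ _⟩⟩⟩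
  unfold nuM; infer_instance

lemma dirac_prod_le : (volume : Measure ℝ).prod (Measure.dirac (0:ℝ)) ≤ nuM := by
  rw [nuM_eq]; exact Measure.le_add_left le_rfl

lemma integral_nuM_add {F : ℝ × ℝ → ℝ} (hF : Integrable F nuM) :
    ∫ z, F z ∂nuM = ∫ z, F z ∂(volume : Measure ℝ).prod tauM + ∫ z, F z ∂(volume : Measure ℝ).prod (Measure.dirac (0:ℝ)) := by
  rw [nuM_eq] at hF ⊢
  exact integral_add_measure hF.left_of_add_measure hF.right_of_add_measure

lemma integral_mul_nuM {F G : ℝ × ℝ → ℝ} (hF : MemLp F 2 nuM) (hG : MemLp G 2 nuM) :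
    ∫ z, F z * G z ∂nuM = ∫ z, F z * G z ∂(volume : Measure ℝ).prod tauM +
      ∫ z, F z * G z ∂(volume : Measure ℝ).prod (Measure.dirac (0:ℝ)) :=
  integral_nuM_add (hF.integrable_mul hG)

lemma Xinf_zero : Xinf (wexp (1/16)) fun _ => 0 := Xinf.of_hasCompactSupport contDiff_const .zero

lemma alg_Xinf_wexp : Alg (Xinf fun _ => 1) (Xinf (wexp (1/16))) := alg_Xinf (wt_wexp (by norm_num) le_rfl) fun z _ => wexp_le_one (by norm_num) z

/-- Data whose boundary and interior parts are smooth and exponentially decaying. -/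
def testSpace : Submodule ℝ XL where
  carrier := {Φ | ∃ b i : ℝ × ℝ → ℝ, Xinf (wexp (1/16)) b ∧ Xinf (wexp (1/16)) i ∧ Φ =ᵐ[nuM] fun z => if z.2 = 0 then b z else i z}
  add_mem' := by
    rintro Φ Φ' ⟨b, i, hb, hi, h⟩ ⟨b', i', hb', hi', h'⟩
    have hA := alg_Xinf_wexp
    refine ⟨_, _, hA.addW hb hb', hA.addW hi hi', ?_⟩
    filter_upwards [h, h', Lp.coeFn_add Φ Φ'] with z e e' e''
    rw [e'', Pi.add_apply, e, e']
    split_ifs <;> rfl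
  zero_mem' := by
    have h0 := Xinf_zero
    refine ⟨_, _, h0, h0, ?_⟩
    filter_upwards [Lp.coeFn_zero ℝ 2 nuM] with z e
    rw [e, ite_self]; rfl
  smul_mem' := by
    rintro c Φ ⟨b, i, hb, hi, h⟩
    have hA := alg_Xinf_wexp
    have hc := hA.const (hA.sub hb) c
    refine ⟨_, _, hA.mulW hc hb, hA.mulW hc hi, ?_⟩
    filter_upwards [h, Lp.coeFn_smul c Φ] with z e e''
    rw [e'', Pi.smul_apply, e, smul_eq_mul]
    split_ifs <;> rfl

lemma testSpace_dense : testSpace.topologicalClosure = ⊤ := by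
  rw [Submodule.topologicalClosure_eq_top_iff, Submodule.eq_bot_iff]
  intro Ψ hΨ
  have h0 := Xinf_zero
  have hW := wt_wexp (by norm_num : (0:ℝ) < 1/16) le_rfl
  have horth : ∀ b i : ℝ × ℝ → ℝ, Xinf (wexp (1/16)) b → Xinf (wexp (1/16)) i →
      Integrable (fun z => (if z.2 = 0 then b z else i z) * Ψ z) nuM ∧ ∫ z, (if z.2 = 0 then b z else i z) * Ψ z ∂nuM = 0 := by
    intro b i hb hi
    have hm : MemLp (fun z : ℝ × ℝ => if z.2 = 0 then b z else i z) 2 nuM :=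
      (hb.bdC.1.piecewise hW hi.bdC.1).memLp_wexp (by norm_num)
    refine ⟨hm.integrable_mul (Lp.memLp Ψ), ?_⟩
    rw [← inner_L2_congr hm.coeFn_toLp (EventuallyEq.refl _ _)]
    exact (Submodule.mem_orthogonal _ _).mp hΨ _ ⟨b, i, hb, hi, hm.coeFn_toLp⟩
  have hloc : LocallyIntegrable Ψ nuM := (Lp.memLp Ψ).locallyIntegrable one_le_two
  apply Lp.ext
  refine EventuallyEq.trans (g := fun _ => (0:ℝ)) ?_ (Lp.coeFn_zero ℝ 2 nuM).symm
  rw [EventuallyEq, ae_nuM_iff]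
  constructor
  · refine ae_eq_zero_of_integral_contDiff_smul_eq_zero (hloc.mono_measure prod_tau_le) fun g hg hc => ?_
    obtain ⟨hi, h⟩ := horth _ g h0 (Xinf.of_hasCompactSupport hg hc)
    rw [integral_nuM_add hi] at h
    rw [integral_congr_ae (μ := volume.prod (Measure.dirac 0)) (g := fun _ => 0)
      (by filter_upwards [ae_bdry] with z hz; simp [hz]), integral_zero, add_zero] at h
    refine (integral_congr_ae ?_).trans h
    filter_upwards [ae_int] with z hz
    simp [hz.ne']
  · refine ae_eq_zero_of_integral_contDiff_smul_eq_zero (hloc.mono_measure dirac_prod_le) fun g hg hc => ?_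
    obtain ⟨hi, h⟩ := horth g _ (Xinf.of_hasCompactSupport hg hc) h0
    rw [integral_nuM_add hi] at h
    rw [integral_congr_ae (μ := volume.prod tauM) (g := fun _ => 0)
      (by filter_upwards [ae_int] with z hz; simp [hz.ne']), integral_zero, zero_add] at h
    refine (integral_congr_ae ?_).trans h
    filter_upwards [ae_bdry] with z hz
    simp [hz]

lemma inner_kerOp_k0 (Ψ Φ : XL) : ⟪kerOp schurBd_k0 Ψ, Φ⟫_ℝ = ⟪Ψ, kerOp schurBd_k0 Φ⟫_ℝ := by
  rw [inner_L2_congr (coeFn_kerOp schurBd_k0 Ψ) (EventuallyEq.refl _ _),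
    inner_L2_congr (EventuallyEq.refl _ _) (coeFn_kerOp schurBd_k0 Φ),
    schurBd_k0.integral_ker_mul (Lp.memLp Ψ) (Lp.memLp Φ)]
  have e : (fun t z z' => k0 t z' z) = k0 := by ext t z z'; exact k0_comm _ _ _
  rw [e]

namespace Prof
variable {f θ : ℝ → ℝ} (h : Prof f θ)
include h

lemma exists_bound_mask : ∃ M : ℝ≥0, ∀ z : ℝ × ℝ, |if z.2 = 0 then 0 else 1 - deriv (deriv f) (θ z.1)| ≤ M := by
  obtain ⟨M, hM⟩ := h.exists_bound_well
  have h0 : 0 ≤ M := (abs_nonneg _).trans (hM 0)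
  refine ⟨⟨1 + M, by positivity⟩, fun z => ?_⟩
  show _ ≤ 1 + M
  split_ifs
  · rw [abs_zero]; positivity
  · exact (abs_sub _ _).trans (by rw [abs_one]; linarith [hM z.1])

lemma measurable_mask : Measurable fun z : ℝ × ℝ => if z.2 = 0 then 0 else 1 - deriv (deriv f) (θ z.1) :=
  Measurable.ite (measurableSet_eq_fun measurable_snd measurable_const) measurable_const
    (measurable_const.sub (h.continuous_well.measurable.comp measurable_fst))

end Prof

/-- Multiplication by `1 - f''(θ)` in the open half-plane and by `0` on the boundary. -/
noncomputable def Prof.wellOp {f θ : ℝ → ℝ} (h : Prof f θ) : XL →L[ℝ] XL :=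
  mulOp h.measurable_mask h.exists_bound_mask.choose_spec

lemma Prof.coeFn_wellOp {f θ : ℝ → ℝ} (h : Prof f θ) (Ψ : XL) :
    h.wellOp Ψ =ᵐ[nuM] fun z => (if z.2 = 0 then 0 else 1 - deriv (deriv f) (θ z.1)) * Ψ z := coeFn_mulOp _ _ Ψ

lemma Prof.isUnit_modified {f θ : ℝ → ℝ} (h : Prof f θ) (hp : MemLp (deriv θ) 2) :
    IsUnit (1 - (h.wellOp - jOp hp ∘L (jOp hp).adjoint) * kerOp schurBd_k0) := by
  obtain ⟨m, hm, hco⟩ := h.coercive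
  refine isUnit_one_sub_of_coercive inner_kerOp_k0 (fun x y => ?_) hm fun Φ => ?_
  · simp only [sub_apply, mul_apply_eq_comp, inner_sub_left, inner_sub_right]
    congr 1
    · rw [inner_L2_congr (h.coeFn_wellOp x) (EventuallyEq.refl _ _), inner_L2_congr (EventuallyEq.refl _ _) (h.coeFn_wellOp y)]
      exact integral_congr_ae (.of_forall fun z => by ring)
    · rw [ContinuousLinearMap.comp_apply, ContinuousLinearMap.comp_apply, ← ContinuousLinearMap.adjoint_inner_right,
        ContinuousLinearMap.adjoint_inner_left]
  · have hmem : Φ ∈ testSpace.topologicalClosure := by rw [testSpace_dense]; trivial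
    refine closure_minimal (t := {Φ : XL | m * ‖kerOp schurBd_k0 Φ‖ ^ 2 ≤ ⟪Φ - (h.wellOp - jOp hp ∘L (jOp hp).adjoint)
      (kerOp schurBd_k0 Φ), kerOp schurBd_k0 Φ⟫_ℝ}) ?_ (isClosed_le (by fun_prop) (by fun_prop)) hmem
    rintro Φ ⟨b, i, hb, hi, hΦ⟩
    set U := kerFun tauM nuM k0 fun z => if z.2 = 0 then b z else i z with hU
    have hKΦ : kerOp schurBd_k0 Φ =ᵐ[nuM] U :=
      (coeFn_kerOp schurBd_k0 Φ).trans (EventuallyEq.of_eq (funext fun z => ker_congr_ae hΦ z))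
    obtain ⟨hq, key⟩ := hco b i U hb hi rfl
    have hUm : MemLp U 2 nuM := (memLp_congr_ae hKΦ).mp (Lp.memLp _)
    have e1 : ‖kerOp schurBd_k0 Φ‖ ^ 2 = ∫ z, U z * U z ∂nuM := by
      rw [← real_inner_self_eq_norm_sq, inner_L2_congr hKΦ hKΦ]
    have e2 : ⟪h.wellOp (kerOp schurBd_k0 Φ), kerOp schurBd_k0 Φ⟫_ℝ =
        ∫ z, (1 - deriv (deriv f) (θ z.1)) * (U z * U z) ∂((volume : Measure ℝ).prod tauM) := by
      have hw := (h.coeFn_wellOp (kerOp schurBd_k0 Φ)).trans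
        (by filter_upwards [hKΦ] with z hz; rw [hz] : _ =ᵐ[nuM] fun z => (if z.2 = 0 then 0 else 1 - deriv (deriv f) (θ z.1)) * U z)
      rw [inner_L2_congr hw hKΦ, integral_mul_nuM ((memLp_congr_ae hw).mp (Lp.memLp _)) hUm,
        integral_congr_ae (μ := volume.prod (Measure.dirac 0)) (g := fun _ => 0)
          (by filter_upwards [ae_bdry] with z hz; simp [hz]), integral_zero, add_zero]
      refine integral_congr_ae ?_
      filter_upwards [ae_int] with z hz
      rw [if_neg hz.ne']; ring
    have e3 : ∫ y, (∫ x, deriv θ x * U (x, y)) * (∫ x, deriv θ x * U (x, y)) ∂tauM ≤ ‖(jOp hp).adjoint (kerOp schurBd_k0 Φ)‖ ^ 2 := by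
      set g : YL := hq.toLp _ with hg
      have e4 : ‖g‖ ^ 2 = ∫ y, (∫ x, deriv θ x * U (x, y)) * (∫ x, deriv θ x * U (x, y)) ∂tauM := by
        rw [← real_inner_self_eq_norm_sq, inner_L2_congr hq.coeFn_toLp hq.coeFn_toLp]
      have hj := memLp_jf hp hq
      have e5 : ⟪(jOp hp).adjoint (kerOp schurBd_k0 Φ), g⟫_ℝ = ‖g‖ ^ 2 := by
        have hjg : jOp hp g =ᵐ[nuM] jf (deriv θ) fun y => ∫ x, deriv θ x * U (x, y) := by
          refine (coeFn_jOp hp g).trans (ae_nuM_iff.mpr ⟨?_, ?_⟩)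
          · filter_upwards [Measure.quasiMeasurePreserving_snd.ae hq.coeFn_toLp] with z hz
            simp only [jf, hg, hz]
          · filter_upwards [ae_bdry] with z hz
            simp only [jf, if_pos hz]
        have hint : Integrable (fun z : ℝ × ℝ => U z * (deriv θ z.1 * ∫ x, deriv θ x * U (x, z.2))) (volume.prod tauM) := by
          refine ((hUm.integrable_mul hj).mono_measure prod_tau_le).congr ?_
          filter_upwards [jf_ae_int (deriv θ) fun y => ∫ x, deriv θ x * U (x, y)] with z hz
          rw [Pi.mul_apply, hz]
        rw [ContinuousLinearMap.adjoint_inner_left, inner_L2_congr hKΦ hjg, integral_mul_nuM hUm hj,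
          integral_congr_ae (μ := volume.prod (Measure.dirac 0)) (g := fun _ => 0)
            (by filter_upwards [ae_bdry] with z hz; simp [jf, hz]), integral_zero, add_zero, e4,
          integral_congr_ae (g := fun z => U z * (deriv θ z.1 * ∫ x, deriv θ x * U (x, z.2)))
            (by filter_upwards [jf_ae_int (deriv θ) fun y => ∫ x, deriv θ x * U (x, y)] with z hz; rw [hz]),
          integral_prod_symm _ hint]
        refine integral_congr_ae (.of_forall fun y => ?_)
        beta_reduce
        rw [← integral_mul_const]
        exact integral_congr_ae (.of_forall fun x => by ring)
      rw [← e4]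
      have := real_inner_le_norm ((jOp hp).adjoint (kerOp schurBd_k0 Φ)) g
      rw [e5] at this
      nlinarith [norm_nonneg g, norm_nonneg ((jOp hp).adjoint (kerOp schurBd_k0 Φ)), sq_nonneg (‖g‖ - ‖(jOp hp).adjoint (kerOp schurBd_k0 Φ)‖)]
    have e6 : ⟪(jOp hp) ((jOp hp).adjoint (kerOp schurBd_k0 Φ)), kerOp schurBd_k0 Φ⟫_ℝ = ‖(jOp hp).adjoint (kerOp schurBd_k0 Φ)‖ ^ 2 := by
      rw [← ContinuousLinearMap.adjoint_inner_right, real_inner_self_eq_norm_sq]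
    simp only [Set.mem_ofPred_eq, sub_apply, ContinuousLinearMap.comp_apply, inner_sub_left]
    rw [e1, e2, e6, inner_L2_congr hΦ hKΦ]
    linarith


/-! ### Sheared and exponentially conjugated kernels -/

lemma abs_exp_neg_sub_le {u v m : ℝ} (hu : m ≤ u) (hv : m ≤ v) : |exp (-u) - exp (-v)| ≤ |u - v| * exp (-m) := by
  wlog h : u ≤ v generalizing u v
  · rw [abs_sub_comm, abs_sub_comm u]; exact this hv hu (le_of_not_ge h)
  have h1 : exp (-u) - exp (-v) ≤ (v - u) * exp (-u) := by
    have e : exp (-v) = exp (-(v - u)) * exp (-u) := by rw [← exp_add]; congr 1; ring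
    nlinarith [add_one_le_exp (-(v - u)), exp_pos (-u)]
  rw [abs_of_nonneg (by linarith [exp_le_exp.mpr (neg_le_neg h)]), abs_sub_comm, abs_of_nonneg (by linarith)]
  exact h1.trans (mul_le_mul_of_nonneg_left (exp_le_exp.mpr (by linarith)) (by linarith))

set_option maxHeartbeats 800000 in
lemma abs_shear_exp_sub_le {c s x y d T : ℝ} (hc : |c| ≤ 1/4) (hs : 0 < s) (hs' : s ^ 2 = 1 - c ^ 2) (hT : 0 < T) (hd : y ^ 2 ≤ d ^ 2) :
    |s⁻¹ * (exp (-(((x + c * y) / s) ^ 2) / T) * exp (-(d ^ 2) / T)) - exp (-(x ^ 2) / T) * exp (-(d ^ 2) / T)| ≤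
      17 * |c| * exp (-(x ^ 2) / (4 * T)) * exp (-(y ^ 2) / (4 * T)) := by
  have hc0 := abs_nonneg c
  have hcc : c ^ 2 ≤ |c| * (1/4) := by rw [← sq_abs]; nlinarith
  have hs2 : 15/16 ≤ s ^ 2 := by rw [hs']; nlinarith
  have hs1 : s ≤ 1 := by nlinarith [sq_nonneg c]
  have hs3 : 3/4 ≤ s := by nlinarith
  set r := (x ^ 2 + y ^ 2) / T with hr
  have hr0 : 0 ≤ r := by positivity
  set a := ((x + c * y) / s) ^ 2 / T with ha
  have e : a + y ^ 2 / T - r = (2 * c * (x * y) + c ^ 2 * (x ^ 2 + y ^ 2)) / (s ^ 2 * T) := by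
    rw [ha, hr, div_pow]; field_simp; rw [hs']; ring
  have hxy : |x * y| ≤ (x ^ 2 + y ^ 2) / 2 := by rw [abs_le]; constructor <;> nlinarith [sq_nonneg (x + y), sq_nonneg (x - y)]
  have h1 : |a + y ^ 2 / T - r| ≤ 2 * |c| * r := by
    rw [e, abs_div, abs_of_pos (by positivity : 0 < s ^ 2 * T), div_le_iff₀ (by positivity), hr]
    have h2 : |2 * c * (x * y) + c ^ 2 * (x ^ 2 + y ^ 2)| ≤ 2 * |c| * ((x ^ 2 + y ^ 2) / 2) + |c| * (1/4) * (x ^ 2 + y ^ 2) := by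
      refine (abs_add_le _ _).trans (add_le_add ?_ ?_)
      · rw [abs_mul, abs_mul, abs_two]; gcongr
      · rw [abs_of_nonneg (by positivity)]; gcongr
    refine h2.trans ?_
    rw [show 2 * |c| * ((x ^ 2 + y ^ 2) / T) * (s ^ 2 * T) = (|c| * (x ^ 2 + y ^ 2)) * (2 * s ^ 2) by field_simp]
    nlinarith [mul_nonneg hc0 (add_nonneg (sq_nonneg x) (sq_nonneg y))]
  have h2 : r / 2 ≤ a + y ^ 2 / T := by
    have := (abs_le.mp h1).1
    nlinarith
  have h3 := (abs_exp_neg_sub_le h2 (by linarith : r / 2 ≤ r)).trans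
    (mul_le_mul_of_nonneg_right h1 (exp_pos _).le)
  have h4 : r * exp (-(r / 2)) ≤ 4 * exp (-(r / 4)) := by
    rw [show -(r / 2) = -(r / 4) + -(r / 4) by ring, exp_add, ← mul_assoc]
    refine mul_le_mul_of_nonneg_right ?_ (exp_pos _).le
    rw [exp_neg, ← div_eq_mul_inv, div_le_iff₀ (exp_pos _)]
    linarith [add_one_le_exp (r / 4)]
  have h5 : |exp (-(a + y ^ 2 / T)) - exp (-r)| ≤ 8 * |c| * exp (-(r / 4)) := by nlinarith
  have h6 : exp (-(d ^ 2) / T) = exp (-(d ^ 2 - y ^ 2) / T) * exp (-(y ^ 2 / T)) := by rw [← exp_add]; congr 1; ring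
  have h7 : exp (-(d ^ 2 - y ^ 2) / T) ≤ 1 := exp_le_one_iff.mpr (div_nonpos_of_nonpos_of_nonneg (by linarith) hT.le)
  have hsi : s⁻¹ ≤ 2 := by rw [inv_le_comm₀ hs two_pos]; linarith
  have hsi1 : |s⁻¹ - 1| ≤ |c| := by
    rw [abs_of_nonneg (by rw [sub_nonneg]; exact (one_le_inv₀ hs).mpr hs1), sub_le_iff_le_add, inv_le_iff_one_le_mul₀ hs]
    nlinarith [sq_nonneg (|c| - 1), sq_abs c]
  have e1 : exp (-(((x + c * y) / s) ^ 2) / T) * exp (-(d ^ 2) / T) = exp (-(d ^ 2 - y ^ 2) / T) * exp (-(a + y ^ 2 / T)) := by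
    rw [h6, neg_add, exp_add, ha, neg_div]; ring
  have e2 : exp (-(x ^ 2) / T) * exp (-(d ^ 2) / T) = exp (-(d ^ 2 - y ^ 2) / T) * exp (-r) := by
    rw [h6, hr, add_div, neg_add, exp_add, neg_div]; ring
  have e3 : exp (-(x ^ 2) / (4 * T)) * exp (-(y ^ 2) / (4 * T)) = exp (-(r / 4)) := by
    rw [← exp_add, hr]; congr 1; field_simp; ring
  have h8 : exp (-r) ≤ exp (-(r / 4)) := exp_le_exp.mpr (by linarith)
  rw [e1, e2, mul_assoc, e3, show s⁻¹ * (exp (-(d ^ 2 - y ^ 2) / T) * exp (-(a + y ^ 2 / T))) - exp (-(d ^ 2 - y ^ 2) / T) * exp (-r) =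
    exp (-(d ^ 2 - y ^ 2) / T) * (s⁻¹ * (exp (-(a + y ^ 2 / T)) - exp (-r)) + (s⁻¹ - 1) * exp (-r)) by ring, abs_mul,
    abs_of_pos (exp_pos _)]
  refine (mul_le_of_le_one_left (abs_nonneg _) h7).trans ((abs_add_le _ _).trans ?_)
  rw [abs_mul, abs_mul, abs_of_pos (inv_pos.mpr hs), abs_of_pos (exp_pos (-r))]
  nlinarith [mul_le_mul hsi h5 (abs_nonneg _) zero_le_two, mul_le_mul hsi1 h8 (exp_pos _).le hc0]

lemma abs_shear_gk_sub_le {c s x y d t : ℝ} (hc : |c| ≤ 1/4) (hs : 0 < s) (hs' : s ^ 2 = 1 - c ^ 2) (ht : 0 < t) (hd : |y| ≤ |d|) :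
    |s⁻¹ * (gk t ((x + c * y) / s) * gk t d) - gk t x * gk t d| ≤ 68 * |c| * (gk (4 * t) x * gk (4 * t) y) := by
  have h := abs_shear_exp_sub_le (T := 4 * t) (x := x) hc hs hs' (by linarith) (sq_le_sq.mpr hd)
  have e : ∀ x, gk (4 * t) x = 2⁻¹ * (√(4 * π * t))⁻¹ * exp (-(x ^ 2) / (4 * (4 * t))) := fun x => by
    rw [gk, show 4 * π * (4 * t) = 2 ^ 2 * (4 * π * t) by ring, sqrt_mul (by norm_num), sqrt_sq zero_le_two, mul_inv]
  rw [e, e]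
  simp only [gk]
  rw [show ∀ q a b a' : ℝ, s⁻¹ * (q * a * (q * b)) - q * a' * (q * b) = q * q * (s⁻¹ * (a * b) - a' * b) by intros; ring, abs_mul,
    abs_of_nonneg (mul_self_nonneg _)]
  refine (mul_le_mul_of_nonneg_left h (mul_self_nonneg _)).trans_eq (by ring)

/-- The `ℓ¹` length of a point. -/
noncomputable def len (z : ℝ × ℝ) : ℝ := |z.1| + |z.2|

/-- The change of variables that normalizes the operator `div A ∇`. -/
noncomputable def shr (c : ℝ) (z : ℝ × ℝ) : ℝ × ℝ := ((z.1 + c * z.2) / √(1 - c ^ 2), z.2)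

/-- The sheared kernel conjugated with the weight `exp (b * len z)`. -/
noncomputable def kap (c b t : ℝ) (z z' : ℝ × ℝ) : ℝ :=
  exp (b * (len z - len z')) * ((√(1 - c ^ 2))⁻¹ * k0 t (shr c z) (shr c z'))

@[fun_prop]
lemma measurable_len : Measurable len := by unfold len; fun_prop

@[fun_prop]
lemma measurable_shr (c : ℝ) : Measurable (shr c) := by unfold shr; fun_prop

lemma measurable_kap (c b : ℝ) : Measurable fun p : ℝ × (ℝ × ℝ) × ℝ × ℝ => kap c b p.1 p.2.1 p.2.2 := by
  unfold kap; fun_prop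

lemma shr_zero (z : ℝ × ℝ) : shr 0 z = z := by simp [shr]

lemma kap_zero : kap 0 0 = k0 := by
  ext t z z'; simp [kap, shr_zero]

lemma abs_len_sub_le (z z' : ℝ × ℝ) : |len z - len z'| ≤ |z.1 - z'.1| + |z.2 - z'.2| := by
  have h1 := abs_abs_sub_abs_le z.1 z'.1
  have h2 := abs_abs_sub_abs_le z.2 z'.2
  unfold len
  rw [show |z.1| + |z.2| - (|z'.1| + |z'.2|) = (|z.1| - |z'.1|) + (|z.2| - |z'.2|) by ring]
  exact (abs_add_le _ _).trans (add_le_add h1 h2)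

lemma exp_mul_gk_gk_le {t : ℝ} (ht : 0 < t) (z z' : ℝ × ℝ) :
    exp (1/16 * (|z.1 - z'.1| + |z.2 - z'.2|)) * (exp (-t) * (gk (4 * t) (z.1 - z'.1) * gk (4 * t) (z.2 - z'.2))) ≤
      4 * (exp (-t / 2) * Dk t z z') := by
  have key : ∀ x, exp (1/16 * |x|) * gk (4 * t) x ≤ 2 * exp (t / 32) * gk (8 * t) x := fun x => by
    have := exp_mul_gk_le (β := 1/16) (by linarith : 0 < 4 * t) x
    rwa [show 2 * (1/16 : ℝ) ^ 2 * (4 * t) = t / 32 by ring, show 2 * (4 * t) = 8 * t by ring] at this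
  rw [mul_add, exp_add]
  have e : exp (-t) * (exp (t / 32) * exp (t / 32)) ≤ exp (-t / 2) := by
    rw [← exp_add, ← exp_add]; exact exp_le_exp.mpr (by linarith)
  have hg := gk_nonneg (8 * t)
  have hg' := gk_nonneg (4 * t)
  calc _ = exp (-t) * ((exp (1/16 * |z.1 - z'.1|) * gk (4 * t) (z.1 - z'.1)) * (exp (1/16 * |z.2 - z'.2|) * gk (4 * t) (z.2 - z'.2))) := by ring
    _ ≤ exp (-t) * ((2 * exp (t / 32) * gk (8 * t) (z.1 - z'.1)) * (2 * exp (t / 32) * gk (8 * t) (z.2 - z'.2))) :=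
      mul_le_mul_of_nonneg_left (mul_le_mul (key _) (key _) (mul_nonneg (exp_pos _).le (hg' _))
        (mul_nonneg (by positivity) (hg _))) (exp_pos _).le
    _ = 4 * ((exp (-t) * (exp (t / 32) * exp (t / 32))) * Dk t z z') := by unfold Dk; ring
    _ ≤ _ := mul_le_mul_of_nonneg_left (mul_le_mul_of_nonneg_right e (Dk_nonneg _ _ _)) (by norm_num)

lemma abs_kap_sub_le {c b t : ℝ} {z z' : ℝ × ℝ} (hc : |c| ≤ 1/4) (hb : 0 ≤ b) (hb' : b ≤ 1/16) (ht : 0 < t) (hz : 0 ≤ z.2)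
    (hz' : 0 ≤ z'.2) : |kap c b t z z' - kap 0 b t z z'| ≤ 544 * |c| * (exp (-t / 2) * Dk t z z') := by
  have hs2 : 0 < 1 - c ^ 2 := by nlinarith [sq_abs c, abs_nonneg c]
  set s := √(1 - c ^ 2) with hs
  have h1 : |s⁻¹ * k0 t (shr c z) (shr c z') - k0 t z z'| ≤ 136 * |c| * (exp (-t) * (gk (4 * t) (z.1 - z'.1) * gk (4 * t) (z.2 - z'.2))) := by
    have e : (shr c z).1 - (shr c z').1 = ((z.1 - z'.1) + c * (z.2 - z'.2)) / s := by simp only [shr, ← hs]; ring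
    have a1 := abs_shear_gk_sub_le (x := z.1 - z'.1) (y := z.2 - z'.2) (d := z.2 - z'.2) hc (sqrt_pos.mpr hs2) (sq_sqrt hs2.le) ht le_rfl
    have a2 := abs_shear_gk_sub_le (x := z.1 - z'.1) (y := z.2 - z'.2) (d := z.2 + z'.2) hc (sqrt_pos.mpr hs2) (sq_sqrt hs2.le) ht
      (by rw [abs_of_nonneg (add_nonneg hz hz'), abs_le]; constructor <;> linarith)
    rw [← hs] at a1 a2
    rw [k0, k0, e, nk, nk, show (shr c z).2 = z.2 from rfl, show (shr c z').2 = z'.2 from rfl]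
    set X := ((z.1 - z'.1) + c * (z.2 - z'.2)) / s
    rw [show s⁻¹ * (exp (-t) * (gk t X * (gk t (z.2 - z'.2) + gk t (z.2 + z'.2)))) -
      exp (-t) * (gk t (z.1 - z'.1) * (gk t (z.2 - z'.2) + gk t (z.2 + z'.2))) = exp (-t) * ((s⁻¹ * (gk t X * gk t (z.2 - z'.2)) -
        gk t (z.1 - z'.1) * gk t (z.2 - z'.2)) + (s⁻¹ * (gk t X * gk t (z.2 + z'.2)) - gk t (z.1 - z'.1) * gk t (z.2 + z'.2))) by ring,
      abs_mul, abs_of_pos (exp_pos _)]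
    have := mul_le_mul_of_nonneg_left ((abs_add_le _ _).trans (add_le_add a1 a2)) (exp_pos (-t)).le
    refine this.trans_eq (by ring)
  have h2 : exp (b * (len z - len z')) ≤ exp (1/16 * (|z.1 - z'.1| + |z.2 - z'.2|)) := by
    have h3 := abs_len_sub_le z z'
    have := le_abs_self (len z - len z')
    have := abs_nonneg (len z - len z')
    exact exp_le_exp.mpr (by nlinarith)
  have e : kap c b t z z' - kap 0 b t z z' = exp (b * (len z - len z')) * (s⁻¹ * k0 t (shr c z) (shr c z') - k0 t z z') := by
    simp only [kap, shr_zero, ← hs]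
    norm_num
    ring
  rw [e, abs_mul, abs_of_pos (exp_pos _)]
  refine (mul_le_mul h2 h1 (abs_nonneg _) (exp_pos _).le).trans ?_
  have := mul_le_mul_of_nonneg_left (exp_mul_gk_gk_le ht z z') (by positivity : 0 ≤ 136 * |c|)
  calc _ = 136 * |c| * (exp (1/16 * (|z.1 - z'.1| + |z.2 - z'.2|)) * (exp (-t) * (gk (4 * t) (z.1 - z'.1) * gk (4 * t) (z.2 - z'.2)))) := by ring
    _ ≤ _ := this
    _ = _ := by ring

lemma abs_kap_zero_sub_le {b t : ℝ} {z z' : ℝ × ℝ} (hb : 0 ≤ b) (hb' : b ≤ 1/32) (ht : 0 < t) (hz : 0 ≤ z.2)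
    (hz' : 0 ≤ z'.2) : |kap 0 b t z z' - k0 t z z'| ≤ 1024 * b * (exp (-t / 2) * Dk t z z') := by
  have h3 := abs_len_sub_le z z'
  set δ := |z.1 - z'.1| + |z.2 - z'.2| with hδ
  have hδ0 : 0 ≤ δ := by positivity
  have h1 : |exp (b * (len z - len z')) - 1| ≤ 32 * b * exp (1/16 * δ) := by
    have h4 := abs_exp_neg_sub_le (u := -(b * (len z - len z'))) (v := 0) (m := -(b * δ))
      (by nlinarith [le_abs_self (len z - len z')]) (by nlinarith)
    rw [neg_neg, neg_neg, neg_zero, exp_zero, sub_zero, abs_neg, abs_mul, abs_of_nonneg hb] at h4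
    refine h4.trans ?_
    have h5 : δ ≤ 32 * exp (1/32 * δ) := by linarith [add_one_le_exp (1/32 * δ)]
    calc b * |len z - len z'| * exp (b * δ) ≤ b * (32 * exp (1/32 * δ)) * exp (1/32 * δ) := by
          refine mul_le_mul (mul_le_mul_of_nonneg_left (h3.trans h5) hb) (exp_le_exp.mpr (by nlinarith)) (exp_pos _).le (by positivity)
      _ = 32 * b * exp (1/16 * δ) := by rw [show 1/16 * δ = 1/32 * δ + 1/32 * δ by ring, exp_add]; ring
  have h2 : k0 t z z' ≤ 8 * (exp (-t) * (gk (4 * t) (z.1 - z'.1) * gk (4 * t) (z.2 - z'.2))) := by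
    have g : ∀ x, gk t x ≤ 2 * gk (4 * t) x := gk_le_of_le ht (by linarith) le_rfl
    rw [k0]
    calc exp (-t) * (gk t (z.1 - z'.1) * nk t z.2 z'.2) ≤ exp (-t) * ((2 * gk (4 * t) (z.1 - z'.1)) * (2 * (2 * gk (4 * t) (z.2 - z'.2)))) :=
          mul_le_mul_of_nonneg_left (mul_le_mul (g _) ((nk_le ht hz hz').trans (mul_le_mul_of_nonneg_left (g _) zero_le_two))
            (nk_nonneg _ _ _) (mul_nonneg zero_le_two (gk_nonneg _ _))) (exp_pos _).le
      _ = _ := by ring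
  have e : kap 0 b t z z' - k0 t z z' = (exp (b * (len z - len z')) - 1) * k0 t z z' := by
    simp only [kap, shr_zero]; norm_num; ring
  rw [e, abs_mul, abs_of_nonneg (k0_nonneg _ _ _)]
  refine (mul_le_mul h1 h2 (k0_nonneg _ _ _) (by positivity)).trans ?_
  have := mul_le_mul_of_nonneg_left (exp_mul_gk_gk_le ht z z') (by positivity : 0 ≤ 256 * b)
  calc _ = 256 * b * (exp (1/16 * δ) * (exp (-t) * (gk (4 * t) (z.1 - z'.1) * gk (4 * t) (z.2 - z'.2)))) := by ring
    _ ≤ _ := this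
    _ = _ := by ring

lemma abs_kap_le {c b t : ℝ} {z z' : ℝ × ℝ} (hc : |c| ≤ 1/4) (hb : 0 ≤ b) (hb' : b ≤ 1/32) (ht : 0 < t) (hz : 0 ≤ z.2)
    (hz' : 0 ≤ z'.2) : |kap c b t z z'| ≤ (200 : ℝ≥0) * (exp (-t / 2) * Dk t z z') := by
  have h1 := abs_kap_sub_le hc hb (by linarith) ht hz hz'
  have h2 := abs_kap_zero_sub_le hb hb' ht hz hz'
  have h3 := abs_k0_le_Dk ht hz hz'
  have hD : 0 ≤ exp (-t / 2) * Dk t z z' := mul_nonneg (exp_pos _).le (Dk_nonneg _ _ _)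
  have e : kap c b t z z' = (kap c b t z z' - kap 0 b t z z') + (kap 0 b t z z' - k0 t z z') + k0 t z z' := by ring
  rw [e]
  refine ((abs_add_le _ _).trans (add_le_add_left (abs_add_le _ _) _)).trans ?_
  push_cast at h3 ⊢
  nlinarith [abs_nonneg c]

lemma SchurBd.of_le_Dk {κ : ℝ → ℝ × ℝ → ℝ × ℝ → ℝ}
    (hm : Measurable (fun p : ℝ × (ℝ × ℝ) × ℝ × ℝ => κ p.1 p.2.1 p.2.2)) {C : ℝ≥0}
    (h : ∀ t z z', 0 < t → 0 ≤ z.2 → 0 ≤ z'.2 → |κ t z z'| ≤ C * (exp (-t / 2) * Dk t z z')) :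
    SchurBd tauM nuM κ (C * AD) :=
  .of_le_Dm hm fun t z z' ht hz hz' => (h t z z' ht hz hz').trans
    (mul_le_mul_of_nonneg_left (exp_mul_Dk_le_Dm ht z z') C.2)

lemma schurBd_kap {c b : ℝ} (hc : |c| ≤ 1/4) (hb : 0 ≤ b) (hb' : b ≤ 1/32) : SchurBd tauM nuM (kap c b) (200 * AD) :=
  .of_le_Dk (measurable_kap c b) fun _ _ _ => abs_kap_le hc hb hb'

lemma norm_kerOp_kap_sub_le {c b : ℝ} (hc : |c| ≤ 1/4) (hb : 0 ≤ b) (hb' : b ≤ 1/32) :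
    ‖kerOp (schurBd_kap hc hb hb') - kerOp (schurBd_kap (c := 0) (by norm_num) hb hb')‖ ≤ 544 * |c| * AD := by
  have h := norm_kerOp_sub_le (schurBd_kap hc hb hb') (schurBd_kap (c := 0) (by norm_num) hb hb')
    (.of_le_Dk ((measurable_kap c b).sub (measurable_kap 0 b)) (C := 544 * |c|.toNNReal) fun t z z' ht hz hz' => by
      simpa [Real.coe_toNNReal] using abs_kap_sub_le hc hb (by linarith) ht hz hz')
  simpa [Real.coe_toNNReal] using h

lemma norm_kerOp_kap_zero_sub_le {b : ℝ} (hb : 0 ≤ b) (hb' : b ≤ 1/32) :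
    ‖kerOp (schurBd_kap (c := 0) (by norm_num) hb hb') - kerOp schurBd_k0‖ ≤ 1024 * b * AD := by
  have h := norm_kerOp_sub_le (schurBd_kap (c := 0) (by norm_num) hb hb') schurBd_k0
    (.of_le_Dk ((measurable_kap 0 b).sub (by fun_prop)) (C := 1024 * b.toNNReal) fun t z z' ht hz hz' => by
      simpa [Real.coe_toNNReal, hb] using abs_kap_zero_sub_le hb hb' ht hz hz')
  simpa [Real.coe_toNNReal, hb] using h


/-! ### The right inverse of the weighted linearized operator -/

lemma memLp_exp_abs {a : ℝ} (ha : 0 < a) : MemLp (fun x : ℝ => exp (-a * |x|)) 2 volume := by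
  rw [memLp_two_iff_integrable_sq (by fun_prop)]
  refine (integrable_exp_mul_abs (a := a + a) (by positivity)).congr (.of_forall fun x => ?_)
  beta_reduce
  rw [sq, ← exp_add]; congr 1; ring

lemma eLpNorm_le_of_le_exp {a C : ℝ} (hC : 0 ≤ C) {φ : ℝ → ℝ} (h : ∀ x, |φ x| ≤ C * exp (-a * |x|)) :
    eLpNorm φ 2 volume ≤ ENNReal.ofReal C * eLpNorm (fun x : ℝ => exp (-a * |x|)) 2 volume := by
  refine (eLpNorm_le_nnreal_smul_eLpNorm_of_ae_le_mul (c := C.toNNReal) (.of_forall fun x => ?_) 2)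
  rw [← NNReal.coe_le_coe, NNReal.coe_mul, coe_nnnorm, coe_nnnorm, norm_eq_abs, norm_eq_abs, abs_exp, Real.coe_toNNReal _ hC]
  exact h x

lemma exists_isUnit_near {E F : Type*} [NormedAddCommGroup E] [InnerProductSpace ℝ E] [CompleteSpace E]
    [NormedAddCommGroup F] [InnerProductSpace ℝ F] [CompleteSpace F] (M K : F →L[ℝ] F) (J : E →L[ℝ] F)
    (hu : IsUnit (1 - (M - J ∘L J.adjoint) * K)) : ∃ δ > 0, ∀ (J₁ J₂ : E →L[ℝ] F) (K' : F →L[ℝ] F),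
      ‖J₁ - J‖ < δ → ‖J₂ - J‖ < δ → ‖K' - K‖ < δ → IsUnit (1 - (M - J₁ ∘L J₂.adjoint) * K') := by
  have hc : Continuous fun p : (E →L[ℝ] F) × (E →L[ℝ] F) × (F →L[ℝ] F) => (1 - (M - p.1 ∘L p.2.1.adjoint) * p.2.2 : F →L[ℝ] F) := by
    have h1 : Continuous fun p : (E →L[ℝ] F) × (E →L[ℝ] F) × (F →L[ℝ] F) => p.2.1.adjoint :=
      ContinuousLinearMap.adjoint.continuous.comp (continuous_fst.comp continuous_snd)
    exact continuous_const.sub ((continuous_const.sub (continuous_fst.clm_comp h1)).mul (continuous_snd.comp continuous_snd))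
  obtain ⟨δ, hδ, hball⟩ := Metric.isOpen_iff.mp (Units.isOpen.preimage hc) (J, J, K) hu
  refine ⟨δ, hδ, fun J₁ J₂ K' h1 h2 h3 => hball (a := (J₁, J₂, K')) ?_⟩
  rw [Metric.mem_ball, Prod.dist_eq, Prod.dist_eq, dist_eq_norm, dist_eq_norm, dist_eq_norm]
  exact max_lt h1 (max_lt h2 h3)

/-- The weighted profile derivative. -/
noncomputable def wprof (θ : ℝ → ℝ) (b x : ℝ) : ℝ := exp (b * |x|) * deriv θ x

namespace Prof
variable {f θ : ℝ → ℝ} (h : Prof f θ)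
include h

lemma measurable_wprof (b : ℝ) : Measurable (wprof θ b) :=
  (by fun_prop : Measurable fun x : ℝ => exp (b * |x|)).mul h.continuous_deriv.measurable

lemma exists_memLp_wprof : ∃ κ > 0, (∃ C, 0 ≤ C ∧ ∀ b, |b| ≤ κ → ∀ x, |wprof θ b x| ≤ C * exp (-κ * |x|)) ∧ (∀ b, |b| ≤ κ → MemLp (wprof θ b) 2 volume) ∧
    ∃ L : ℝ, ∀ b, |b| ≤ κ → (eLpNorm (wprof θ b - wprof θ 0) 2 volume).toReal ≤ L * |b| := by
  obtain ⟨κ, hκ, C, hC, -⟩ := h.exists_decay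
  have hC0 : 0 ≤ C := by simpa using (abs_nonneg _).trans (hC 0)
  have hE := memLp_exp_abs (a := κ / 2) (by positivity)
  have hD : ∀ b, |b| ≤ κ / 4 → ∀ x, |wprof θ b x| ≤ C * exp (-(κ / 4) * |x|) := fun b hb x => by
    rw [wprof, abs_mul, abs_exp]
    refine (mul_le_mul_of_nonneg_left (hC x) (exp_pos _).le).trans ?_
    rw [mul_left_comm, ← exp_add]
    refine mul_le_mul_of_nonneg_left (exp_le_exp.mpr ?_) hC0
    nlinarith [le_abs_self b, abs_nonneg x]
  refine ⟨κ / 4, by positivity, ⟨C, hC0, hD⟩, fun b hb => ⟨(h.measurable_wprof b).aestronglyMeasurable,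
    (eLpNorm_le_of_le_exp hC0 (hD b hb)).trans_lt (ENNReal.mul_lt_top ENNReal.ofReal_lt_top (memLp_exp_abs (by positivity)).2)⟩,
    C * (4 / κ) * (eLpNorm (fun x : ℝ => exp (-(κ / 2) * |x|)) 2 volume).toReal, fun b hb => ?_⟩
  · have key : ∀ x, |(wprof θ b - wprof θ 0) x| ≤ |b| * (C * (4 / κ)) * exp (-(κ / 2) * |x|) := fun x => by
      have e : (wprof θ b - wprof θ 0) x = (exp (b * |x|) - 1) * deriv θ x := by simp [wprof, sub_mul]
      rw [e, abs_mul]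
      have h1 := abs_exp_neg_sub_le (u := -(b * |x|)) (v := 0) (m := -(κ / 4 * |x|))
        (by nlinarith [le_abs_self b, abs_nonneg x]) (by nlinarith [abs_nonneg x])
      rw [neg_neg, neg_neg, neg_zero, exp_zero, sub_zero, abs_neg, abs_mul, abs_abs] at h1
      have h2 : |x| ≤ 4 / κ * exp (κ / 4 * |x|) := by
        rw [div_mul_eq_mul_div, le_div_iff₀ hκ]; linarith [add_one_le_exp (κ / 4 * |x|)]
      have h3 : |exp (b * |x|) - 1| ≤ |b| * (4 / κ * exp (κ / 4 * |x|)) * exp (κ / 4 * |x|) :=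
        h1.trans (mul_le_mul_of_nonneg_right (mul_le_mul_of_nonneg_left h2 (abs_nonneg b)) (exp_pos _).le)
      refine (mul_le_mul h3 (hC x) (abs_nonneg _) (by positivity)).trans_eq ?_
      rw [show -(κ / 2) * |x| = κ / 4 * |x| + κ / 4 * |x| + -κ * |x| by ring, exp_add, exp_add]; ring
    have := ENNReal.toReal_mono (ENNReal.mul_ne_top ENNReal.ofReal_ne_top hE.2.ne) (eLpNorm_le_of_le_exp (by positivity) key)
    rw [ENNReal.toReal_mul, ENNReal.toReal_ofReal (by positivity)] at this
    refine this.trans_eq (by ring)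

/-- Invertibility of the modified weighted operator for small weights. -/
lemma exists_isUnit_weighted : ∃ κ > 0, (∃ C, 0 ≤ C ∧ ∀ b, |b| ≤ κ → ∀ x, |wprof θ b x| ≤ C * exp (-κ * |x|)) ∧
    ∃ hm : ∀ b, |b| ≤ κ → MemLp (wprof θ b) 2 volume, ∀ b, ∀ hb : 0 < b, ∀ hbκ : b ≤ κ, ∀ hb' : b ≤ 1/32,
    IsUnit (1 - (h.wellOp - jOp (hm b (by rwa [abs_of_pos hb])) ∘L (jOp (hm (-b) (by rwa [abs_neg, abs_of_pos hb]))).adjoint) *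
      kerOp (schurBd_kap (c := 0) (by norm_num) hb.le hb')) := by
  obtain ⟨κ, hκ, ⟨C, hC0, hC⟩, hm, L, hL⟩ := h.exists_memLp_wprof
  have h0 : MemLp (wprof θ 0) 2 volume := hm 0 (by rw [abs_zero]; exact hκ.le)
  have hu : IsUnit (1 - (h.wellOp - jOp h0 ∘L (jOp h0).adjoint) * kerOp schurBd_k0) := by
    have e : wprof θ 0 = deriv θ := by ext x; simp [wprof]
    revert h0; rw [e]; exact fun h0 => h.isUnit_modified h0
  obtain ⟨δ, hδ, hball⟩ := exists_isUnit_near h.wellOp (kerOp schurBd_k0) (jOp h0) hu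
  set M := max 1 (max L (1024 * AD))
  have hM : 0 < M := lt_max_of_lt_left one_pos
  refine ⟨min κ (δ / (2 * M)), by positivity, ⟨C, hC0, fun b hb x => (hC b (hb.trans (min_le_left _ _)) x).trans
    (mul_le_mul_of_nonneg_left (exp_le_exp.mpr (mul_le_mul_of_nonneg_right (neg_le_neg (min_le_left _ _)) (abs_nonneg x))) hC0)⟩, fun b hb => hm b (hb.trans (min_le_left _ _)), fun b hb hbκ hb' => ?_⟩
  have hbM : M * b < δ := by
    have := hbκ.trans (min_le_right _ _)
    rw [le_div_iff₀ (by positivity)] at this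
    nlinarith
  have hk : |b| ≤ κ := by rw [abs_of_pos hb]; exact hbκ.trans (min_le_left _ _)
  have hj : ∀ b', |b'| = b → ∀ hb'' : |b'| ≤ κ, ‖jOp (hm b' hb'') - jOp h0‖ < δ := fun b' e hb'' => by
    rw [jOp_sub]
    refine ((norm_jOp_le _).trans (hL b' hb'')).trans_lt (lt_of_le_of_lt ?_ hbM)
    rw [e]
    exact mul_le_mul_of_nonneg_right ((le_max_left _ _).trans (le_max_right _ _)) hb.le
  refine hball _ _ _ (hj b (abs_of_pos hb) hk) (hj (-b) (by rw [abs_neg, abs_of_pos hb]) (by rwa [abs_neg])) ?_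
  refine (norm_kerOp_kap_zero_sub_le hb.le hb').trans_lt (lt_of_le_of_lt ?_ hbM)
  rw [mul_right_comm]
  exact mul_le_mul_of_nonneg_right ((le_max_right _ _).trans (le_max_right _ _)) hb.le

end Prof

/-- The kernel of the decaying second antiderivative on the half-line, conjugated with `exp (b y)`. -/
noncomputable def hk (b : ℝ) (_ : Unit) (y s : ℝ) : ℝ := if y < s then -((s - y) * exp (-b * (s - y))) else 0

lemma exists_schurBd_hk {b : ℝ} (hb : 0 < b) : ∃ A, SchurBd (Measure.dirac ()) tauM (hk b) A := by
  set g : ℝ → ℝ := fun u => |u| * exp (-b * |u|) with hg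
  have hgi : Integrable g := by
    refine ((integrable_exp_mul_abs (a := b / 2) (by positivity)).const_mul (2 / b)).mono' (by fun_prop) (.of_forall fun u => ?_)
    rw [hg, norm_mul, norm_eq_abs, norm_eq_abs, abs_abs, abs_exp, show -b * |u| = -(b / 2) * |u| + -(b / 2) * |u| by ring, exp_add, ← mul_assoc]
    refine mul_le_mul_of_nonneg_right ?_ (exp_pos _).le
    rw [neg_mul, exp_neg, ← div_eq_mul_inv, div_le_div_iff₀ (exp_pos _) hb]
    linarith [add_one_le_exp (b / 2 * |u|)]
  have hle : ∀ y s, ‖hk b () y s‖ₑ ≤ ‖g (y - s)‖ₑ := fun y s => by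
    rw [hk]
    split_ifs with h
    · simp only [hg]; rw [enorm_neg, abs_sub_comm, abs_of_pos (sub_pos.mpr h)]
    · simp
  have hmeas : Measurable fun p : Unit × ℝ × ℝ => hk b p.1 p.2.1 p.2.2 :=
    Measurable.ite (measurableSet_lt (by fun_prop) (by fun_prop)) (by fun_prop) measurable_const
  have e : ∀ F : Unit × ℝ → ℝ≥0∞, Measurable F → ∫⁻ p, F p ∂((Measure.dirac ()).prod tauM) = ∫⁻ s, F ((), s) ∂tauM := fun F hF => by
    rw [Measure.dirac_prod, lintegral_map hF (by fun_prop)]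
  have hA : ∀ y, ∫⁻ s, ‖g (y - s)‖ₑ ∂tauM ≤ ((∫⁻ u, ‖g u‖ₑ).toNNReal : ℝ≥0∞) := fun y => by
    rw [ENNReal.coe_toNNReal hgi.2.ne]
    exact (lintegral_mono' Measure.restrict_le_self le_rfl).trans (lintegral_sub_left_eq_self (fun u => ‖g u‖ₑ) y).le
  refine ⟨(∫⁻ u, ‖g u‖ₑ).toNNReal, hmeas, Eventually.of_forall fun y => ?_, Eventually.of_forall fun s => ?_⟩
  · rw [e (fun p => ‖hk b p.1 y p.2‖ₑ) (hmeas.comp (by fun_prop : Measurable fun p : Unit × ℝ => (p.1, y, p.2))).enorm]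
    exact (lintegral_mono fun s => hle y s).trans (hA y)
  · rw [e (fun p => ‖hk b p.1 p.2 s‖ₑ) (hmeas.comp (by fun_prop : Measurable fun p : Unit × ℝ => (p.1, p.2, s))).enorm]
    refine (lintegral_mono fun y => (hle y s).trans_eq ?_).trans (hA s)
    simp only [hg]; rw [abs_sub_comm]

lemma kerFun_hk {b : ℝ} {p : ℝ → ℝ} (hp : Measurable p) {y : ℝ} (hy : 0 < y) :
    kerFun (Measure.dirac ()) tauM (hk b) p y = exp (b * y) * -∫ s in Set.Ioi y, (s - y) * (exp (-b * s) * p s) := by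
  have hm : Measurable fun s => hk b () y s * p s :=
    (Measurable.ite (measurableSet_lt measurable_const measurable_id) (by fun_prop) measurable_const).mul hp
  have e : (fun s => hk b () y s * p s) = (Set.Ioi y).indicator fun s => exp (b * y) * -((s - y) * (exp (-b * s) * p s)) := by
    ext s
    by_cases h : y < s
    · rw [Set.indicator_of_mem (show s ∈ Set.Ioi y from h), hk, if_pos h, show -b * (s - y) = b * y + -b * s by ring, exp_add]; ring
    · rw [Set.indicator_of_notMem (show s ∉ Set.Ioi y from h), hk, if_neg h, zero_mul]
  rw [kerFun, Measure.dirac_prod, integral_map (by fun_prop) (by exact (hm.comp measurable_snd).aestronglyMeasurable), ← integral_neg,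
    ← integral_const_mul, tauM]
  beta_reduce
  rw [e, integral_indicator measurableSet_Ioi, Measure.restrict_restrict measurableSet_Ioi, Set.Ioi_inter_Ioi, sup_of_le_left hy.le]


lemma kap_mul_exp (c b t : ℝ) (z z' : ℝ × ℝ) (a : ℝ) : kap c b t z z' * (exp (b * len z') * a) = exp (b * len z) * (kap c 0 t z z' * a) := by
  have e : exp (b * (len z - len z')) * exp (b * len z') = exp (b * len z) := by rw [← exp_add]; congr 1; ring
  rw [kap, kap, zero_mul, exp_zero, ← e]; ring

lemma kerFun_kap_exp (c b : ℝ) (ψ : ℝ × ℝ → ℝ) (z : ℝ × ℝ) :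
    kerFun tauM nuM (kap c b) (fun z => exp (b * len z) * ψ z) z = exp (b * len z) * kerFun tauM nuM (kap c 0) ψ z := by
  rw [kerFun, kerFun, ← integral_const_mul]
  exact integral_congr_ae (.of_forall fun p => kap_mul_exp c b _ _ _ _)

/-- The weighted boundary trace of the profile derivative. -/
noncomputable def qf (θ : ℝ → ℝ) (b : ℝ) (z : ℝ × ℝ) : ℝ := if z.2 = 0 then wprof θ b z.1 else 0

lemma integral_Ioi_of_eq_zero {F F' : ℝ → ℝ} {y M : ℝ} (hF : ∀ s, HasDerivAt F (F' s) s) (hF' : Continuous F')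
    (h0 : ∀ s, M ≤ s → F s = 0 ∧ F' s = 0) (hM : y ≤ M) : ∫ s in Set.Ioi y, F' s = -F y := by
  have hi : IntegrableOn F' (Set.Ioi y) := by
    rw [← Set.Ioc_union_Ioi_eq_Ioi hM]
    refine IntegrableOn.union ((hF'.integrableOn_Icc (a := y) (b := M)).mono_set Set.Ioc_subset_Icc_self) ?_
    exact integrableOn_zero.congr_fun (fun s hs => (h0 s (le_of_lt hs)).2.symm) measurableSet_Ioi
  rw [integral_Ioi_of_hasDerivAt_of_tendsto' (m := 0) (fun s _ => hF s) hi, zero_sub]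
  exact tendsto_const_nhds.congr' (by filter_upwards [eventually_ge_atTop M] with s hs using (h0 s hs).1.symm)

/-- Second antiderivative vanishing at infinity. -/
lemma exists_antideriv₂ {ζ : ℝ → ℝ} (hζ : Continuous ζ) {M : ℝ} (hM : 0 ≤ M) (h0 : ∀ y, M ≤ y → ζ y = 0) :
    ∃ h h' : ℝ → ℝ, (∀ y, HasDerivAt h (h' y) y) ∧ (∀ y, HasDerivAt h' (-ζ y) y) ∧ (∀ y, M ≤ y → h y = 0 ∧ h' y = 0) ∧
      (∀ y, ∫ s in Set.Ioi y, (s - y) * ζ s = -h y) ∧ ∀ y, ∫ s in Set.Ioi y, ζ s = h' y := by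
  obtain ⟨η, hη, η0⟩ := exists_antideriv (ζ := fun y => -ζ y) hζ.neg hM fun y hy => by rw [h0 y hy, neg_zero]
  obtain ⟨h, hh, hh0⟩ := exists_antideriv (ζ := η) (.of_hasDerivAt hη) hM η0
  refine ⟨h, η, hh, hη, fun y hy => ⟨hh0 y hy, η0 y hy⟩, fun y => ?_, fun y => ?_⟩
  · rw [integral_Ioi_of_eq_zero (F := fun s => h s - (s - y) * η s) (M := max y M) (fun s => ((hh s).sub (((hasDerivAt_id s).sub_const y).mul (hη s))).congr_deriv (by simp))
      (by fun_prop) (fun s hs => ?_) (le_max_left _ _)]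
    · simp
    · have := (le_max_right y M).trans hs
      simp [hh0 s this, η0 s this, h0 s this]
  · rw [integral_Ioi_of_eq_zero (F := fun s => -η s) (M := max y M) (fun s => (hη s).neg.congr_deriv (neg_neg _)) hζ
      (fun s hs => ?_) (le_max_left _ _), neg_neg]
    have := (le_max_right y M).trans hs
    simp [η0 s this, h0 s this]

namespace Prof
variable {f θ : ℝ → ℝ} (h : Prof f θ)
include h

lemma exists_bddC2R : ∃ C, BddC2R (deriv θ) (fun x => deriv f (θ x)) (fun x => deriv (deriv f) (θ x) * deriv θ x) C := by
  obtain ⟨κ, hκ, C, hC, hφ⟩ := h.exists_decay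
  obtain ⟨C', hC'⟩ := hφ (deriv f) h.hf.deriv_infty h.dp h.dm
  obtain ⟨M, hM⟩ := h.exists_bound_well
  have hb := abs_le_of_le_exp hκ hC
  exact ⟨_, BddC2R.of_bounds h.hasDerivAt' (fun x => (h.hf.deriv_infty.hasDerivAt _).comp x (h.hasDerivAt x))
    (h.continuous_well.mul h.continuous_deriv).measurable hb (abs_le_of_le_exp hκ hC') fun x => by
      rw [abs_mul]
      exact mul_le_mul (hM x) (hb x) (abs_nonneg _) ((abs_nonneg _).trans (hM 0))⟩

lemma kerFun_kap_antideriv {b : ℝ} {p : ℝ → ℝ} (hp : Continuous p) {M : ℝ} (hM : 0 ≤ M) (h0 : ∀ y, M ≤ y → p y = 0)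
    (hb : 0 < b) : ∃ g, (∀ y, 0 < y → kerFun (Measure.dirac ()) tauM (hk b) p y = g y) ∧ ∀ z : ℝ × ℝ, 0 ≤ z.2 →
      kerFun tauM nuM (kap 0 b) (fun z => (if z.2 = 0 then 0 else 1 - deriv (deriv f) (θ z.1)) * jf (wprof θ b) g z + jf (wprof θ b) p z
        - (∫ s, exp (-b * |s|) * p s ∂tauM) * qf θ b z) z = wprof θ b z.1 * g z.2 := by
  have hζ : Continuous fun s => exp (-b * s) * p s := by fun_prop
  obtain ⟨η, η', d1, d2, z0, i2, i1⟩ := exists_antideriv₂ hζ hM fun y hy => by rw [h0 y hy, mul_zero]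
  have hη : Continuous η := .of_hasDerivAt d1
  have hη' : Continuous η' := .of_hasDerivAt d2
  obtain ⟨C, hC⟩ := h.exists_bddC2R
  obtain ⟨C1, hg⟩ := exists_bddC2 d1 d2 hζ.neg (fun y hy => (z0 y hy).1) (fun y hy => (z0 y hy).2)
    fun y hy => by rw [h0 y hy, mul_zero, neg_zero]
  refine ⟨fun y => exp (b * y) * η y, fun y hy => by rw [kerFun_hk hp.measurable hy, i2, neg_neg], fun z hz => ?_⟩
  have hℓ : ∫ s, exp (-b * |s|) * p s ∂tauM = η' 0 := by
    rw [← i1, tauM]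
    exact setIntegral_congr_fun measurableSet_Ioi fun s hs => by rw [abs_of_pos (show 0 < s from hs)]
  have hw : ∀ z : ℝ × ℝ, 0 ≤ z.2 → exp (b * len z) = exp (b * |z.1|) * exp (b * z.2) := fun z hz => by
    rw [len, mul_add, exp_add, abs_of_nonneg hz]
  have e := kerFun_kap_exp 0 b (bdData (fun x => -(deriv θ x * η' 0)) fun x y =>
    (deriv θ x - deriv (deriv f) (θ x) * deriv θ x) * η y - deriv θ x * -(exp (-b * y) * p y)) z
  rw [kap_zero, green_tensor hC hg z.1 hz, hw z hz] at e
  refine (ker_congr_ae ?_ z).trans (e.trans (by rw [wprof]; ring))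
  filter_upwards [ae_nu_nonneg] with z' hz'
  rw [hw z' hz', hℓ]
  simp only [jf, qf, bdData, wprof]
  split_ifs with h0
  · rw [h0, mul_zero b, exp_zero]; ring
  · have : exp (b * z'.2) * exp (-b * z'.2) = 1 := by rw [← exp_add]; simp
    linear_combination (-(exp (b * |z'.1|) * deriv θ z'.1 * p z'.2)) * this

/-- Right inverse of the weighted linearized operator, up to a multiple of `qf`. -/
theorem exists_right_inverse : ∃ κ > 0, (∃ C, 0 ≤ C ∧ ∀ b, |b| ≤ κ → ∀ x, |wprof θ b x| ≤ C * exp (-κ * |x|)) ∧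
    ∀ b, 0 < b → b ≤ κ → ∀ hb : 0 ≤ b, ∀ hb' : b ≤ 1/32, ∀ hq : MemLp (qf θ b) 2 nuM, ∃ (S : XL →L[ℝ] XL) (ℓ : XL →L[ℝ] ℝ),
      ∀ D, S D - h.wellOp (kerOp (schurBd_kap (c := 0) (by norm_num) hb hb') (S D)) = D + ℓ D • hq.toLp := by
  obtain ⟨κ, hκ, hC, hm, hunit⟩ := h.exists_isUnit_weighted
  refine ⟨κ, hκ, hC, fun b hb hbκ _ hb' hq => ?_⟩
  have hbabs : |b| ≤ κ := by rwa [abs_of_pos hb]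
  obtain ⟨u, hu⟩ := hunit b hb hbκ hb'
  obtain ⟨A, hA⟩ := exists_schurBd_hk hb
  set K := kerOp (schurBd_kap (c := 0) (by norm_num) hb.le hb')
  set J := jOp (hm b hbabs)
  set J' := jOp (hm (-b) (by rwa [abs_neg]))
  set W := h.wellOp
  have hE : MemLp (fun y : ℝ => exp (-b * |y|)) 2 tauM := (memLp_exp_abs hb).restrict _
  set e : YL →L[ℝ] ℝ := innerSL ℝ (hE.toLp _)
  set R : YL →L[ℝ] XL := W ∘L J ∘L kerOp hA + J - e.smulRight hq.toLp
  have : IsFiniteMeasureOnCompacts tauM := by unfold tauM; infer_instance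
  have key : W ∘L K ∘L R = W ∘L J ∘L kerOp hA := by
    refine DFunLike.coe_injective ((W ∘L K ∘L R).continuous.ext_on (Lp.dense_hasCompactSupport_contDiff (by simp)) (W ∘L J ∘L kerOp hA).continuous ?_)
    rintro P ⟨p, hPp, hpc, hps⟩
    obtain ⟨M, hM⟩ := hpc.isCompact.isBounded.subset_closedBall 0
    have hp0 : ∀ y, max M 0 + 1 ≤ y → p y = 0 := fun y hy => by
      by_contra hne
      have := hM (subset_tsupport p hne)
      rw [mem_closedBall_zero_iff, norm_eq_abs] at this
      linarith [le_abs_self y, le_max_left M 0]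
    obtain ⟨g, hg, hK⟩ := h.kerFun_kap_antideriv hps.continuous (by positivity) hp0 hb
    have h1 : J (kerOp hA P) =ᵐ[nuM] jf (wprof θ b) g := (coeFn_jOp _ _).trans (jf_congr _ (by
      filter_upwards [coeFn_kerOp hA P, ae_tau_pos] with y e1 hy
      rw [e1, ker_congr_ae hPp, hg y hy]))
    have h2 : e P = ∫ s, exp (-b * |s|) * p s ∂tauM := by
      rw [innerSL_apply_apply, inner_L2_congr hE.coeFn_toLp hPp]
    have h3 : R P =ᵐ[nuM] fun z => (if z.2 = 0 then 0 else 1 - deriv (deriv f) (θ z.1)) * jf (wprof θ b) g z + jf (wprof θ b) p z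
        - (∫ s, exp (-b * |s|) * p s ∂tauM) * qf θ b z := by
      filter_upwards [Lp.coeFn_sub (W (J (kerOp hA P)) + J P) (e P • hq.toLp), Lp.coeFn_add (W (J (kerOp hA P))) (J P),
        Lp.coeFn_smul (e P) hq.toLp, h.coeFn_wellOp (J (kerOp hA P)), h1, coeFn_jOp (hm b hbabs) P, jf_congr (wprof θ b) hPp, hq.coeFn_toLp] with z a1 a2 a3 a4 a5 a6 a7 a8
      change (W (J (kerOp hA P)) + J P - e P • hq.toLp) z = _
      rw [a1, Pi.sub_apply, a2, Pi.add_apply, a3, Pi.smul_apply, a4, a5, a6, a7, a8, h2, smul_eq_mul]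
    refine Lp.ext ?_
    filter_upwards [coeFn_kerOp (schurBd_kap (c := 0) (by norm_num) hb.le hb') (R P), h1, ae_nu_nonneg, h.coeFn_wellOp (K (R P)), h.coeFn_wellOp (J (kerOp hA P))] with z a1 a2 hz a3 a4
    change W (K (R P)) z = W (J (kerOp hA P)) z
    rw [a3, a4, a1, a2, ker_congr_ae h3, hK z hz]
    by_cases h0 : z.2 = 0 <;> simp [h0, jf]
  set T : XL →L[ℝ] YL := J'.adjoint ∘L K ∘L ((u⁻¹ : (XL →L[ℝ] XL)ˣ) : XL →L[ℝ] XL)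
  refine ⟨((u⁻¹ : (XL →L[ℝ] XL)ˣ) : XL →L[ℝ] XL) + R ∘L T, -(e ∘L T), fun D => ?_⟩
  set Ψ := ((u⁻¹ : (XL →L[ℝ] XL)ˣ) : XL →L[ℝ] XL) D
  have h1 : Ψ - (W (K Ψ) - J (T D)) = D := by
    have := congrArg (fun F : XL →L[ℝ] XL => F D) u.mul_inv
    rw [hu] at this
    exact this
  have h2 : W (K (R (T D))) = W (J (kerOp hA (T D))) := congrArg (fun F : YL →L[ℝ] XL => F (T D)) key
  have h3 : R (T D) = W (J (kerOp hA (T D))) + J (T D) - e (T D) • hq.toLp := rfl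
  change Ψ + R (T D) - W (K (Ψ + R (T D))) = D + -(e (T D)) • hq.toLp
  rw [map_add, map_add, h2, h3, neg_smul]
  clear_value Ψ
  generalize T D = t at *
  rw [← h1]; abel

end Prof


/-! ### The contraction argument -/

lemma exists_nemytskii {Z : Type*} [MeasurableSpace Z] {μ : Measure Z} {G : Z → ℝ → ℝ} (hG : Measurable fun p : Z × ℝ => G p.1 p.2)
    (h0 : MemLp (fun z => G z 0) 2 μ) {L : ℝ≥0} (hL : ∀ z r r', |G z r - G z r'| ≤ L * |r - r'|) :
    ∃ 𝒢 : Lp ℝ 2 μ → Lp ℝ 2 μ, (∀ Ψ : Lp ℝ 2 μ, 𝒢 Ψ =ᵐ[μ] fun z => G z (Ψ z)) ∧ ∀ Ψ Φ, ‖𝒢 Ψ - 𝒢 Φ‖ ≤ L * ‖Ψ - Φ‖ := by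
  have hm : ∀ Ψ : Lp ℝ 2 μ, Measurable fun z => G z (Ψ z) := fun Ψ =>
    hG.comp (measurable_id.prodMk (Lp.stronglyMeasurable Ψ).measurable)
  have hmem : ∀ Ψ : Lp ℝ 2 μ, MemLp (fun z => G z (Ψ z)) 2 μ := fun Ψ => by
    have : MemLp (fun z => G z (Ψ z) - G z 0) 2 μ := (Lp.memLp Ψ).of_le_mul (c := L)
      ((hm Ψ).sub (hG.comp (measurable_id.prodMk measurable_const))).aestronglyMeasurable (.of_forall fun z => by
        simpa using hL z (Ψ z) 0)
    refine (this.add h0).congr_norm (hm Ψ).aestronglyMeasurable (.of_forall fun z => by simp)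
  refine ⟨fun Ψ => (hmem Ψ).toLp, fun Ψ => (hmem Ψ).coeFn_toLp, fun Ψ Φ => Lp.norm_le_mul_norm_of_ae_le_mul ?_⟩
  filter_upwards [Lp.coeFn_sub (hmem Ψ).toLp (hmem Φ).toLp, Lp.coeFn_sub Ψ Φ, (hmem Ψ).coeFn_toLp, (hmem Φ).coeFn_toLp] with z a1 a2 a3 a4
  rw [a1, a2, Pi.sub_apply, Pi.sub_apply, a3, a4]
  exact hL z _ _

/-- Truncation to `[-ρ, ρ]`. -/
noncomputable def clamp (ρ r : ℝ) : ℝ := max (-ρ) (min ρ r)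

lemma clamp_of_le {ρ r : ℝ} (h : |r| ≤ ρ) : clamp ρ r = r := by
  rw [clamp, min_eq_right (abs_le.mp h).2, max_eq_right (abs_le.mp h).1]

lemma abs_clamp_le {ρ : ℝ} (h : 0 ≤ ρ) (r : ℝ) : |clamp ρ r| ≤ ρ :=
  abs_le.mpr ⟨le_max_left _ _, max_le (by linarith) (min_le_left _ _)⟩

lemma abs_clamp_sub_le (ρ r r' : ℝ) : |clamp ρ r - clamp ρ r'| ≤ |r - r'| := by
  refine (abs_max_sub_max_le_max (-ρ) (min ρ r) (-ρ) (min ρ r')).trans ?_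
  rw [sub_self, abs_zero, max_eq_right (abs_nonneg _)]
  refine (abs_min_sub_min_le_max ρ r ρ r').trans_eq ?_
  rw [sub_self, abs_zero, max_eq_right (abs_nonneg _)]

/-- The nonlinearity, on the boundary and in the interior, as a function of the perturbation. -/
noncomputable def bareNonlin (f θ σ : ℝ → ℝ) (c : ℝ) (z : ℝ × ℝ) (s : ℝ) : ℝ :=
  if z.2 = 0 then -c * (deriv θ z.1 + σ (θ z.1 + s)) else -(deriv f (θ z.1 + s) - deriv f (θ z.1) - deriv (deriv f) (θ z.1) * s)

/-- The truncated nonlinearity, conjugated with the weight. -/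
noncomputable def nonlin (f θ σ : ℝ → ℝ) (c b ρ : ℝ) (z : ℝ × ℝ) (r : ℝ) : ℝ :=
  exp (b * len z) * bareNonlin f θ σ c z (clamp ρ (exp (-(b * len z)) * r))

namespace Prof
variable {f θ : ℝ → ℝ} (h : Prof f θ)
include h

lemma abs_le_one (x : ℝ) : |θ x| ≤ 1 := abs_le.mpr ⟨(h.neg_one_lt x).le, (h.lt_one x).le⟩

lemma exists_lipschitz_nonlin {σ : ℝ → ℝ} (hσ : ContDiff ℝ ∞ σ) : ∃ L, 0 ≤ L ∧ ∀ c b ρ, 0 ≤ ρ → ρ ≤ 1 → |c| ≤ ρ → ∀ z r r',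
    |nonlin f θ σ c b ρ z r - nonlin f θ σ c b ρ z r'| ≤ L * ρ * |r - r'| := by
  obtain ⟨L₁, hL₁, h₁⟩ := exists_lipschitz_Icc hσ 2
  obtain ⟨L₂, hL₂, h₂⟩ := exists_lipschitz_Icc h.hf.deriv_infty.deriv_infty 2
  refine ⟨max L₁ L₂, hL₁.trans (le_max_left _ _), fun c b ρ hρ hρ1 hc z r r' => ?_⟩
  have hθ := h.abs_le_one z.1
  set E := exp (-(b * len z)) with hE
  set s := clamp ρ (E * r)
  set s' := clamp ρ (E * r')
  have hs : |s| ≤ ρ := abs_clamp_le hρ _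
  have hs' : |s'| ≤ ρ := abs_clamp_le hρ _
  have hss : |s - s'| ≤ E * |r - r'| := (abs_clamp_sub_le _ _ _).trans_eq (by rw [← mul_sub, abs_mul, abs_exp])
  have hd : ∀ t, |t| ≤ ρ → |θ z.1 + t| ≤ 2 := fun t ht => (abs_add_le _ _).trans (by linarith)
  suffices H : |bareNonlin f θ σ c z s - bareNonlin f θ σ c z s'| ≤ max L₁ L₂ * ρ * |s - s'| by
    rw [nonlin, nonlin, ← mul_sub, abs_mul, abs_exp]
    refine (mul_le_mul_of_nonneg_left (H.trans (mul_le_mul_of_nonneg_left hss (by positivity))) (exp_pos _).le).trans_eq ?_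
    have : exp (b * len z) * E = 1 := by rw [hE, ← exp_add, add_neg_cancel, exp_zero]
    linear_combination (max L₁ L₂ * ρ * |r - r'|) * this
  unfold bareNonlin
  split_ifs with h0
  · have := h₁ (θ z.1 + s) (θ z.1 + s') (hd s hs) (hd s' hs')
    rw [add_sub_add_left_eq_sub] at this
    rw [show -c * (deriv θ z.1 + σ (θ z.1 + s)) - -c * (deriv θ z.1 + σ (θ z.1 + s')) = -c * (σ (θ z.1 + s) - σ (θ z.1 + s')) by ring, abs_mul, abs_neg,
      mul_comm (max L₁ L₂), mul_assoc]
    exact mul_le_mul hc (this.trans (mul_le_mul_of_nonneg_right (le_max_left _ _) (abs_nonneg _))) (abs_nonneg _) hρ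
  · have hder : ∀ t, HasDerivAt (fun t => -(deriv f (θ z.1 + t) - deriv f (θ z.1) - deriv (deriv f) (θ z.1) * t))
        (-(deriv (deriv f) (θ z.1 + t) - deriv (deriv f) (θ z.1))) t := fun t => by
      have := ((h.hf.deriv_infty.hasDerivAt (θ z.1 + t)).comp t ((hasDerivAt_id t).const_add (θ z.1)))
      exact ((this.sub_const (deriv f (θ z.1))).sub ((hasDerivAt_id t).const_mul (deriv (deriv f) (θ z.1)))).neg.congr_deriv (by simp)
    refine (convex_Icc (-ρ) ρ).norm_image_sub_le_of_norm_hasDerivWithin_le (fun t _ => (hder t).hasDerivWithinAt) (fun t ht => ?_)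
      (abs_le.mp hs') (abs_le.mp hs)
    have ht' : |t| ≤ ρ := abs_le.mpr ht
    have := h₂ (θ z.1 + t) (θ z.1) (hd t ht') (by linarith)
    rw [add_sub_cancel_left] at this
    rw [norm_neg, norm_eq_abs]
    exact this.trans (mul_le_mul (le_max_right _ _) ht' (abs_nonneg _) (hL₁.trans (le_max_left _ _)))

lemma measurable_nonlin {σ : ℝ → ℝ} (hσ : ContDiff ℝ ∞ σ) (c b ρ : ℝ) : Measurable fun p : (ℝ × ℝ) × ℝ => nonlin f θ σ c b ρ p.1 p.2 := by
  have h1 : Measurable σ := hσ.continuous.measurable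
  have h2 : Measurable (deriv f) := h.hf.deriv_infty.continuous.measurable
  have h3 : Measurable (deriv (deriv f)) := h.hf.deriv_infty.deriv_infty.continuous.measurable
  have h4 : Measurable θ := h.hθ.continuous.measurable
  have h5 : Measurable (deriv θ) := h.continuous_deriv.measurable
  unfold nonlin bareNonlin clamp
  exact Measurable.mul (by fun_prop) (Measurable.ite (measurableSet_eq_fun (by fun_prop) measurable_const) (by fun_prop) (by fun_prop))

lemma exists_memLp_forcing {σ : ℝ → ℝ} (hσ : ContDiff ℝ ∞ σ) (h1 : σ 1 = 0) (h2 : σ (-1) = 0) : ∃ κ > 0, ∀ b, 0 < b → b ≤ κ → MemLp (qf θ b) 2 nuM ∧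
    ∃ g : ℝ × ℝ → ℝ, MemLp g 2 nuM ∧ ∀ c ρ, 0 ≤ ρ → ∀ z, nonlin f θ σ c b ρ z 0 = -c * g z := by
  obtain ⟨κ, hκ, C, hC, hφ⟩ := h.exists_decay
  obtain ⟨C', hC'⟩ := hφ σ hσ h1 h2
  have key : ∀ b, 0 < b → b ≤ κ / 2 → ∀ (ψ : ℝ → ℝ) (D : ℝ), Measurable ψ → (∀ x, |ψ x| ≤ D * exp (-κ * |x|)) →
      MemLp (fun z : ℝ × ℝ => if z.2 = 0 then exp (b * |z.1|) * ψ z.1 else 0) 2 nuM := fun b hb hb' ψ D hψ hD => by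
    have hD0 : 0 ≤ D := by simpa using (abs_nonneg _).trans (hD 0)
    refine memLp_nuM_of_le (a := κ / 2) (C := D) (by positivity) (Measurable.ite (measurableSet_eq_fun (by fun_prop) measurable_const) (by fun_prop) measurable_const) fun z hz => ?_
    split_ifs with h0
    · rw [h0, abs_zero, mul_zero, exp_zero, mul_one, abs_mul, abs_exp]
      refine (mul_le_mul_of_nonneg_left (hD z.1) (exp_pos _).le).trans ?_
      rw [mul_left_comm, ← exp_add]
      refine mul_le_mul_of_nonneg_left (exp_le_exp.mpr ?_) hD0
      nlinarith [abs_nonneg z.1]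
    · rw [abs_zero]; positivity
  refine ⟨κ / 2, by positivity, fun b hb hb' => ⟨key b hb hb' _ C h.continuous_deriv.measurable hC, _,
    key b hb hb' (fun x => deriv θ x + σ (θ x)) (C + C') (h.continuous_deriv.measurable.add (hσ.continuous.comp h.hθ.continuous).measurable)
      fun x => (abs_add_le _ _).trans ((add_le_add (hC x) (hC' x)).trans_eq (add_mul _ _ _).symm), fun c ρ hρ z => ?_⟩⟩
  rw [nonlin, mul_zero, clamp_of_le (by rwa [abs_zero]), bareNonlin]
  split_ifs with h0
  · rw [len, h0, abs_zero, add_zero, add_zero]; ring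
  · simp

set_option maxHeartbeats 1000000 in
/-- The nonlinear problem, up to a multiple of the profile derivative on the boundary. -/
theorem exists_solution {σ : ℝ → ℝ} (hσ : ContDiff ℝ ∞ σ) (h1 : σ 1 = 0) (h2 : σ (-1) = 0) :
    ∃ b₁ > 0, b₁ ≤ 1/32 ∧ ∀ b, 0 < b → b ≤ b₁ → ∃ C, 0 ≤ C ∧ ∃ c₀ > 0, c₀ ≤ 1/4 ∧ ∀ c, |c| ≤ c₀ → ∃ (u : ℝ × ℝ → ℝ) (m : ℝ), Measurable u ∧
      (∀ z, 0 ≤ z.2 → |u z| ≤ C * |c| * exp (-(b * len z))) ∧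
      ∀ z, 0 ≤ z.2 → u z = kerFun tauM nuM (kap c 0) (fun z => if z.2 = 0 then -c * (deriv θ z.1 + σ (θ z.1 + u z)) + m * deriv θ z.1
        else u z - (deriv f (θ z.1 + u z) - deriv f (θ z.1))) z := by
  obtain ⟨κ₁, hκ₁, -, hinv⟩ := h.exists_right_inverse
  obtain ⟨κ₂, hκ₂, hforce⟩ := h.exists_memLp_forcing hσ h1 h2
  obtain ⟨L, hL, hlip⟩ := h.exists_lipschitz_nonlin hσ
  refine ⟨min (min κ₁ κ₂) (1/32), by positivity, min_le_right _ _, fun b hb hbb => ?_⟩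
  obtain ⟨⟨hb₁, hb₂⟩, hb'⟩ := by simpa only [le_min_iff] using hbb
  obtain ⟨hq, g, hg, hg0⟩ := hforce b hb hb₂
  obtain ⟨S, ℓ, hS⟩ := hinv b hb hb₁ hb.le hb' hq
  set B₁ : ℝ := L * (200 * AD * ‖S‖) with hB₁
  set B₂ : ℝ := ‖h.wellOp‖ * (544 * AD * ‖S‖) with hB₂
  have hB₁0 : 0 ≤ B₁ := by positivity
  have hB₂0 : 0 ≤ B₂ := by positivity
  have hdiv : ∀ {a t x : ℝ}, 0 ≤ a → 0 ≤ x → x ≤ t / (a + 1) → x * a ≤ t := fun ha hx hxt => by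
    rw [le_div_iff₀ (by positivity)] at hxt
    linarith
  set ρ : ℝ := min 1 (1/4 / (B₁ + 1)) with hρ
  have hρ0 : 0 < ρ := by positivity
  have hρB : ρ * B₁ ≤ 1/4 := hdiv hB₁0 hρ0.le (min_le_right _ _)
  set C : ℝ := 200 * (AD₂ * (‖S‖ * (2 * ‖hg.toLp‖))) with hC
  have hC0 : 0 ≤ C := by positivity
  refine ⟨C, hC0, min (min (1/4) ρ) (min (1/4 / (B₂ + 1)) (ρ / (C + 1))), by positivity,
    (min_le_left _ _).trans (min_le_left _ _), fun c hc => ?_⟩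
  obtain ⟨⟨hc4, hcρ⟩, hcB, hcC⟩ := by simpa only [le_min_iff] using hc
  replace hcB := hdiv hB₂0 (abs_nonneg c) hcB
  replace hcC := hdiv hC0 (abs_nonneg c) hcC
  set K := kerOp (schurBd_kap hc4 hb.le hb') with hK
  set K₀ := kerOp (schurBd_kap (c := 0) (by norm_num) hb.le hb')
  have hKn : ‖K‖ ≤ 200 * AD := norm_kerOp_le _
  have hKK : ‖K - K₀‖ ≤ 544 * |c| * AD := norm_kerOp_kap_sub_le hc4 hb.le hb'
  obtain ⟨G, hG, hGL⟩ := exists_nemytskii (h.measurable_nonlin hσ c b ρ) (μ := nuM) (hg.const_mul (-c) |>.congr_norm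
    ((h.measurable_nonlin hσ c b ρ).comp (measurable_id.prodMk measurable_const)).aestronglyMeasurable
    (.of_forall fun z => congrArg _ (hg0 c ρ hρ0.le z).symm)) (L := ⟨L * ρ, by positivity⟩) (hlip c b ρ hρ0.le (min_le_left _ _) hcρ)
  set T : XL → XL := fun D => h.wellOp ((K - K₀) (S D)) + G (K (S D)) with hT
  have hlipT : ∀ D D', ‖T D - T D'‖ ≤ 1/2 * ‖D - D'‖ := fun D D' => by
    have e : T D - T D' = h.wellOp ((K - K₀) (S (D - D'))) + (G (K (S D)) - G (K (S D'))) := by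
      rw [hT]; beta_reduce; rw [map_sub, map_sub, map_sub]; abel
    have n1 : ‖h.wellOp ((K - K₀) (S (D - D')))‖ ≤ |c| * B₂ * ‖D - D'‖ :=
      (h.wellOp.le_opNorm_of_le ((K - K₀).le_of_opNorm_le_of_le hKK (S.le_opNorm _))).trans_eq (by rw [hB₂]; ring)
    have n2 : ‖G (K (S D)) - G (K (S D'))‖ ≤ ρ * B₁ * ‖D - D'‖ := by
      refine (hGL _ _).trans ?_
      rw [← map_sub, ← map_sub]
      refine (mul_le_mul_of_nonneg_left (K.le_of_opNorm_le_of_le hKn (S.le_opNorm _)) (NNReal.coe_nonneg _)).trans_eq ?_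
      change L * ρ * (200 * AD * (‖S‖ * ‖D - D'‖)) = ρ * (L * (200 * AD * ‖S‖)) * ‖D - D'‖
      ring
    rw [e]
    refine (norm_add_le _ _).trans ((add_le_add n1 n2).trans ?_)
    nlinarith [norm_nonneg (D - D')]
  have hcon : ContractingWith (1/2) T := ⟨by norm_num, LipschitzWith.of_dist_le_mul fun D D' => by
    rw [dist_eq_norm, dist_eq_norm]; simpa using hlipT D D'⟩
  obtain ⟨D, hD⟩ : ∃ D, T D = D := ⟨hcon.fixedPoint, hcon.fixedPoint_isFixedPt⟩
  have hT0 : ‖T 0‖ ≤ |c| * ‖hg.toLp‖ := by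
    rw [hT]; beta_reduce
    rw [map_zero, map_zero, map_zero, map_zero, zero_add]
    refine Lp.norm_le_mul_norm_of_ae_le_mul ?_
    filter_upwards [hG 0, Lp.coeFn_zero ℝ 2 nuM, hg.coeFn_toLp] with z a1 a2 a3
    rw [a1, a2, a3, Pi.zero_apply, hg0 c ρ hρ0.le, norm_mul, norm_neg, norm_eq_abs]
  have hDn : ‖D‖ ≤ |c| * (2 * ‖hg.toLp‖) := by
    have := hlipT D 0
    rw [hD, sub_zero] at this
    linarith [norm_sub_norm_le D (T 0)]
  set Ψ := S D
  have hΨn : ‖Ψ‖ ≤ |c| * (‖S‖ * (2 * ‖hg.toLp‖)) :=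
    (S.le_opNorm_of_le hDn).trans_eq (by ring)
  have hΨ : Ψ = h.wellOp (K Ψ) + G (K Ψ) + ℓ D • hq.toLp := by
    have e1 := hS D
    have e2 : h.wellOp ((K - K₀) Ψ) + G (K Ψ) = D := hD
    rw [sub_apply, map_sub] at e2
    rw [sub_eq_iff_eq_add] at e1
    refine e1.trans ?_
    change D + ℓ D • hq.toLp + h.wellOp (K₀ Ψ) = _
    clear_value Ψ
    generalize ℓ D = t at *
    rw [← e2]
    abel
  set v := kerFun tauM nuM (kap c b) Ψ with hv
  have hvb : ∀ z, 0 ≤ z.2 → |v z| ≤ C * |c| := fun z hz => by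
    refine (abs_kerFun_le (fun t z' ht hz' => abs_kap_le hc4 hb.le hb' ht hz hz') (Lp.memLp Ψ)).trans ?_
    rw [← Lp.norm_def, NNReal.coe_ofNat, hC]
    refine (mul_le_mul_of_nonneg_left (mul_le_mul_of_nonneg_left hΨn (NNReal.coe_nonneg _)) (by norm_num)).trans_eq (by ring)
  have hvm : Measurable v := by
    have : StronglyMeasurable (fun q : (ℝ × ℝ) × (ℝ × ℝ × ℝ) => kap c b q.2.1 q.1 q.2.2 * Ψ q.2.2) :=
      (((measurable_kap c b).comp (by fun_prop : Measurable fun q : (ℝ × ℝ) × (ℝ × ℝ × ℝ) => (q.2.1, q.1, q.2.2))).mul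
        ((Lp.stronglyMeasurable Ψ).measurable.comp (by fun_prop))).stronglyMeasurable
    exact this.integral_prod_right.measurable
  refine ⟨fun z => exp (-(b * len z)) * v z, ℓ D, by fun_prop, fun z hz => ?_, fun z hz => ?_⟩
  · rw [abs_mul, abs_exp, mul_comm]
    exact mul_le_mul_of_nonneg_right (hvb z hz) (exp_pos _).le
  beta_reduce
  have hE : ∀ z, exp (b * len z) * exp (-(b * len z)) = 1 := fun z => by rw [← exp_add, add_neg_cancel, exp_zero]
  have e : v z = exp (b * len z) * _ := (ker_congr_ae ?_ z).trans (kerFun_kap_exp c b (fun z => if z.2 = 0 then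
    -c * (deriv θ z.1 + σ (θ z.1 + exp (-(b * len z)) * v z)) + ℓ D * deriv θ z.1
    else exp (-(b * len z)) * v z - (deriv f (θ z.1 + exp (-(b * len z)) * v z) - deriv f (θ z.1))) z)
  · rw [e, ← mul_assoc, mul_comm (exp _), hE, one_mul]
  have a0 : (Ψ : ℝ × ℝ → ℝ) =ᵐ[nuM] ⇑(h.wellOp (K Ψ) + G (K Ψ) + ℓ D • hq.toLp) := by rw [← hΨ]
  filter_upwards [a0, Lp.coeFn_add (h.wellOp (K Ψ) + G (K Ψ)) (ℓ D • hq.toLp), Lp.coeFn_add (h.wellOp (K Ψ)) (G (K Ψ)), Lp.coeFn_smul (ℓ D) hq.toLp,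
    hq.coeFn_toLp, h.coeFn_wellOp (K Ψ), hG (K Ψ), coeFn_kerOp (schurBd_kap hc4 hb.le hb') Ψ, ae_nu_nonneg] with z a1 a2 a3 a4 a5 a6 a7 a8 hz
  have hcl : clamp ρ (exp (-(b * len z)) * v z) = exp (-(b * len z)) * v z := clamp_of_le (by
    rw [abs_mul, abs_exp]
    refine (mul_le_of_le_one_left (abs_nonneg _) (exp_le_one_iff.mpr ?_)).trans ((hvb z hz).trans ((mul_comm _ _).trans_le hcC))
    have : 0 ≤ len z := by unfold len; positivity
    nlinarith)
  rw [a1, a2, Pi.add_apply, a3, Pi.add_apply, a4, Pi.smul_apply, a5, a6, a7, a8, nonlin, hcl, bareNonlin, qf, smul_eq_mul]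
  have hEz := hE z
  split_ifs with h0
  · rw [wprof, len, h0, abs_zero, add_zero]; ring
  · linear_combination (-(1 - deriv (deriv f) (θ z.1)) * v z) * hEz

end Prof


/-! ### Isotropic coordinates -/

/-- The inverse of `shr c`. -/
noncomputable def unshr (c : ℝ) (z : ℝ × ℝ) : ℝ × ℝ := (√(1 - c ^ 2) * z.1 - c * z.2, z.2)

/-- The exponential weight in isotropic coordinates. -/
noncomputable def wsh (c b : ℝ) (z : ℝ × ℝ) : ℝ := exp (-(b * len (unshr c z)))

@[fun_prop]
lemma measurable_unshr (c : ℝ) : Measurable (unshr c) := by unfold unshr; fun_prop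

lemma sqrt_bounds {c : ℝ} (hc : |c| ≤ 1/4) : 9/10 ≤ √(1 - c ^ 2) ∧ √(1 - c ^ 2) ≤ 1 := by
  have h : c ^ 2 ≤ (1/4) ^ 2 := sq_le_sq' (abs_le.mp hc).1 (abs_le.mp hc).2
  exact ⟨Real.le_sqrt_of_sq_le (by linarith), Real.sqrt_le_one.mpr (by nlinarith)⟩

lemma shr_unshr {c : ℝ} (hc : |c| ≤ 1/4) (z : ℝ × ℝ) : shr c (unshr c z) = z := by
  have := (sqrt_bounds hc).1
  refine Prod.ext ?_ rfl
  simp only [shr, unshr]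
  field_simp; ring

lemma unshr_shr {c : ℝ} (hc : |c| ≤ 1/4) (z : ℝ × ℝ) : unshr c (shr c z) = z := by
  have := (sqrt_bounds hc).1
  refine Prod.ext ?_ rfl
  simp only [shr, unshr]
  field_simp; ring

lemma map_unshr {c : ℝ} (hc : |c| ≤ 1/4) : nuM = ENNReal.ofReal √(1 - c ^ 2) • nuM.map (unshr c) := by
  have hs : 0 < √(1 - c ^ 2) := by linarith [(sqrt_bounds hc).1]
  refine Measure.ext_of_lintegral _ fun g hg => ?_
  rw [lintegral_smul_measure, lintegral_map hg (by fun_prop), nuM, lintegral_prod_symm' _ hg, lintegral_prod_symm' _ (by fun_prop),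
    smul_eq_mul, ← lintegral_const_mul _ (Measurable.lintegral_prod_left' (f := fun z => g (unshr c z)) (by fun_prop))]
  refine lintegral_congr fun y => ?_
  have e := lintegral_map (μ := volume) (f := fun r => g (r - c * y, y)) (g := fun x => √(1 - c ^ 2) * x) (by fun_prop) (by fun_prop)
  rw [Real.map_volume_mul_left hs.ne', lintegral_smul_measure, lintegral_sub_right_eq_self (fun r => g (r, y)), abs_of_pos (inv_pos.mpr hs)] at e
  unfold unshr
  rw [← e, smul_eq_mul, ← mul_assoc, ← ENNReal.ofReal_mul hs.le, mul_inv_cancel₀ hs.ne', ENNReal.ofReal_one, one_mul]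

lemma kerFun_kap_eq {c : ℝ} (hc : |c| ≤ 1/4) {F : ℝ × ℝ → ℝ} (hF : Measurable F) (z : ℝ × ℝ) :
    kerFun tauM nuM (kap c 0) F (unshr c z) = kerFun tauM nuM k0 (fun w => F (unshr c w)) z := by
  have hs : 0 < √(1 - c ^ 2) := by linarith [(sqrt_bounds hc).1]
  have e : tauM.prod nuM = ENNReal.ofReal √(1 - c ^ 2) • (tauM.prod nuM).map (Prod.map id (unshr c)) := by
    have : SFinite (nuM.map (unshr c)) := inferInstance
    rw [← Measure.map_prod_map tauM nuM measurable_id (measurable_unshr c), Measure.map_id]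
    conv_lhs => rw [map_unshr hc, Measure.prod_smul_right]
  unfold kerFun
  conv_lhs => rw [e]
  rw [integral_smul_measure, integral_map (by fun_prop) ?_, ENNReal.toReal_ofReal hs.le, smul_eq_mul, ← integral_const_mul]
  · refine integral_congr_ae (.of_forall fun p => ?_)
    simp only [kap, Prod.map, id, zero_mul, exp_zero, one_mul, shr_unshr hc]
    rw [← mul_assoc, mul_inv_cancel_left₀ hs.ne']
  · exact (((measurable_kap c 0).comp (by fun_prop : Measurable fun p : ℝ × ℝ × ℝ => (p.1, unshr c z, p.2))).mul
      (hF.comp measurable_snd)).aestronglyMeasurable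

lemma wt_exp {b : ℝ} (hb : 0 ≤ b) (hb' : b ≤ 1/32) {g : ℝ × ℝ → ℝ} (hg : Measurable g)
    (h : ∀ z z', g z - g z' ≤ 2 * (|z.1 - z'.1| + |z.2 - z'.2|)) : Wt fun z => exp (-(b * g z)) where
  pos z := exp_pos _
  meas := by fun_prop
  le z z' := by
    rw [← exp_add, ← exp_add]
    refine exp_le_exp.mpr ?_
    nlinarith [h z z', abs_nonneg (z.1 - z'.1), abs_nonneg (z.2 - z'.2)]

lemma abs_fst_unshr_sub_le {c : ℝ} (hc : |c| ≤ 1/4) (z z' : ℝ × ℝ) :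
    |(unshr c z).1| - |(unshr c z').1| ≤ |z.1 - z'.1| + |z.2 - z'.2| := by
  have hs := sqrt_bounds hc
  refine (abs_sub_abs_le_abs_sub _ _).trans ?_
  have e : (unshr c z).1 - (unshr c z').1 = √(1 - c ^ 2) * (z.1 - z'.1) - c * (z.2 - z'.2) := by simp only [unshr]; ring
  rw [e]
  refine (abs_sub _ _).trans ?_
  rw [abs_mul, abs_mul, abs_of_nonneg (sqrt_nonneg _)]
  nlinarith [abs_nonneg (z.1 - z'.1), abs_nonneg (z.2 - z'.2)]

lemma half_le_len_unshr {c : ℝ} (hc : |c| ≤ 1/4) (z : ℝ × ℝ) : 1/2 * (|z.1| + |z.2|) ≤ len (unshr c z) := by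
  have h := abs_sub_abs_le_abs_sub (√(1 - c ^ 2) * z.1) (c * z.2)
  rw [abs_mul, abs_mul, abs_of_nonneg (sqrt_nonneg _)] at h
  have hs := sqrt_bounds hc
  change _ ≤ |√(1 - c ^ 2) * z.1 - c * z.2| + |z.2|
  nlinarith [abs_nonneg z.1, abs_nonneg z.2]

section
variable {c b : ℝ} (hc : |c| ≤ 1/4) (hb : 0 < b) (hb' : b ≤ 1/32)
include hc hb

include hb' in
lemma wt_wsh : Wt (wsh c b) := wt_exp hb.le hb' (by fun_prop) fun z z' => by
  have h1 := abs_fst_unshr_sub_le hc z z'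
  have h2 : |z.2| - |z'.2| ≤ _ := abs_sub_abs_le_abs_sub _ _
  have h3 := abs_nonneg (z.1 - z'.1)
  simp only [len] at *
  change |(unshr c z).1| + |z.2| - (|(unshr c z').1| + |z'.2|) ≤ _
  linarith

omit hc in
lemma wsh_le_one (z : ℝ × ℝ) : wsh c b z ≤ 1 := exp_le_one_iff.mpr (by have : 0 ≤ len (unshr c z) := by unfold len; positivity
                                                                       nlinarith)

lemma memLp_wsh : MemLp (wsh c b) 2 nuM := by
  refine memLp_nuM_of_le (a := b / 2) (C := 1) (by positivity) (by unfold wsh; fun_prop) fun z _ => ?_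
  rw [one_mul, wsh, abs_exp, ← exp_add]
  refine exp_le_exp.mpr ?_
  nlinarith [half_le_len_unshr hc z]

end


lemma RC.map {R : (ℝ × ℝ → ℝ) → (ℝ × ℝ → ℝ) → Prop} {Q Q' : (ℝ × ℝ → ℝ) → Prop} {T : (ℝ × ℝ → ℝ) → (ℝ × ℝ → ℝ)}
    (hQ : ∀ g, Q g → Q' (T g)) (hR : ∀ g g', R g g' → R (T g) (T g')) {n : ℕ} {g : ℝ × ℝ → ℝ} (h : RC R Q n g) : RC R Q' n (T g) := by
  induction n generalizing g with
  | zero => exact hQ _ h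
  | succ n ih => obtain ⟨h1, g', h2, h3⟩ := h; exact ⟨hQ _ h1, _, hR _ _ h2, ih h3⟩

lemma Hol.of_rx {W g g' : ℝ × ℝ → ℝ} (hW : Wt W) (h : Bd W g) (hd : Rx g g') (h' : Bd W g') : Hol W g := by
  refine ⟨h, ?_⟩
  obtain ⟨-, C, hC, b⟩ := h
  obtain ⟨-, D, hD, b'⟩ := h'
  refine ⟨C + 3 * D, by positivity, fun x x' y hy => ?_⟩
  have w := hW.pos (x, y)
  have w' := hW.pos (x', y)
  rcases le_total |x' - x| 1 with h1 | h1
  · have h2 : |x' - x| ≤ √|x' - x| := Real.le_sqrt_of_sq_le (by nlinarith [abs_nonneg (x' - x)])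
    have := (convex_uIcc x x').norm_image_sub_le_of_norm_hasDerivWithin_le (f := fun x => g (x, y)) (C := D * (3 * W (x, y)))
      (fun ξ _ => (hd ξ y hy).hasDerivWithinAt) (fun ξ hξ => (b' (ξ, y) hy).trans (mul_le_mul_of_nonneg_left (hW.le_of_dist ?_) hD))
      Set.left_mem_uIcc Set.right_mem_uIcc
    · refine this.trans ?_
      rw [norm_eq_abs]
      have := mul_le_mul_of_nonneg_left h2 (by positivity : 0 ≤ D * (3 * W (x, y)))
      have : 0 ≤ √|x' - x| * (C * (W (x, y) + W (x', y)) + 3 * D * W (x', y)) := by positivity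
      nlinarith
    · rw [abs_sub_comm]; exact (Set.abs_sub_left_of_mem_uIcc hξ).trans h1
  · have h2 : 1 ≤ √|x' - x| := Real.one_le_sqrt.mpr h1
    refine (abs_sub _ _).trans ((add_le_add (b _ hy) (b _ hy)).trans ?_)
    have := mul_le_mul_of_nonneg_left h2 (by positivity : 0 ≤ C * (W (x, y) + W (x', y)))
    have : 0 ≤ 3 * D * √|x' - x| * (W (x, y) + W (x', y)) := by positivity
    nlinarith

lemma RC.hol {W g : ℝ × ℝ → ℝ} {k : ℕ} (hW : Wt W) (h : RC Rx (Bd W) (k + 1) g) : RC Rx (Hol W) k g := by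
  induction k generalizing g with
  | zero => obtain ⟨h1, g', h2, h3⟩ := h; exact .of_rx hW h1 h2 h3
  | succ k ih => obtain ⟨h1, g', h2, h3⟩ := h; exact ⟨.of_rx hW h1 h2 h3.1, g', h2, ih h3⟩

namespace Prof
variable {f θ : ℝ → ℝ} (h : Prof f θ)
include h

lemma rc_comp {R : (ℝ × ℝ → ℝ) → (ℝ × ℝ → ℝ) → Prop} {Q1 QW : (ℝ × ℝ → ℝ) → Prop} (hA : Alg Q1 QW) (hR : Drv R) {A : ℝ × ℝ → ℝ} {a : ℝ}
    (hRA : R A fun _ => a) (h1 : Q1 fun z => θ (A z)) (h2 : QW fun z => deriv θ (A z))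
    (h3 : ∀ φ : ℝ → ℝ, ContDiff ℝ ∞ φ → φ 1 = 0 → φ (-1) = 0 → QW fun z => φ (θ (A z))) (n : ℕ) :
    RC R Q1 n (fun z => θ (A z)) ∧ RC R QW n (fun z => deriv θ (A z)) ∧
      ∀ φ : ℝ → ℝ, ContDiff ℝ ∞ φ → φ 1 = 0 → φ (-1) = 0 → RC R QW n fun z => φ (θ (A z)) := by
  induction n with
  | zero => exact ⟨h1, h2, h3⟩
  | succ n ih =>
    obtain ⟨i1, i2, i3⟩ := ih
    have hAn := hA.rc hR n
    have e : deriv (deriv θ) = fun x => deriv f (θ x) := funext fun x => by linarith [h.ode x]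
    have m : ∀ {g}, RC R QW n g → RC R QW n fun z => g z * a := fun hg => by
      simpa only [mul_comm] using hAn.mulW (hAn.const i1 a) hg
    have t := hR.comp h.hθ.deriv_infty hRA
    rw [e] at t
    refine ⟨⟨h1, _, hR.comp h.hθ hRA, (hAn.sub (m i2))⟩, ⟨h2, _, t, m (i3 _ h.hf.deriv_infty h.dp h.dm)⟩, fun φ hφ p1 p2 =>
      ⟨h3 φ hφ p1 p2, _, hR.comp hφ (hR.comp h.hθ hRA), hAn.mulW (hAn.comp hφ.deriv_infty i1) (m i2)⟩⟩

lemma exists_rc_unshr : ∃ κ > 0, ∀ c b : ℝ, |c| ≤ 1/4 → 0 < b → b ≤ 1/32 → b ≤ κ →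
    (∀ n, RC Ry (Xinf fun _ => 1) n fun z => θ (unshr c z).1) ∧ (Xinf fun _ => 1) (fun z => θ (unshr c z).1) ∧
      Xinf (wsh c b) (fun z => exp (-z.2) * deriv θ (unshr c z).1) ∧
      ∀ φ : ℝ → ℝ, ContDiff ℝ ∞ φ → φ 1 = 0 → φ (-1) = 0 → Xinf (wsh c b) fun z => exp (-z.2) * φ (θ (unshr c z).1) := by
  obtain ⟨κ, hκ, C, hC, hφ⟩ := h.exists_decay
  refine ⟨κ, hκ, fun c b hc hb hb' hbκ => ?_⟩
  set W₀ : ℝ × ℝ → ℝ := fun z => exp (-(b * |(unshr c z).1|)) with hW₀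
  have hW : Wt W₀ := wt_exp hb.le hb' (by fun_prop) fun z z' => (abs_fst_unshr_sub_le hc z z').trans (by
    linarith [abs_nonneg (z.1 - z'.1), abs_nonneg (z.2 - z'.2)])
  have hB : ∀ z : ℝ × ℝ, 0 ≤ z.2 → W₀ z ≤ 1 := fun z _ => exp_le_one_iff.mpr (by
    have := mul_nonneg hb.le (abs_nonneg (unshr c z).1); linarith)
  have hcu : Continuous fun z => (unshr c z).1 := by unfold unshr; fun_prop
  have bd : ∀ (ψ : ℝ → ℝ) (D : ℝ), Continuous ψ → (∀ x, |ψ x| ≤ D * exp (-κ * |x|)) → BdC W₀ fun z => ψ (unshr c z).1 := fun ψ D hψ hD => by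
    have hD0 : 0 ≤ D := by simpa using (abs_nonneg _).trans (hD 0)
    refine ⟨⟨by fun_prop, D, hD0, fun z _ => (hD _).trans (mul_le_mul_of_nonneg_left (exp_le_exp.mpr ?_) hD0)⟩, by fun_prop⟩
    nlinarith [abs_nonneg (unshr c z).1]
  have b1 : BdC (fun _ => 1) fun z => θ (unshr c z).1 :=
    ⟨⟨(h.hθ.continuous.comp hcu).measurable, 1, one_pos.le, fun z _ => by rw [one_mul]; exact h.abs_le_one _⟩, (h.hθ.continuous.comp hcu).continuousOn⟩
  have key := h.rc_comp (alg_BdC hW hB) drv_Rx (A := fun z => (unshr c z).1) (a := √(1 - c ^ 2))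
    (fun x y _ => by simpa [unshr] using ((hasDerivAt_id x).const_mul √(1 - c ^ 2)).sub_const (c * y)) b1
    (bd _ C h.continuous_deriv hC) (fun φ h1 h2 h3 => by
      obtain ⟨D, hD⟩ := hφ φ h1 h2 h3
      exact bd _ D (h1.continuous.comp h.hθ.continuous) hD)
  have kE : ∀ {n g}, RC Rx (BdC W₀) n g → RC Rx (BdC (wsh c b)) n fun z => exp (-z.2) * g z := fun hg =>
    RC.map (T := fun g z => exp (-z.2) * g z) (fun g hg => by
      obtain ⟨⟨hm, D, hD, hb1⟩, hcont⟩ := hg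
      refine ⟨⟨by fun_prop, D, hD, fun z hz => ?_⟩, by fun_prop⟩
      rw [abs_mul, abs_exp]
      refine (mul_le_mul_of_nonneg_left (hb1 z hz) (exp_pos _).le).trans ?_
      rw [mul_left_comm, hW₀]
      beta_reduce
      rw [← exp_add, wsh, len]
      refine mul_le_mul_of_nonneg_left (exp_le_exp.mpr ?_) hD
      change _ ≤ -(b * (|(unshr c z).1| + |z.2|))
      rw [abs_of_nonneg hz]
      nlinarith) (fun g g' hg x y hy => (hg x y hy).const_mul (exp (-y))) hg
  have x1 : (Xinf fun _ => 1) (fun z => θ (unshr c z).1) := fun n => (key n).1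
  have hS := alg_Xinf (W := fun _ => 1) wt_one (B := 1) fun _ _ => le_rfl
  have s1 := alg_Xinf hW hB
  refine ⟨fun n => (h.rc_comp hS drv_Ry (A := fun z => (unshr c z).1) (a := -c)
    (fun x y _ => by simpa [unshr] using ((hasDerivAt_id y).const_mul c).const_sub (√(1 - c ^ 2) * x)) x1
    (s1.sub fun n => (key n).2.1) (fun φ h1 h2 h3 => s1.sub fun n => (key n).2.2 φ h1 h2 h3) n).1, x1, fun n => kE (key n).2.1,
    fun φ h1 h2 h3 n => kE ((key n).2.2 φ h1 h2 h3)⟩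

/-- In isotropic coordinates, solutions of the integral equation are smooth up to the boundary. -/
theorem exists_family_of_solution : ∃ κ > 0, ∀ {c b C : ℝ}, |c| ≤ 1/4 → 0 < b → b ≤ 1/32 → b ≤ κ → 0 ≤ C → ∀ {σ : ℝ → ℝ},
    ContDiff ℝ ∞ σ → σ 1 = 0 → σ (-1) = 0 → ∀ {u : ℝ × ℝ → ℝ} {m : ℝ}, Measurable u → (∀ z, 0 ≤ z.2 → |u z| ≤ C * exp (-(b * len z))) →
    (∀ z, 0 ≤ z.2 → u z = kerFun tauM nuM (kap c 0) (fun z => if z.2 = 0 then -c * (deriv θ z.1 + σ (θ z.1 + u z)) + m * deriv θ z.1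
        else u z - (deriv f (θ z.1 + u z) - deriv f (θ z.1))) z) →
    ∃ G : ℕ → ℕ → ℝ × ℝ → ℝ, (∀ k l, BdC (wsh c b) (G k l)) ∧ (∀ k l, Rx (G k l) (G (k + 1) l)) ∧ (∀ k l, Ry (G k l) (G k (l + 1))) ∧
      (∀ z, 0 ≤ z.2 → G 0 0 z = u (unshr c z)) ∧
      (∀ z, 0 < z.2 → G 2 0 z + G 0 2 z = deriv f (θ (unshr c z).1 + G 0 0 z) - deriv f (θ (unshr c z).1)) ∧
      ∀ x, G 0 1 (x, 0) = c * (deriv θ (unshr c (x, 0)).1 + σ (θ (unshr c (x, 0)).1 + G 0 0 (x, 0))) - m * deriv θ (unshr c (x, 0)).1 := by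
  obtain ⟨κ, hκ, hκ'⟩ := h.exists_rc_unshr
  refine ⟨κ, hκ, fun {c b C} hc hb hb' hbκ hC {σ} hσ h1 h2 {u m} hum hub hu => ?_⟩
  obtain ⟨Θy, Θx, E1, E2⟩ := hκ' c b hc hb hb' hbκ
  have hf' := h.hf.deriv_infty
  have hW := wt_wsh hc hb hb'
  have hB : ∀ z : ℝ × ℝ, 0 ≤ z.2 → wsh c b z ≤ 1 := fun z _ => wsh_le_one hb z
  set F : ℝ × ℝ → ℝ := fun z => if z.2 = 0 then -c * (deriv θ z.1 + σ (θ z.1 + u z)) + m * deriv θ z.1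
        else u z - (deriv f (θ z.1 + u z) - deriv f (θ z.1)) with hF
  have hFm : Measurable F := by
    have m1 := h.continuous_deriv.measurable
    have m2 := h.hθ.continuous.measurable
    have m3 := hσ.continuous.measurable
    have m4 := hf'.continuous.measurable
    exact Measurable.ite (measurableSet_eq_fun (by fun_prop) measurable_const) (by fun_prop) (by fun_prop)
  set U := kerFun tauM nuM k0 fun w => F (unshr c w) with hUdef
  have hUu : ∀ z, 0 ≤ z.2 → U z = u (unshr c z) := fun z hz => ((hu (unshr c z) hz).trans (kerFun_kap_eq hc hFm z)).symm
  set Θ : ℝ × ℝ → ℝ := fun z => θ (unshr c z).1 with hΘ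
  set B : ℝ × ℝ → ℝ := fun z => -c * (exp (-z.2) * deriv θ (unshr c z).1 + (σ (Θ z + U z) - σ (Θ z)) + exp (-z.2) * σ (Θ z))
    + m * (exp (-z.2) * deriv θ (unshr c z).1) with hBdef
  have hB0 : ∀ z : ℝ × ℝ, z.2 = 0 → B z = -c * (deriv θ (unshr c z).1 + σ (Θ z + U z)) + m * deriv θ (unshr c z).1 := fun z hz => by
    rw [hBdef]; beta_reduce; rw [hz, neg_zero, exp_zero]; ring
  have hUψ : U = kerFun tauM nuM k0 (fun z => if z.2 = 0 then B z else U z - (deriv f (Θ z + U z) - deriv f (Θ z))) := by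
    refine funext fun z => ker_congr_ae ?_ z
    filter_upwards [ae_nu_nonneg] with w hw
    rw [hF]
    change (if w.2 = 0 then _ else _) = _
    split_ifs with h0
    · rw [hB0 w h0, hUu w hw]
    · rw [hUu w hw]
  have alg : ∀ {Q1 QW : (ℝ × ℝ → ℝ) → Prop}, Alg Q1 QW → Q1 Θ → QW (fun z => exp (-z.2) * deriv θ (unshr c z).1) →
      QW (fun z => exp (-z.2) * σ (Θ z)) → QW U → QW B ∧ QW fun z => U z - (deriv f (Θ z + U z) - deriv f (Θ z)) := fun hA q1 q2 q3 q4 =>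
    ⟨hA.addW (hA.mulW (hA.const q1 _) (hA.addW (hA.addW q2 (hA.dcomp hσ q1 q4)) q3)) (hA.mulW (hA.const q1 _) q2),
      hA.sub_W q4 (hA.dcomp hf' q1 q4)⟩
  have E2σ := E2 σ hσ h1 h2
  have toBd : ∀ {W g} n, Xinf W g → RC Rx (Bd W) n g := fun n hg => (hg n).imp fun _ h => h.1
  have hU0 : Bd (wsh c b) U := ⟨measurable_kerFun_k0 (hFm.comp (measurable_unshr c)), C, hC, fun z hz => by rw [hUu z hz]; exact hub _ hz⟩
  have cBd : ∀ k, RC Rx (Bd (wsh c b)) k U → RC Rx (Bd (wsh c b)) k fun z => if z.2 = 0 then B z else U z - (deriv f (Θ z + U z) - deriv f (Θ z)) :=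
    fun k hk => by
      have := alg ((alg_Bd hW hB).rc drv_Rx k) (toBd k Θx) (toBd k E1) (toBd k E2σ) hk
      exact RC.piecewise (fun _ _ => Bd.piecewise hW) this.1 this.2
  have hUB := tangential_regularity hW hUψ hU0 cBd fun k hk => by
    have := alg ((alg_Hol hW hB).rc drv_Rx k) ((toBd (k + 1) Θx).hol wt_one) ((toBd (k + 1) E1).hol hW) ((toBd (k + 1) E2σ).hol hW) hk
    exact RC.piecewise (fun _ _ => Hol.piecewise hW) this.1 this.2
  have hUX : Xinf (wsh c b) U := fun k => by rw [hUψ]; exact (cBd k (hUB k)).kerFun_bdC hW hB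
  obtain ⟨U₁, U₂, P, r1, r2, r3, r4, r5, r6, r7⟩ := full_regularity (memLp_wsh hc hb) hB hW hf' Θy (alg (alg_Xinf hW hB) Θx E1 E2σ hUX).1 hUX
    fun z _ => congrFun hUψ z
  obtain ⟨G, g0, g1, g2, g3⟩ := exists_family hB r6
  have e01 := (g3 0 0).unique (by rw [g0]; exact r3) (g1 0 1) r7
  have e10 := (g2 0 0).unique (by rw [g0]; exact r1)
  have e20 := ((g2 1 0).congr fun z hz => (e10 z hz).symm).unique r2
  refine ⟨G, g1, g2, g3, fun z hz => by rw [g0, hUu z hz], fun z hz => ?_, fun x => ?_⟩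
  · have e : G 0 2 z = _ := (g3 0 1 z.1 z.2 hz).unique ((r4 z.1 z.2 hz).congr_of_eventuallyEq (by
      filter_upwards [lt_mem_nhds hz] with y hy using e01 (z.1, y) hy.le))
    rw [e, e20 z hz.le, g0]; ring
  · rw [e01 _ le_rfl, r5, hB0 _ rfl, g0]; ring

end Prof

open scoped ContDiff

section Extension

lemma norm_pow_mul_exp_mul_le {φ : ℝ → ℝ} {M : ℝ} (hb : ∀ x, 0 < x → |φ x| ≤ M) (n : ℕ) {τ : ℝ} (hτ : 0 < τ) :
    ‖τ ^ n * exp (-τ) * φ τ‖ ≤ τ ^ n * exp (-τ) * M := by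
  rw [norm_eq_abs, abs_mul, abs_of_nonneg (by positivity)]
  exact mul_le_mul_of_nonneg_left (hb τ hτ) (by positivity)

lemma tendsto_pow_mul_exp_mul {φ : ℝ → ℝ} {M : ℝ} (hb : ∀ x, 0 < x → |φ x| ≤ M) (n : ℕ) :
    Tendsto (fun τ : ℝ => τ ^ n * exp (-τ) * φ τ) atTop (𝓝 0) :=
  squeeze_zero_norm' ((eventually_gt_atTop 0).mono fun _ => norm_pow_mul_exp_mul_le hb n) (by
    simpa using (tendsto_pow_mul_exp_neg_atTop_nhds_zero n).mul_const M)

lemma integrableOn_pow_mul_exp (n : ℕ) : IntegrableOn (fun τ : ℝ => τ ^ n * exp (-τ)) (Set.Ioi 0) := by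
  refine (GammaIntegral_convergent (s := n + 1) (by positivity)).congr_fun (fun τ _ => ?_) measurableSet_Ioi
  simp only [add_sub_cancel_right, rpow_natCast]; ring

lemma integrableOn_pow_mul_exp_mul {φ : ℝ → ℝ} {M : ℝ} (hφ : Measurable φ) (hb : ∀ x, 0 < x → |φ x| ≤ M) (n : ℕ) :
    IntegrableOn (fun τ : ℝ => τ ^ n * exp (-τ) * φ τ) (Set.Ioi 0) :=
  ((integrableOn_pow_mul_exp n).mul_const M).mono' (by fun_prop)
    ((ae_restrict_mem measurableSet_Ioi).mono fun _ => norm_pow_mul_exp_mul_le hb n)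

lemma abs_sin_cos_le (p q x : ℝ) : |p * sin x + q * cos x| ≤ |p| + |q| := by
  refine (abs_add_le _ _).trans (add_le_add ?_ ?_)
  · rw [abs_mul]; exact mul_le_of_le_one_right (abs_nonneg _) (abs_sin_le_one x)
  · rw [abs_mul]; exact mul_le_of_le_one_right (abs_nonneg _) (abs_cos_le_one x)

/-- The oscillating moments `∫ τⁿ e^{-τ} (p sin τ + q cos τ) dτ`. -/
noncomputable def oscMoment (n : ℕ) (p q : ℝ) : ℝ := ∫ τ in Set.Ioi (0:ℝ), τ ^ n * exp (-τ) * (p * sin τ + q * cos τ)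

lemma integrableOn_osc (n : ℕ) (p q : ℝ) :
    IntegrableOn (fun τ => τ ^ n * exp (-τ) * (p * sin τ + q * cos τ)) (Set.Ioi 0) :=
  integrableOn_pow_mul_exp_mul (by fun_prop) (fun x _ => abs_sin_cos_le p q x) n

lemma hasDerivAt_osc (p q τ : ℝ) : HasDerivAt (fun τ => exp (-τ) * (p * sin τ + q * cos τ))
    (-(exp (-τ) * ((p + q) * sin τ + (q - p) * cos τ))) τ :=
  ((hasDerivAt_neg τ).exp.fun_mul (((hasDerivAt_sin τ).const_mul p).fun_add ((hasDerivAt_cos τ).const_mul q))).congr_deriv (by ring)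

lemma oscMoment_zero (p : ℝ) : oscMoment 0 p (-p) = 0 := by
  have := integral_Ioi_of_hasDerivAt_of_tendsto' (a := 0) (fun τ _ => hasDerivAt_osc p 0 τ)
    (by simpa using (integrableOn_osc 0 p (-p)).neg) (m := 0) (by
      simpa using tendsto_pow_mul_exp_mul (fun x _ => abs_sin_cos_le p 0 x) 0)
  rw [integral_neg] at this
  simpa [oscMoment] using this

lemma oscMoment_succ (n : ℕ) (p q : ℝ) : oscMoment (n + 1) (p + q) (q - p) = (n + 1) * oscMoment n p q := by
  have h1 := (integrableOn_osc n p q).const_mul (n + 1 : ℝ)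
  have h2 := integrableOn_osc (n + 1) (p + q) (q - p)
  have := integral_Ioi_of_hasDerivAt_of_tendsto' (a := 0) (m := 0) (fun τ _ => ((hasDerivAt_pow (n + 1) τ).fun_mul (hasDerivAt_osc p q τ)).congr_deriv
    (show _ = (n + 1) * (τ ^ n * exp (-τ) * (p * sin τ + q * cos τ)) - τ ^ (n + 1) * exp (-τ) * ((p + q) * sin τ + (q - p) * cos τ) by
      push_cast; ring))
    (h1.sub h2) (by simpa [mul_assoc] using tendsto_pow_mul_exp_mul (fun x _ => abs_sin_cos_le p q x) (n + 1))
  rw [integral_sub h1 h2, integral_const_mul] at this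
  simp only [oscMoment]
  simp at this
  linarith

lemma oscMoment_eq_zero (n : ℕ) : ∀ p, oscMoment (4 * n + 3) p 0 = 0 := by
  have key : ∀ n p q p' q', p' = p + q → q' = q - p → oscMoment n p q = 0 → oscMoment (n + 1) p' q' = 0 :=
    fun n p q p' q' h1 h2 h => by rw [h1, h2, oscMoment_succ, h, mul_zero]
  induction n with
  | zero => exact fun p => key 2 (p / 2) (p / 2) _ _ (by ring) (by ring) (key 1 0 (p / 2) _ _ (by ring) (by ring)
      (key 0 (-(p / 4)) (p / 4) _ _ (by ring) (by ring) (by simpa using oscMoment_zero (-(p / 4)))))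
  | succ n ih => exact fun p => key _ (p / 2) (p / 2) _ _ (by ring) (by ring) (key _ 0 (p / 2) _ _ (by ring) (by ring)
      (key _ (-(p / 4)) (p / 4) _ _ (by ring) (by ring) (key _ (-(p / 4)) 0 _ _ (by ring) (by ring) (ih _))))

/-- A weight on a ray all of whose moments agree with those of the point mass at `-1`. -/
structure ReflWeight (w l : ℝ → ℝ) : Prop where
  meas : Measurable l
  pos : ∀ τ, 0 < τ → 0 < l τ
  int : ∀ n : ℕ, IntegrableOn (fun τ => (-l τ) ^ n * w τ) (Set.Ioi 0)
  moment : ∀ n : ℕ, ∫ τ in Set.Ioi (0:ℝ), (-l τ) ^ n * w τ = 1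

lemma exists_reflWeight : ∃ w l, ReflWeight w l := by
  set l : ℝ → ℝ := fun τ => 2 ^ 14 * τ ^ 4 with hl
  have hl0 : ∀ τ, 0 ≤ l τ := fun τ => by positivity
  set ρ : ℝ → ℝ := fun τ => τ ^ 3 * exp (-τ) * (1 * sin τ + 0 * cos τ) with hρ
  have hi : ∀ n, IntegrableOn (fun τ => (-l τ) ^ n * ρ τ) (Set.Ioi 0) := fun n => by
    refine ((integrableOn_osc (4 * n + 3) 1 0).const_mul ((-2 ^ 14) ^ n)).congr (.of_forall fun τ => ?_)
    simp only [hl, hρ]; ring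
  have hz : ∀ n, ∫ τ in Set.Ioi (0:ℝ), (-l τ) ^ n * ρ τ = 0 := fun n => by
    rw [show (fun τ => (-l τ) ^ n * ρ τ) = fun τ => (-2 ^ 14) ^ n * (τ ^ (4 * n + 3) * exp (-τ) * (1 * sin τ + 0 * cos τ)) by
      funext τ; simp only [hl, hρ]; ring, integral_const_mul]
    exact mul_eq_zero_of_right _ (oscMoment_eq_zero n 1)
  have hj : ∀ n, Integrable (fun τ => (-l τ) ^ n * (ρ τ / (l τ + 1))) (volume.restrict (Set.Ioi 0)) := fun n => by
    refine Integrable.mono (hi n) (by fun_prop) (.of_forall fun τ => ?_)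
    rw [norm_mul, norm_mul, norm_div]
    refine mul_le_mul_of_nonneg_left (div_le_self (norm_nonneg _) ?_) (norm_nonneg _)
    rw [norm_eq_abs, abs_of_nonneg (by linarith [hl0 τ])]; linarith [hl0 τ]
  set c := ∫ τ in Set.Ioi (0:ℝ), ρ τ / (l τ + 1) with hc
  have ha : ∀ n, ∫ τ in Set.Ioi (0:ℝ), (-l τ) ^ n * (ρ τ / (l τ + 1)) = c := fun n => by
    induction n with
    | zero => simp [hc]
    | succ n ih =>
      have := integral_sub (hj n) (hi n)
      rw [ih, hz, sub_zero] at this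
      rw [← this]
      refine integral_congr_ae (.of_forall fun τ => ?_)
      have : l τ + 1 ≠ 0 := by linarith [hl0 τ]
      field_simp
      ring
  have hc0 : 0 < c := by
    have hd : ∀ τ ∈ Set.Ici (0:ℝ), HasDerivAt (fun τ => τ ^ 2 * exp (-τ) * (1 / 6) + τ ^ 1 * exp (-τ) * (1 / 3) + τ ^ 0 * exp (-τ) * (-5 / 12) + exp (-τ) * (exp (-8 * τ) / 3))
        (exp (-τ) * (3 / 4 - τ ^ 2 / 6 - 3 * exp (-8 * τ))) τ := fun τ _ => by
      have e := (hasDerivAt_neg τ).exp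
      have e8 := ((hasDerivAt_id τ).const_mul (-8)).exp
      refine ((((((hasDerivAt_pow 2 τ).fun_mul e).mul_const (1 / 6)).fun_add (((hasDerivAt_pow 1 τ).fun_mul e).mul_const (1 / 3))).add
        (((hasDerivAt_pow 0 τ).fun_mul e).mul_const (-5 / 12))).fun_add (e.fun_mul (e8.div_const 3))).congr_deriv ?_
      simp
      ring
    have e8 : ∀ x : ℝ, 0 < x → |exp (-8 * x)| ≤ 1 := fun x hx => by rw [abs_exp]; exact exp_le_one_iff.mpr (by linarith)
    have hg : IntegrableOn (fun τ : ℝ => exp (-τ) * (3 / 4 - τ ^ 2 / 6 - 3 * exp (-8 * τ))) (Set.Ioi 0) := by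
      refine ((((integrableOn_pow_mul_exp 0).const_mul (3 / 4)).sub ((integrableOn_pow_mul_exp 2).const_mul (1 / 6))).sub
        ((integrableOn_pow_mul_exp_mul (by fun_prop) e8 0).const_mul 3)).congr (.of_forall fun τ => ?_)
      simp only [Pi.sub_apply, pow_zero]; ring
    have h1 := integral_Ioi_of_hasDerivAt_of_tendsto' hd hg (m := 0) (by
      have t := fun n => tendsto_pow_mul_exp_mul e8 n
      have k := fun n => tendsto_pow_mul_exp_neg_atTop_nhds_zero n
      have := ((((k 2).mul_const (1 / 6)).add ((k 1).mul_const (1 / 3))).add ((k 0).mul_const (-5 / 12))).add ((t 0).div_const 3)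
      simpa [mul_div_assoc] using this)
    have hj1 : Integrable (fun τ => ρ τ / (l τ + 1)) (volume.restrict (Set.Ioi 0)) := by simpa using hj 0
    have h2 : ∫ τ in Set.Ioi (0:ℝ), exp (-τ) * (3 / 4 - τ ^ 2 / 6 - 3 * exp (-8 * τ)) ≤ ∫ τ in Set.Ioi (0:ℝ), 2 ^ 14 * (ρ τ / (l τ + 1)) := by
      refine setIntegral_mono_on hg (hj1.const_mul _ :) measurableSet_Ioi fun τ hτ => ?_
      have hτ' : 0 < τ := hτ
      rw [show 2 ^ 14 * (ρ τ / (l τ + 1)) = exp (-τ) * (2 ^ 14 * τ ^ 3 * sin τ / (l τ + 1)) by simp only [hρ]; ring]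
      refine mul_le_mul_of_nonneg_left ?_ (exp_pos _).le
      have hp : 0 < l τ + 1 := by positivity
      have hk : 1 / (l τ + 1) ≤ 3 * exp (-8 * τ) + 1 / 4 := by
        rcases le_total τ (1 / 8) with h8 | h8
        · have : 1 / 3 ≤ exp (-8 * τ) := by
            refine le_trans ?_ (exp_le_exp.mpr (by linarith : (-1:ℝ) ≤ _))
            rw [exp_neg, ← one_div]
            exact one_div_le_one_div_of_le (exp_pos _) (by linarith [exp_one_lt_d9])
          linarith [(div_le_one hp).mpr (by linarith [hl0 τ] : 1 ≤ l τ + 1)]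
        · have h4 : (1 / 8) ^ 4 ≤ τ ^ 4 := pow_le_pow_left₀ (by norm_num) h8 4
          linarith [exp_pos (-8 * τ), one_div_le_one_div_of_le four_pos (show 4 ≤ l τ + 1 by simp only [hl]; linarith)]
      have h3 := div_le_div_of_nonneg_right (mul_le_mul_of_nonneg_left (sin_gt_sub_cube hτ').le (show 0 ≤ 2 ^ 14 * τ ^ 3 by positivity)) hp.le
      rw [show 2 ^ 14 * τ ^ 3 * (τ - τ ^ 3 / 6) / (l τ + 1) = 1 - 1 / (l τ + 1) - τ ^ 2 / 6 + τ ^ 2 / 6 * (1 / (l τ + 1)) by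
        field_simp; simp only [hl]; ring] at h3
      linarith [show 0 ≤ τ ^ 2 / 6 * (1 / (l τ + 1)) by positivity]
    rw [h1, integral_const_mul] at h2
    norm_num at h2
    linarith
  refine ⟨fun τ => ρ τ / (l τ + 1) / c, l, by fun_prop, fun τ hτ => by positivity, fun n => ?_, fun n => ?_⟩
  · simpa only [mul_div_assoc, IntegrableOn] using (hj n).div_const c
  · simp_rw [← mul_div_assoc]
    rw [integral_div]
    simp_rw [mul_div_assoc]
    rw [ha, div_self hc0.ne']

variable {W g g' : ℝ × ℝ → ℝ} {B : ℝ} {w l : ℝ → ℝ}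

/-- The reflected average `∫ (-l)ⁿ g(x, -l y) w` of a function on the half-plane. -/
noncomputable def reflAvg (w l : ℝ → ℝ) (n : ℕ) (g : ℝ × ℝ → ℝ) (z : ℝ × ℝ) : ℝ :=
  ∫ τ in Set.Ioi (0:ℝ), g (z.1, max (l τ * -z.2) 0) * ((-l τ) ^ n * w τ)

lemma BdC.refl_bound (hB : ∀ z, 0 ≤ z.2 → W z ≤ B) (h : BdC W g) : ∃ C, ∀ x y v : ℝ, ‖g (x, max y 0) * v‖ ≤ C * |v| :=
  let ⟨C, _, b⟩ := BdC.bound hB h.1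
  ⟨C, fun x y v => by rw [norm_mul]; exact mul_le_mul_of_nonneg_right (b _ (le_max_right y 0)) (norm_nonneg v)⟩

lemma BdC.integrable_refl (hB : ∀ z, 0 ≤ z.2 → W z ≤ B) (h : BdC W g) (hw : ReflWeight w l) (n : ℕ) (x y : ℝ) :
    IntegrableOn (fun τ => g (x, max (l τ * -y) 0) * ((-l τ) ^ n * w τ)) (Set.Ioi 0) :=
  let ⟨C, b⟩ := h.refl_bound hB
  have := hw.meas
  ((hw.int n).abs.const_mul C).mono' ((h.continuous_clip.measurable.comp
    (by fun_prop : Measurable fun τ => (x, l τ * -y))).aestronglyMeasurable.mul (hw.int n).1) (.of_forall fun τ => b ..)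

lemma BdC.continuous_reflAvg (hB : ∀ z, 0 ≤ z.2 → W z ≤ B) (h : BdC W g) (hw : ReflWeight w l) {n : ℕ} : Continuous (reflAvg w l n g) := by
  obtain ⟨C, b⟩ := h.refl_bound hB
  exact continuous_of_dominated (fun z => (h.integrable_refl hB hw n ..).1)
    (fun z => .of_forall fun τ => b ..) ((hw.int n).abs.const_mul C) (.of_forall fun τ =>
      (h.continuous_clip.comp (by fun_prop : Continuous fun z : ℝ × ℝ => (z.1, l τ * -z.2))).mul continuous_const)

lemma Rx.reflAvg (hd : Rx g g') (hB : ∀ z, 0 ≤ z.2 → W z ≤ B) (h : BdC W g) (h' : BdC W g') (hw : ReflWeight w l) {n : ℕ} (x y : ℝ) :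
    HasDerivAt (fun x => reflAvg w l n g (x, y)) (reflAvg w l n g' (x, y)) x := by
  obtain ⟨C, b⟩ := h'.refl_bound hB
  refine (hasDerivAt_integral_of_dominated_loc_of_deriv_le (s := Set.univ) Filter.univ_mem
    (.of_forall fun x => (h.integrable_refl hB hw n x y).1) (h.integrable_refl hB hw n x y) (h'.integrable_refl hB hw n x y).1
    (.of_forall fun τ x _ => ?_) ((hw.int n).abs.const_mul C)
    (.of_forall fun τ x _ => (hd x (max (l τ * -y) 0) (le_max_right _ _)).mul_const ((-l τ) ^ n * w τ))).2
  exact b ..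

lemma Ry.reflAvg (hd : Ry g g') (hB : ∀ z, 0 ≤ z.2 → W z ≤ B) (h : BdC W g) (h' : BdC W g') (hw : ReflWeight w l) (n : ℕ) (x : ℝ)
    {y : ℝ} (hy : y < 0) : HasDerivAt (fun y => reflAvg w l n g (x, y)) (reflAvg w l (n + 1) g' (x, y)) y := by
  obtain ⟨C, b⟩ := h'.refl_bound hB
  refine (hasDerivAt_integral_of_dominated_loc_of_deriv_le (s := Set.Iio 0)
    (F' := fun y τ => g' (x, max (l τ * -y) 0) * ((-l τ) ^ (n + 1) * w τ)) (Iio_mem_nhds hy)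
    (.of_forall fun y => (h.integrable_refl hB hw n x y).1) (h.integrable_refl hB hw n x y)
    (h'.integrable_refl hB hw (n + 1) x y).1 (.of_forall fun τ y _ => b ..) ((hw.int (n + 1)).abs.const_mul C) ?_).2
  filter_upwards [ae_restrict_mem measurableSet_Ioi] with τ hτ y hy
  have hp : ∀ y < 0, 0 < l τ * -y := fun y hy => mul_pos (hw.pos τ hτ) (neg_pos.mpr hy)
  have h1 := ((hd x _ (hp y hy)).comp y ((hasDerivAt_neg y).const_mul (l τ))).mul_const ((-l τ) ^ n * w τ)
  refine (h1.congr_of_eventuallyEq ?_).congr_deriv ?_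
  · filter_upwards [Iio_mem_nhds (show y < 0 from hy)] with t ht
    rw [max_eq_left (hp t ht).le]; rfl
  · rw [max_eq_left (hp y hy).le]; ring

/-- A family of bounded mixed derivatives on the half-plane extends smoothly across the boundary. -/
theorem exists_extension {G : ℕ → ℕ → ℝ × ℝ → ℝ} (hB : ∀ z, 0 ≤ z.2 → W z ≤ B) (hG : ∀ k n, BdC W (G k n))
    (hx : ∀ k n, Rx (G k n) (G (k + 1) n)) (hy : ∀ k n, Ry (G k n) (G k (n + 1))) :
    ∃ E : ℕ → ℕ → ℝ × ℝ → ℝ, (∀ k n z, 0 ≤ z.2 → E k n z = G k n z) ∧ (∀ k n, ContDiff ℝ ∞ (E k n)) ∧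
      (∀ k n x y, HasDerivAt (fun x => E k n (x, y)) (E (k + 1) n (x, y)) x) ∧
      ∀ k n x y, HasDerivAt (fun y => E k n (x, y)) (E k (n + 1) (x, y)) y := by
  obtain ⟨w, l, hw⟩ := exists_reflWeight
  set E : ℕ → ℕ → ℝ × ℝ → ℝ := fun k n z => G k n (z.1, max z.2 0) + reflAvg w l n (G k n) z - G k n (z.1, 0) with hE
  have hA : ∀ k n (z : ℝ × ℝ), 0 ≤ z.2 → reflAvg w l n (G k n) z = G k n (z.1, 0) := fun k n z hz => by
    rw [reflAvg, setIntegral_congr_fun (g := fun τ => G k n (z.1, 0) * ((-l τ) ^ n * w τ)) measurableSet_Ioi fun τ hτ => by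
      beta_reduce; rw [max_eq_right (mul_nonpos_of_nonneg_of_nonpos (hw.pos τ hτ).le (neg_nonpos.mpr hz))], integral_const_mul, hw.moment, mul_one]
  have e1 : ∀ k n (z : ℝ × ℝ), 0 ≤ z.2 → E k n z = G k n z := fun k n z hz => by
    simp only [hE]; rw [hA k n z hz, max_eq_left hz]; ring
  have e2 : ∀ k n (z : ℝ × ℝ), z.2 < 0 → E k n z = reflAvg w l n (G k n) z := fun k n z hz => by
    simp only [hE]; rw [max_eq_right hz.le]; ring
  have c : ∀ k n, Continuous (E k n) := fun k n =>
    ((hG k n).continuous_clip.add ((hG k n).continuous_reflAvg hB hw)).sub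
      (((hG k n).continuous_slice_fst le_rfl).comp continuous_fst)
  have dx : ∀ k n x y, HasDerivAt (fun x => E k n (x, y)) (E (k + 1) n (x, y)) x := fun k n x y =>
    (((hx k n) x _ (le_max_right y 0)).add ((hx k n).reflAvg hB (hG k n) (hG (k + 1) n) hw x y)).sub (hx k n x 0 le_rfl)
  have dy : ∀ k n x y, HasDerivAt (fun y => E k n (x, y)) (E k (n + 1) (x, y)) y := fun k n x => by
    refine hasDerivAt_of_hasDerivAt_of_ne' (x := 0) (fun y h0 => ?_) ((c k n).comp (by fun_prop)).continuousAt
      ((c k (n + 1)).comp (by fun_prop : Continuous fun y : ℝ => (x, y))).continuousAt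
    rcases lt_or_gt_of_ne h0 with h0 | h0
    · rw [e2 k (n + 1) (x, y) h0]
      refine ((hy k n).reflAvg hB (hG k n) (hG k (n + 1)) hw n x h0).congr_of_eventuallyEq ?_
      filter_upwards [Iio_mem_nhds h0] with t ht using e2 k n (x, t) ht
    · rw [e1 k (n + 1) (x, y) h0.le]
      refine (hy k n x y h0).congr_of_eventuallyEq ?_
      filter_upwards [Ioi_mem_nhds h0] with t ht using e1 k n (x, t) (le_of_lt ht)
  refine ⟨E, e1, fun k n => ?_, dx, dy⟩
  have key : ∀ (N : ℕ) k n, ContDiff ℝ N (E k n) := fun N => by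
    induction N with
    | zero => exact fun k n => contDiff_zero.mpr (c k n)
    | succ N ih =>
      refine fun k n => contDiff_succ_iff_hasFDerivAt.mpr ⟨fun z => E (k + 1) n z • ContinuousLinearMap.fst ℝ ℝ ℝ +
        E k (n + 1) z • ContinuousLinearMap.snd ℝ ℝ ℝ, ((ih _ _).smul contDiff_const).add ((ih _ _).smul contDiff_const), fun z => ?_⟩
      have s1 : Continuous fun a : ℝ => ContinuousLinearMap.toSpanSingleton ℝ a := (ContinuousLinearMap.toSpanSingletonCLE (𝕜 := ℝ) (E := ℝ)).continuous
      refine (hasStrictFDerivAt_uncurry_coprod (f := fun x y => E k n (x, y))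
          (f₁ := fun x y => ContinuousLinearMap.toSpanSingleton ℝ (E (k + 1) n (x, y)))
          (f₂ := fun x y => ContinuousLinearMap.toSpanSingleton ℝ (E k (n + 1) (x, y)))
          (.of_forall fun v => (dx k n v.1 v.2).hasFDerivAt) (.of_forall fun v => (dy k n v.1 v.2).hasFDerivAt)
          (s1.comp (c (k + 1) n)).continuousAt (s1.comp (c k (n + 1))).continuousAt).hasFDerivAt.congr_fderiv ?_
      ext <;> simp [Function.HasUncurry.uncurry]
  exact contDiff_infty.mpr fun N => key N k n

end Extension


/-! ### The momentum balance -/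

lemma BdC.integrable_fst {a y : ℝ} (ha : 0 < a) {g : ℝ × ℝ → ℝ} (h : BdC (wexp a) g) (hy : 0 ≤ y) : Integrable fun x => g (x, y) := by
  obtain ⟨C, -, b⟩ := h.1.abs_slice_le
  exact integrable_of_le_exp ha (h.continuous_slice_fst hy) (b y hy)

lemma integral_flux_eq_zero {a : ℝ} (ha : 0 < a) {P P' Q : ℝ × ℝ → ℝ} (hP : BdC (wexp a) P) (hP' : BdC (wexp a) P')
    (hQ : BdC (wexp a) Q) (hd : Ry P P') (hdQ : ∀ x y, 0 < y → HasDerivAt (fun x => Q (x, y)) (-P' (x, y)) x) :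
    ∫ x, P (x, 0) = 0 := by
  have hi : Integrable P' (volume.prod tauM) := by
    obtain ⟨⟨m, C, -, b⟩, -⟩ := hP'
    refine (((integrable_exp_nuM ha).const_mul C).mono' m.aestronglyMeasurable ?_).mono_measure prod_tau_le
    filter_upwards [ae_nu_nonneg] with z hz using b z hz
  have e : ∫ x, -P (x, 0) = ∫ x, ∫ y, P' (x, y) ∂tauM := integral_congr_ae <| by
    filter_upwards [hi.prod_right_ae] with x hx using (Ry.integral_Ioi ha hP hd hx).symm
  rw [← neg_eq_zero, ← integral_neg, e, integral_integral_swap (f := fun x y => P' (x, y)) hi]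
  refine integral_eq_zero_of_ae ?_
  filter_upwards [ae_tau_pos] with y hy
  have := integral_eq_zero_of_hasDerivAt_of_integrable (hdQ · y hy) (hP'.integrable_fst ha hy.le).neg (hQ.integrable_fst ha hy.le)
  rwa [integral_neg, neg_eq_zero] at this

lemma BdC.wexp_of_wsh {c b : ℝ} (hc : |c| ≤ 1/4) (hb : 0 < b) {g : ℝ × ℝ → ℝ} (h : BdC (wsh c b) g) : BdC (wexp (b / 2)) g := by
  obtain ⟨⟨m, C, hC, h⟩, h'⟩ := h
  refine ⟨⟨m, C, hC, fun z hz => (h z hz).trans (mul_le_mul_of_nonneg_left ?_ hC)⟩, h'⟩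
  rw [wsh, wexp, ← exp_add]
  exact exp_le_exp.mpr (by nlinarith [half_le_len_unshr hc z])

namespace Prof
variable {f θ : ℝ → ℝ} (h : Prof f θ)
include h

lemma integrable_deriv_deriv : Integrable fun x => deriv f (θ x) := by
  obtain ⟨κ, hκ, -, -, hp⟩ := h.exists_decay
  obtain ⟨C, hC⟩ := hp _ h.hf.deriv_infty h.dp h.dm
  exact integrable_of_le_exp hκ (h.hf.deriv_infty.continuous.comp h.hθ.continuous) hC

lemma integrable_deriv : Integrable (deriv θ) := by
  obtain ⟨κ, hκ, C, hp, -⟩ := h.exists_decay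
  exact integrable_of_le_exp hκ h.continuous_deriv hp

lemma integral_sq_deriv : ∫ x, deriv θ x * deriv θ x = ∫ r in (-1:ℝ)..1, √(2 * (f r - f (-1))) := by
  have hc : Continuous fun r => √(2 * (f r - f (-1))) := by have := h.hf.continuous; fun_prop
  have hd : ∀ r, HasDerivAt (fun r => ∫ t in (-1:ℝ)..r, √(2 * (f t - f (-1)))) (√(2 * (f r - f (-1)))) r := fun r =>
    hc.hasDerivAt_integral _ _
  have := integral_of_hasDerivAt_of_tendsto (fun x => ((hd (θ x)).comp x (h.hasDerivAt x)).congr_deriv (by rw [← h.sqrt]))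
    h.integrable_sq_deriv ((hd (-1)).continuousAt.tendsto.comp h.bot) ((hd 1).continuousAt.tendsto.comp h.top)
  simpa using this

lemma integral_deriv_mul_deriv_pos {w w' : ℝ → ℝ} {B : ℝ} (hw : ∀ x, HasDerivAt w (w' x) x) (hwi : Integrable w) (hwi' : Integrable w')
    (hB : ∀ x, |w x| ≤ B) (hs : B * ∫ x, |deriv f (θ x)| < ∫ x, deriv θ x * deriv θ x) : 0 < ∫ x, deriv θ x * (deriv θ x + w' x) := by
  obtain ⟨C, hpb⟩ := h.exists_abs_deriv_le
  have hm := h.continuous_deriv.aestronglyMeasurable (μ := volume)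
  have hwc : Continuous w := .of_hasDerivAt hw
  have i1 : Integrable fun x => deriv θ x * w' x := hwi'.bdd_mul hm (.of_forall hpb)
  have i2 : Integrable fun x => deriv θ x * w x := hwi.bdd_mul hm (.of_forall hpb)
  have i3 : Integrable fun x => deriv f (θ x) * w x := (h.integrable_deriv_deriv.bdd_mul hwc.aestronglyMeasurable
    (.of_forall hB)).congr (.of_forall fun x => mul_comm _ _)
  have e1 := integral_mul_deriv_eq_deriv_mul_of_integrable (fun x _ => h.hasDerivAt' x) (fun x _ => hw x) i1 i3 i2
  have e2 : |∫ x, deriv f (θ x) * w x| ≤ B * ∫ x, |deriv f (θ x)| := by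
    rw [← integral_const_mul]
    refine abs_integral_le_integral_abs.trans (integral_mono i3.abs (h.integrable_deriv_deriv.abs.const_mul B) fun x => ?_)
    simp only [abs_mul]
    rw [mul_comm]
    exact mul_le_mul_of_nonneg_right (hB x) (abs_nonneg _)
  simp only [mul_add]
  rw [integral_add h.integrable_sq_deriv i1, e1]
  linarith [(abs_le.mp e2).2]

lemma momentum_balance {c b m : ℝ} (hc : |c| ≤ 1/4) (hb : 0 < b) (hb' : b ≤ 1/32) {σ : ℝ → ℝ} (hσ : ContDiff ℝ ∞ σ)
    (hσv : σ (-1) - σ 1 = ∫ r in (-1:ℝ)..1, √(2 * (f r - f (-1)))) {G : ℕ → ℕ → ℝ × ℝ → ℝ} (hG : ∀ k l, BdC (wsh c b) (G k l))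
    (hx : ∀ k l, Rx (G k l) (G (k + 1) l)) (hy : ∀ k l, Ry (G k l) (G k (l + 1)))
    (hi : ∀ z, 0 < z.2 → G 2 0 z + G 0 2 z = deriv f (θ (unshr c z).1 + G 0 0 z) - deriv f (θ (unshr c z).1))
    (h0 : ∀ x, G 0 1 (x, 0) = c * (deriv θ (unshr c (x, 0)).1 + deriv σ (θ (unshr c (x, 0)).1 + G 0 0 (x, 0))) -
      m * deriv θ (unshr c (x, 0)).1) :
    m * ∫ x, deriv θ x * (deriv θ x + G 1 0 (x / √(1 - c ^ 2), 0) / √(1 - c ^ 2)) = 0 := by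
  have ha : 0 < b / 2 := by positivity
  have hA := alg_BdC (wt_wexp ha (by linarith)) fun z _ => wexp_le_one ha z
  have hG' := fun k l => (hG k l).wexp_of_wsh hc hb
  have hs := (sqrt_bounds hc).1
  have hss : √(1 - c ^ 2) ^ 2 = 1 - c ^ 2 := Real.sq_sqrt (by nlinarith [abs_le.mp hc])
  set s := √(1 - c ^ 2) with hsdef
  have hs0 : s ≠ 0 := by linarith
  have hf' := h.hf.deriv_infty
  have hpc := h.continuous_deriv
  have bd : ∀ {φ : ℝ → ℝ} {C : ℝ}, Continuous φ → (∀ x, |φ x| ≤ C) → BdC (fun _ => 1) fun z => φ (unshr c z).1 := fun {φ C} hφ hC => by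
    have hcn : Continuous fun z => φ (unshr c z).1 := by unfold unshr; fun_prop
    exact ⟨⟨hcn.measurable, C, (abs_nonneg _).trans (hC 0), fun z _ => by simpa using hC _⟩, hcn.continuousOn⟩
  have hΘ : BdC (fun _ => 1) fun z => θ (unshr c z).1 := bd h.hθ.continuous h.abs_le_one
  have hF := hA.comp hf' hΘ
  obtain ⟨C, hp⟩ := h.exists_abs_deriv_le
  have hT := bd hpc hp
  have k := fun r : ℝ => hA.const hT r
  have kW : ∀ (r : ℝ) {g}, BdC (wexp (b / 2)) g → BdC (wexp (b / 2)) fun z => r * g z := fun r g hg => hA.mulW (k r) hg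
  have hAx : ∀ x y : ℝ, HasDerivAt (fun x => (unshr c (x, y)).1) s x := fun x y => by
    simpa [unshr] using ((hasDerivAt_id x).const_mul s).sub_const (c * y)
  have hAy : ∀ x y : ℝ, HasDerivAt (fun y => (unshr c (x, y)).1) (-c) y := fun x y => by
    simpa [unshr] using ((hasDerivAt_id y).const_mul c).const_sub (s * x)
  have key := integral_flux_eq_zero ha
    (P := fun z => s * (deriv θ (unshr c z).1 * G 0 1 z) + -c * (deriv θ (unshr c z).1 * G 1 0 z) + G 1 0 z * G 0 1 z)
    (P' := fun z => (-c * s) * (deriv f (θ (unshr c z).1) * G 0 1 z) + s * (deriv θ (unshr c z).1 * G 0 2 z) +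
      ((c * c) * (deriv f (θ (unshr c z).1) * G 1 0 z) + -c * (deriv θ (unshr c z).1 * G 1 1 z)) +
      (G 1 1 z * G 0 1 z + G 1 0 z * G 0 2 z))
    (Q := fun z => s * (deriv θ (unshr c z).1 * G 1 0 z) + (1/2) * (G 1 0 z * G 1 0 z) + c * (deriv θ (unshr c z).1 * G 0 1 z) +
      ((-1/2) * (G 0 1 z * G 0 1 z) + (-1) * (f (θ (unshr c z).1 + G 0 0 z) - f (θ (unshr c z).1))))
    (hA.addW (hA.addW (kW s (hA.mulW hT (hG' 0 1))) (kW _ (hA.mulW hT (hG' 1 0)))) (hA.mulW (hA.sub (hG' 1 0)) (hG' 0 1)))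
    (hA.addW (hA.addW (hA.addW (kW _ (hA.mulW hF (hG' 0 1))) (kW _ (hA.mulW hT (hG' 0 2))))
      (hA.addW (kW _ (hA.mulW hF (hG' 1 0))) (kW _ (hA.mulW hT (hG' 1 1)))))
      (hA.addW (hA.mulW (hA.sub (hG' 1 1)) (hG' 0 1)) (hA.mulW (hA.sub (hG' 1 0)) (hG' 0 2))))
    (hA.addW (hA.addW (hA.addW (kW _ (hA.mulW hT (hG' 1 0))) (kW _ (hA.mulW (hA.sub (hG' 1 0)) (hG' 1 0)))) (kW _ (hA.mulW hT (hG' 0 1))))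
      (hA.addW (kW _ (hA.mulW (hA.sub (hG' 0 1)) (hG' 0 1))) (kW _ (hA.dcomp h.hf hΘ (hG' 0 0)))))
    (fun x y hy' => ?_) (fun x y hy' => ?_)
  · have hu : ∀ r, (unshr c (r / s, 0)).1 = r := fun r => by simp only [unshr, ← hsdef]; field_simp; ring
    have hwi : ∀ k l, Integrable fun r => G k l (r / s, 0) := fun k l => ((hG' k l).integrable_fst ha le_rfl).comp_div hs0
    have hwd : ∀ r, HasDerivAt (fun r => G 0 0 (r / s, 0)) (G 1 0 (r / s, 0) / s) r := fun r => by
      have := (hx 0 0 (r / s) 0 le_rfl).comp r ((hasDerivAt_id r).div_const s)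
      rwa [mul_one_div] at this
    have iV : Integrable fun r => deriv θ r + G 1 0 (r / s, 0) / s := h.integrable_deriv.add ((hwi 1 0).div_const s)
    have hVc : Continuous fun r => θ r + G 0 0 (r / s, 0) := .of_hasDerivAt fun r =>
      (h.hasDerivAt r).add (hwd r)
    have hw0 : ∀ {l : Filter ℝ}, Tendsto (fun r => |r|) l atTop → Tendsto (fun r => G 0 0 (r / s, 0)) l (𝓝 0) := fun {l} hl => by
      obtain ⟨C, hC, b1⟩ := (hG' 0 0).1.abs_slice_le
      have ht : Tendsto (fun r : ℝ => C * exp (-(b / 2) * 0) * exp (-(b / 2 * (|r| / s)))) l (𝓝 (C * exp (-(b / 2) * 0) * 0)) :=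
        (tendsto_exp_neg_atTop_nhds_zero.comp ((hl.atTop_div_const (by linarith)).const_mul_atTop ha)).const_mul _
      rw [mul_zero (C * _)] at ht
      refine squeeze_zero_norm (fun r => (b1 0 le_rfl (r / s)).trans_eq ?_) ht
      rw [abs_div, abs_of_pos (by linarith : 0 < s), neg_mul (b / 2) (|r| / s)]
    have iσ : Integrable fun r => (deriv θ r + G 1 0 (r / s, 0) / s) * deriv σ (θ r + G 0 0 (r / s, 0)) := by
      obtain ⟨C, -, b1⟩ := (hA.comp hσ.deriv_infty (hA.add1 hΘ (hA.sub (hG' 0 0)))).1.2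
      refine (iV.bdd_mul (c := C * 1) (hσ.deriv_infty.continuous.comp hVc).aestronglyMeasurable (.of_forall fun r => ?_)).congr
        (.of_forall fun r => mul_comm _ _)
      have := b1 (r / s, 0) le_rfl
      simpa only [hu, norm_eq_abs, Function.comp] using this
    have e1 : ∫ r, (deriv θ r + G 1 0 (r / s, 0) / s) * deriv σ (θ r + G 0 0 (r / s, 0)) = σ (1 + 0) - σ (-1 + 0) :=
      integral_of_hasDerivAt_of_tendsto (fun r => (((hσ.hasDerivAt _).comp r
      ((h.hasDerivAt r).add (hwd r))).congr_deriv (mul_comm _ _))) iσ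
      ((hσ.continuous.tendsto _).comp (h.bot.add (hw0 tendsto_abs_atBot_atTop)))
      ((hσ.continuous.tendsto _).comp (h.top.add (hw0 tendsto_abs_atTop_atTop)))
    have iT : Integrable fun r => deriv θ r * (deriv θ r + G 1 0 (r / s, 0) / s) :=
      iV.bdd_mul hpc.aestronglyMeasurable (.of_forall hp)
    have e2 := Measure.integral_comp_div (fun x => s * (deriv θ (unshr c (x, 0)).1 * G 0 1 (x, 0)) +
      -c * (deriv θ (unshr c (x, 0)).1 * G 1 0 (x, 0)) + G 1 0 (x, 0) * G 0 1 (x, 0)) s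
    rw [key, smul_zero] at e2
    have e3 : ∫ r, s * (c * ((deriv θ r + G 1 0 (r / s, 0) / s) * deriv σ (θ r + G 0 0 (r / s, 0))) -
        m * (deriv θ r * (deriv θ r + G 1 0 (r / s, 0) / s)) + c * (deriv θ r * deriv θ r)) = 0 := by
      refine (integral_congr_ae (.of_forall fun r => ?_)).trans e2
      simp only [h0, hu]
      field_simp
      ring
    have i4 : Integrable fun r => c * ((deriv θ r + G 1 0 (r / s, 0) / s) * deriv σ (θ r + G 0 0 (r / s, 0))) -
        m * (deriv θ r * (deriv θ r + G 1 0 (r / s, 0) / s)) := (iσ.const_mul c).sub (iT.const_mul m)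
    rw [integral_const_mul, integral_add i4 (h.integrable_sq_deriv.const_mul c),
      integral_sub (iσ.const_mul c) (iT.const_mul m), integral_const_mul, integral_const_mul, integral_const_mul, e1,
      h.integral_sq_deriv, ← hσv, add_zero, add_zero] at e3
    have := (mul_eq_zero.mp e3).resolve_left hs0
    linarith
  · have dA := (h.hasDerivAt' _).comp y (hAy x y)
    refine ((((dA.mul (hy 0 1 x y hy')).const_mul s).add ((dA.mul (hy 1 0 x y hy')).const_mul (-c))).add
      ((hy 1 0 x y hy').mul (hy 0 1 x y hy'))).congr_deriv ?_
    simp only [Function.comp]; ring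
  · have dA := (h.hasDerivAt' _).comp x (hAx x y)
    have dθ := (h.hasDerivAt _).comp x (hAx x y)
    have df := h.hf.hasDerivAt
    have d := fun k l => hx k l x y hy'.le
    refine (((((dA.mul (d 1 0)).const_mul s).add (((d 1 0).mul (d 1 0)).const_mul (1/2))).add ((dA.mul (d 0 1)).const_mul c)).add
      ((((d 0 1).mul (d 0 1)).const_mul (-1/2)).add
        ((((df _).comp x (dθ.add (d 0 0))).sub ((df _).comp x dθ)).const_mul (-1)))).congr_deriv ?_
    have e := hi (x, y) hy'
    simp only [Function.comp, Pi.add_apply]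
    linear_combination (s * deriv θ (unshr c (x, y)).1 + G 1 0 (x, y)) * e + deriv f (θ (unshr c (x, y)).1) * G 1 0 (x, y) * hss
end Prof


/-! ### Return to the half-plane -/

/-- A smooth function together with all its mixed derivatives, bounded by the weight `W` on the upper half-plane. -/
structure Fam (W : ℝ × ℝ → ℝ) (E : ℕ → ℕ → ℝ × ℝ → ℝ) : Prop where
  smooth : ∀ k n, ContDiff ℝ ∞ (E k n)
  dx : ∀ k n x y, HasDerivAt (fun x => E k n (x, y)) (E (k + 1) n (x, y)) x
  dy : ∀ k n x y, HasDerivAt (fun y => E k n (x, y)) (E k (n + 1) (x, y)) y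
  bd : ∀ k n, ∃ C, 0 ≤ C ∧ ∀ z, 0 ≤ z.2 → |E k n z| ≤ C * W z

namespace Fam
variable {W : ℝ × ℝ → ℝ} {E : ℕ → ℕ → ℝ × ℝ → ℝ} (h : Fam W E)
include h

lemma lin (α β : ℝ) : Fam W fun k n z => α * E (k + 1) n z + β * E k (n + 1) z where
  smooth k n := (contDiff_const.mul (h.smooth _ _)).add (contDiff_const.mul (h.smooth _ _))
  dx k n x y := ((h.dx _ _ x y).const_mul α).add ((h.dx _ _ x y).const_mul β)
  dy k n x y := ((h.dy _ _ x y).const_mul α).add ((h.dy _ _ x y).const_mul β)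
  bd k n := by
    obtain ⟨C, hC, h1⟩ := h.bd (k + 1) n
    obtain ⟨C', hC', h2⟩ := h.bd k (n + 1)
    refine ⟨|α| * C + |β| * C', by positivity, fun z hz => (abs_add_le _ _).trans ?_⟩
    rw [abs_mul, abs_mul, add_mul, mul_assoc, mul_assoc]
    gcongr
    exacts [h1 z hz, h2 z hz]

lemma hasDerivAt (k n : ℕ) {p q : ℝ → ℝ} {p' q' t : ℝ} (hp : HasDerivAt p p' t) (hq : HasDerivAt q q' t) :
    HasDerivAt (fun t => E k n (p t, q t)) (p' * E (k + 1) n (p t, q t) + q' * E k (n + 1) (p t, q t)) t := by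
  have hd := (((h.smooth k n).differentiable (by simp)) (p t, q t)).hasFDerivAt
  have e1 := (hd.comp_hasDerivAt (p t) ((hasDerivAt_id (p t)).prodMk (hasDerivAt_const _ (q t)))).unique (h.dx k n (p t) (q t))
  have e2 := (hd.comp_hasDerivAt (q t) ((hasDerivAt_const _ (p t)).prodMk (hasDerivAt_id (q t)))).unique (h.dy k n (p t) (q t))
  refine (hd.comp_hasDerivAt t (hp.prodMk hq)).congr_deriv ?_
  rw [← e1, ← e2, ← smul_eq_mul, ← smul_eq_mul, ← map_smul, ← map_smul, ← map_add]
  simp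

lemma hasDerivAt_shr_fst (c : ℝ) (k n : ℕ) (R H : ℝ) :
    HasDerivAt (fun r => E k n (shr c (r, H))) ((√(1 - c ^ 2))⁻¹ * E (k + 1) n (shr c (R, H)) + 0 * E k (n + 1) (shr c (R, H))) R :=
  h.hasDerivAt k n (p := fun r => (r + c * H) / √(1 - c ^ 2)) (q := fun _ => H)
    (by simpa using ((hasDerivAt_id R).add_const (c * H)).div_const (√(1 - c ^ 2))) (hasDerivAt_const _ _)

lemma hasDerivAt_shr_snd (c : ℝ) (k n : ℕ) (R H : ℝ) :
    HasDerivAt (fun t => E k n (shr c (R, t))) (c / √(1 - c ^ 2) * E (k + 1) n (shr c (R, H)) + 1 * E k (n + 1) (shr c (R, H))) H :=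
  h.hasDerivAt k n (p := fun t => (R + c * t) / √(1 - c ^ 2)) (q := fun t => t)
    (by simpa using (((hasDerivAt_id H).const_mul c).const_add R).div_const (√(1 - c ^ 2))) (hasDerivAt_id H)

lemma exists_iteratedDeriv_snd (c : ℝ) (l : ℕ) : ∃ E', Fam W E' ∧
    ∀ R, iteratedDeriv l (fun t => E 0 0 (shr c (R, t))) = fun t => E' 0 0 (shr c (R, t)) := by
  induction l with
  | zero => exact ⟨E, h, fun R => iteratedDeriv_zero⟩
  | succ l ih =>
    obtain ⟨E', h', e⟩ := ih
    exact ⟨_, h'.lin (c / √(1 - c ^ 2)) 1, fun R => by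
      rw [iteratedDeriv_succ, e]; exact funext fun t => (h'.hasDerivAt_shr_snd c 0 0 R t).deriv⟩

lemma exists_iteratedDeriv_fst (c : ℝ) (k : ℕ) : ∃ E', Fam W E' ∧
    ∀ H, iteratedDeriv k (fun r => E 0 0 (shr c (r, H))) = fun r => E' 0 0 (shr c (r, H)) := by
  induction k with
  | zero => exact ⟨E, h, fun R => iteratedDeriv_zero⟩
  | succ k ih =>
    obtain ⟨E', h', e⟩ := ih
    exact ⟨_, h'.lin (√(1 - c ^ 2))⁻¹ 0, fun H => by
      rw [iteratedDeriv_succ, e]; exact funext fun r => (h'.hasDerivAt_shr_fst c 0 0 r H).deriv⟩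

lemma exists_pdMix (c : ℝ) (k l : ℕ) : ∃ E', Fam W E' ∧
    ∀ R H, pdMix k l (fun R H => E 0 0 (shr c (R, H))) R H = E' 0 0 (shr c (R, H)) := by
  obtain ⟨E₁, h₁, e₁⟩ := h.exists_iteratedDeriv_snd c l
  obtain ⟨E₂, h₂, e₂⟩ := h₁.exists_iteratedDeriv_fst c k
  refine ⟨E₂, h₂, fun R H => ?_⟩
  unfold pdMix
  simp only [e₁]
  rw [e₂]

end Fam

lemma Fam.integrable_sq {c b : ℝ} (hc : |c| ≤ 1/4) (hb : 0 < b) {E : ℕ → ℕ → ℝ × ℝ → ℝ} (h : Fam (wsh c b) E) :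
    Integrable (fun p : ℝ × ℝ => (exp (b / 2 * |p.1| + b / 2 * p.2) * E 0 0 (shr c p)) ^ 2)
      (volume.restrict (Set.univ ×ˢ Set.Ioi (0:ℝ))) := by
  obtain ⟨C, hC, hE⟩ := h.bd 0 0
  have hcn := (h.smooth 0 0).continuous
  have hm : Continuous (shr c) := by unfold shr; fun_prop
  have hi := ((integrable_exp_nuM hb).mono_measure prod_tau_le).const_mul (C ^ 2)
  have e : volume.restrict (Set.univ ×ˢ Set.Ioi (0:ℝ)) = (volume : Measure ℝ).prod tauM := by
    rw [Measure.volume_eq_prod, ← Measure.prod_restrict, Measure.restrict_univ]; rfl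
  rw [← e] at hi
  refine hi.mono' (by fun_prop) ((ae_restrict_mem (MeasurableSet.univ.prod measurableSet_Ioi)).mono fun p hp => ?_)
  have hp' : 0 < p.2 := hp.2
  have h1 := hE (shr c p) hp'.le
  rw [wsh, unshr_shr hc] at h1
  rw [norm_pow, norm_mul, norm_eq_abs, norm_eq_abs, abs_exp]
  calc _ ≤ (exp (b / 2 * |p.1| + b / 2 * p.2) * (C * exp (-(b * len p)))) ^ 2 := by gcongr
    _ = C ^ 2 * (exp (b / 2 * |p.1| + b / 2 * p.2) * exp (-(b * len p))) ^ 2 := by ring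
    _ = _ := by
      rw [← exp_add, ← exp_nat_mul, ← exp_add, len, abs_of_pos hp']
      congr 2; push_cast; ring

namespace Prof
variable {f θ : ℝ → ℝ} (h : Prof f θ)
include h

lemma exists_fam {σ : ℝ → ℝ} (hσ : ContDiff ℝ ∞ σ) (h1 : deriv σ 1 = 0) (h2 : deriv σ (-1) = 0)
    (hσv : σ (-1) - σ 1 = ∫ r in (-1:ℝ)..1, √(2 * (f r - f (-1)))) : ∃ b > 0, ∃ c₀ > 0, c₀ ≤ 1/4 ∧ ∀ c, |c| ≤ c₀ → ∃ E, Fam (wsh c b) E ∧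
      (∀ z, 0 < z.2 → E 2 0 z + E 0 2 z = deriv f (θ (unshr c z).1 + E 0 0 z) - deriv f (θ (unshr c z).1)) ∧
      (∀ x, E 0 1 (x, 0) = c * (deriv θ (unshr c (x, 0)).1 + deriv σ (θ (unshr c (x, 0)).1 + E 0 0 (x, 0)))) ∧
      0 < ∫ x, deriv θ x * (deriv θ x + E 1 0 (x / √(1 - c ^ 2), 0) / √(1 - c ^ 2)) ∧ (c = 0 → ∀ z, E 0 0 z = 0) := by
  have hP := h.integral_sq_deriv_pos
  have hσ' := hσ.deriv_infty
  obtain ⟨κ, hκ, hfam⟩ := h.exists_family_of_solution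
  obtain ⟨b₁, hb₁, hb₁', hsol⟩ := h.exists_solution hσ' h1 h2
  obtain ⟨C, hC, c₀, hc₀, hc₀', hu⟩ := hsol (min b₁ κ) (by positivity) (min_le_left _ _)
  have hb : 0 < min b₁ κ := by positivity
  have hb' : min b₁ κ ≤ 1/32 := (min_le_left _ _).trans hb₁'
  have hbκ := min_le_right b₁ κ
  set b := min b₁ κ
  set P := ∫ x, deriv θ x * deriv θ x
  set M := ∫ x, |deriv f (θ x)|
  have hM : 0 ≤ M := integral_nonneg fun x => abs_nonneg _
  refine ⟨b, hb, min c₀ (P / (2 * (C * M + 1))), by positivity, (min_le_left _ _).trans hc₀', fun c hc => ?_⟩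
  by_cases hc0 : c = 0
  · refine ⟨fun _ _ _ => 0, ⟨fun _ _ => contDiff_const, fun _ _ _ _ => hasDerivAt_const _ _, fun _ _ _ _ => hasDerivAt_const _ _,
      fun _ _ => ⟨0, le_rfl, by simp⟩⟩, ?_, ?_, ?_, fun _ _ => rfl⟩
    · simp
    · simp [hc0]
    · simpa using hP
  have hc1 := hc.trans (min_le_left _ _)
  have hc4 := hc1.trans hc₀'
  obtain ⟨u, m, hum, hub, hueq⟩ := hu c hc1
  obtain ⟨G, hG, hx, hy, hG0, hi, hbc⟩ := hfam hc4 hb hb' hbκ (by positivity) hσ' h1 h2 hum hub hueq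
  have hs := (sqrt_bounds hc4).1
  have hw := fun k l => (((hG k l).wexp_of_wsh hc4 hb).integrable_fst (by positivity) le_rfl).comp_div (R := √(1 - c ^ 2)) (by linarith)
  have hpos : 0 < ∫ x, deriv θ x * (deriv θ x + G 1 0 (x / √(1 - c ^ 2), 0) / √(1 - c ^ 2)) := by
    refine h.integral_deriv_mul_deriv_pos (B := C * |c|) (fun x => ?_) (hw 0 0) ((hw 1 0).div_const _) (fun x => ?_) ?_
    · have := (hx 0 0 (x / √(1 - c ^ 2)) 0 le_rfl).comp x ((hasDerivAt_id x).div_const (√(1 - c ^ 2)))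
      rwa [mul_one_div] at this
    · rw [hG0 _ le_rfl]
      exact (hub _ le_rfl).trans (mul_le_of_le_one_right (by positivity) (exp_le_one_iff.mpr (by unfold len; simp; positivity)))
    · have := hc.trans (min_le_right _ _)
      rw [le_div_iff₀ (by positivity)] at this
      change C * |c| * M < P
      nlinarith [mul_nonneg (mul_nonneg hC (abs_nonneg c)) hM, abs_nonneg c]
  have hm : m = 0 := (mul_eq_zero.mp (h.momentum_balance hc4 hb hb' hσ hσv hG hx hy hi hbc)).resolve_right hpos.ne'
  obtain ⟨E, hEG, hEs, hEx, hEy⟩ := exists_extension (fun z _ => wsh_le_one hb z) hG hx hy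
  refine ⟨E, ⟨hEs, hEx, hEy, fun k n => ?_⟩, fun z hz => ?_, fun x => ?_, ?_, fun h => absurd h hc0⟩
  · obtain ⟨⟨-, C, hC, hb⟩, -⟩ := hG k n
    exact ⟨C, hC, fun z hz => by rw [hEG k n z hz]; exact hb z hz⟩
  · simp only [hEG _ _ z hz.le]; exact hi z hz
  · simp only [hEG _ _ (x, 0) le_rfl]; rw [hbc, hm, zero_mul, sub_zero]
  · simpa only [hEG _ _ (_, (0:ℝ)) le_rfl] using hpos

/-- The half-plane problem with parameter `c = cos α`. -/
theorem exists_halfplane_solution {σ : ℝ → ℝ} (hσ : ContDiff ℝ ∞ σ) (h1 : deriv σ 1 = 0) (h2 : deriv σ (-1) = 0)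
    (hσv : σ (-1) - σ 1 = ∫ r in (-1:ℝ)..1, √(2 * (f r - f (-1)))) : ∃ β > 0, ∃ c₀ > 0, ∀ c, |c| ≤ c₀ → ∃ v : ℝ → ℝ → ℝ,
      (ContDiff ℝ ∞ (fun p : ℝ × ℝ => v p.1 p.2) ∧
        (∀ R : ℝ, ∀ H : ℝ, 0 < H →
          -pdR (pdR v) R H + 2 * c * pdR (pdH v) R H - pdH (pdH v) R H + deriv f (v R H) = 0) ∧
        (∀ R : ℝ, c * pdR v R 0 - pdH v R 0 + c * deriv σ (v R 0) = 0) ∧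
        (∀ k l : ℕ, Integrable (fun p : ℝ × ℝ => (exp (β * |p.1| + β * p.2) * pdMix k l (fun R H => v R H - θ R) p.1 p.2) ^ 2)
            (volume.restrict (Set.univ ×ˢ Set.Ioi (0:ℝ)))) ∧
        (0 < ∫ R : ℝ, deriv θ R * pdR v R 0)) ∧ (c = 0 → ∀ R H, v R H = θ R) := by
  obtain ⟨b, hb, c₀, hc₀, hc₀', hex⟩ := h.exists_fam hσ h1 h2 hσv
  refine ⟨b / 2, by positivity, c₀, hc₀, fun c hc => ?_⟩
  have hc4 := hc.trans hc₀'
  obtain ⟨E, hE, hi, hbc, hpos, hz⟩ := hex c hc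
  have hs := (sqrt_bounds hc4).1
  have hss : √(1 - c ^ 2) ^ 2 = 1 - c ^ 2 := Real.sq_sqrt (by nlinarith [abs_le.mp hc4])
  have hu : ∀ R H, (unshr c (shr c (R, H))).1 = R := fun R H => by rw [unshr_shr hc4]
  set v : ℝ → ℝ → ℝ := fun R H => θ R + E 0 0 (shr c (R, H)) with hv
  have hR : pdR v = fun R H => deriv θ R + ((√(1 - c ^ 2))⁻¹ * E 1 0 (shr c (R, H)) + 0 * E 0 1 (shr c (R, H))) :=
    funext₂ fun R H => ((h.hasDerivAt R).add (hE.hasDerivAt_shr_fst c 0 0 R H)).deriv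
  have hH : pdH v = fun R H => c / √(1 - c ^ 2) * E 1 0 (shr c (R, H)) + 1 * E 0 1 (shr c (R, H)) :=
    funext₂ fun R H => ((hE.hasDerivAt_shr_snd c 0 0 R H).const_add (θ R)).deriv
  refine ⟨v, ⟨?_, fun R H hH' => ?_, fun R => ?_, fun k l => ?_, ?_⟩, fun h0 R H => by simp [hv, hz h0]⟩
  · exact (h.hθ.comp contDiff_fst).add ((hE.smooth 0 0).comp (by unfold shr; fun_prop))
  · have e1 := ((h.hasDerivAt' R).add ((hE.lin (√(1 - c ^ 2))⁻¹ 0).hasDerivAt_shr_fst c 0 0 R H)).deriv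
    have e2 := ((hE.lin (c / √(1 - c ^ 2)) 1).hasDerivAt_shr_fst c 0 0 R H).deriv
    have e3 := ((hE.lin (c / √(1 - c ^ 2)) 1).hasDerivAt_shr_snd c 0 0 R H).deriv
    have e4 := hi (shr c (R, H)) hH'
    rw [hu] at e4
    rw [hR, hH, show deriv f (v R H) = E 2 0 (shr c (R, H)) + E 0 2 (shr c (R, H)) + deriv f (θ R) by rw [e4]; ring]
    simp only [Pi.add_def] at e1
    simp only [pdR, pdH, e1, e2, e3, zero_add, Nat.reduceAdd]
    field_simp
    linear_combination E 2 0 (shr c (R, H)) * hss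
  · have e4 := hbc (shr c (R, 0)).1
    change E 0 1 (shr c (R, 0)) = c * (deriv θ (unshr c (shr c (R, 0))).1 + deriv σ (θ (unshr c (shr c (R, 0))).1 + E 0 0 (shr c (R, 0)))) at e4
    rw [hu] at e4
    rw [hR, hH]
    simp only [e4, hv]
    ring
  · obtain ⟨E', hE', e⟩ := hE.exists_pdMix c k l
    simp only [hv, add_sub_cancel_left, e]
    exact hE'.integrable_sq hc4 hb
  · rw [hR]
    refine hpos.trans_eq (integral_congr_ae (.of_forall fun R => ?_))
    simp only [shr, mul_zero, add_zero, zero_mul, div_eq_inv_mul]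
end Prof


/-- solvability of the nonlinear half-plane model problem for contact
angles `α` close to `π/2`: there are `α₀, β₀, γ₀ > 0` and a family `v_α` of smooth
solutions of `−div(A_α∇v_α) + f'(v_α) = 0` in `ℝ²₊` with boundary condition
`N·A_α∇v_α + σ_α'(v_α) = 0` at `H = 0` (where `σ_α = cos α · σ̂`, so
`σ_α' = cos α · σ̂'`), such that all derivatives of `v_α − θ₀` are square integrable
against the exponential weight `e^{β₀|R| + γ₀H}`, `∫ θ₀' ∂_R v_α(·,0) > 0`, and
`v_{π/2} = θ₀`. Here `−div(A_α∇v) = −∂_R²v + 2cos α ∂_R∂_H v − ∂_H²v` and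
`N·A_α∇v = cos α ∂_R v − ∂_H v` at `H = 0`. -/
theorem nonlinear_halfplane_solvable_near_pi_div_two
    (f : ℝ → ℝ) (hf : ContDiff ℝ (⊤ : ℕ∞) f)
    (hf'm : deriv f (-1) = 0) (hf'p : deriv f 1 = 0)
    (hf''m : 0 < deriv (deriv f) (-1)) (hf''p : 0 < deriv (deriv f) 1)
    (hfeq : f (-1) = f 1)
    (hfgt : ∀ r ∈ Set.Ioo (-1 : ℝ) 1, f 1 < f r)
    (θ₀ : ℝ → ℝ) (hθsm : ContDiff ℝ (⊤ : ℕ∞) θ₀)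
    (hode : ∀ z : ℝ, -deriv (deriv θ₀) z + deriv f (θ₀ z) = 0)
    (hzero : θ₀ 0 = 0)
    (htop : Tendsto θ₀ atTop (nhds 1)) (hbot : Tendsto θ₀ atBot (nhds (-1)))
    (hθ' : ∀ z : ℝ, deriv θ₀ z = Real.sqrt (2 * (f (θ₀ z) - f (-1))))
    (hθ'pos : ∀ z : ℝ, 0 < deriv θ₀ z)
    (σh : ℝ → ℝ) (hσh : ContDiff ℝ (⊤ : ℕ∞) σh)
    (hσh' : ∀ r : ℝ, r ∉ Set.Ioo (-1 : ℝ) 1 → deriv σh r = 0)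
    (hσhval : σh (-1) - σh 1 = ∫ r in (-1:ℝ)..1, Real.sqrt (2 * (f r - f (-1)))) :
    ∃ α₀ > (0:ℝ), ∃ β₀ > (0:ℝ), ∃ γ₀ > (0:ℝ), ∃ V : ℝ → ℝ → ℝ → ℝ,
      (∀ α ∈ Set.Icc (π / 2 - α₀) (π / 2 + α₀),
        ContDiff ℝ (⊤ : ℕ∞) (fun p : ℝ × ℝ => V α p.1 p.2) ∧
        (∀ R : ℝ, ∀ H : ℝ, 0 < H →
          -pdR (pdR (V α)) R H + 2 * Real.cos α * pdR (pdH (V α)) R H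
            - pdH (pdH (V α)) R H + deriv f (V α R H) = 0) ∧
        (∀ R : ℝ,
          Real.cos α * pdR (V α) R 0 - pdH (V α) R 0
            + Real.cos α * deriv σh (V α R 0) = 0) ∧
        (∀ k l : ℕ,
          Integrable
            (fun p : ℝ × ℝ =>
              (Real.exp (β₀ * |p.1| + γ₀ * p.2) *
                pdMix k l (fun R H => V α R H - θ₀ R) p.1 p.2) ^ 2)
            (MeasureTheory.volume.restrict (Set.univ ×ˢ Set.Ioi (0:ℝ)))) ∧
        (0 < ∫ R : ℝ, deriv θ₀ R * pdR (V α) R 0)) ∧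
      (∀ R H : ℝ, V (π / 2) R H = θ₀ R) := by
  have h : Prof f θ₀ := ⟨hf, hf'm, hf'p, hf''m, hf''p, hfeq, hfgt, hθsm, hode, hzero, htop, hbot, hθ', hθ'pos⟩
  obtain ⟨β, hβ, c₀, hc₀, hex⟩ := h.exists_halfplane_solution hσh (hσh' 1 (by simp)) (hσh' (-1) (by simp)) hσhval
  choose! v hv hv0 using hex
  refine ⟨c₀, hc₀, β, hβ, β, hβ, fun α => v (cos α), fun α hα => hv _ ?_, hv0 _ (by simpa using hc₀.le) cos_pi_div_two⟩
  rw [← sin_pi_div_two_sub]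
  exact abs_sin_le_abs.trans (abs_le.mpr ⟨by linarith [hα.2], by linarith [hα.1]⟩)
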